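/- Let s₁, s₂, s₃, s₄ ∈ GL₄(ℤ) be the matrices s₁ = [[−1,2,2,2],[0,1,0,0],[0,0,1,0],[0,0,0,1]], s₂ = [[1,0,0,0],[2,−1,2,2],[0,0,1,0],[0,0,0,1]], s₃ = [[1,0,0,0],[0,1,0,0],[2,2,−1,2],[0,0,0,1]], s₄ = [[1,0,0,0],[0,1,0,0],[0,0,1,0],[2,2,2,−1]], and let 𝒜 be the subgroup of GL₄(ℤ) they generate. Let v₀ = (−6,11,14,15) ∈ ℤ⁴. Then there exist c > 0 and T₀ such that for all T ≥ T₀, the number of positive integers n ≤ T for which some coordinate of some vector γ·v₀ with γ ∈ 𝒜 equals n, is at least c·T. -/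

import Mathlib

/-- The matrix `s₁` of the Apollonian group. -/
def apolM₁ : Matrix (Fin 4) (Fin 4) ℤ :=
  !![-1, 2, 2, 2; 0, 1, 0, 0; 0, 0, 1, 0; 0, 0, 0, 1]

/-- The matrix `s₂` of the Apollonian group. -/
def apolM₂ : Matrix (Fin 4) (Fin 4) ℤ :=
  !![1, 0, 0, 0; 2, -1, 2, 2; 0, 0, 1, 0; 0, 0, 0, 1]

/-- The matrix `s₃` of the Apollonian group. -/
def apolM₃ : Matrix (Fin 4) (Fin 4) ℤ :=
  !![1, 0, 0, 0; 0, 1, 0, 0; 2, 2, -1, 2; 0, 0, 0, 1]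

/-- The matrix `s₄` of the Apollonian group. -/
def apolM₄ : Matrix (Fin 4) (Fin 4) ℤ :=
  !![1, 0, 0, 0; 0, 1, 0, 0; 0, 0, 1, 0; 2, 2, 2, -1]

/-- `s₁` as an element of `GL₄(ℤ)` (it is an involution). -/
def apolS₁ : Matrix.GeneralLinearGroup (Fin 4) ℤ := ⟨apolM₁, apolM₁, by decide, by decide⟩

/-- `s₂` as an element of `GL₄(ℤ)`. -/
def apolS₂ : Matrix.GeneralLinearGroup (Fin 4) ℤ := ⟨apolM₂, apolM₂, by decide, by decide⟩

/-- `s₃` as an element of `GL₄(ℤ)`. -/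
def apolS₃ : Matrix.GeneralLinearGroup (Fin 4) ℤ := ⟨apolM₃, apolM₃, by decide, by decide⟩

/-- `s₄` as an element of `GL₄(ℤ)`. -/
def apolS₄ : Matrix.GeneralLinearGroup (Fin 4) ℤ := ⟨apolM₄, apolM₄, by decide, by decide⟩

/-- The Apollonian group `𝒜 ⊆ GL₄(ℤ)`. -/
def apollonianGroup : Subgroup (Matrix.GeneralLinearGroup (Fin 4) ℤ) :=
  Subgroup.closure {apolS₁, apolS₂, apolS₃, apolS₄}

/-- The root quadruple `(-6, 11, 14, 15)`. -/
def rootQuadruple : Fin 4 → ℤ := ![-6, 11, 14, 15]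

inductive Gd : ℤ → ℤ → ℤ → ℤ → Prop
  | base : Gd (-6) 11 14 15
  | sw12 {a b c d : ℤ} : Gd a b c d → Gd b a c d
  | sw23 {a b c d : ℤ} : Gd a b c d → Gd a c b d
  | sw34 {a b c d : ℤ} : Gd a b c d → Gd a b d c
  | refl1 {a b c d : ℤ} : Gd a b c d → Gd (2 * (b + c + d) - a) b c d

lemma apol_refl (i : Fin 4) : ∃ γ ∈ apollonianGroup, ∀ v : Fin 4 → ℤ, 
    Matrix.mulVec (γ : Matrix (Fin 4) (Fin 4) ℤ) v =
      Function.update v i (2 * (v 0 + v 1 + v 2 + v 3) - 3 * v i) := by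
  fin_cases i
  · refine ⟨apolS₁, Subgroup.subset_closure (by simp), fun v => ?_⟩
    ext j; fin_cases j <;> simp [apolS₁, apolM₁, Matrix.mulVec, dotProduct, Fin.sum_univ_four]
    ring
  · refine ⟨apolS₂, Subgroup.subset_closure (by simp), fun v => ?_⟩
    ext j; fin_cases j <;> simp [apolS₂, apolM₂, Matrix.mulVec, dotProduct, Fin.sum_univ_four]
    ring
  · refine ⟨apolS₃, Subgroup.subset_closure (by simp), fun v => ?_⟩
    ext j; fin_cases j <;> simp [apolS₃, apolM₃, Matrix.mulVec, dotProduct, Fin.sum_univ_four]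
    ring
  · refine ⟨apolS₄, Subgroup.subset_closure (by simp), fun v => ?_⟩
    ext j; fin_cases j <;> simp [apolS₄, apolM₄, Matrix.mulVec, dotProduct, Fin.sum_univ_four]
    ring

lemma Gd.orbit {a b c d : ℤ} (h : Gd a b c d) : ∃ γ ∈ apollonianGroup, ∃ σ : Equiv.Perm (Fin 4),
    ∀ i, Matrix.mulVec (γ : Matrix (Fin 4) (Fin 4) ℤ) rootQuadruple (σ i) = ![a, b, c, d] i := by
  induction h with
  | base => 
    refine ⟨1, one_mem _, 1, fun i => ?_⟩
    simp [rootQuadruple]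
  | sw12 h ih => 
    obtain ⟨γ, hγ, σ, hs⟩ := ih
    refine ⟨γ, hγ, σ * Equiv.swap 0 1, fun i => ?_⟩
    rw [Equiv.Perm.mul_apply, hs]
    fin_cases i <;> rfl
  | sw23 h ih => 
    obtain ⟨γ, hγ, σ, hs⟩ := ih
    refine ⟨γ, hγ, σ * Equiv.swap 1 2, fun i => ?_⟩
    rw [Equiv.Perm.mul_apply, hs]
    fin_cases i <;> rfl
  | sw34 h ih => 
    obtain ⟨γ, hγ, σ, hs⟩ := ih
    refine ⟨γ, hγ, σ * Equiv.swap 2 3, fun i => ?_⟩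
    rw [Equiv.Perm.mul_apply, hs]
    fin_cases i <;> rfl
  | @refl1 a b c d h ih =>
    obtain ⟨γ, hγ, σ, hs⟩ := ih
    obtain ⟨δ, hδ, hd⟩ := apol_refl (σ 0)
    refine ⟨δ * γ, mul_mem hδ hγ, σ, fun i => ?_⟩
    rw [Matrix.GeneralLinearGroup.coe_mul, ← Matrix.mulVec_mulVec, hd]
    set v := Matrix.mulVec (γ : Matrix (Fin 4) (Fin 4) ℤ) rootQuadruple with hv
    have hsum : v 0 + v 1 + v 2 + v 3 = a + b + c + d := by
      have := Equiv.sum_comp σ v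
      simp only [hs] at this
      simp [Fin.sum_univ_four] at this
      linarith
    have h0 := hs 0
    simp at h0
    by_cases hi : i = 0
    · subst hi
      rw [Function.update_self, hsum, h0]; simp; ring
    · rw [Function.update_of_ne (fun hh => hi (σ.injective hh)), hs]
      fin_cases i <;> simp at hi ⊢

lemma Gd.refl4 {a b c d : ℤ} (h : Gd a b c d) : Gd a b c (2 * (a + b + c) - d) := by
  have h1 := (h.sw34.sw23.sw12).refl1
  have h2 := h1.sw12.sw23.sw34
  convert h2 using 1

lemma Gd.form {a A B k : ℤ} (h : Gd a (A - a) (B - a) (A + k + B - a)) (z w z1 w1 : ℤ)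
    (hd : z * w1 - w * z1 = 1) :
    Gd a (A * z ^ 2 + k * z * w + B * w ^ 2 - a) (A * z1 ^ 2 + k * z1 * w1 + B * w1 ^ 2 - a)
      (A * (z + z1) ^ 2 + k * (z + z1) * (w + w1) + B * (w + w1) ^ 2 - a) := by
  let Q : Matrix.SpecialLinearGroup (Fin 2) ℤ → Prop := fun g =>
    Gd a (A * (g 0 0) ^ 2 + k * (g 0 0) * (g 1 0) + B * (g 1 0) ^ 2 - a)
      (A * (g 0 1) ^ 2 + k * (g 0 1) * (g 1 1) + B * (g 1 1) ^ 2 - a)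
      (A * (g 0 0 + g 0 1) ^ 2 + k * (g 0 0 + g 0 1) * (g 1 0 + g 1 1) 
        + B * (g 1 0 + g 1 1) ^ 2 - a)
  have key : ∀ g, Q g := by
    intro g
    have hg : g ∈ Subgroup.closure {ModularGroup.S, ModularGroup.T} := by
      simp [SpecialLinearGroup.SL2Z_generators]
    induction hg using Subgroup.closure_induction_right with
    | one => 
      simp only [Q]
      simp
      exact h
    | mul_right x hx y hy ih =>
      simp only [Q] at ih ⊢
      rcases hy with rfl | rfl
      · simp only [Matrix.SpecialLinearGroup.coe_mul, ModularGroup.coe_S, Matrix.mul_apply, Fin.sum_univ_two]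
        simp
        convert ih.refl4.sw23 using 1 <;> ring
      · simp only [Matrix.SpecialLinearGroup.coe_mul, ModularGroup.coe_T, Matrix.mul_apply, Fin.sum_univ_two]
        simp
        convert ih.sw34.refl4 using 1 <;> ring
    | mul_inv_cancel x hx y hy ih =>
      simp only [Q] at ih ⊢
      rcases hy with rfl | rfl
      · simp only [Matrix.SpecialLinearGroup.coe_mul, Matrix.SpecialLinearGroup.coe_inv, ModularGroup.coe_S, Matrix.adjugate_fin_two, Matrix.mul_apply, Fin.sum_univ_two]
        simp
        convert ih.refl4.sw23 using 1 <;> ring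
      · simp only [Matrix.SpecialLinearGroup.coe_mul, ModularGroup.coe_T_inv, Matrix.mul_apply, Fin.sum_univ_two]
        simp
        convert ih.refl4.sw34 using 1 <;> ring
  have := key ⟨!![z, z1; w, w1], by rw [Matrix.det_fin_two_of]; linarith⟩
  simpa [Q] using this

theorem geom (x1 x2 P1 P2 : ℤ) (h2 : 2 ∣ x1) (h3 : 3 ∣ x1 + x2) (hc : IsCoprime x1 x2)
    (hP : IsCoprime P1 P2) (ha : x1 ^ 2 + x2 ^ 2 + 6 ∣ x1 * P2 - x2 * P1) :
    ∃ γ ∈ apollonianGroup, ∃ i : Fin 4,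
      Matrix.mulVec (γ : Matrix (Fin 4) (Fin 4) ℤ) rootQuadruple i
        = P1 ^ 2 + P2 ^ 2 - (x1 ^ 2 + x2 ^ 2 + 6) := by
  obtain ⟨y, hy⟩ := h2
  obtain ⟨x, hx⟩ := h3
  obtain ⟨e, f, hef⟩ := hc
  obtain ⟨p, q, hpq⟩ := hP
  -- ξ = (2 (x - y'), ...)
  set Y : ℤ := x - y with hY
  have e1 : x1 = 2 * x - 2 * Y := by rw [hY]; linarith
  have e2 : x2 = x + 2 * Y := by rw [hY]; linarith
  have hb : x * (2 * e + f) - Y * (2 * e - 2 * f) = 1 := by rw [← hef, e1, e2]; ring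
  have hbase : Gd (-6) (5 - (-6)) (8 - (-6)) (5 + (-4) + 8 - (-6)) := by
    norm_num; exact Gd.base
  have s1 := hbase.form x Y (2 * e - 2 * f) (2 * e + f) hb
  generalize 2 * e - 2 * f = X' at *
  generalize 2 * e + f = Y' at *
  -- now at circle a
  set a : ℤ := x1 ^ 2 + x2 ^ 2 + 6 with hadef
  have s2 := s1.sw12
  set u1 : ℤ := 2 * X' - 2 * Y' with hu1
  set u2 : ℤ := X' + 2 * Y' with hu2
  set v1 := u1 - x2 with hv1
  set v2 := u2 + x1 with hv2
  have hdet : x1 * v2 - x2 * v1 = a := by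
    rw [hv1, hv2, hu1, hu2, hadef]; 
    have : x1 * (X' + 2 * Y') - x2 * (2 * X' - 2 * Y') = 6 := by
      rw [e1, e2]; linear_combination 6 * hb
    linarith
  have s3 : Gd a (x1 ^ 2 + x2 ^ 2 - a) (v1 ^ 2 + v2 ^ 2 - a)
      (x1 ^ 2 + x2 ^ 2 + 2 * (x1 * v1 + x2 * v2) + (v1 ^ 2 + v2 ^ 2) - a) := by
    convert s2 using 1
    · rw [hadef, e1, e2]; ring
    · rw [hadef]; ring
    · rw [hadef, hv1, hv2, hu1, hu2, e1, e2]; linear_combination 12 * hb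
    · rw [hadef, hv1, hv2, hu1, hu2, e1, e2]; linear_combination 12 * hb
  obtain ⟨w, hw⟩ := ha
  have hz : a ∣ P1 * v2 - P2 * v1 := by
    -- P = (eP1+fP2) ξ + det * (-f, e)
    have : P1 * v2 - P2 * v1 = (e * P1 + f * P2) * (x1 * v2 - x2 * v1) 
        - (x1 * P2 - x2 * P1) * (f * v2 + e * v1) := by
      linear_combination (-(P1 * v2 - P2 * v1)) * hef
    rw [this, hdet, hw]
    exact dvd_sub (Dvd.intro_left _ rfl) (Dvd.dvd.mul_right (Dvd.intro _ rfl) _)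
  obtain ⟨z, hz⟩ := hz
  have ha0 : a ≠ 0 := by rw [hadef]; positivity
  have hP1 : P1 = z * x1 + w * v1 := by
    apply mul_left_cancel₀ ha0
    rw [mul_add, ← mul_assoc, ← mul_assoc, ← hz, ← hw, ← hdet]; ring
  have hP2 : P2 = z * x2 + w * v2 := by
    apply mul_left_cancel₀ ha0
    rw [mul_add, ← mul_assoc, ← mul_assoc, ← hz, ← hw, ← hdet]; ring
  have s4 := s3.form z w (-(p * v1 + q * v2)) (p * x1 + q * x2) (by
    rw [← hpq, hP1, hP2]; ring)
  have s5 := s4.sw12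
  obtain ⟨γ, hγ, σ, hs⟩ := s5.orbit
  refine ⟨γ, hγ, σ 0, ?_⟩
  rw [hs 0, hP1, hP2]
  simp
  ring

/-- number of divisors -/
def tau (n : ℕ) : ℕ := n.divisors.card

lemma tau_pos {n : ℕ} (hn : 0 < n) : 0 < tau n := by
  unfold tau; exact Finset.card_pos.mpr ⟨1, by simp [hn.ne']⟩

lemma tau_le_self (n : ℕ) : tau n ≤ n := Nat.card_divisors_le_self n

lemma tau_le_of_dvd {m n : ℕ} (h : m ∣ n) (hn : n ≠ 0) : tau m ≤ tau n :=
  Finset.card_le_card (Nat.divisors_subset_of_dvd hn h)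

lemma tau_bound (ε : ℝ) (hε : 0 < ε) : ∃ C : ℝ, 1 ≤ C ∧ ∀ n : ℕ, (tau n : ℝ) ≤ C * (n : ℝ) ^ ε := by
  set K : ℝ := 1 + 1 / (ε * Real.log 2) with hK
  have hl2 : 0 < Real.log 2 := Real.log_pos (by norm_num)
  have hK1 : 1 ≤ K := by rw [hK]; have : 0 < 1 / (ε * Real.log 2) := by positivity
                         linarith
  set P0 : ℕ := ⌈(2:ℝ) ^ (1/ε)⌉₊ with hP0
  have hKp : ∀ p : ℕ, 2 ≤ p → ∀ v : ℕ, ((v:ℝ) + 1) ≤ K * ((p:ℝ) ^ v) ^ ε := by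
    intro p hp v
    have h2p : (2:ℝ) ≤ p := by exact_mod_cast hp
    have h1 : ((2:ℝ) ^ v) ^ ε ≤ ((p:ℝ) ^ v) ^ ε := by gcongr
    have h2 : 1 + ε * v * Real.log 2 ≤ ((2:ℝ) ^ v) ^ ε := by
      rw [← Real.rpow_natCast, ← Real.rpow_mul (by norm_num), Real.rpow_def_of_pos (by norm_num)]
      have := Real.add_one_le_exp (Real.log 2 * (v * ε))
      linarith
    have h3 : (v:ℝ) + 1 ≤ K * (1 + ε * v * Real.log 2) := by
      have : K * (1 + ε * v * Real.log 2) = 1 + v + 1 / (ε * Real.log 2) + ε * v * Real.log 2 := by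
        rw [hK]; field_simp; ring
      rw [this]
      have : 0 < 1 / (ε * Real.log 2) := by positivity
      have : 0 ≤ ε * v * Real.log 2 := by positivity
      linarith
    calc (v:ℝ) + 1 ≤ K * (1 + ε * v * Real.log 2) := h3
      _ ≤ K * ((p:ℝ) ^ v) ^ ε := by gcongr; linarith
  have hbig : ∀ p : ℕ, P0 ≤ p → ∀ v : ℕ, ((v:ℝ) + 1) ≤ ((p:ℝ) ^ v) ^ ε := by
    intro p hp v
    have h1 : (2:ℝ) ^ (1/ε) ≤ p := le_trans (Nat.le_ceil _) (by exact_mod_cast hp)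
    have h2 : (2:ℝ) ≤ (p:ℝ) ^ ε := by
      calc (2:ℝ) = ((2:ℝ) ^ (1/ε)) ^ ε := by
            rw [← Real.rpow_mul (by norm_num)]; field_simp; simp
        _ ≤ _ := by gcongr
    have h3 : ((p:ℝ) ^ v) ^ ε = ((p:ℝ) ^ ε) ^ v := by
      rw [← Real.rpow_natCast, ← Real.rpow_natCast, ← Real.rpow_mul (by positivity), 
        ← Real.rpow_mul (by positivity), mul_comm]
    rw [h3]
    calc (v:ℝ) + 1 ≤ 2 ^ v := by exact_mod_cast Nat.lt_two_pow_self
      _ ≤ _ := by gcongr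
  refine ⟨K ^ P0, one_le_pow₀ hK1, fun n => ?_⟩
  rcases Nat.eq_zero_or_pos n with rfl | hn
  · simp [tau]; positivity
  have hc : (tau n : ℝ) = ∏ p ∈ n.primeFactors, ((n.factorization p : ℝ) + 1) := by
    unfold tau; rw [Nat.card_divisors hn.ne']; push_cast; rfl
  have hr : (n:ℝ) ^ ε = ∏ p ∈ n.primeFactors, (((p:ℝ) ^ (n.factorization p)) ^ ε) := by
    rw [Real.finsetProd_rpow _ _ (fun i _ => by positivity)]
    congr 1
    conv_lhs => rw [← Nat.prod_factorization_pow_eq_self hn.ne']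
    rw [Finsupp.prod]; push_cast; rfl
  have h1 : (tau n : ℝ) ≤ ∏ p ∈ n.primeFactors, ((if p < P0 then K else 1) * (((p:ℝ) ^ (n.factorization p)) ^ ε)) := by
    rw [hc]
    apply Finset.prod_le_prod
    · intros; positivity
    · intro p hp
      split_ifs with h
      · exact hKp p (Nat.prime_of_mem_primeFactors hp).two_le _
      · rw [one_mul]; exact hbig p (by omega) _
  rw [Finset.prod_mul_distrib, ← hr] at h1
  refine h1.trans ?_
  gcongr
  rw [Finset.prod_ite]
  simp only [Finset.prod_const, one_pow, mul_one]
  apply pow_le_pow_right₀ hK1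
  calc _ ≤ (Finset.range P0).card := Finset.card_le_card (by intro p; simp)
    _ = P0 := by simp

lemma le_tau_mul_totient (c : ℕ) : c ≤ tau c * c.totient := by
  rcases Nat.eq_zero_or_pos c with rfl | hc
  · simp
  calc c = ∑ d ∈ c.divisors, d.totient := (Nat.sum_totient c).symm
    _ ≤ ∑ d ∈ c.divisors, c.totient := by
        apply Finset.sum_le_sum
        intro d hd
        exact Nat.le_of_dvd (Nat.totient_pos.mpr hc) (Nat.totient_dvd_of_dvd (Nat.dvd_of_mem_divisors hd))
    _ = _ := by simp [tau]

/-- solutions of a linear congruence -/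
lemma card_lin (n : ℕ) [NeZero n] (r k : ZMod n) :
    (Finset.univ.filter (fun y : ZMod n => r * y = k)).card ≤ Nat.gcd r.val n := by
  classical
  -- injection into those with r*y=0
  have h0 : (Finset.univ.filter (fun y : ZMod n => r * y = 0)).card ≤ Nat.gcd r.val n := by
    set g := Nat.gcd r.val n with hg
    have hgn : g ∣ n := Nat.gcd_dvd_right _ _
    have hn : 0 < n := NeZero.pos n
    have hgpos : 0 < g := Nat.gcd_pos_of_pos_right _ hn
    obtain ⟨e, he⟩ := hgn
    have hepos : 0 < e := by rcases Nat.eq_zero_or_pos e with h | h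
                             · rw [h] at he; omega
                             · exact h
    calc _ ≤ ((Finset.range g).image (fun i => ((e * i : ℕ) : ZMod n))).card := by
          apply Finset.card_le_card
          intro y hy
          simp only [Finset.mem_filter, Finset.mem_univ, true_and] at hy
          have h1 : n ∣ r.val * y.val := by
            rw [← ZMod.natCast_eq_zero_iff]; push_cast; simpa using hy
          have h2 : e ∣ y.val := by
            have : e = n / g := by rw [he]; exact (Nat.mul_div_cancel_left e hgpos).symm
            rw [this]
            have hcop : Nat.Coprime (n / g) (r.val / g) := 
              (Nat.coprime_div_gcd_div_gcd (m := r.val) (n := n) hgpos).symm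
            apply hcop.dvd_of_dvd_mul_left
            rw [← Nat.mul_dvd_mul_iff_left hgpos, ← mul_assoc, Nat.mul_div_cancel' (Nat.gcd_dvd_right _ _),
              Nat.mul_div_cancel' (Nat.gcd_dvd_left _ _)]
            exact h1
          obtain ⟨i, hi⟩ := h2
          simp only [Finset.mem_image, Finset.mem_range]
          refine ⟨i, ?_, ?_⟩
          · have := ZMod.val_lt y
            rw [hi, he, mul_comm g e] at this
            exact lt_of_mul_lt_mul_left this (Nat.zero_le _)
          · rw [← hi]; simp
      _ ≤ g := by simpa using Finset.card_image_le (s := Finset.range g) (f := fun i => ((e * i : ℕ) : ZMod n))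
  by_cases h : ∃ y0, r * y0 = k
  · obtain ⟨y0, hy0⟩ := h
    refine le_trans ?_ h0
    apply Finset.card_le_card_of_injOn (fun y => y - y0)
    · intro y hy
      simp at hy ⊢
      rw [mul_sub, hy, hy0, sub_self]
    · intro a _ b _ hab
      simpa using hab
  · rw [Finset.filter_false_of_mem]
    · simp
    · intro y _ hy; exact h ⟨y, hy⟩

open ZMod in
lemma parseval2 (c : ℕ) [NeZero c] {ι : Type*} [Fintype ι] (F1 F2 : ι → ZMod c) :
    ∑ m : ZMod c, ∑ n : ZMod c, ‖∑ i, stdAddChar (m * F1 i + n * F2 i)‖ ^ 2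
      = (c:ℝ) ^ 2 * ((Finset.univ.filter (fun p : ι × ι => F1 p.1 = F1 p.2 ∧ F2 p.1 = F2 p.2)).card : ℝ) := by
  classical
  have key : ((∑ m : ZMod c, ∑ n : ZMod c, ‖∑ i, stdAddChar (m * F1 i + n * F2 i)‖ ^ 2 : ℝ) : ℂ)
      = ((c:ℝ) ^ 2 * ((Finset.univ.filter (fun p : ι × ι => F1 p.1 = F1 p.2 ∧ F2 p.1 = F2 p.2)).card : ℝ) : ℝ) := by
    push_cast
    have h1 : ∀ m n : ZMod c, ((‖∑ i, stdAddChar (m * F1 i + n * F2 i)‖ : ℂ)) ^ 2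
        = ∑ p : ι × ι, stdAddChar (m * (F1 p.1 - F1 p.2)) * stdAddChar (n * (F2 p.1 - F2 p.2)) := by
      intro m n
      rw [← Complex.mul_conj', map_sum, Finset.sum_mul_sum, Fintype.sum_prod_type]
      refine Finset.sum_congr rfl fun i _ => Finset.sum_congr rfl fun j _ => ?_
      rw [← AddChar.map_neg_eq_conj, ← AddChar.map_add_eq_mul, ← AddChar.map_add_eq_mul]
      congr 1; ring
    simp_rw [h1]
    have h2 : ∀ m : ZMod c, ∑ n : ZMod c, ∑ p : ι × ι, 
        (stdAddChar (m * (F1 p.1 - F1 p.2)) * stdAddChar (n * (F2 p.1 - F2 p.2)) : ℂ)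
        = ∑ p : ι × ι, stdAddChar (m * (F1 p.1 - F1 p.2)) * (if F2 p.1 = F2 p.2 then (c:ℂ) else 0) := by
      intro m
      rw [Finset.sum_comm]
      refine Finset.sum_congr rfl fun p _ => ?_
      rw [← Finset.mul_sum, AddChar.sum_mulShift _ (isPrimitive_stdAddChar c)]
      simp [sub_eq_zero]
    simp_rw [h2]
    rw [Finset.sum_comm]
    have h3 : ∀ p : ι × ι, ∑ m : ZMod c, (stdAddChar (m * (F1 p.1 - F1 p.2)) * (if F2 p.1 = F2 p.2 then (c:ℂ) else 0) : ℂ)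
        = (c:ℂ)^2 * (if F1 p.1 = F1 p.2 ∧ F2 p.1 = F2 p.2 then 1 else 0) := by
      intro p
      rw [← Finset.sum_mul, AddChar.sum_mulShift _ (isPrimitive_stdAddChar c)]
      by_cases h : F1 p.1 = F1 p.2 <;> by_cases h' : F2 p.1 = F2 p.2 <;> simp [sub_eq_zero, h, h']
      ring
    simp_rw [h3]
    rw [← Finset.mul_sum]
    congr 1
    simp
  exact_mod_cast key

lemma sum_gcd_le (c : ℕ) [NeZero c] : ∑ u : ZMod c, Nat.gcd u.val c ≤ c * tau c := by
  have hc : 0 < c := NeZero.pos c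
  have h0 : ∑ u : ZMod c, Nat.gcd u.val c = ∑ i ∈ Finset.range c, Nat.gcd i c := by
    apply Finset.sum_bij (fun (u : ZMod c) _ => u.val)
    · intro u _; simp [ZMod.val_lt u]
    · intro a _ b _ h; exact ZMod.val_injective c h
    · intro b hb; exact ⟨(b : ZMod c), by simp, ZMod.val_cast_of_lt (by simpa using hb)⟩
    · intros; rfl
  rw [h0]
  calc ∑ i ∈ Finset.range c, Nat.gcd i c 
      ≤ ∑ i ∈ Finset.range c, ∑ d ∈ c.divisors, (if d ∣ i then d else 0) := by
        apply Finset.sum_le_sum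
        intro i _
        have := Finset.single_le_sum (f := fun d => if d ∣ i then d else 0) (s := c.divisors)
          (fun _ _ => Nat.zero_le _) (a := Nat.gcd i c) (by simp [Nat.gcd_dvd_right, hc.ne'])
        simpa [Nat.gcd_dvd_left] using this
    _ = ∑ d ∈ c.divisors, ∑ i ∈ Finset.range c, (if d ∣ i then d else 0) := Finset.sum_comm
    _ ≤ ∑ d ∈ c.divisors, c := by
        apply Finset.sum_le_sum
        intro d hd
        obtain ⟨e, he⟩ := Nat.dvd_of_mem_divisors hd
        have hd0 : 0 < d := Nat.pos_of_mem_divisors hd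
        rw [← Finset.sum_filter, Finset.sum_const, smul_eq_mul]
        have : ((Finset.range c).filter (fun i => d ∣ i)).card ≤ e := by
          calc _ ≤ ((Finset.range e).image (fun i => d * i)).card := by
                apply Finset.card_le_card
                intro i hi
                simp only [Finset.mem_filter, Finset.mem_range, Finset.mem_image] at hi ⊢
                obtain ⟨h1, j, rfl⟩ := hi
                refine ⟨j, ?_, rfl⟩
                rw [he] at h1
                exact lt_of_mul_lt_mul_left h1 (Nat.zero_le _)
            _ ≤ e := by simpa using Finset.card_image_le (s := Finset.range e) (f := fun i => d * i)
        calc _ ≤ e * d := Nat.mul_le_mul_right _ this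
          _ = c := by rw [he, mul_comm]
    _ = c * tau c := by simp [tau, mul_comm]

lemma card_uvw (c : ℕ) [NeZero c] :
    (Finset.univ.filter (fun p : ZMod c × ZMod c × ZMod c => p.1 * p.2.1 * p.2.2 = 0)).card ≤ (c * tau c) ^ 2 := by
  classical
  rw [Finset.card_filter, Fintype.sum_prod_type]
  simp_rw [Fintype.sum_prod_type]
  calc _ ≤ ∑ u : ZMod c, ∑ v : ZMod c, Nat.gcd u.val c * Nat.gcd v.val c := by
        apply Finset.sum_le_sum; intro u _
        apply Finset.sum_le_sum; intro v _
        have := card_lin c (u * v) 0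
        rw [Finset.card_filter] at this
        refine this.trans ?_
        rw [ZMod.val_mul]
        rw [← Nat.gcd_rec, Nat.gcd_comm c, Nat.gcd_comm u.val c, Nat.gcd_comm v.val c, Nat.gcd_comm _ c]
        calc _ ≤ _ := Nat.le_of_dvd (by 
              have : 0 < c := NeZero.pos c
              positivity) (Nat.gcd_mul_right_dvd_mul_gcd _ _ _)
          _ = _ := rfl
    _ = (∑ u : ZMod c, Nat.gcd u.val c) ^ 2 := by rw [sq, Finset.sum_mul_sum]
    _ ≤ _ := Nat.pow_le_pow_left (sum_gcd_le c) 2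

lemma two_torsion (c : ℕ) [NeZero c] (k : ZMod c) :
    (Finset.univ.filter (fun y : ZMod c => 2 * y = k)).card ≤ 2 := by
  refine (card_lin c 2 k).trans ?_
  rcases Nat.lt_or_ge 2 c with h | h
  · have : (2 : ZMod c).val = 2 := by
      have := ZMod.val_cast_of_lt h
      simpa using this
    rw [this]; exact Nat.gcd_le_left _ (by norm_num)
  · exact (Nat.gcd_le_right _ (NeZero.pos c)).trans h

lemma E4_bound (c : ℕ) [NeZero c] :
    (Finset.univ.filter (fun p : ((ZMod c)ˣ × (ZMod c)ˣ) × ((ZMod c)ˣ × (ZMod c)ˣ) => 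
      (p.1.1 + p.1.2 : ZMod c) = p.2.1 + p.2.2 ∧ 
      ((p.1.1⁻¹ : (ZMod c)ˣ) + (p.1.2⁻¹ : (ZMod c)ˣ) : ZMod c) = (p.2.1⁻¹ : (ZMod c)ˣ) + (p.2.2⁻¹ : (ZMod c)ˣ))).card 
      ≤ 2 * (c * tau c) ^ 2 := by
  classical
  set S := (Finset.univ.filter (fun p : ((ZMod c)ˣ × (ZMod c)ˣ) × ((ZMod c)ˣ × (ZMod c)ˣ) => 
      (p.1.1 + p.1.2 : ZMod c) = p.2.1 + p.2.2 ∧ 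
      ((p.1.1⁻¹ : (ZMod c)ˣ) + (p.1.2⁻¹ : (ZMod c)ˣ) : ZMod c) = (p.2.1⁻¹ : (ZMod c)ˣ) + (p.2.2⁻¹ : (ZMod c)ˣ))) with hS
  set T := (Finset.univ.filter (fun p : ZMod c × ZMod c × ZMod c => p.1 * p.2.1 * p.2.2 = 0)) with hT
  let f : ((ZMod c)ˣ × (ZMod c)ˣ) × ((ZMod c)ˣ × (ZMod c)ˣ) → ZMod c × ZMod c × ZMod c := fun p =>
    (p.1.1 + p.1.2, p.2.1 - p.1.1, p.1.2 - p.2.1)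
  have hmap : ∀ p ∈ S, f p ∈ T := by
    rintro ⟨⟨x1, x2⟩, ⟨x3, x4⟩⟩ hp
    simp only [hS, hT, f, Finset.mem_filter, Finset.mem_univ, true_and] at hp ⊢
    obtain ⟨h1, h2⟩ := hp
    have i1 : (x1 : ZMod c) * (x1⁻¹ : (ZMod c)ˣ) = 1 := by simp
    have i2 : (x2 : ZMod c) * (x2⁻¹ : (ZMod c)ˣ) = 1 := by simp
    have i3 : (x3 : ZMod c) * (x3⁻¹ : (ZMod c)ˣ) = 1 := by simp
    have i4 : (x4 : ZMod c) * (x4⁻¹ : (ZMod c)ˣ) = 1 := by simp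
    generalize ((x1⁻¹ : (ZMod c)ˣ) : ZMod c) = y1 at *
    generalize ((x2⁻¹ : (ZMod c)ˣ) : ZMod c) = y2 at *
    generalize ((x3⁻¹ : (ZMod c)ˣ) : ZMod c) = y3 at *
    generalize ((x4⁻¹ : (ZMod c)ˣ) : ZMod c) = y4 at *
    generalize (x1 : ZMod c) = a1 at *
    generalize (x2 : ZMod c) = a2 at *
    generalize (x3 : ZMod c) = a3 at *
    generalize (x4 : ZMod c) = a4 at *
    have e4 : a4 = a1 + a2 - a3 := by rw [h1]; ring
    have hA : a1 * a2 * a3 * a4 * (y1 + y2) = (a1 + a2) * (a3 * a4) := by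
      linear_combination (a2 * a3 * a4) * i1 + (a1 * a3 * a4) * i2
    have hB : a1 * a2 * a3 * a4 * (y3 + y4) = (a1 + a2) * (a1 * a2) := by
      rw [h1]
      linear_combination (a1 * a2 * a4) * i3 + (a1 * a2 * a3) * i4
    rw [h2] at hA
    have := hA.symm.trans hB
    rw [e4] at this
    linear_combination this
  have hfib : ∀ q ∈ T, (S.filter (fun p => f p = q)).card ≤ 2 := by
    rintro ⟨u, v, w⟩ _
    refine le_trans ?_ (two_torsion c (u - v - w))
    apply Finset.card_le_card_of_injOn (fun p => (p.1.1 : ZMod c))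
    · rintro ⟨⟨x1, x2⟩, ⟨x3, x4⟩⟩ hp
      simp [f] at hp ⊢
      obtain ⟨_, h1, h2, h3⟩ := hp
      rw [← h1, ← h2, ← h3]; ring
    · rintro ⟨⟨x1, x2⟩, ⟨x3, x4⟩⟩ hp ⟨⟨x1', x2'⟩, ⟨x3', x4'⟩⟩ hp' h
      simp [f, hS] at hp hp' h
      obtain ⟨⟨h0, _⟩, h1, h2, h3⟩ := hp
      obtain ⟨⟨h0', _⟩, h1', h2', h3'⟩ := hp'
      have e2 : (x2 : ZMod c) = x2' := by linear_combination h1 - h1' - h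
      have e3 : (x3 : ZMod c) = x3' := by linear_combination h2 - h2' + h
      have e4 : (x4 : ZMod c) = x4' := by linear_combination h0' - h0 + e2 - e3 + h
      simp [Units.ext_iff, h, e2, e3, e4]
  have := Finset.card_le_mul_card_image_of_maps_to hmap 2 hfib
  refine this.trans ?_
  exact Nat.mul_le_mul_left _ (card_uvw c)

open ZMod in
/-- Kloosterman sum -/
noncomputable def KS (c : ℕ) [NeZero c] (k : (ZMod c)ˣ) (m n : ZMod c) : ℂ :=
  ∑ x : (ZMod c)ˣ, stdAddChar (N := c) (m * (x : ZMod c) + n * ((k : ZMod c) * ((x⁻¹ : (ZMod c)ˣ) : ZMod c)))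

lemma KS_inv (c : ℕ) [NeZero c] (k u : (ZMod c)ˣ) (m n : ZMod c) :
    KS c k (m * u) (n * (u⁻¹ : (ZMod c)ˣ)) = KS c k m n := by
  unfold KS
  refine Fintype.sum_equiv (Equiv.mulLeft u) _ _ (fun x => ?_)
  simp only [Equiv.coe_mulLeft, mul_inv, Units.val_mul]
  congr 1; ring

lemma KS_fourth (c : ℕ) [NeZero c] (k : (ZMod c)ˣ) :
    ∑ m : ZMod c, ∑ n : ZMod c, ‖KS c k m n‖ ^ 4 ≤ 2 * (c : ℝ) ^ 4 * (tau c : ℝ) ^ 2 := by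
  classical
  have h := parseval2 c (ι := (ZMod c)ˣ × (ZMod c)ˣ) (fun p => (p.1 + p.2 : ZMod c)) 
    (fun p => k * ((p.1⁻¹ : (ZMod c)ˣ) + (p.2⁻¹ : (ZMod c)ˣ)))
  have h1 : ∀ m n : ZMod c, ‖KS c k m n‖ ^ 4 = ‖∑ p : (ZMod c)ˣ × (ZMod c)ˣ, ZMod.stdAddChar (N := c) (m * (p.1 + p.2 : ZMod c) 
      + n * (k * (((p.1⁻¹ : (ZMod c)ˣ) : ZMod c) + (p.2⁻¹ : (ZMod c)ˣ))))‖ ^ 2 := by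
    intro m n
    rw [show (4:ℕ) = 2 * 2 by norm_num, pow_mul, ← norm_pow]
    congr 2
    unfold KS
    rw [sq, Finset.sum_mul_sum, Fintype.sum_prod_type]
    refine Finset.sum_congr rfl fun i _ => Finset.sum_congr rfl fun j _ => ?_
    rw [← AddChar.map_add_eq_mul]
    congr 1; ring
  simp_rw [h1]
  rw [h]
  have h2 := E4_bound c
  have h3 : (Finset.univ.filter (fun p : ((ZMod c)ˣ × (ZMod c)ˣ) × ((ZMod c)ˣ × (ZMod c)ˣ) => 
      (p.1.1 + p.1.2 : ZMod c) = p.2.1 + p.2.2 ∧ 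
      (k * ((p.1.1⁻¹ : (ZMod c)ˣ) + (p.1.2⁻¹ : (ZMod c)ˣ)) : ZMod c) = k * ((p.2.1⁻¹ : (ZMod c)ˣ) + (p.2.2⁻¹ : (ZMod c)ˣ)))).card
      ≤ 2 * (c * tau c) ^ 2 := by
    simp only [Units.mul_right_inj]
    exact h2
  calc _ ≤ (c:ℝ) ^ 2 * ((2 * (c * tau c) ^ 2 : ℕ) : ℝ) := by gcongr
    _ = _ := by push_cast; ring

lemma KS_bound1 (c : ℕ) [NeZero c] (k : (ZMod c)ˣ) (m n : ZMod c) :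
    ‖KS c k m n‖ ^ 4 ≤ (Nat.gcd m.val c : ℝ) * (2 * (c : ℝ) ^ 3 * (tau c : ℝ) ^ 3) := by
  classical
  have hc : 0 < c := NeZero.pos c
  have h1 : (c.totient : ℝ) * ‖KS c k m n‖ ^ 4 = ∑ u : (ZMod c)ˣ, ‖KS c k (m * u) (n * (u⁻¹ : (ZMod c)ˣ))‖ ^ 4 := by
    simp_rw [KS_inv]
    rw [Finset.sum_const, Finset.card_univ, ZMod.card_units_eq_totient, nsmul_eq_mul]
  have h2 : ∑ u : (ZMod c)ˣ, ‖KS c k (m * u) (n * (u⁻¹ : (ZMod c)ˣ))‖ ^ 4 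
      ≤ ∑ u : (ZMod c)ˣ, ∑ n' : ZMod c, ‖KS c k (m * u) n'‖ ^ 4 := by
    apply Finset.sum_le_sum
    intro u _
    exact Finset.single_le_sum (f := fun n' => ‖KS c k (m * u) n'‖ ^ 4) (fun _ _ => by positivity) (Finset.mem_univ _)
  have h3 : ∑ u : (ZMod c)ˣ, ∑ n' : ZMod c, ‖KS c k (m * u) n'‖ ^ 4 
      = ∑ m' : ZMod c, ((Finset.univ.filter (fun u : (ZMod c)ˣ => m * u = m')).card : ℝ) * ∑ n' : ZMod c, ‖KS c k m' n'‖ ^ 4 := by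
    rw [← Finset.sum_fiberwise (s := Finset.univ) (g := fun u : (ZMod c)ˣ => m * u)]
    refine Finset.sum_congr rfl fun m' _ => ?_
    rw [Finset.sum_congr rfl (g := fun _ => ∑ n' : ZMod c, ‖KS c k m' n'‖ ^ 4)]
    · rw [Finset.sum_const, nsmul_eq_mul]
    · intro u hu
      simp at hu
      rw [hu]
  have h4 : ∀ m' : ZMod c, (Finset.univ.filter (fun u : (ZMod c)ˣ => m * u = m')).card ≤ Nat.gcd m.val c := by
    intro m'
    refine le_trans ?_ (card_lin c m m')
    apply Finset.card_le_card_of_injOn (fun u : (ZMod c)ˣ => (u : ZMod c))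
    · intro u hu; simpa using hu
    · intro a _ b _ h; exact Units.ext h
  have h5 : (c.totient : ℝ) * ‖KS c k m n‖ ^ 4 ≤ (Nat.gcd m.val c : ℝ) * (2 * (c : ℝ) ^ 4 * (tau c : ℝ) ^ 2) := by
    rw [h1]
    refine (h2.trans h3.le).trans ?_
    calc _ ≤ ∑ m' : ZMod c, (Nat.gcd m.val c : ℝ) * ∑ n' : ZMod c, ‖KS c k m' n'‖ ^ 4 := by
          apply Finset.sum_le_sum; intro m' _
          gcongr
          exact_mod_cast h4 m'
      _ = (Nat.gcd m.val c : ℝ) * ∑ m' : ZMod c, ∑ n' : ZMod c, ‖KS c k m' n'‖ ^ 4 := by rw [Finset.mul_sum]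
      _ ≤ _ := by gcongr; exact KS_fourth c k
  have h6 : (c:ℝ) ≤ tau c * c.totient := by exact_mod_cast le_tau_mul_totient c
  have hc' : (0:ℝ) < c := by exact_mod_cast hc
  have h7 : (c:ℝ) * ‖KS c k m n‖ ^ 4 ≤ c * ((Nat.gcd m.val c : ℝ) * (2 * (c : ℝ) ^ 3 * (tau c : ℝ) ^ 3)) := by
    calc (c:ℝ) * ‖KS c k m n‖ ^ 4 ≤ (tau c * c.totient) * ‖KS c k m n‖ ^ 4 := by gcongr
      _ = tau c * (c.totient * ‖KS c k m n‖ ^ 4) := by ring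
      _ ≤ tau c * ((Nat.gcd m.val c : ℝ) * (2 * (c : ℝ) ^ 4 * (tau c : ℝ) ^ 2)) := by gcongr
      _ = _ := by ring
  exact le_of_mul_le_mul_left h7 hc'

lemma KS_symm (c : ℕ) [NeZero c] (k : (ZMod c)ˣ) (m n : ZMod c) : KS c k m n = KS c k n m := by
  unfold KS
  refine Fintype.sum_equiv ((Equiv.inv _).trans (Equiv.mulLeft k)) _ _ (fun x => ?_)
  simp only [Equiv.trans_apply, Equiv.inv_apply, Equiv.coe_mulLeft, mul_inv, Units.val_mul, inv_inv]
  congr 1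
  have : (k : ZMod c) * (k⁻¹ : (ZMod c)ˣ) = 1 := by simp
  linear_combination (-(m * x)) * this

/-- distance to zero -/
def nabs {c : ℕ} (m : ZMod c) : ℕ := m.valMinAbs.natAbs

lemma gcd_le_nabs (c : ℕ) [NeZero c] (m : ZMod c) (hm : m ≠ 0) : Nat.gcd m.val c ≤ nabs m := by
  have h1 : Nat.gcd m.val c = Nat.gcd (nabs m) c := by
    have h0 : (Int.gcd (m.val : ℤ) c) = Int.gcd m.valMinAbs c := by
      have h' : m.valMinAbs ≡ (m.val : ℤ) [ZMOD c] := by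
        rw [← ZMod.intCast_eq_intCast_iff]; simp
      obtain ⟨t, ht⟩ := h'.dvd
      have : (m.val : ℤ) = m.valMinAbs + c * t := by linarith
      rw [this]; simp
    exact h0
  rw [h1]
  apply Nat.gcd_le_left
  unfold nabs
  simpa [Nat.pos_iff_ne_zero] using hm

/-- geometric sums -/
noncomputable def Ahat (c : ℕ) [NeZero c] (L : ℕ) (m : ZMod c) : ℂ :=
  ∑ i ∈ Finset.range L, ZMod.stdAddChar (m * (i : ZMod c))

lemma Ahat_bound (c : ℕ) [NeZero c] (L : ℕ) (m : ZMod c) (hm : m ≠ 0) :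
    ‖Ahat c L m‖ ≤ c / nabs m := by
  have hc : (0:ℝ) < c := by exact_mod_cast NeZero.pos c
  set z : ℂ := ZMod.stdAddChar m with hz
  have h1 : Ahat c L m = ∑ i ∈ Finset.range L, z ^ i := by
    unfold Ahat
    refine Finset.sum_congr rfl fun i _ => ?_
    rw [hz, ← AddChar.map_nsmul_eq_pow, nsmul_eq_mul, mul_comm]
  have hz1 : ‖z‖ = 1 := by rw [hz]; exact AddChar.norm_apply _ _
  have h2 : ‖z - 1‖ * ‖Ahat c L m‖ ≤ 2 := by
    rw [h1, ← norm_mul, mul_geom_sum]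
    calc _ ≤ ‖z ^ L‖ + ‖(1:ℂ)‖ := norm_sub_le _ _
      _ = 2 := by rw [norm_pow, hz1]; norm_num
  have hn0 : 0 < nabs m := by unfold nabs; simpa [Nat.pos_iff_ne_zero] using hm
  have hn : (0:ℝ) < nabs m := by exact_mod_cast hn0
  have h3 : 2 * (nabs m : ℝ) / c ≤ ‖z - 1‖ := by
    have e1 : z = Complex.exp (Complex.I * ((2 * Real.pi * m.valMinAbs / c : ℝ) : ℂ)) := by
      rw [hz, ← ZMod.coe_valMinAbs m, ZMod.stdAddChar_coe, ZMod.coe_valMinAbs]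
      congr 1; push_cast; ring
    rw [e1, Complex.norm_exp_I_mul_ofReal_sub_one]
    have e2 : ‖2 * Real.sin (2 * Real.pi * m.valMinAbs / c / 2)‖ = 2 * |Real.sin (Real.pi * (nabs m : ℝ) / c)| := by
      rw [norm_mul, Real.norm_eq_abs, Real.norm_eq_abs, abs_of_pos (by norm_num : (0:ℝ) < 2)]
      congr 1
      have : (nabs m : ℝ) = |(m.valMinAbs : ℝ)| := by unfold nabs; rw [Nat.cast_natAbs]; push_cast; rfl
      rw [this]
      rcases abs_cases (m.valMinAbs : ℝ) with ⟨h, _⟩ | ⟨h, _⟩ <;> rw [h]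
      · congr 2; ring
      · rw [← abs_neg, ← Real.sin_neg]; congr 2; ring
    rw [e2]
    have hle : (nabs m : ℝ) ≤ c / 2 := by
      have := ZMod.natAbs_valMinAbs_le m
      have h' : nabs m * 2 ≤ c := by unfold nabs; omega
      have : (nabs m : ℝ) * 2 ≤ c := by exact_mod_cast h'
      linarith
    have h4 := Real.mul_le_sin (x := Real.pi * (nabs m : ℝ) / c) (by positivity) (by
      rw [div_le_div_iff₀ hc (by norm_num)]
      nlinarith [Real.pi_pos])
    have h5 := le_abs_self (Real.sin (Real.pi * (nabs m : ℝ) / c))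
    have h6 : 2 / Real.pi * (Real.pi * (nabs m : ℝ) / c) = 2 * (nabs m : ℝ) / c := by
      field_simp
    rw [h6] at h4
    have : 0 ≤ 2 * (nabs m : ℝ) / c := by positivity
    linarith
  have h4 : 2 * (nabs m : ℝ) / c * ‖Ahat c L m‖ ≤ 2 := 
    (mul_le_mul_of_nonneg_right h3 (norm_nonneg _)).trans h2
  rw [le_div_iff₀ hn]
  have : 2 * (nabs m : ℝ) / c * ‖Ahat c L m‖ * c = 2 * (‖Ahat c L m‖ * nabs m) := by
    field_simp
  nlinarith

lemma sum_prod_mul {α β : Type*} (s : Finset α) (t : Finset β) (f : α → ℂ) (g : β → ℂ) :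
    ∑ p ∈ s ×ˢ t, f p.1 * g p.2 = (∑ a ∈ s, f a) * ∑ b ∈ t, g b := by
  rw [Finset.sum_mul_sum, Finset.sum_product]

lemma sum_nabs_le (c : ℕ) [NeZero c] (F : ℕ → ℝ) (hF : ∀ n, 0 ≤ F n) :
    ∑ m ∈ Finset.univ.filter (fun m : ZMod c => m ≠ 0), F (nabs m) ≤ 2 * ∑ k ∈ Finset.range c, F (k + 1) := by
  classical
  set s := Finset.univ.filter (fun m : ZMod c => m ≠ 0)
  have hmaps : ∀ m ∈ s, nabs m - 1 ∈ Finset.range c := by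
    intro m hm
    have := ZMod.natAbs_valMinAbs_le m
    have hc : 0 < c := NeZero.pos c
    simp only [nabs, Finset.mem_range]; omega
  rw [← Finset.sum_fiberwise_of_maps_to hmaps, Finset.mul_sum]
  apply Finset.sum_le_sum
  intro k _
  have h1 : ∀ m ∈ s.filter (fun m => nabs m - 1 = k), F (nabs m) = F (k + 1) := by
    intro m hm
    simp [s] at hm
    have h0 : 0 < nabs m := by unfold nabs; simpa [Nat.pos_iff_ne_zero] using hm.1
    congr 1; omega
  rw [Finset.sum_congr rfl h1, Finset.sum_const, nsmul_eq_mul]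
  gcongr
  · exact hF _
  have : (s.filter (fun m => nabs m - 1 = k)).card ≤ ({((k:ℤ)+1), -((k:ℤ)+1)} : Finset ℤ).card := by
    apply Finset.card_le_card_of_injOn (fun m => m.valMinAbs)
    · intro m hm
      simp [s] at hm
      have h0 : 0 < nabs m := by unfold nabs; simpa [Nat.pos_iff_ne_zero] using hm.1
      simp only [nabs] at hm h0
      simp
      omega
    · intro a _ b _ h
      exact ZMod.injective_valMinAbs h
  exact_mod_cast this.trans Finset.card_le_two

lemma KS_bound2 (c : ℕ) [NeZero c] (k : (ZMod c)ˣ) (m n : ZMod c) :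
    ‖KS c k m n‖ ≤ (if m = 0 ∧ n = 0 then (c:ℝ) else 0) + 
      (2 * (c : ℝ) ^ 3 * (tau c : ℝ) ^ 3) ^ (1/4 : ℝ) * ((nabs m : ℝ) ^ (1/4:ℝ) + (nabs n : ℝ) ^ (1/4:ℝ)) := by
  have main : ∀ m n : ZMod c, m ≠ 0 → ‖KS c k m n‖ ≤ (2 * (c : ℝ) ^ 3 * (tau c : ℝ) ^ 3) ^ (1/4 : ℝ) * (nabs m : ℝ) ^ (1/4:ℝ) := by
    intro m n hm
    have h1 := KS_bound1 c k m n
    have h2 : (Nat.gcd m.val c : ℝ) ≤ nabs m := by exact_mod_cast gcd_le_nabs c m hm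
    have h3 : ‖KS c k m n‖ ^ 4 ≤ (2 * (c : ℝ) ^ 3 * (tau c : ℝ) ^ 3) * (nabs m : ℝ) := by
      refine h1.trans ?_
      rw [mul_comm]
      gcongr
    rw [← Real.mul_rpow (by positivity) (by positivity)]
    calc ‖KS c k m n‖ = (‖KS c k m n‖ ^ 4) ^ (1/4:ℝ) := by
          rw [← Real.rpow_natCast, ← Real.rpow_mul (norm_nonneg _)]; norm_num
      _ ≤ _ := by gcongr
  by_cases hm : m = 0
  · by_cases hn : n = 0
    · simp only [hm, hn, and_self, if_true]
      have : ‖KS c k 0 0‖ ≤ c := by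
        unfold KS
        simp
        exact Nat.totient_le c
      have : 0 ≤ (2 * (c : ℝ) ^ 3 * (tau c : ℝ) ^ 3) ^ (1/4 : ℝ) * ((nabs (0 : ZMod c) : ℝ) ^ (1/4:ℝ) + (nabs (0 : ZMod c) : ℝ) ^ (1/4:ℝ)) := by positivity
      linarith
    · rw [if_neg (by simp [hn]), zero_add, KS_symm]
      refine (main n m hn).trans ?_
      gcongr
      have : (0:ℝ) ≤ (nabs m : ℝ) ^ (1/4:ℝ) := by positivity
      linarith
  · rw [if_neg (by simp [hm]), zero_add]
    refine (main m n hm).trans ?_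
    gcongr
    have : (0:ℝ) ≤ (nabs n : ℝ) ^ (1/4:ℝ) := by positivity
    linarith

open ZMod in
lemma count4 (c : ℕ) [NeZero c] (k : (ZMod c)ˣ) (α β : ZMod c) (A : Finset ℕ) :
    (c:ℝ) ^ 2 * (((Finset.univ ×ˢ (A ×ˢ (A ×ˢ (A ×ˢ A)))).filter (fun t : (ZMod c)ˣ × (ℕ × ℕ × ℕ × ℕ) => 
      (t.1 : ZMod c) - α - (t.2.1 : ZMod c) + (t.2.2.1 : ZMod c) = 0 ∧ 
      (k : ZMod c) * ((t.1⁻¹ : (ZMod c)ˣ) : ZMod c) - β - (t.2.2.2.1 : ZMod c) + (t.2.2.2.2 : ZMod c) = 0)).card : ℝ)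
    ≤ ∑ m : ZMod c, ∑ n : ZMod c, ‖KS c k m n‖ * ‖∑ i ∈ A, stdAddChar (N := c) (m * (i : ZMod c))‖ ^ 2 
        * ‖∑ i ∈ A, stdAddChar (N := c) (n * (i : ZMod c))‖ ^ 2 := by
  classical
  set I : Finset ((ZMod c)ˣ × (ℕ × ℕ × ℕ × ℕ)) := Finset.univ ×ˢ (A ×ˢ (A ×ˢ (A ×ˢ A))) with hI
  set x : (ZMod c)ˣ × (ℕ × ℕ × ℕ × ℕ) → ZMod c := fun t => (t.1 : ZMod c) - α - (t.2.1 : ZMod c) + (t.2.2.1 : ZMod c) with hx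
  set y : (ZMod c)ˣ × (ℕ × ℕ × ℕ × ℕ) → ZMod c := fun t => (k : ZMod c) * ((t.1⁻¹ : (ZMod c)ˣ) : ZMod c) - β - (t.2.2.2.1 : ZMod c) + (t.2.2.2.2 : ZMod c) with hy
  have h1 : (((c:ℝ) ^ 2 * ((I.filter (fun t => x t = 0 ∧ y t = 0)).card : ℝ) : ℝ) : ℂ)
      = ∑ m : ZMod c, ∑ n : ZMod c, ∑ t ∈ I, stdAddChar (m * x t) * stdAddChar (n * y t) := by
    have e1 : ∀ m : ZMod c, ∑ n : ZMod c, ∑ t ∈ I, (stdAddChar (m * x t) * stdAddChar (n * y t) : ℂ)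
        = ∑ t ∈ I, stdAddChar (m * x t) * (if y t = 0 then (c:ℂ) else 0) := by
      intro m
      rw [Finset.sum_comm]
      refine Finset.sum_congr rfl fun t _ => ?_
      rw [← Finset.mul_sum, AddChar.sum_mulShift _ (isPrimitive_stdAddChar c)]
      simp
    simp_rw [e1]
    rw [Finset.sum_comm]
    have e2 : ∀ t : (ZMod c)ˣ × (ℕ × ℕ × ℕ × ℕ), ∑ m : ZMod c, (stdAddChar (m * x t) * (if y t = 0 then (c:ℂ) else 0) : ℂ)
        = (c:ℂ)^2 * (if x t = 0 ∧ y t = 0 then 1 else 0) := by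
      intro t
      rw [← Finset.sum_mul, AddChar.sum_mulShift _ (isPrimitive_stdAddChar c)]
      by_cases h : x t = 0 <;> by_cases h' : y t = 0 <;> simp [h, h']
      ring
    simp_rw [e2]
    rw [← Finset.mul_sum]
    push_cast
    congr 1
    simp
  have h2 : ∀ m n : ZMod c, ‖∑ t ∈ I, (stdAddChar (m * x t) * stdAddChar (n * y t) : ℂ)‖ = 
      ‖KS c k m n‖ * ‖∑ i ∈ A, stdAddChar (N := c) (m * (i : ZMod c))‖ ^ 2 
        * ‖∑ i ∈ A, stdAddChar (N := c) (n * (i : ZMod c))‖ ^ 2 := by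
    intro m n
    have hneg : ∀ m : ZMod c, ‖∑ i ∈ A, stdAddChar (N := c) (-(m * (i : ZMod c)))‖ = ‖∑ i ∈ A, stdAddChar (N := c) (m * (i : ZMod c))‖ := by
      intro m
      simp_rw [AddChar.map_neg_eq_conj]
      rw [← map_sum, Complex.norm_conj]
    have e1 : ∑ t ∈ I, (stdAddChar (m * x t) * stdAddChar (n * y t) : ℂ) = 
        stdAddChar (-(m * α + n * β)) * (KS c k m n * ((∑ i ∈ A, stdAddChar (N := c) (-(m * (i : ZMod c)))) *
          ((∑ i ∈ A, stdAddChar (N := c) (m * (i : ZMod c))) * ((∑ i ∈ A, stdAddChar (N := c) (-(n * (i : ZMod c)))) *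
          (∑ i ∈ A, stdAddChar (N := c) (n * (i : ZMod c))))))) := by
      unfold KS
      rw [← sum_prod_mul, ← sum_prod_mul, ← sum_prod_mul, ← sum_prod_mul, Finset.mul_sum]
      refine Finset.sum_congr rfl fun t _ => ?_
      simp only [← AddChar.map_add_eq_mul]
      congr 1
      simp only [hx, hy]; ring
    rw [e1, norm_mul, norm_mul, norm_mul, norm_mul, norm_mul, hneg, hneg, AddChar.norm_apply]
    ring
  have h3 : (c:ℝ) ^ 2 * ((I.filter (fun t => x t = 0 ∧ y t = 0)).card : ℝ) 
      = ‖(((c:ℝ) ^ 2 * ((I.filter (fun t => x t = 0 ∧ y t = 0)).card : ℝ) : ℝ) : ℂ)‖ := by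
    rw [Complex.norm_real, Real.norm_of_nonneg (by positivity)]
  rw [h3, h1]
  refine (norm_sum_le _ _).trans ?_
  apply Finset.sum_le_sum; intro m _
  refine (norm_sum_le _ _).trans ?_
  apply Finset.sum_le_sum; intro n _
  rw [h2]

lemma count4_lower (c : ℕ) [NeZero c] (k : (ZMod c)ˣ) (α β : ZMod c) (ℓ : ℕ) (hl : ℓ ≤ c) :
    ((Finset.range ℓ ×ˢ Finset.range ℓ).filter (fun p : ℕ × ℕ => 
      ((p.1 : ZMod c) + α) * ((p.2 : ZMod c) + β) = k)).card * ℓ ^ 2 ≤ 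
    ((Finset.univ ×ˢ (Finset.range (2 * ℓ) ×ˢ (Finset.range (2 * ℓ) ×ˢ (Finset.range (2 * ℓ) ×ˢ Finset.range (2 * ℓ))))).filter (fun t : (ZMod c)ˣ × (ℕ × ℕ × ℕ × ℕ) => 
      (t.1 : ZMod c) - α - (t.2.1 : ZMod c) + (t.2.2.1 : ZMod c) = 0 ∧ 
      (k : ZMod c) * ((t.1⁻¹ : (ZMod c)ˣ) : ZMod c) - β - (t.2.2.2.1 : ZMod c) + (t.2.2.2.2 : ZMod c) = 0)).card := by
  classical
  set S := (Finset.range ℓ ×ˢ Finset.range ℓ).filter (fun p : ℕ × ℕ => 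
      ((p.1 : ZMod c) + α) * ((p.2 : ZMod c) + β) = k) with hS
  have e : S.card * ℓ ^ 2 = (S ×ˢ (Finset.range ℓ ×ˢ Finset.range ℓ)).card := by
    simp [Finset.card_product, sq]
  rw [e]
  have hu : ∀ p ∈ S, IsUnit ((p.1 : ZMod c) + α) := by
    intro p hp
    simp [hS] at hp
    exact isUnit_of_mul_isUnit_left (hp.2 ▸ k.isUnit)
  apply Finset.card_le_card_of_injOn (fun q => 
    (if h : IsUnit ((q.1.1 : ZMod c) + α) then h.unit else 1, (q.1.1 + q.2.1, q.2.1, q.1.2 + q.2.2, q.2.2)))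
  · rintro ⟨⟨x, y⟩, ⟨i, j⟩⟩ hq
    simp only [Finset.coe_product, Set.mem_prod, Finset.mem_coe] at hq
    have hun := hu _ hq.1
    simp only [hS, Finset.mem_filter, Finset.mem_product, Finset.mem_range] at hq
    simp only [dif_pos hun, Finset.coe_filter, Set.mem_setOf_eq, Finset.mem_product, Finset.mem_univ, Finset.mem_range, true_and]
    refine ⟨⟨by omega, by omega, by omega, by omega⟩, ?_, ?_⟩
    · simp
    · have h1 : (hun.unit : ZMod c) * ((y : ZMod c) + β) = k := by simpa using hq.1.2
      have h2 : ((hun.unit⁻¹ : (ZMod c)ˣ) : ZMod c) * (hun.unit : ZMod c) = 1 := by simp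
      push_cast
      rw [← h1]
      linear_combination ((y : ZMod c) + β) * h2
  · rintro ⟨⟨x, y⟩, ⟨i, j⟩⟩ _ ⟨⟨x', y'⟩, ⟨i', j'⟩⟩ _ h
    simp only [Prod.mk.injEq] at h ⊢
    omega

lemma KB_bound : ∃ C : ℝ, 0 < C ∧ ∀ c : ℕ, 1 ≤ c → (2 * (c : ℝ) ^ 3 * (tau c : ℝ) ^ 3) ^ (1/4 : ℝ) ≤ C * (c:ℝ) ^ (4/5 : ℝ) := by
  obtain ⟨C, hC1, hC⟩ := tau_bound (1/15) (by norm_num)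
  refine ⟨(2 * C ^ 3) ^ (1/4:ℝ), by positivity, fun c hc => ?_⟩
  have hc0 : (0:ℝ) < c := by exact_mod_cast hc
  have h1 : 2 * (c : ℝ) ^ 3 * (tau c : ℝ) ^ 3 ≤ (2 * C ^ 3) * (c:ℝ) ^ (16/5 : ℝ) := by
    have h2 := hC c
    calc 2 * (c : ℝ) ^ 3 * (tau c : ℝ) ^ 3 ≤ 2 * (c:ℝ)^3 * (C * (c:ℝ) ^ (1/15:ℝ)) ^ 3 := by gcongr
      _ = (2 * C^3) * ((c:ℝ)^(3:ℝ) * ((c:ℝ) ^ (1/15:ℝ)) ^ (3:ℝ)) := by norm_num [mul_pow]; ring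
      _ = _ := by
        rw [← Real.rpow_mul hc0.le, ← Real.rpow_add hc0]; norm_num
  calc _ ≤ ((2 * C ^ 3) * (c:ℝ) ^ (16/5 : ℝ)) ^ (1/4:ℝ) := by gcongr
    _ = _ := by
      rw [Real.mul_rpow (by positivity) (by positivity), ← Real.rpow_mul hc0.le]; norm_num

lemma K2_aux {c a l B B' s s' t t' : ℝ} (hc : 0 ≤ c) (ha : 0 ≤ a) (hal : a ≤ l) (hB : 0 ≤ B) (hB' : B ≤ B') (hs : 0 ≤ s) (hs' : s ≤ s')
    (ht : 0 ≤ t) (ht' : t ≤ t') : c * (a * a) + 2 * B * (s * t) ≤ c * (l * l) + 2 * B' * (s' * t') := by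
  have := hB.trans hB'
  have := hs.trans hs'
  have := ha.trans hal
  gcongr

set_option maxHeartbeats 1000000 in
/-- the shifted modular hyperbola bound -/
lemma K2 : ∃ C : ℝ, 0 < C ∧ ∀ (c : ℕ) [NeZero c] (k : (ZMod c)ˣ) (α β : ZMod c) (ℓ : ℕ), 1 ≤ ℓ → ℓ ≤ c →
    (((Finset.range ℓ ×ˢ Finset.range ℓ).filter (fun p : ℕ × ℕ => 
      ((p.1 : ZMod c) + α) * ((p.2 : ZMod c) + β) = k)).card : ℝ) ≤ 
      16 * (ℓ:ℝ)^2 / c + C * ((c:ℝ) / ℓ) ^ 2 * (c:ℝ) ^ (4/5 : ℝ) := by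
  obtain ⟨C1, hC1, hB⟩ := KB_bound
  have hsum : Summable (fun k : ℕ => 1 / (((k:ℝ) + 1) ^ (7/4 : ℝ))) := by
    have := (summable_nat_add_iff 1).2 (Real.summable_one_div_nat_rpow.2 (show (1:ℝ) < 7/4 by norm_num))
    simpa using this
  set S : ℝ := 2 * ∑' k : ℕ, 1 / (((k:ℝ) + 1) ^ (7/4 : ℝ)) with hS
  have hS0 : 0 ≤ S := by
    have : 0 ≤ ∑' k : ℕ, 1 / (((k:ℝ) + 1) ^ (7/4 : ℝ)) := tsum_nonneg fun k => by positivity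
    positivity
  refine ⟨2 * C1 * ((S+1) * (4 + S)), by positivity, ?_⟩
  intro c _ k α β ℓ hl1 hl
  have hc : 1 ≤ c := NeZero.one_le
  have hc0 : (0:ℝ) < c := by exact_mod_cast hc
  have hl0 : (0:ℝ) < ℓ := by exact_mod_cast hl1
  set n := ((Finset.range ℓ ×ˢ Finset.range ℓ).filter (fun p : ℕ × ℕ => 
      ((p.1 : ZMod c) + α) * ((p.2 : ZMod c) + β) = k)).card with hn
  set A : ZMod c → ℝ := fun m => ‖Ahat c (2*ℓ) m‖ ^ 2 with hA
  have hA0 : ∀ m, 0 ≤ A m := fun m => by positivity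
  have hAz : A 0 ≤ 4 * (ℓ:ℝ)^2 := by
    have : ‖Ahat c (2*ℓ) 0‖ ≤ 2 * ℓ := by
      unfold Ahat; simp
    calc A 0 ≤ (2*ℓ)^2 := by simp only [hA]; gcongr
      _ = _ := by ring
  set H : ZMod c → ℝ := fun m => (nabs m : ℝ) ^ (1/4 : ℝ) with hH
  have hH0 : ∀ m, 0 ≤ H m := fun m => by positivity
  have hHA : ∀ m ≠ 0, A m * H m ≤ (c:ℝ)^2 * (1 / ((nabs m : ℝ) ^ (7/4:ℝ))) := by
    intro m hm
    have hn0 : 0 < nabs m := by unfold nabs; simpa [Nat.pos_iff_ne_zero] using hm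
    have hn : (0:ℝ) < nabs m := by exact_mod_cast hn0
    have := Ahat_bound c (2*ℓ) m hm
    calc A m * H m ≤ (c / nabs m)^2 * H m := by simp only [hA]; gcongr
      _ = _ := by
        have e : (nabs m : ℝ)^2 = (nabs m:ℝ)^(7/4:ℝ) * (nabs m:ℝ)^(1/4:ℝ) := by
          rw [← Real.rpow_add hn]; norm_num
        rw [div_pow, e]
        simp only [hH]
        field_simp
  have hHA' : ∑ m, A m * H m ≤ (c:ℝ)^2 * S := by
    have e : ∑ m, A m * H m = ∑ m ∈ Finset.univ.filter (fun m : ZMod c => m ≠ 0), A m * H m := by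
      rw [Finset.sum_filter]
      refine Finset.sum_congr rfl fun m _ => ?_
      by_cases hm : m = 0
      · simp [hm, hH, nabs]
      · simp [hm]
    rw [e]
    calc _ ≤ ∑ m ∈ Finset.univ.filter (fun m : ZMod c => m ≠ 0), (c:ℝ)^2 * (1 / ((nabs m : ℝ) ^ (7/4:ℝ))) := by
          apply Finset.sum_le_sum; intro m hm; exact hHA m (by simpa using hm)
      _ ≤ 2 * ∑ k ∈ Finset.range c, (c:ℝ)^2 * (1 / (((k+1 : ℕ) : ℝ) ^ (7/4:ℝ))) := 
          sum_nabs_le c (fun k => (c:ℝ)^2 * (1 / ((k : ℝ) ^ (7/4:ℝ)))) (fun k => by positivity)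
      _ ≤ _ := by
          rw [← Finset.mul_sum, hS]
          have := hsum.sum_le_tsum (Finset.range c) (fun i _ => by positivity)
          push_cast
          nlinarith [sq_nonneg (c:ℝ)]
  have hAA : ∑ m, A m ≤ (c:ℝ)^2 * (4 + S) := by
    have : ∀ m, A m ≤ (if m = 0 then A 0 else 0) + A m * H m := by
      intro m
      by_cases hm : m = 0
      · simp [hm, hH, nabs]
      · have hn0 : 0 < nabs m := by unfold nabs; simpa [Nat.pos_iff_ne_zero] using hm
        have hn : (1:ℝ) ≤ nabs m := by exact_mod_cast hn0
        have : 1 ≤ H m := Real.one_le_rpow hn (by norm_num)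
        simp only [hm, if_false, zero_add]
        exact le_mul_of_one_le_right (hA0 m) this
    calc ∑ m, A m ≤ ∑ m, ((if m = 0 then A 0 else 0) + A m * H m) := Finset.sum_le_sum fun m _ => this m
      _ = A 0 + ∑ m, A m * H m := by rw [Finset.sum_add_distrib]; simp
      _ ≤ 4 * (c:ℝ)^2 + (c:ℝ)^2 * S := by
        have : (ℓ:ℝ) ≤ c := by exact_mod_cast hl
        have : (ℓ:ℝ)^2 ≤ (c:ℝ)^2 := by gcongr
        linarith
      _ = _ := by ring
  set B := (2 * (c : ℝ) ^ 3 * (tau c : ℝ) ^ 3) ^ (1/4 : ℝ) with hBdef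
  have hB0 : 0 ≤ B := by positivity
  have hmain : (c:ℝ)^2 * (n * (ℓ:ℝ)^2) ≤ c * (A 0 * A 0) + 2 * B * ((∑ m, A m * H m) * ∑ m, A m) := by
    have h1 := count4_lower c k α β ℓ hl
    have h2 := count4 c k α β (Finset.range (2*ℓ))
    have h1' := (Nat.cast_le (α := ℝ)).2 h1
    rw [Nat.cast_mul, Nat.cast_pow] at h1'
    have h3 := (mul_le_mul_of_nonneg_left h1' (sq_nonneg (c:ℝ))).trans h2
    refine h3.trans ?_
    have h4 : ∀ m n : ZMod c, ‖KS c k m n‖ * ‖∑ i ∈ Finset.range (2*ℓ), ZMod.stdAddChar (N := c) (m * (i : ZMod c))‖ ^ 2 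
        * ‖∑ i ∈ Finset.range (2*ℓ), ZMod.stdAddChar (N := c) (n * (i : ZMod c))‖ ^ 2 ≤ 
        (if m = 0 then (if n = 0 then c * (A 0 * A 0) else 0) else 0) + (B * ((A m * H m) * A n) + B * ((A n * H n) * A m)) := by
      intro m n
      have := KS_bound2 c k m n
      change ‖KS c k m n‖ * A m * A n ≤ _
      calc ‖KS c k m n‖ * A m * A n ≤ ((if m=0∧n=0 then (c:ℝ) else 0) + B * (H m + H n)) * A m * A n := by
            gcongr
        _ = _ := by
          by_cases hm : m = 0 <;> by_cases hn : n = 0 <;> simp [hm, hn] <;> ring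
    refine (Finset.sum_le_sum fun m _ => Finset.sum_le_sum fun n _ => h4 m n).trans ?_
    apply le_of_eq
    simp only [Finset.sum_add_distrib, ← Finset.mul_sum, ← Finset.sum_mul]
    simp
    ring
  have hB' := hB c hc
  rw [← hBdef] at hB'
  have h5 : (c:ℝ)^2 * (n * (ℓ:ℝ)^2) ≤ c * (4*(ℓ:ℝ)^2 * (4*(ℓ:ℝ)^2)) + 2 * (C1 * (c:ℝ)^(4/5:ℝ)) * (((c:ℝ)^2*(S+1)) * ((c:ℝ)^2*(4+S))) := by
    refine hmain.trans ?_
    have : 0 ≤ ∑ m, A m := Finset.sum_nonneg fun m _ => hA0 m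
    have : ∑ m, A m * H m ≤ (c:ℝ)^2*(S+1) := by nlinarith [sq_nonneg (c:ℝ)]
    have h0 := hA0 0
    clear_value A H B
    exact K2_aux hc0.le h0 hAz hB0 hB' (Finset.sum_nonneg fun m _ => mul_nonneg (hA0 m) (hH0 m)) (by assumption) (by assumption) hAA
  have h6 : (n:ℝ) * ((c:ℝ)^2 * (ℓ:ℝ)^2) ≤ (16 * (ℓ:ℝ)^2 / c + 2 * C1 * ((S+1) * (4 + S)) * ((c:ℝ) / ℓ) ^ 2 * (c:ℝ) ^ (4/5 : ℝ)) * ((c:ℝ)^2 * (ℓ:ℝ)^2) := by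
    calc _ = (c:ℝ)^2 * (n * (ℓ:ℝ)^2) := by ring
      _ ≤ _ := h5
      _ = _ := by field_simp; ring
  exact le_of_mul_le_mul_right h6 (by positivity)

/-- pairwise congruent integers in an interval -/
lemma card_congr_le (S : Finset ℤ) (a : ℤ) (L D : ℕ) (hD : 0 < D) (h1 : ∀ x ∈ S, a ≤ x ∧ x < a + L)
    (h2 : ∀ x ∈ S, ∀ y ∈ S, (D:ℤ) ∣ x - y) : S.card ≤ L / D + 1 := by
  have : S.card ≤ (Finset.range (L / D + 1)).card := by
    apply Finset.card_le_card_of_injOn (fun x => ((x - a) / D).toNat)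
    · intro x hx
      have := h1 x hx
      simp only [Finset.coe_range, Set.mem_Iio]
      have h3 : (x - a) / (D:ℤ) ≤ L / D := Int.ediv_le_ediv (by exact_mod_cast hD) (by linarith)
      have h4 : 0 ≤ (x - a) / (D:ℤ) := Int.ediv_nonneg (by linarith) (by positivity)
      zify
      rw [Int.toNat_of_nonneg h4]
      linarith
    · intro x hx y hy hxy
      have hx1 := h1 x hx
      have hy1 := h1 y hy
      have hD' : (0:ℤ) < D := by exact_mod_cast hD
      have p1 : 0 ≤ (x - a) / (D:ℤ) := Int.ediv_nonneg (by linarith) hD'.le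
      have p2 : 0 ≤ (y - a) / (D:ℤ) := Int.ediv_nonneg (by linarith) hD'.le
      simp only at hxy
      have e : (x - a) / (D:ℤ) = (y - a) / (D:ℤ) := by omega
      have e2 : (x - a) % (D:ℤ) = (y - a) % (D:ℤ) := by
        apply Int.emod_emod_of_dvd _ dvd_rfl |>.symm.trans
        have := h2 x hx y hy
        rw [Int.emod_emod_of_dvd _ dvd_rfl]
        apply Int.ModEq.symm
        apply (Int.modEq_iff_dvd).2
        simpa using this
      have := Int.mul_ediv_add_emod (x - a) D
      have := Int.mul_ediv_add_emod (y - a) D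
      rw [e, e2] at *
      linarith
  simpa using this

/-- trivial count for a given modulus -/
lemma N_triv (N c : ℕ) (h : ℤ) (hh : h ≠ 0) (hc : 2 * N ≤ c) (hN : 1 ≤ N) :
    (((Finset.Ioo (-(4 * N : ℤ)) (4 * N)) ×ˢ (Finset.Ioo (-(4 * N : ℤ)) (4 * N))).filter
      (fun p : ℤ × ℤ => (c : ℤ) ∣ h - p.1 * p.2)).card ≤ 40 * N * h.natAbs := by
  classical
  have hh1 : 1 ≤ h.natAbs := Int.natAbs_pos.2 hh
  rw [Finset.card_filter, Finset.sum_product]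
  have key : ∀ r ∈ Finset.Ioo (-(4 * N : ℤ)) (4 * N), (∑ t ∈ Finset.Ioo (-(4 * N : ℤ)) (4 * N), if (c : ℤ) ∣ h - r * t then 1 else 0) ≤ 5 * h.natAbs := by
    intro r _
    rw [← Finset.card_filter]
    set S := (Finset.Ioo (-(4 * N : ℤ)) (4 * N)).filter (fun t => (c:ℤ) ∣ h - r * t) with hS
    rcases S.eq_empty_or_nonempty with he | ⟨t0, ht0⟩
    · simp [he]
    have hc0 : 0 < c := by omega
    set g := Nat.gcd r.natAbs c with hg
    have hg0 : 0 < g := Nat.gcd_pos_of_pos_right _ hc0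
    obtain ⟨D, hD⟩ : g ∣ c := Nat.gcd_dvd_right _ _
    have hD0 : 0 < D := Nat.pos_of_ne_zero (by rintro rfl; omega)
    have hgr : (g:ℤ) ∣ r := Int.natCast_dvd.2 (Nat.gcd_dvd_left _ _)
    have hgc : (g:ℤ) ∣ c := by exact_mod_cast Nat.gcd_dvd_right _ _
    have hgh : g ≤ h.natAbs := by
      apply Nat.le_of_dvd hh1
      rw [← Int.natCast_dvd]
      have h1 := (Finset.mem_filter.1 ht0).2
      have h2 := hgc.trans h1
      have := dvd_add h2 (hgr.mul_right t0)
      simpa using this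
    have hcard := card_congr_le S (-(4*N:ℤ)) (8 * N) D hD0 (by
      intro x hx
      have := (Finset.mem_filter.1 hx).1
      rw [Finset.mem_Ioo] at this
      push_cast; constructor <;> linarith) (by
      intro x hx y hy
      have h1 := (Finset.mem_filter.1 hx).2
      have h2 := (Finset.mem_filter.1 hy).2
      have h3 : (c:ℤ) ∣ r * (x - y) := by
        have := dvd_sub h2 h1
        ring_nf at this ⊢
        simpa using this
      have h4 : c ∣ r.natAbs * (x-y).natAbs := by
        rw [← Int.natAbs_mul]; exact Int.natCast_dvd.1 h3
      rw [Int.natCast_dvd]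
      have h5 : Nat.Coprime D (r.natAbs / g) := by
        have := Nat.coprime_div_gcd_div_gcd (m := r.natAbs) (n := c) (hg ▸ hg0)
        rw [← hg, hD, Nat.mul_div_cancel_left _ hg0] at this
        exact this.symm
      apply h5.dvd_of_dvd_mul_left
      obtain ⟨r', hr'⟩ : g ∣ r.natAbs := Nat.gcd_dvd_left _ _
      rw [hr', Nat.mul_div_cancel_left _ hg0]
      rw [hr', hD, mul_assoc] at h4
      exact Nat.dvd_of_mul_dvd_mul_left hg0 h4)
    have : 8 * N / D ≤ 4 * g := by
      rw [Nat.div_le_iff_le_mul_add_pred hD0]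
      nlinarith
    omega
  refine (Finset.sum_le_sum key).trans ?_
  simp
  have : (4 * (N:ℤ) + 4 * N).toNat - 1 ≤ 8 * N := by omega
  calc _ ≤ 8 * N * (5 * h.natAbs) := Nat.mul_le_mul_right _ this
    _ = _ := by ring

/-- class count -/
lemma N_class (q c' : ℕ) (hq : 0 < q) (hc' : 0 < c') (h H r0 t0 : ℤ) (hcop : ∀ p : ℕ, p.Prime → p ∣ q → (p:ℤ) ∣ r0 → ¬ (p:ℤ) ∣ t0)
    (hH : (c' : ℤ) ∣ h - H) (hh : h ≠ 0) :
    (((Finset.Ico (0:ℤ) (c' * q)) ×ˢ (Finset.Ico (0:ℤ) (c' * q))).filter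
      (fun p : ℤ × ℤ => (q:ℤ) ∣ p.1 - r0 ∧ (q:ℤ) ∣ p.2 - t0 ∧ ((c' * q : ℕ) : ℤ) ∣ H - p.1 * p.2)).card ≤ c' * tau (Nat.gcd h.natAbs c') := by
  classical
  set S := ((Finset.Ico (0:ℤ) (c' * q)) ×ˢ (Finset.Ico (0:ℤ) (c' * q))).filter
      (fun p : ℤ × ℤ => (q:ℤ) ∣ p.1 - r0 ∧ (q:ℤ) ∣ p.2 - t0 ∧ ((c' * q : ℕ) : ℤ) ∣ H - p.1 * p.2) with hS
  have hq' : (0:ℤ) < q := by exact_mod_cast hq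
  unfold tau
  have hgh : ∀ p ∈ S, Nat.gcd p.1.natAbs c' ∈ (Nat.gcd h.natAbs c').divisors := by
    intro p hp
    have h1 := (Finset.mem_filter.1 hp).2
    rw [Nat.mem_divisors]
    refine ⟨Nat.dvd_gcd ?_ (Nat.gcd_dvd_right _ _), (Nat.gcd_pos_of_pos_right _ hc').ne'⟩
    rw [← Int.natCast_dvd]
    have e1 : ((Nat.gcd p.1.natAbs c' : ℕ) : ℤ) ∣ p.1 := Int.natCast_dvd.2 (Nat.gcd_dvd_left _ _)
    have e2 : ((Nat.gcd p.1.natAbs c' : ℕ) : ℤ) ∣ c' := by exact_mod_cast Nat.gcd_dvd_right _ _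
    have e3 : (c':ℤ) ∣ H - p.1 * p.2 := dvd_trans (by push_cast; exact dvd_mul_right _ _) h1.2.2
    have := dvd_add (dvd_add (e2.trans e3) (e2.trans hH)) (e1.mul_right p.2)
    ring_nf at this; exact this
  apply Finset.card_le_mul_card_image_of_maps_to hgh
  intro g hg
  have hg1 := Nat.mem_divisors.1 hg
  obtain ⟨D, hD⟩ : g ∣ c' := hg1.1.trans (Nat.gcd_dvd_right _ _)
  have hg0 : 0 < g := Nat.pos_of_ne_zero (by rintro rfl; omega)
  have hD0 : 0 < D := Nat.pos_of_ne_zero (by rintro rfl; omega)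
  have hg0' : (0:ℤ) < g := by exact_mod_cast hg0
  have hD0' : (0:ℤ) < D := by exact_mod_cast hD0
  have hcz : (c':ℤ) = g * D := by exact_mod_cast hD
  have : ((S.filter (fun p => Nat.gcd p.1.natAbs c' = g))).card ≤ (Finset.Ico (0:ℤ) D ×ˢ Finset.Ico (0:ℤ) g).card := by
    apply Finset.card_le_card_of_injOn (fun p : ℤ × ℤ => (p.1 / (q:ℤ) / (g:ℤ), p.2 / (q:ℤ) / (D:ℤ)))
    · rintro ⟨r, t⟩ hp
      simp only [Finset.coe_filter, hS, Finset.mem_filter, Finset.mem_product, Finset.mem_Ico, Set.mem_setOf_eq] at hp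
      simp only [Finset.coe_product, Set.mem_prod, Finset.coe_Ico, Set.mem_Ico]
      obtain ⟨⟨⟨⟨a1, a2⟩, a3, a4⟩, _⟩, _⟩ := hp
      refine ⟨⟨Int.ediv_nonneg (Int.ediv_nonneg a1 hq'.le) hg0'.le, ?_⟩, Int.ediv_nonneg (Int.ediv_nonneg a3 hq'.le) hD0'.le, ?_⟩
      · rw [Int.ediv_lt_iff_lt_mul hg0', Int.ediv_lt_iff_lt_mul hq']
        calc r < c' * q := a2
          _ = D * g * q := by rw [hcz]; ring
      · rw [Int.ediv_lt_iff_lt_mul hD0', Int.ediv_lt_iff_lt_mul hq']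
        calc t < c' * q := a4
          _ = g * D * q := by rw [hcz]
    · rintro ⟨r, t⟩ hp ⟨r', t'⟩ hp' heq
      simp only [Finset.coe_filter, hS, Finset.mem_filter, Finset.mem_product, Finset.mem_Ico, Set.mem_setOf_eq] at hp hp'
      obtain ⟨⟨-, a1, a2, a3⟩, ag⟩ := hp
      obtain ⟨⟨-, b1, b2, b3⟩, bg⟩ := hp'
      simp only [Prod.mk.injEq] at heq ⊢
      obtain ⟨E1, E2⟩ := heq
      -- differences
      obtain ⟨X, hX⟩ : (q:ℤ) ∣ r - r' := by have := dvd_sub a1 b1; ring_nf at this ⊢; simpa using this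
      obtain ⟨Y, hY⟩ : (q:ℤ) ∣ t - t' := by have := dvd_sub a2 b2; ring_nf at this ⊢; simpa using this
      have eX : r / q = r' / q + X := by
        rw [show r = r' + q * X by linarith]; exact Int.add_mul_ediv_left _ _ hq'.ne'
      have eY : t / q = t' / q + Y := by
        rw [show t = t' + q * Y by linarith]; exact Int.add_mul_ediv_left _ _ hq'.ne'
      have gr : (g:ℤ) ∣ r := Int.natCast_dvd.2 (ag ▸ Nat.gcd_dvd_left _ _)
      have gr' : (g:ℤ) ∣ r' := Int.natCast_dvd.2 (bg ▸ Nat.gcd_dvd_left _ _)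
      have main : (c':ℤ) ∣ t * X + r' * Y := by
        have h1 := dvd_sub b3 a3
        have h2 : H - r' * t' - (H - r * t) = q * (t * X + r' * Y) := by
          linear_combination t * hX + r' * hY
        rw [h2, Nat.cast_mul, mul_comm (c':ℤ)] at h1
        exact Int.dvd_of_mul_dvd_mul_left hq'.ne' h1
      have gX : (g:ℤ) ∣ X := by
        have h1 : (g:ℤ) ∣ t * X := by
          have := dvd_sub ((Dvd.intro _ hcz.symm).trans main) (gr'.mul_right Y)
          simpa using this
        have h2 : (g:ℤ) ∣ q * X := by rw [← hX]; exact dvd_sub gr gr'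
        have h3 : Int.gcd (Int.gcd t q) g = 1 := by
          rw [Int.gcd_natCast_natCast]
          change Nat.Coprime _ _
          by_contra hne
          obtain ⟨p, hp, hp1, hp2⟩ := Nat.Prime.not_coprime_iff_dvd.1 hne
          have p1 : (p:ℤ) ∣ t := (Int.natCast_dvd_natCast.2 hp1).trans (Int.gcd_dvd_left _ _)
          have p2 : (p:ℤ) ∣ q := (Int.natCast_dvd_natCast.2 hp1).trans (Int.gcd_dvd_right _ _)
          have p3 : (p:ℤ) ∣ r := (Int.natCast_dvd_natCast.2 hp2).trans gr
          refine hcop p hp (by exact_mod_cast p2) ?_ ?_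
          · have := dvd_sub p3 (p2.trans a1); simpa using this
          · have := dvd_sub p1 (p2.trans a2); simpa using this
        have h4 : (g:ℤ) ∣ (Int.gcd t q : ℤ) * X := by
          rw [Int.gcd_eq_gcd_ab]
          have := dvd_add (h1.mul_right (Int.gcdA t q)) (h2.mul_right (Int.gcdB t q))
          ring_nf at this ⊢; exact this
        exact Int.dvd_of_dvd_mul_right_of_gcd_one h4 (by rw [Int.gcd_comm]; exact h3)
      obtain ⟨X', hX'⟩ := gX
      have X0 : X = 0 := by
        rw [eX, hX', Int.add_mul_ediv_left _ _ hg0'.ne'] at E1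
        have : X' = 0 := by linarith
        rw [hX', this, mul_zero]
      have hr : r = r' := by rw [X0] at hX; linarith
      refine ⟨hr, ?_⟩
      have DY : (D:ℤ) ∣ Y := by
        rw [X0, mul_zero, zero_add] at main
        have h4 : c' ∣ r'.natAbs * Y.natAbs := by
          rw [← Int.natAbs_mul]; exact Int.natCast_dvd.1 main
        rw [Int.natCast_dvd]
        have h5 : Nat.Coprime D (r'.natAbs / g) := by
          have := Nat.coprime_div_gcd_div_gcd (m := r'.natAbs) (n := c') (bg.symm ▸ hg0)
          rw [bg] at this
          rw [hD, Nat.mul_div_cancel_left _ hg0] at this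
          exact this.symm
        apply h5.dvd_of_dvd_mul_left
        obtain ⟨r1, hr1⟩ : g ∣ r'.natAbs := bg ▸ Nat.gcd_dvd_left _ _
        rw [hr1, Nat.mul_div_cancel_left _ hg0]
        rw [hr1, hD, mul_assoc] at h4
        exact Nat.dvd_of_mul_dvd_mul_left hg0 h4
      obtain ⟨Y', hY'⟩ := DY
      rw [eY, hY', Int.add_mul_ediv_left _ _ hD0'.ne'] at E2
      have : Y' = 0 := by linarith
      rw [hY', this] at hY
      linarith
  refine this.trans ?_
  rw [Finset.card_product]; simp [hD, mul_comm]

lemma NG_num {C : ℝ} (hC : 0 < C) {q N c' c2 W l : ℕ} (hc'0 : 0 < c') (hc20 : 0 < c2) (hq : 8 ≤ q) (hN : 1 ≤ N)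
    (hl1 : 1 ≤ l) (hc1 : 2 * N ≤ c' * c2) (hc2 : c' * c2 < 4 * N) (hl : l = 2 * W) (hWl : 4 * N < c' * q * W) (hWQ : W * (c' * q) ≤ 5 * N)
    {A B T : ℝ} (hA : A ≤ B * (16 * (l:ℝ)^2 / c2 + C * ((c2:ℝ) / l) ^ 2 * (c2:ℝ) ^ (4/5 : ℝ))) (hB : B ≤ c' * T) (hT : 0 ≤ T) :
    A ≤ T * ((10000 + 100 * C) * ((N:ℝ) / q^2 + c' * q^2 * (N:ℝ)^(4/5:ℝ))) := by
  have hc'r : (0:ℝ) < c' := by exact_mod_cast hc'0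
  have hc2r : (0:ℝ) < c2 := by exact_mod_cast hc20
  have hqr : (0:ℝ) < q := by positivity
  have hNr : (0:ℝ) < N := by exact_mod_cast hN
  have hlr : (0:ℝ) < l := by exact_mod_cast hl1
  have hc1r : 2 * (N:ℝ) ≤ c' * c2 := by exact_mod_cast hc1
  have hc2r' : (c':ℝ) * c2 ≤ 4 * N := by exact_mod_cast hc2.le
  have hlup : (l:ℝ) * (c' * q) ≤ 10 * N := by
    have : l * (c' * q) ≤ 10 * N := by rw [hl]; nlinarith
    exact_mod_cast this
  have hllo : 8 * (N:ℝ) ≤ l * (c' * q) := by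
    have : 8 * N ≤ l * (c' * q) := by rw [hl]; nlinarith
    exact_mod_cast this
  have b1 : 16 * (l:ℝ)^2 / c2 ≤ 800 * N / (c' * q^2) := by
    rw [div_le_div_iff₀ hc2r (by positivity)]
    have h1 : ((l:ℝ) * (c' * q))^2 ≤ (10 * N)^2 := by gcongr
    have h2 : 100 * (N:ℝ)^2 ≤ 50 * N * (c' * c2) := by nlinarith
    have h3 : 16 * (l:ℝ)^2 * (c' * q^2) * c' ≤ 800 * N * c2 * c' := by
      calc 16 * (l:ℝ)^2 * (c' * q^2) * c' = 16 * ((l:ℝ) * (c' * q))^2 := by ring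
        _ ≤ 16 * (10 * (N:ℝ))^2 := by linarith
        _ = 16 * (100 * (N:ℝ)^2) := by ring
        _ ≤ 16 * (50 * N * (c' * c2)) := by linarith
        _ = _ := by ring
    exact le_of_mul_le_mul_right h3 hc'r
  have b2 : (c2:ℝ) / l ≤ q := by
    rw [div_le_iff₀ hlr]
    have : (c2:ℝ) * c' ≤ q * l * c' := by
      calc (c2:ℝ) * c' = c' * c2 := mul_comm _ _
        _ ≤ 8 * N := by linarith
        _ ≤ l * (c' * q) := hllo
        _ = _ := by ring
    exact le_of_mul_le_mul_right this hc'r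
  have b3 : (c2:ℝ)^(4/5:ℝ) ≤ 4 * (N:ℝ)^(4/5:ℝ) := by
    have h1 : (c2:ℝ) ≤ 4 * N := by
      have : (1:ℝ) ≤ c' := by exact_mod_cast hc'0
      exact (le_mul_of_one_le_left hc2r.le this).trans hc2r'
    calc (c2:ℝ)^(4/5:ℝ) ≤ (4 * N)^(4/5:ℝ) := by gcongr
      _ = 4^(4/5:ℝ) * (N:ℝ)^(4/5:ℝ) := Real.mul_rpow (by norm_num) hNr.le
      _ ≤ 4^(1:ℝ) * (N:ℝ)^(4/5:ℝ) := by gcongr <;> norm_num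
      _ = _ := by norm_num
  have b4 : 16 * (l:ℝ)^2 / c2 + C * ((c2:ℝ) / l) ^ 2 * (c2:ℝ) ^ (4/5 : ℝ) ≤ 
      800 * N / (c' * q^2) + C * (q:ℝ)^2 * (4 * (N:ℝ)^(4/5:ℝ)) := by gcongr
  calc A ≤ B * (16 * (l:ℝ)^2 / c2 + C * ((c2:ℝ) / l) ^ 2 * (c2:ℝ) ^ (4/5 : ℝ)) := hA
    _ ≤ (c' * T) * (800 * N / (c' * q^2) + C * (q:ℝ)^2 * (4 * (N:ℝ)^(4/5:ℝ))) := by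
        gcongr
    _ = T * (800 * (N / q^2) + 4 * C * (c' * q^2 * (N:ℝ)^(4/5:ℝ))) := by
        field_simp 
    _ ≤ _ := by
        gcongr
        have h1 : 0 ≤ (N:ℝ)/q^2 := by positivity
        have h2 : 0 ≤ c' * (q:ℝ)^2 * (N:ℝ)^(4/5:ℝ) := by positivity
        nlinarith [mul_nonneg hC.le h1, mul_nonneg hC.le h2]

set_option maxHeartbeats 1000000 in
lemma NG : ∃ C : ℝ, 0 < C ∧ ∀ (q N c' c2 : ℕ) (h s0 r0 t0 : ℤ), 8 ≤ q → 1 ≤ N → 2 * N ≤ c' * c2 → c' * c2 < 4 * N →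
    Nat.Coprime c2 c' → Nat.Coprime c2 q → Nat.Coprime c2 h.natAbs → h ≠ 0 →
    (∀ p : ℕ, p.Prime → p ∣ q → (p:ℤ) ∣ r0 → ¬ (p:ℤ) ∣ t0) → c' * q ≤ N →
    ((((Finset.Ioo (-(4 * N : ℤ)) (4 * N)) ×ˢ (Finset.Ioo (-(4 * N : ℤ)) (4 * N))).filter
      (fun p : ℤ × ℤ => (q:ℤ) ∣ p.1 - r0 ∧ (q:ℤ) ∣ p.2 - t0 ∧ ((c' * c2 * q : ℕ) : ℤ) ∣ h - p.1 * p.2 - (c' * c2 : ℕ) * s0)).card : ℝ) ≤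
    tau (Nat.gcd h.natAbs c') * (C * ((N:ℝ) / q^2 + c' * q^2 * (N:ℝ)^(4/5:ℝ))) := by
  obtain ⟨C, hC, hK⟩ := K2
  refine ⟨10000 + 100 * C, by positivity, ?_⟩
  intro q N c' c2 h s0 r0 t0 hq hN hc1 hc2 hcop1 hcop2 hcop3 hh hrt hQN
  classical
  have hc'0 : 0 < c' := Nat.pos_of_ne_zero (by rintro rfl; omega)
  have hc20 : 0 < c2 := Nat.pos_of_ne_zero (by rintro rfl; omega)
  haveI : NeZero c2 := ⟨hc20.ne'⟩
  set Q := c' * q with hQ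
  have hQ0 : 0 < Q := by positivity
  have hQz : (0:ℤ) < Q := by exact_mod_cast hQ0
  set W := 4 * N / Q + 1 with hW
  set ℓ := 2 * W with hl
  set S := ((Finset.Ioo (-(4 * N : ℤ)) (4 * N)) ×ˢ (Finset.Ioo (-(4 * N : ℤ)) (4 * N))).filter
      (fun p : ℤ × ℤ => (q:ℤ) ∣ p.1 - r0 ∧ (q:ℤ) ∣ p.2 - t0 ∧ ((c' * c2 * q : ℕ) : ℤ) ∣ h - p.1 * p.2 - (c' * c2 : ℕ) * s0) with hS
  set H : ℤ := h - (c' * c2 : ℕ) * s0 with hH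
  set S' := (((Finset.Ico (0:ℤ) (c' * q)) ×ˢ (Finset.Ico (0:ℤ) (c' * q))).filter
      (fun p : ℤ × ℤ => (q:ℤ) ∣ p.1 - r0 ∧ (q:ℤ) ∣ p.2 - t0 ∧ ((c' * q : ℕ) : ℤ) ∣ H - p.1 * p.2)) with hS'
  have hS'card : S'.card ≤ c' * tau (Nat.gcd h.natAbs c') := 
    N_class q c' (by omega) hc'0 h H r0 t0 hrt (by rw [hH]; push_cast; exact ⟨c2 * s0, by ring⟩) hh
  -- unit data
  have hQcop : Nat.Coprime Q c2 := (Nat.Coprime.mul_right hcop1 hcop2).symm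
  set U : (ZMod c2)ˣ := ZMod.unitOfCoprime Q hQcop with hU
  have hUv : (U : ZMod c2) = (Q : ZMod c2) := ZMod.coe_unitOfCoprime _ _
  have hhunit : IsUnit ((h : ℤ) : ZMod c2) := by
    rw [ZMod.coe_int_isUnit_iff_isCoprime]
    rw [Int.isCoprime_iff_gcd_eq_one]
    exact hcop3
  set u : ZMod c2 := ((U⁻¹ : (ZMod c2)ˣ) : ZMod c2) with hu
  have huQ : u * (Q : ZMod c2) = 1 := by rw [← hUv, hu]; simp
  have hWl : ((4 * N : ℕ) : ℤ) < (Q:ℤ) * W := by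
    have := Nat.lt_mul_div_succ (4*N) hQ0
    rw [hW]; exact_mod_cast this
  have hl1 : 1 ≤ ℓ := by rw [hl, hW]; exact Nat.one_le_iff_ne_zero.2 (by positivity)
  have hWQ : W * Q ≤ 5 * N := by
    have := Nat.div_mul_le_self (4*N) Q
    rw [hW, add_mul]; omega
  have hlc : ℓ ≤ c2 := by
    have h1 : ℓ * Q ≤ 10 * N := by rw [hl]; nlinarith
    have h2 : ℓ * c' * 8 ≤ 10 * N := by
      calc ℓ * c' * 8 ≤ ℓ * c' * q := by gcongr
        _ = ℓ * Q := by rw [hQ]; ring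
        _ ≤ _ := h1
    by_contra hcon
    push Not at hcon
    nlinarith
  have hfib : ∀ b ∈ S', ((S.filter (fun p => ((p.1 % Q, p.2 % Q) : ℤ × ℤ) = b)).card : ℝ) ≤ 
      16 * (ℓ:ℝ)^2 / c2 + C * ((c2:ℝ) / ℓ) ^ 2 * (c2:ℝ) ^ (4/5 : ℝ) := by
    rintro ⟨ρ, σ⟩ hb
    set k : (ZMod c2)ˣ := hhunit.unit * U⁻¹ * U⁻¹ with hk
    refine le_trans ?_ (hK c2 k ((ρ : ZMod c2) * u - W) ((σ : ZMod c2) * u - W) ℓ hl1 hlc)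
    norm_cast
    have hrec : ∀ x : ℤ, x ∈ Finset.Ioo (-(4 * N : ℤ)) (4 * N) → 0 ≤ x / Q + W ∧ x / Q + W < ℓ := by
      intro x hx
      rw [Finset.mem_Ioo] at hx
      push_cast at hWl
      have a1 : -(W:ℤ) ≤ x / Q := by
        rw [Int.le_ediv_iff_mul_le hQz]; linarith
      have a2 : x / Q < W := by
        rw [Int.ediv_lt_iff_lt_mul hQz]; linarith
      rw [hl]; push_cast
      constructor <;> linarith
    have hval : ∀ x : ℤ, x ∈ Finset.Ioo (-(4 * N : ℤ)) (4 * N) → 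
        (((x / Q + W).toNat : ℕ) : ZMod c2) + (((x % Q : ℤ) : ZMod c2) * u - W) = (x : ZMod c2) * u := by
      intro x hx
      have e1 : (((x / Q + W).toNat : ℕ) : ZMod c2) = (((x / Q + W : ℤ)) : ZMod c2) := by
        rw [← Int.cast_natCast, Int.toNat_of_nonneg (hrec x hx).1]
      rw [e1]
      have e2 : (x : ZMod c2) = (Q : ZMod c2) * ((x / Q : ℤ) : ZMod c2) + ((x % Q : ℤ) : ZMod c2) := by
        conv_lhs => rw [← Int.mul_ediv_add_emod x Q]
        push_cast; rfl
      rw [e2]; push_cast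
      linear_combination -((x / Q : ℤ) : ZMod c2) * huQ
    apply Finset.card_le_card_of_injOn (fun p : ℤ × ℤ => ((p.1 / Q + W).toNat, (p.2 / Q + W).toNat))
    · rintro ⟨r, t⟩ hp
      simp only [Finset.coe_filter, hS, Finset.mem_filter, Finset.mem_product, Set.mem_setOf_eq, Prod.mk.injEq] at hp
      obtain ⟨⟨⟨hr, ht⟩, -, -, hd⟩, e1, e2⟩ := hp
      simp only [Finset.coe_filter, Finset.mem_product, Finset.mem_range, Set.mem_setOf_eq]
      have i1 := hrec r hr
      have i2 := hrec t ht
      refine ⟨⟨by omega, by omega⟩, ?_⟩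
      have j1 := hval r hr
      have j2 := hval t ht
      rw [e1] at j1
      rw [e2] at j2
      rw [j1, j2, hk]
      push_cast
      have hz : ((h : ℤ) : ZMod c2) = (r : ZMod c2) * (t : ZMod c2) := by
        have h1 : ((c2:ℕ):ℤ) ∣ h - r * t := by
          have h2 : ((c2:ℕ):ℤ) ∣ h - r * t - (c' * c2 : ℕ) * s0 := dvd_trans (by push_cast; exact ⟨c' * q, by ring⟩) hd
          have := dvd_add h2 (show ((c2:ℕ):ℤ) ∣ (c' * c2 : ℕ) * s0 by push_cast; exact ⟨c' * s0, by ring⟩)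
          simpa using this
        have := (ZMod.intCast_zmod_eq_zero_iff_dvd _ _).2 h1
        push_cast at this
        exact sub_eq_zero.1 this
      simp only [IsUnit.unit_spec]
      rw [hz, ← hu]; ring
    · rintro ⟨r, t⟩ hp ⟨r', t'⟩ hp' heq
      simp only [Finset.coe_filter, hS, Finset.mem_filter, Finset.mem_product, Set.mem_setOf_eq, Prod.mk.injEq] at hp hp' heq ⊢
      obtain ⟨⟨⟨hr, ht⟩, -, -, hd⟩, e1, e2⟩ := hp
      obtain ⟨⟨⟨hr', ht'⟩, -, -, hd'⟩, e1', e2'⟩ := hp'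
      have i1 := hrec r hr
      have i2 := hrec t ht
      have i1' := hrec r' hr'
      have i2' := hrec t' ht'
      have f1 : r / Q = r' / Q := by omega
      have f2 : t / Q = t' / Q := by omega
      have g1 := Int.mul_ediv_add_emod r Q
      have g2 := Int.mul_ediv_add_emod r' Q
      have g3 := Int.mul_ediv_add_emod t Q
      have g4 := Int.mul_ediv_add_emod t' Q
      rw [f1, e1] at g1
      rw [e1'] at g2
      rw [f2, e2] at g3
      rw [e2'] at g4
      exact ⟨by linarith, by linarith⟩
  have hmaps : ∀ p ∈ S, ((p.1 % Q, p.2 % Q) : ℤ × ℤ) ∈ S' := by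
    rintro ⟨r, t⟩ hp
    simp only [hS, Finset.mem_filter, Finset.mem_product] at hp
    obtain ⟨-, a1, a2, a3⟩ := hp
    have d1 : (Q:ℤ) ∣ r % Q - r := by
      have := Int.mul_ediv_add_emod r Q; exact ⟨-(r/Q), by linarith⟩
    have d2 : (Q:ℤ) ∣ t % Q - t := by
      have := Int.mul_ediv_add_emod t Q; exact ⟨-(t/Q), by linarith⟩
    have hqQ : (q:ℤ) ∣ Q := by rw [hQ]; push_cast; exact dvd_mul_left _ _
    have hQe : ((c':ℤ) * q) = Q := by rw [hQ]; push_cast; rfl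
    simp only [hS', Finset.mem_filter, Finset.mem_product, Finset.mem_Ico, hQe]
    refine ⟨⟨⟨Int.emod_nonneg _ hQz.ne', Int.emod_lt_of_pos _ hQz⟩, ⟨Int.emod_nonneg _ hQz.ne', Int.emod_lt_of_pos _ hQz⟩⟩, ?_, ?_, ?_⟩
    · have := dvd_add (hqQ.trans d1) a1; simpa using this
    · have := dvd_add (hqQ.trans d2) a2; simpa using this
    · have h2 : (Q:ℤ) ∣ h - r * t - (c' * c2 : ℕ) * s0 := dvd_trans (by rw [hQ]; push_cast; exact ⟨c2, by ring⟩) a3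
      rw [← hQ]
      have h3 := dvd_sub h2 (dvd_add (d1.mul_right (t % Q)) (d2.mul_left r))
      have e : H - (r % Q) * (t % Q) = h - r * t - (c' * c2 : ℕ) * s0 - ((r % Q - r) * (t % Q) + r * (t % Q - t)) := by
        rw [hH]; ring
      rw [e]; exact h3
  have hcardS : (S.card : ℝ) ≤ S'.card * (16 * (ℓ:ℝ)^2 / c2 + C * ((c2:ℝ) / ℓ) ^ 2 * (c2:ℝ) ^ (4/5 : ℝ)) := by
    rw [Finset.card_eq_sum_card_fiberwise hmaps]
    push_cast
    refine (Finset.sum_le_sum hfib).trans ?_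
    rw [Finset.sum_const, nsmul_eq_mul]
  exact NG_num hC hc'0 hc20 hq hN hl1 hc1 hc2 hl (by exact_mod_cast hWl) hWQ hcardS (by exact_mod_cast hS'card) (Nat.cast_nonneg _)

lemma decomp (m : ℕ) : ∀ c : ℕ, 1 ≤ c → ∃ c' c2 k : ℕ, c = c' * c2 ∧ c' ∣ m ^ k ∧ Nat.Coprime c2 m := by
  intro c
  induction c using Nat.strong_induction_on with
  | _ c ih =>
    intro hc
    by_cases hg : Nat.gcd c m = 1
    · exact ⟨1, c, 0, by simp, by simp, hg⟩
    · obtain ⟨d, hd⟩ := Nat.gcd_dvd_left c m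
      set g := Nat.gcd c m with hgdef
      have hg0 : 0 < g := Nat.gcd_pos_of_pos_left _ hc
      have hd0 : 0 < d := Nat.pos_of_ne_zero (by rintro rfl; omega)
      have hlt : d < c := by
        have : 2 ≤ g := by omega
        nlinarith
      obtain ⟨c', c2, k, h1, h2, h3⟩ := ih d hlt hd0
      refine ⟨g * c', c2, k + 1, by rw [hd, h1]; ring, ?_, h3⟩
      rw [pow_succ, mul_comm]
      exact mul_dvd_mul h2 (Nat.gcd_dvd_right c m)

lemma big_sq (m F c c' c2 k : ℕ) (hm : 1 ≤ m) (hc : c = c' * c2) (hk : c' ∣ m ^ k) (hbig : m * F ^ 2 < c') : ∃ f, F < f ∧ f ^ 2 ∣ c := by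
  obtain ⟨s, f, hsf, hs⟩ := Nat.sq_mul_squarefree c'
  have hsm : s ∣ m := by
    have h1 : s ∣ m ^ k := (Dvd.intro_left _ hsf).trans hk
    rcases Nat.eq_zero_or_pos k with rfl | hk0
    · rw [pow_zero, Nat.dvd_one] at h1; simp [h1]
    · exact (hs.dvd_pow_iff_dvd hk0.ne').1 h1
  have hsle := Nat.le_of_dvd hm hsm
  refine ⟨f, ?_, (Dvd.intro _ hsf).trans (Dvd.intro _ hc.symm)⟩
  by_contra hcon
  push Not at hcon
  have : f ^ 2 ≤ F ^ 2 := by gcongr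
  have : f ^ 2 * s ≤ F ^ 2 * m := Nat.mul_le_mul this hsle
  nlinarith

open Classical in
lemma bad_count (N F : ℕ) (hN : 1 ≤ N) (hF : 1 ≤ F) : 
    (((Finset.Ico (2 * N) (4 * N)).filter (fun c => ∃ f, F < f ∧ f ^ 2 ∣ c)).card : ℝ) ≤ 4 * N / F := by
  have hsub : (Finset.Ico (2 * N) (4 * N)).filter (fun c => ∃ f, F < f ∧ f ^ 2 ∣ c) ⊆ 
      (Finset.Ioc F (F + 4 * N)).biUnion (fun f => (Finset.Ioc 0 (4 * N)).filter (fun c => f ^ 2 ∣ c)) := by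
    intro c hc
    simp only [Finset.mem_filter, Finset.mem_Ico, Finset.mem_biUnion, Finset.mem_Ioc] at hc ⊢
    obtain ⟨⟨h1, h2⟩, f, hf, hd⟩ := hc
    refine ⟨f, ⟨hf, ?_⟩, ⟨by omega, by omega⟩, hd⟩
    have := Nat.le_of_dvd (by omega) hd
    nlinarith
  have h1 := (Finset.card_le_card hsub).trans Finset.card_biUnion_le
  have h2 : ((∑ f ∈ Finset.Ioc F (F + 4 * N), ((Finset.Ioc 0 (4 * N)).filter (fun c => f ^ 2 ∣ c)).card : ℕ) : ℝ) ≤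
      ∑ f ∈ Finset.Ioc F (F + 4 * N), 4 * (N:ℝ) * ((f:ℝ)^2)⁻¹ := by
    push_cast
    apply Finset.sum_le_sum
    intro f hf
    rw [Nat.Ioc_filter_dvd_card_eq_div]
    have := Nat.cast_div_le (α := ℝ) (m := 4 * N) (n := f ^ 2)
    push_cast at this
    rw [← div_eq_mul_inv]; exact this
  have h3 := sum_Ioc_inv_sq_le_sub (α := ℝ) (k := F) (n := F + 4 * N) (by omega) (by omega)
  calc _ ≤ ((∑ f ∈ Finset.Ioc F (F + 4 * N), ((Finset.Ioc 0 (4 * N)).filter (fun c => f ^ 2 ∣ c)).card : ℕ) : ℝ) := by exact_mod_cast h1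
    _ ≤ _ := h2
    _ = 4 * (N:ℝ) * ∑ f ∈ Finset.Ioc F (F + 4 * N), ((f:ℝ)^2)⁻¹ := by rw [Finset.mul_sum]
    _ ≤ 4 * (N:ℝ) * (F:ℝ)⁻¹ := by
      gcongr
      refine h3.trans ?_
      have : (0:ℝ) ≤ ((F + 4 * N : ℕ) : ℝ)⁻¹ := by positivity
      linarith
    _ = _ := by rw [div_eq_mul_inv]

lemma tau_gcd_sum (N q H : ℕ) (c0 : ℤ) (hq : 1 ≤ q) (hH : 1 ≤ H) (hN : q * H ≤ N) :
    ((∑ c ∈ (Finset.Ico (2 * N) (4 * N)).filter (fun c : ℕ => (q:ℤ) ∣ c - c0), tau (Nat.gcd H c) : ℕ) : ℝ) ≤ 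
      3 * (N / q) * ∑ d ∈ H.divisors, (Nat.gcd d q : ℝ) / d := by
  have h1 : ∀ c : ℕ, tau (Nat.gcd H c) = ∑ d ∈ H.divisors, if d ∣ c then 1 else 0 := by
    intro c
    rw [← Finset.card_filter]
    unfold tau
    congr 1
    ext d
    simp only [Nat.mem_divisors, Finset.mem_filter]
    rw [Nat.dvd_gcd_iff]
    have : Nat.gcd H c ≠ 0 := (Nat.gcd_pos_of_pos_left _ hH).ne'
    have : H ≠ 0 := by omega
    tauto
  simp_rw [h1]
  rw [Finset.sum_comm]
  push_cast
  rw [Finset.mul_sum]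
  apply Finset.sum_le_sum
  intro d hd
  have hd' := Nat.mem_divisors.1 hd
  have hd0 : 0 < d := Nat.pos_of_dvd_of_pos hd'.1 hH
  have hdH : d ≤ H := Nat.le_of_dvd hH hd'.1
  rw [← Finset.sum_filter, Finset.sum_const, nsmul_eq_mul, mul_one]
  set S := ((Finset.Ico (2 * N) (4 * N)).filter (fun c : ℕ => (q:ℤ) ∣ c - c0)).filter (fun c => d ∣ c) with hS
  have hlcm0 : 0 < Nat.lcm d q := Nat.lcm_pos hd0 hq
  have hc := card_congr_le (S.map Nat.castEmbedding) (2 * N : ℕ) (2 * N) (Nat.lcm d q) hlcm0 (by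
    intro x hx
    simp only [Finset.mem_map, hS, Finset.mem_filter, Finset.mem_Ico, Nat.castEmbedding_apply] at hx
    obtain ⟨c, hc, rfl⟩ := hx
    have := hc.1.1
    omega) (by
    intro x hx y hy
    simp only [Finset.mem_map, hS, Finset.mem_filter, Nat.castEmbedding_apply] at hx hy
    obtain ⟨c, hc, rfl⟩ := hx
    obtain ⟨c', hc', rfl⟩ := hy
    have e1 : (d:ℤ) ∣ (c:ℤ) - c' := dvd_sub (by exact_mod_cast hc.2) (by exact_mod_cast hc'.2)
    have e2 : (q:ℤ) ∣ (c:ℤ) - c' := by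
      have := dvd_sub hc.1.2 hc'.1.2
      simpa using this
    have := lcm_dvd e1 e2
    rw [Int.natCast_dvd] at *
    exact Nat.lcm_dvd e1 e2)
  rw [Finset.card_map] at hc
  have hgl : (Nat.gcd d q : ℝ) * (Nat.lcm d q : ℝ) = d * q := by exact_mod_cast Nat.gcd_mul_lcm d q
  have hlr : (0:ℝ) < Nat.lcm d q := by exact_mod_cast hlcm0
  have hdr : (0:ℝ) < d := by exact_mod_cast hd0
  have hqr : (0:ℝ) < q := by exact_mod_cast hq
  have hgr : (1:ℝ) ≤ Nat.gcd d q := by exact_mod_cast Nat.gcd_pos_of_pos_left q hd0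
  have hqdN : (q:ℝ) * d ≤ N := by
    have : q * d ≤ N := (Nat.mul_le_mul_left q hdH).trans hN
    exact_mod_cast this
  calc (S.card : ℝ) ≤ ((2 * N / Nat.lcm d q : ℕ) : ℝ) + 1 := by exact_mod_cast hc
    _ ≤ (2 * N) / Nat.lcm d q + 1 := by
      have := Nat.cast_div_le (α := ℝ) (m := 2 * N) (n := Nat.lcm d q)
      push_cast at this; linarith
    _ = 2 * (N / q) * (Nat.gcd d q / d) + 1 := by
      rw [eq_div_of_mul_eq hlr.ne' hgl]
      field_simp
    _ ≤ 2 * (N / q) * (Nat.gcd d q / d) + (N / q) * (Nat.gcd d q / d) := by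
      gcongr
      rw [div_mul_div_comm, le_div_iff₀ (by positivity), one_mul]
      nlinarith
    _ = _ := by ring

set_option maxHeartbeats 800000 in
theorem thmN : ∃ C : ℝ, 0 < C ∧ ∀ (q N : ℕ) (h c0 s0 r0 t0 : ℤ), 8 ≤ q → h ≠ 0 → (q * h.natAbs) ^ 60 ≤ N →
    (∀ p : ℕ, p.Prime → p ∣ q → (p:ℤ) ∣ r0 → ¬ (p:ℤ) ∣ t0) →
    (((Finset.Ico (2 * N) (4 * N) ×ˢ (Finset.Ioo (-(4 * N : ℤ)) (4 * N) ×ˢ Finset.Ioo (-(4 * N : ℤ)) (4 * N))).filter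
      (fun x : ℕ × ℤ × ℤ => (q:ℤ) ∣ x.1 - c0 ∧ (q:ℤ) ∣ x.2.1 - r0 ∧ (q:ℤ) ∣ x.2.2 - t0 ∧ ((x.1 * q : ℕ) : ℤ) ∣ h - x.2.1 * x.2.2 - (x.1 : ℤ) * s0)).card : ℝ)
    ≤ C * ((N:ℝ)^2 / q^3) * ∑ d ∈ h.natAbs.divisors, (Nat.gcd d q : ℝ) / d := by
  obtain ⟨C, hC, hNG⟩ := NG
  refine ⟨160 + 6 * C, by positivity, ?_⟩
  intro q N h c0 s0 r0 t0 hq hh hN hrt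
  classical
  set H := h.natAbs with hHdef
  have hH1 : 1 ≤ H := Int.natAbs_pos.2 hh
  set m := q * H with hm
  have hqm : q ≤ m := by rw [hm]; nlinarith
  have hHm : H ≤ m := by rw [hm]; nlinarith
  have hm1 : 1 ≤ m := by omega
  have hmN : m ≤ N := le_trans (by calc m = m^1 := (pow_one m).symm
                                     _ ≤ m ^ 60 := Nat.pow_le_pow_right hm1 (by norm_num)) hN
  have hN1 : 1 ≤ N := by omega
  set F := q ^ 3 * H with hF
  have hF1 : 1 ≤ F := by rw [hF]; exact Nat.one_le_iff_ne_zero.2 (by positivity)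
  set I := Finset.Ioo (-(4 * N : ℤ)) (4 * N) with hI
  have hcard : ((Finset.Ico (2 * N) (4 * N) ×ˢ (I ×ˢ I)).filter
      (fun x : ℕ × ℤ × ℤ => (q:ℤ) ∣ x.1 - c0 ∧ (q:ℤ) ∣ x.2.1 - r0 ∧ (q:ℤ) ∣ x.2.2 - t0 ∧ ((x.1 * q : ℕ) : ℤ) ∣ h - x.2.1 * x.2.2 - (x.1 : ℤ) * s0)).card
      = ∑ c ∈ (Finset.Ico (2 * N) (4 * N)).filter (fun c : ℕ => (q:ℤ) ∣ c - c0), ((I ×ˢ I).filter (fun p : ℤ × ℤ => (q:ℤ) ∣ p.1 - r0 ∧ (q:ℤ) ∣ p.2 - t0 ∧ ((c * q : ℕ) : ℤ) ∣ h - p.1 * p.2 - (c : ℤ) * s0)).card := by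
    rw [Finset.card_filter, Finset.sum_product, Finset.sum_filter]
    refine Finset.sum_congr rfl fun c _ => ?_
    by_cases hcq : (q:ℤ) ∣ c - c0
    · rw [if_pos hcq, Finset.card_filter]
      simp [hcq]
    · simp [hcq]
  have hqr : (0:ℝ) < q := by positivity
  have hNr : (0:ℝ) < N := by exact_mod_cast hN1
  have hpow : ∀ c' : ℕ, c' ≤ m * F ^ 2 → c' * (q:ℝ)^2 * (N:ℝ)^(4/5:ℝ) ≤ N / q^2 := by
    intro c' hc'
    rw [le_div_iff₀ (by positivity)]
    have h1 : (c':ℝ) * (q:ℝ)^4 ≤ (m:ℝ)^12 := by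
      have : c' * q^4 ≤ m^12 := by
        calc c' * q^4 ≤ m * F^2 * q^4 := by gcongr
          _ = m * (q^10 * H^2) := by rw [hF]; ring
          _ ≤ m * (m^9 * m^2) := by
              apply Nat.mul_le_mul_left
              calc q^10 * H^2 = q^8 * (q * H)^2 := by ring
                _ ≤ m^9 * m^2 := by
                  apply Nat.mul_le_mul
                  · exact (Nat.pow_le_pow_left hqm 8).trans (Nat.pow_le_pow_right hm1 (by norm_num))
                  · exact le_of_eq rfl
          _ = m^12 := by ring
      exact_mod_cast this
    have h2 : (m:ℝ)^12 ≤ (N:ℝ)^(1/5:ℝ) := by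
      have : ((m:ℝ)^12)^5 ≤ N := by
        rw [← pow_mul]; exact_mod_cast hN
      calc (m:ℝ)^12 = (((m:ℝ)^12)^5)^(1/5:ℝ) := by
            rw [← Real.rpow_natCast _ 5, ← Real.rpow_mul (by positivity)]; norm_num
        _ ≤ _ := by gcongr
    calc c' * (q:ℝ)^2 * (N:ℝ)^(4/5:ℝ) * q^2 = (c' * (q:ℝ)^4) * (N:ℝ)^(4/5:ℝ) := by ring
      _ ≤ (N:ℝ)^(1/5:ℝ) * (N:ℝ)^(4/5:ℝ) := by gcongr; exact h1.trans h2
      _ = N := by rw [← Real.rpow_add hNr]; norm_num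
  have hc : ∀ c ∈ (Finset.Ico (2 * N) (4 * N)).filter (fun c : ℕ => (q:ℤ) ∣ c - c0), 
      (((I ×ˢ I).filter (fun p : ℤ × ℤ => (q:ℤ) ∣ p.1 - r0 ∧ (q:ℤ) ∣ p.2 - t0 ∧ ((c * q : ℕ) : ℤ) ∣ h - p.1 * p.2 - (c : ℤ) * s0)).card : ℝ) ≤ 
      (if ∃ f, F < f ∧ f ^ 2 ∣ c then 40 * (N:ℝ) * H else 0) + 2 * C * (N / q^2) * (tau (Nat.gcd H c) : ℝ) := by
    intro c hc
    have hc1 := Finset.mem_Ico.1 (Finset.mem_filter.1 hc).1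
    have hpos : 0 ≤ 2 * C * (N / (q:ℝ)^2) * (tau (Nat.gcd H c) : ℝ) := by positivity
    split_ifs with hbad
    · have h1 := N_triv N c h hh hc1.1 hN1
      have h2 : ((I ×ˢ I).filter (fun p : ℤ × ℤ => (q:ℤ) ∣ p.1 - r0 ∧ (q:ℤ) ∣ p.2 - t0 ∧ ((c * q : ℕ) : ℤ) ∣ h - p.1 * p.2 - (c : ℤ) * s0)).card ≤ 
          ((I ×ˢ I).filter (fun p : ℤ × ℤ => (c : ℤ) ∣ h - p.1 * p.2)).card := by
        apply Finset.card_le_card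
        intro p hp
        simp only [Finset.mem_filter] at hp ⊢
        refine ⟨hp.1, ?_⟩
        have h3 : (c:ℤ) ∣ h - p.1 * p.2 - (c:ℤ) * s0 := dvd_trans (by push_cast; exact dvd_mul_right _ _) hp.2.2.2
        have := dvd_add h3 (dvd_mul_right (c:ℤ) s0)
        simpa using this
      have h3 : (((I ×ˢ I).filter (fun p : ℤ × ℤ => (q:ℤ) ∣ p.1 - r0 ∧ (q:ℤ) ∣ p.2 - t0 ∧ ((c * q : ℕ) : ℤ) ∣ h - p.1 * p.2 - (c : ℤ) * s0)).card : ℝ) ≤ 40 * (N:ℝ) * H := by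
        exact_mod_cast h2.trans h1
      linarith
    · obtain ⟨c', c2, k, e1, e2, e3⟩ := decomp m c (by omega)
      have hsmall : c' ≤ m * F ^ 2 := by
        by_contra hcon
        push Not at hcon
        exact hbad (big_sq m F c c' c2 k hm1 e1 e2 hcon)
      have hcop : Nat.Coprime c2 c' := Nat.Coprime.coprime_dvd_right e2 (Nat.Coprime.pow_right _ e3)
      have hQN : c' * q ≤ N := by
        calc c' * q ≤ m * F ^ 2 * q := by gcongr
          _ = m * (q^5 * (q * H)^2) := by rw [hF]; ring
          _ ≤ m * (m^5 * m^2) := by gcongr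
          _ = m^8 := by ring
          _ ≤ m^60 := Nat.pow_le_pow_right hm1 (by norm_num)
          _ ≤ N := hN
      have h1 := hNG q N c' c2 h s0 r0 t0 hq hN1 (e1 ▸ hc1.1) (e1 ▸ hc1.2) hcop (Nat.Coprime.coprime_dvd_right (Dvd.intro _ hm.symm) e3)
        (Nat.Coprime.coprime_dvd_right (Dvd.intro_left _ hm.symm) e3) hh hrt hQN
      rw [← e1] at h1
      rw [zero_add]
      refine h1.trans ?_
      have h2 := hpow c' hsmall
      have h3 : (tau (Nat.gcd H c') : ℝ) ≤ tau (Nat.gcd H c) := by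
        have := tau_le_of_dvd (m := Nat.gcd H c') (n := Nat.gcd H c) (Nat.gcd_dvd_gcd_of_dvd_right _ (Dvd.intro _ e1.symm)) (Nat.gcd_pos_of_pos_left _ hH1).ne'
        exact_mod_cast this
      calc _ ≤ (tau (Nat.gcd H c) : ℝ) * (C * (N / q^2 + N / q^2)) := by gcongr
        _ = _ := by ring
  rw [hcard]
  push_cast
  refine (Finset.sum_le_sum hc).trans ?_
  rw [Finset.sum_add_distrib, ← Finset.mul_sum, ← Finset.sum_filter, Finset.sum_const, nsmul_eq_mul]
  have hb := bad_count N F hN1 hF1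
  have hb' : ((((Finset.Ico (2 * N) (4 * N)).filter (fun c : ℕ => (q:ℤ) ∣ c - c0)).filter (fun c => ∃ f, F < f ∧ f ^ 2 ∣ c)).card : ℝ) ≤ 4 * N / F := by
    refine le_trans ?_ hb
    exact_mod_cast Finset.card_le_card (Finset.filter_subset_filter _ (Finset.filter_subset _ _))
  have ht := tau_gcd_sum N q H c0 (by omega) hH1 (by rw [← hm]; exact hmN)
  push_cast at ht
  set sg := ∑ d ∈ H.divisors, (Nat.gcd d q : ℝ) / d with hsg
  have hsg1 : 1 ≤ sg := by
    have : (1:ℝ) = (Nat.gcd 1 q : ℝ) / (1:ℕ) := by simp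
    rw [this, hsg]
    exact Finset.single_le_sum (f := fun d : ℕ => (Nat.gcd d q : ℝ) / d) (fun i _ => by positivity) (Nat.one_mem_divisors.2 (by omega))
  have hHr : (0:ℝ) < H := by exact_mod_cast hH1
  calc _ ≤ 4 * N / F * (40 * N * H) + 2 * C * (N / q^2) * (3 * (N / q) * sg) := by gcongr
    _ = 160 * ((N:ℝ)^2/q^3) * 1 + 6 * C * ((N:ℝ)^2/q^3) * sg := by
      rw [hF]; push_cast; field_simp; ring
    _ ≤ 160 * ((N:ℝ)^2/q^3) * sg + 6 * C * ((N:ℝ)^2/q^3) * sg := by gcongr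
    _ = _ := by ring

lemma two_pow_omega_le_tau (n : ℕ) (hn : n ≠ 0) : 2 ^ n.primeFactors.card ≤ tau n := by
  rw [← Finset.card_powerset]
  unfold tau
  apply Finset.card_le_card_of_injOn (fun s => ∏ p ∈ s, p)
  · intro s hs
    have hs' : s ⊆ n.primeFactors := by simpa using hs
    simp only [Finset.mem_coe, Nat.mem_divisors]
    exact ⟨(Finset.prod_dvd_prod_of_subset _ _ _ hs').trans (Nat.prod_primeFactors_dvd n), hn⟩
  · intro s hs t ht h
    have hs' : s ⊆ n.primeFactors := by simpa using hs
    have ht' : t ⊆ n.primeFactors := by simpa using ht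
    have e1 := Nat.primeFactors_prod (s := s) (fun p hp => Nat.prime_of_mem_primeFactors (hs' hp))
    have e2 := Nat.primeFactors_prod (s := t) (fun p hp => Nat.prime_of_mem_primeFactors (ht' hp))
    simp only at h
    rw [← e1, ← e2, h]

lemma sqrt_aux (n : ℕ) (hodd : Odd n) (x y z : ℤ) (hz : IsCoprime z n) (hx : (n:ℤ) ∣ x^2 - z^2) (hy : (n:ℤ) ∣ y^2 - z^2)
    (hp : ∀ p : ℕ, p.Prime → p ∣ n → ((p:ℤ) ∣ x - z ↔ (p:ℤ) ∣ y - z)) : (n:ℤ) ∣ x - y := by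
  rw [Int.natCast_dvd, Nat.dvd_iff_prime_pow_dvd_dvd]
  intro p k hpp hpk
  rw [← Int.natCast_dvd]
  rcases Nat.eq_zero_or_pos k with rfl | hk
  · simp
  have hpn : p ∣ n := (dvd_pow_self p hk.ne').trans hpk
  have hpodd : ¬ (p:ℤ) ∣ 2 := by
    intro h2
    have : p ∣ 2 := by exact_mod_cast h2
    have hp2 : p = 2 := (Nat.prime_dvd_prime_iff_eq hpp Nat.prime_two).1 this
    rw [hp2] at hpn
    exact (Nat.not_even_iff_odd.2 hodd) (even_iff_two_dvd.2 hpn)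
  have hpz : ¬ (p:ℤ) ∣ z := by
    intro h
    have := hz.isUnit_of_dvd' h (by exact_mod_cast hpn)
    exact hpp.one_lt.ne' (by simpa using Int.isUnit_iff_natAbs_eq.1 this)
  have hpI : Prime (p:ℤ) := Nat.prime_iff_prime_int.1 hpp
  have hkn : ((p^k : ℕ):ℤ) ∣ n := by exact_mod_cast hpk
  have key : ∀ w : ℤ, (n:ℤ) ∣ w^2 - z^2 → ((p:ℤ) ∣ w - z → ((p^k:ℕ):ℤ) ∣ w - z) ∧ (¬ (p:ℤ) ∣ w - z → ((p^k:ℕ):ℤ) ∣ w + z) := by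
    intro w hw
    have h1 : ((p^k:ℕ):ℤ) ∣ (w - z) * (w + z) := by
      have := hkn.trans hw
      rwa [show w^2 - z^2 = (w - z) * (w + z) by ring] at this
    push_cast at h1 ⊢
    constructor
    · intro h
      have : ¬ (p:ℤ) ∣ w + z := by
        intro h'
        have h3 : (p:ℤ) ∣ 2 * z := by have := dvd_sub h' h; ring_nf at this ⊢; exact this
        rcases hpI.dvd_or_dvd h3 with h4 | h4
        · exact hpodd h4
        · exact hpz h4
      exact (((Prime.coprime_iff_not_dvd hpI).2 this).pow_left).dvd_of_dvd_mul_right h1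
    · intro h
      exact (((Prime.coprime_iff_not_dvd hpI).2 h).pow_left).dvd_of_dvd_mul_left h1
  have kx := key x hx
  have ky := key y hy
  by_cases h : (p:ℤ) ∣ x - z
  · have := dvd_sub (kx.1 h) (ky.1 ((hp p hpp hpn).1 h)); ring_nf at this ⊢; exact this
  · have := dvd_sub (kx.2 h) (ky.2 (fun h' => h ((hp p hpp hpn).2 h'))); ring_nf at this ⊢; exact this

lemma sqrt_card (n : ℕ) [NeZero n] (hodd : Odd n) (u : ZMod n) (hu : IsUnit u) :
    (Finset.univ.filter (fun x : ZMod n => x ^ 2 = u)).card ≤ 2 ^ n.primeFactors.card := by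
  classical
  set S := Finset.univ.filter (fun x : ZMod n => x ^ 2 = u) with hS
  rcases S.eq_empty_or_nonempty with he | ⟨z, hz⟩
  · simp [he]
  have hz' : z ^ 2 = u := (Finset.mem_filter.1 hz).2
  have hzu : IsUnit z := by
    rw [← hz'] at hu; exact (isUnit_pow_iff (by norm_num)).1 hu
  have hcast : ∀ x : ZMod n, (((x.val : ℕ) : ℤ) : ZMod n) = x := by intro x; simp
  rw [← Finset.card_powerset]
  apply Finset.card_le_card_of_injOn (fun x => n.primeFactors.filter (fun p : ℕ => (p:ℤ) ∣ (x.val:ℤ) - (z.val:ℤ)))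
  · intro x _
    exact Finset.mem_coe.2 (Finset.mem_powerset.2 (Finset.filter_subset _ _))
  · intro x hx y hy hxy
    have hx' : x ^ 2 = u := (Finset.mem_filter.1 hx).2
    have hy' : y ^ 2 = u := (Finset.mem_filter.1 hy).2
    have hd : ∀ w : ZMod n, w^2 = u → (n:ℤ) ∣ (w.val:ℤ)^2 - (z.val:ℤ)^2 := by
      intro w hw
      rw [← ZMod.intCast_zmod_eq_zero_iff_dvd]
      push_cast
      simp [hw, hz']
    have := sqrt_aux n hodd x.val y.val z.val (by
      have h1 : IsUnit (((z.val : ℕ) : ℤ) : ZMod n) := by rw [hcast]; exact hzu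
      rw [ZMod.coe_int_isUnit_iff_isCoprime] at h1
      exact h1.symm) (hd x hx') (hd y hy') (by
      intro p hp hpn
      have h1 := Finset.ext_iff.1 hxy p
      simp only [Finset.mem_filter, Nat.mem_primeFactors] at h1
      have : p.Prime ∧ p ∣ n ∧ n ≠ 0 := ⟨hp, hpn, NeZero.ne n⟩
      simpa [this] using h1)
    rw [← ZMod.intCast_zmod_eq_zero_iff_dvd] at this
    push_cast at this
    simp at this
    exact sub_eq_zero.1 this

/-- fibers of reduction -/
lemma fiber_card (m d : ℕ) [NeZero m] (hd : d ∣ m) (s : ZMod d) :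
    (Finset.univ.filter (fun x : ZMod m => ZMod.castHom hd (ZMod d) x = s)).card ≤ m / d := by
  classical
  have hm : 0 < m := NeZero.pos m
  have hd0 : 0 < d := Nat.pos_of_dvd_of_pos hd hm
  have : (Finset.univ.filter (fun x : ZMod m => ZMod.castHom hd (ZMod d) x = s)).card ≤ (Finset.range (m / d)).card := by
    apply Finset.card_le_card_of_injOn (fun x => x.val / d)
    · intro x _
      simp only [Finset.coe_range, Set.mem_Iio]
      exact Nat.div_lt_div_of_lt_of_dvd hd (ZMod.val_lt x)
    · intro x hx y hy hxy
      have h1 : ∀ x : ZMod m, ZMod.castHom hd (ZMod d) x = ((x.val : ℕ) : ZMod d) := by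
        intro x
        conv_lhs => rw [← ZMod.natCast_zmod_val x]
        rw [map_natCast]
      have hx' : ZMod.castHom hd (ZMod d) x = s := (Finset.mem_filter.1 hx).2
      have hy' : ZMod.castHom hd (ZMod d) y = s := (Finset.mem_filter.1 hy).2
      rw [← hy', h1, h1, ZMod.natCast_eq_natCast_iff'] at hx'
      simp only at hxy
      apply ZMod.val_injective m
      rw [← Nat.div_add_mod x.val d, ← Nat.div_add_mod y.val d, hxy, hx']
  simpa using this

lemma castHom_eq_zero_iff (m d : ℕ) [NeZero m] (hd : d ∣ m) (x : ZMod m) : ZMod.castHom hd (ZMod d) x = 0 ↔ d ∣ x.val := by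
  conv_lhs => rw [← ZMod.natCast_zmod_val x]
  rw [map_natCast, ZMod.natCast_eq_zero_iff]

lemma tau_gcd_eq (m k : ℕ) (hm : 0 < m) : tau (Nat.gcd k m) = ∑ d ∈ m.divisors, if d ∣ k then 1 else 0 := by
  rw [← Finset.card_filter]
  unfold tau
  congr 1
  ext d
  simp only [Nat.mem_divisors, Finset.mem_filter, Nat.dvd_gcd_iff]
  have : Nat.gcd k m ≠ 0 := (Nat.gcd_pos_of_pos_right _ hm).ne'
  have : m ≠ 0 := by omega
  tauto

lemma xy_count (m : ℕ) [NeZero m] (u : ZMod m) :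
    (Finset.univ.filter (fun p : ZMod m × ZMod m => p.1 * p.2 = u)).card ≤ m * tau (Nat.gcd u.val m) := by
  classical
  have hm : 0 < m := NeZero.pos m
  rw [Finset.card_filter, Fintype.sum_prod_type]
  have h1 : ∀ X : ZMod m, (∑ Y : ZMod m, if X * Y = u then 1 else 0) ≤ 
      ∑ d ∈ (Nat.gcd u.val m).divisors, if d ∣ X.val then d else 0 := by
    intro X
    rw [← Finset.card_filter]
    rcases (Finset.univ.filter (fun Y : ZMod m => X * Y = u)).eq_empty_or_nonempty with he | ⟨Y, hY⟩
    · rw [he]; simp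
    · refine (card_lin m X u).trans ?_
      have hY' : X * Y = u := (Finset.mem_filter.1 hY).2
      have hg : Nat.gcd X.val m ∣ u.val := by
        rw [← hY', ZMod.val_mul]
        rw [Nat.dvd_mod_iff (Nat.gcd_dvd_right _ _)]
        exact (Nat.gcd_dvd_left _ _).mul_right _
      have := Finset.single_le_sum (f := fun d => if d ∣ X.val then d else 0) (fun i _ => Nat.zero_le _) 
        (Nat.mem_divisors.2 ⟨Nat.dvd_gcd hg (Nat.gcd_dvd_right _ _), (Nat.gcd_pos_of_pos_right _ hm).ne'⟩)
      simpa [Nat.gcd_dvd_left] using this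
  refine (Finset.sum_le_sum fun X _ => h1 X).trans ?_
  rw [Finset.sum_comm]
  have h2 : ∀ d ∈ (Nat.gcd u.val m).divisors, (∑ X : ZMod m, if d ∣ X.val then d else 0) ≤ m := by
    intro d hd
    have hdm : d ∣ m := (Nat.mem_divisors.1 hd).1.trans (Nat.gcd_dvd_right _ _)
    rw [← Finset.sum_filter, Finset.sum_const, smul_eq_mul]
    have h3 := fiber_card m d hdm 0
    simp_rw [castHom_eq_zero_iff] at h3
    calc _ ≤ m / d * d := by gcongr
      _ = m := Nat.div_mul_cancel hdm
  refine (Finset.sum_le_sum h2).trans ?_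
  rw [Finset.sum_const, smul_eq_mul, mul_comm]
  rfl

lemma sigma_count (m : ℕ) [NeZero m] (hodd : Odd m) (k : ZMod m) (hk : IsUnit k) :
    ((∑ s : ZMod m, tau (Nat.gcd (k + s ^ 2).val m) : ℕ) : ℝ) ≤ m * ∑ d ∈ m.divisors, (tau d : ℝ) / d := by
  classical
  have hm : 0 < m := NeZero.pos m
  simp_rw [fun s : ZMod m => tau_gcd_eq m (k + s ^ 2).val hm]
  rw [Finset.sum_comm]
  push_cast
  rw [Finset.mul_sum]
  apply Finset.sum_le_sum
  intro d hd
  have hdm : d ∣ m := (Nat.mem_divisors.1 hd).1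
  have hd0 : 0 < d := Nat.pos_of_dvd_of_pos hdm hm
  haveI : NeZero d := ⟨hd0.ne'⟩
  have hdodd : Odd d := Odd.of_dvd_nat hodd hdm
  set f := ZMod.castHom hdm (ZMod d) with hf
  have h1 : (Finset.univ.filter (fun s : ZMod m => d ∣ (k + s ^ 2).val)).card ≤ (m / d) * tau d := by
    have hu : IsUnit (-(f k)) := (hk.map f).neg
    have h2 := (sqrt_card d hdodd (-(f k)) hu).trans (two_pow_omega_le_tau d hd0.ne')
    refine le_trans ?_ (Nat.mul_le_mul_left _ h2)
    apply Finset.card_le_mul_card_image_of_maps_to (f := f)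
    · intro s hs
      have := (Finset.mem_filter.1 hs).2
      rw [← castHom_eq_zero_iff m d hdm, ← hf, map_add, map_pow] at this
      simp only [Finset.mem_filter, Finset.mem_univ, true_and]
      linear_combination this
    · intro b _
      refine le_trans (Finset.card_le_card ?_) (fiber_card m d hdm b)
      intro s hs
      simp only [Finset.mem_filter, Finset.mem_univ, true_and] at hs ⊢
      exact hs.2
  rw [← Finset.sum_filter, Finset.sum_const, nsmul_eq_mul, mul_one]
  calc _ ≤ (((m / d) * tau d : ℕ) : ℝ) := by exact_mod_cast h1
    _ = _ := by
      push_cast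
      rw [Nat.cast_div hdm (by exact_mod_cast hd0.ne')]
      ring

lemma two_inv_exists (m : ℕ) (hodd : Odd m) : ∃ i : ZMod m, 2 * i = 1 := by
  have h : IsUnit ((2 : ℕ) : ZMod m) := (ZMod.isUnit_iff_coprime 2 m).2 (Nat.coprime_two_left.2 hodd)
  obtain ⟨u, hu⟩ := h
  refine ⟨((u⁻¹ : (ZMod m)ˣ) : ZMod m), ?_⟩
  have := u.mul_inv
  rw [hu] at this
  exact_mod_cast this

lemma W1 (m : ℕ) [NeZero m] (hodd : Odd m) (x1 x2 h : ZMod m) (hn : IsUnit (x1^2+x2^2)) (hh : IsUnit h) :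
    ((Finset.univ.filter (fun p : ZMod m × ZMod m × ZMod m × ZMod m =>
      x1 * p.2.1 = x2 * p.1 ∧ p.1^2 + p.2.1^2 - (p.2.2.1^2 + p.2.2.2^2) = h)).card : ℝ)
      ≤ (m:ℝ)^2 * ∑ d ∈ m.divisors, (tau d : ℝ) / d := by
  classical
  obtain ⟨i, hi⟩ := two_inv_exists m hodd
  obtain ⟨u, hu⟩ := hn
  set ni : ZMod m := ((u⁻¹ : (ZMod m)ˣ) : ZMod m) with hni
  have hnn : (x1^2+x2^2) * ni = 1 := by rw [← hu, hni]; exact u.mul_inv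
  set B := Finset.univ.filter (fun p : ZMod m × ZMod m × ZMod m => p.2.1 * p.2.2 = ni * h + p.1^2) with hB
  have h1 : (Finset.univ.filter (fun p : ZMod m × ZMod m × ZMod m × ZMod m =>
      x1 * p.2.1 = x2 * p.1 ∧ p.1^2 + p.2.1^2 - (p.2.2.1^2 + p.2.2.2^2) = h)).card ≤ B.card := by
    apply Finset.card_le_card_of_injOn (fun p => ((x1*p.2.2.2 - x2*p.2.2.1)*ni,
      (p.1*x1+p.2.1*x2)*ni - (p.2.2.1*x1+p.2.2.2*x2)*ni, (p.1*x1+p.2.1*x2)*ni + (p.2.2.1*x1+p.2.2.2*x2)*ni))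
    · rintro ⟨P1, P2, R1, R2⟩ hp
      simp only [Finset.coe_filter, Finset.mem_univ, true_and, Set.mem_setOf_eq, hB] at hp ⊢
      obtain ⟨e1, e2⟩ := hp
      have e3 : (P1*x1+P2*x2)^2 = (x1^2+x2^2) * (P1^2+P2^2) := by
        linear_combination (-(x1*P2-x2*P1)) * e1
      have e4 : (P1*x1+P2*x2)^2 - (R1*x1+R2*x2)^2 - (x1*R2-x2*R1)^2 = (x1^2+x2^2)*h := by
        rw [e3, ← e2]; ring
      linear_combination (ni^2) * e4 + ni * h * hnn
    · rintro ⟨P1, P2, R1, R2⟩ hp ⟨P1', P2', R1', R2'⟩ hp' he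
      simp only [Finset.coe_filter, Finset.mem_univ, true_and, Set.mem_setOf_eq] at hp hp'
      simp only [Prod.mk.injEq] at he ⊢
      obtain ⟨e1, e2⟩ := hp
      obtain ⟨e1', e2'⟩ := hp'
      obtain ⟨f1, f2, f3⟩ := he
      have l : (P1*x1+P2*x2)*ni = (P1'*x1+P2'*x2)*ni := by
        linear_combination i * (f2 + f3) - ((P1*x1+P2*x2)*ni - (P1'*x1+P2'*x2)*ni) * hi
      have t : (R1*x1+R2*x2)*ni = (R1'*x1+R2'*x2)*ni := by
        linear_combination i * (f3 - f2) - ((R1*x1+R2*x2)*ni - (R1'*x1+R2'*x2)*ni) * hi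
      refine ⟨?_, ?_, ?_, ?_⟩
      · linear_combination x1 * l - x2 * ni * (e1 - e1') - (P1 - P1') * hnn
      · linear_combination x2 * l + x1 * ni * (e1 - e1') - (P2 - P2') * hnn
      · linear_combination x1 * t - x2 * f1 - (R1 - R1') * hnn
      · linear_combination x2 * t + x1 * f1 - (R2 - R2') * hnn
  have h2 : B.card ≤ ∑ s : ZMod m, m * tau (Nat.gcd (ni * h + s^2).val m) := by
    rw [hB, Finset.card_filter, Fintype.sum_prod_type]
    apply Finset.sum_le_sum
    intro s _
    rw [← Finset.card_filter]
    exact xy_count m (ni * h + s^2)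
  have h3 := sigma_count m hodd (ni * h) ((Units.isUnit _).mul hh)
  rw [← Finset.mul_sum] at h2
  calc _ ≤ ((m * ∑ s : ZMod m, tau (Nat.gcd (ni * h + s^2).val m) : ℕ) : ℝ) := by exact_mod_cast h1.trans h2
    _ = (m:ℝ) * ((∑ s : ZMod m, tau (Nat.gcd (ni * h + s^2).val m) : ℕ) : ℝ) := by push_cast; ring
    _ ≤ (m:ℝ) * (m * ∑ d ∈ m.divisors, (tau d : ℝ) / d) := by gcongr
    _ = _ := by ring

lemma W2 (m : ℕ) [NeZero m] (hodd : Odd m) (x1 x2 h : ZMod m) (hn : IsUnit (x1^2+x2^2)) (hh : IsUnit h) :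
    ((Finset.univ.filter (fun p : ZMod m × ZMod m × ZMod m × ZMod m =>
      x1 * p.2.2.2 = x2 * p.2.2.1 ∧ p.1^2 + p.2.1^2 - (p.2.2.1^2 + p.2.2.2^2) = h)).card : ℝ)
      ≤ (m:ℝ)^2 * ∑ d ∈ m.divisors, (tau d : ℝ) / d := by
  classical
  refine le_trans ?_ (W1 m hodd x1 x2 (-h) hn hh.neg)
  have : (Finset.univ.filter (fun p : ZMod m × ZMod m × ZMod m × ZMod m =>
      x1 * p.2.2.2 = x2 * p.2.2.1 ∧ p.1^2 + p.2.1^2 - (p.2.2.1^2 + p.2.2.2^2) = h)).card ≤ 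
      (Finset.univ.filter (fun p : ZMod m × ZMod m × ZMod m × ZMod m =>
      x1 * p.2.1 = x2 * p.1 ∧ p.1^2 + p.2.1^2 - (p.2.2.1^2 + p.2.2.2^2) = -h)).card := by
    apply Finset.card_le_card_of_injOn (fun p => (p.2.2.1, p.2.2.2, p.1, p.2.1))
    · rintro ⟨P1, P2, R1, R2⟩ hp
      simp only [Finset.coe_filter, Finset.mem_univ, true_and, Set.mem_setOf_eq] at hp ⊢
      refine ⟨hp.1, ?_⟩
      rw [← hp.2]; ring
    · rintro ⟨P1, P2, R1, R2⟩ hp ⟨P1', P2', R1', R2'⟩ hp' he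
      simp only [Prod.mk.injEq] at he ⊢
      tauto
  exact_mod_cast this

lemma W3 (Q b b' : ℕ) [NeZero Q] (hodd : Odd Q) (hb : b ∣ Q) (hb' : b' ∣ Q) (k : ℕ) (hk : Q ∣ b^k)
    (x1 x2 y1 y2 h : ZMod Q) (hn : IsUnit (x1^2+x2^2)) (hn' : IsUnit (y1^2+y2^2)) :
    (Finset.univ.filter (fun p : ZMod Q × ZMod Q × ZMod Q × ZMod Q =>
      ZMod.castHom hb (ZMod b) (x1 * p.2.1 - x2 * p.1) = 0 ∧ 
      ZMod.castHom hb' (ZMod b') (y1 * p.2.2.2 - y2 * p.2.2.1) = 0 ∧ IsUnit (p.1^2+p.2.1^2) ∧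
      p.1^2 + p.2.1^2 - (p.2.2.1^2 + p.2.2.2^2) = h)).card 
      ≤ 2^Q.primeFactors.card * ((Q/b) * (Q * (Q/b'))) := by
  classical
  obtain ⟨u, hu⟩ := hn
  set ni : ZMod Q := ((u⁻¹ : (ZMod Q)ˣ) : ZMod Q) with hni
  have hnn : (x1^2+x2^2) * ni = 1 := by rw [← hu, hni]; exact u.mul_inv
  obtain ⟨u', hu'⟩ := hn'
  set ni' : ZMod Q := ((u'⁻¹ : (ZMod Q)ˣ) : ZMod Q) with hni'
  have hnn' : (y1^2+y2^2) * ni' = 1 := by rw [← hu', hni']; exact u'.mul_inv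
  set Bm := Finset.univ.filter (fun x : ZMod Q => ZMod.castHom hb (ZMod b) x = 0) with hBm
  set Bs := Finset.univ.filter (fun x : ZMod Q => ZMod.castHom hb' (ZMod b') x = 0) with hBs
  set D := Bm ×ˢ ((Finset.univ : Finset (ZMod Q)) ×ˢ Bs) with hD
  have hDc : D.card ≤ (Q/b) * (Q * (Q/b')) := by
    rw [hD, Finset.card_product, Finset.card_product, Finset.card_univ, ZMod.card]
    gcongr
    · exact fiber_card Q b hb 0
    · exact fiber_card Q b' hb' 0
  refine le_trans ?_ (Nat.mul_le_mul_left _ hDc)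
  apply Finset.card_le_mul_card_image_of_maps_to
    (f := fun p => (x1 * p.2.1 - x2 * p.1, y1 * p.2.2.1 + y2 * p.2.2.2, y1 * p.2.2.2 - y2 * p.2.2.1))
  · rintro ⟨P1, P2, R1, R2⟩ hp
    simp only [Finset.mem_filter, Finset.mem_univ, true_and] at hp
    simp only [hD, hBm, hBs, Finset.mem_product, Finset.mem_filter, Finset.mem_univ, true_and]
    exact ⟨hp.1, hp.2.1⟩
  · rintro ⟨μ, t, s⟩ hb0
    rcases (Finset.filter (fun p : ZMod Q × ZMod Q × ZMod Q × ZMod Q => (x1 * p.2.1 - x2 * p.1, y1 * p.2.2.1 + y2 * p.2.2.2, y1 * p.2.2.2 - y2 * p.2.2.1) = (μ, t, s)) (Finset.univ.filter (fun p : ZMod Q × ZMod Q × ZMod Q × ZMod Q =>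
      ZMod.castHom hb (ZMod b) (x1 * p.2.1 - x2 * p.1) = 0 ∧ 
      ZMod.castHom hb' (ZMod b') (y1 * p.2.2.2 - y2 * p.2.2.1) = 0 ∧ IsUnit (p.1^2+p.2.1^2) ∧
      p.1^2 + p.2.1^2 - (p.2.2.1^2 + p.2.2.2^2) = h))).eq_empty_or_nonempty with he | ⟨⟨A1, A2, C1, C2⟩, hA⟩
    · rw [he]; simp
    simp only [Finset.mem_filter, Finset.mem_univ, true_and, Prod.mk.injEq] at hA
    obtain ⟨⟨a1, a2, a3, a4⟩, a5, a6, a7⟩ := hA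
    have hnil : IsNilpotent μ := by
      rw [← a5]
      rw [castHom_eq_zero_iff] at a1
      refine ⟨k, ?_⟩
      rw [← ZMod.natCast_zmod_val (x1 * A2 - x2 * A1), ← Nat.cast_pow, ZMod.natCast_eq_zero_iff]
      exact hk.trans (pow_dvd_pow_of_dvd a1 k)
    have hunit : IsUnit ((x1*A1+x2*A2)^2) := by
      have e : (x1*A1+x2*A2)^2 = (x1^2+x2^2)*(A1^2+A2^2) - μ^2 := by rw [← a5]; ring
      rw [e, sub_eq_add_neg]
      have hμ2 : IsNilpotent (-(μ^2)) := (hnil.pow_of_pos (by norm_num)).neg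
      apply IsNilpotent.isUnit_add_left_of_commute hμ2 _ (Commute.all _ _)
      rw [← hu]; exact (Units.isUnit _).mul a3
    refine le_trans ?_ (sqrt_card Q hodd _ hunit)
    apply Finset.card_le_card_of_injOn (fun p => x1*p.1+x2*p.2.1)
    · rintro ⟨P1, P2, R1, R2⟩ hp
      simp only [Finset.coe_filter, Finset.mem_filter, Finset.mem_univ, true_and, Set.mem_setOf_eq, Prod.mk.injEq] at hp ⊢
      obtain ⟨⟨b1, b2, b3, b4⟩, b5, b6, b7⟩ := hp
      have c1 : (y1^2+y2^2) * (R1^2+R2^2) = (y1^2+y2^2) * (C1^2+C2^2) := by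
        have : (y1 * R1 + y2 * R2)^2 + (y1*R2-y2*R1)^2 = (y1 * C1 + y2 * C2)^2 + (y1*C2-y2*C1)^2 := by
          rw [b6, b7, a6, a7]
        linear_combination this
      have c2 : R1^2+R2^2 = C1^2+C2^2 := by
        linear_combination ni' * c1 - ((R1^2+R2^2) - (C1^2+C2^2)) * hnn'
      have c3 : P1^2+P2^2 = A1^2+A2^2 := by linear_combination b4 - a4 + c2
      linear_combination (x1^2+x2^2)*c3 - (x1*P2-x2*P1 + μ) * b5 + (x1*A2-x2*A1+μ) * a5
    · rintro ⟨P1, P2, R1, R2⟩ hp ⟨P1', P2', R1', R2'⟩ hp' he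
      simp only [Finset.coe_filter, Finset.mem_filter, Finset.mem_univ, true_and, Set.mem_setOf_eq, Prod.mk.injEq] at hp hp' he ⊢
      obtain ⟨_, b5, b6, b7⟩ := hp
      obtain ⟨_, b5', b6', b7'⟩ := hp'
      refine ⟨?_, ?_, ?_, ?_⟩
      · linear_combination x1 * ni * he - x2 * ni * (b5 - b5') - (P1 - P1') * hnn
      · linear_combination x2 * ni * he + x1 * ni * (b5 - b5') - (P2 - P2') * hnn
      · linear_combination y1 * ni' * (b6-b6') - y2 * ni' * (b7 - b7') - (R1 - R1') * hnn'
      · linear_combination y2 * ni' * (b6-b6') + y1 * ni' * (b7 - b7') - (R2 - R2') * hnn'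

lemma gcd_lcm_dvd (a a' d : ℕ) (ha : 0 < a) (ha' : 0 < a') (hd : 0 < d) (h : (d:ℤ) ∣ (a:ℤ) - a') :
    Nat.gcd d (Nat.lcm a a') ∣ Nat.gcd a a' := by
  have key : ∀ p k : ℕ, p.Prime → p^k ∣ Nat.gcd d (Nat.lcm a a') → p^k ∣ Nat.gcd a a' := by
    intro p k hp hk
    have h1 : p^k ∣ d := hk.trans (Nat.gcd_dvd_left _ _)
    have h2 : p^k ∣ Nat.lcm a a' := hk.trans (Nat.gcd_dvd_right _ _)
    have h3 : ((p^k:ℕ):ℤ) ∣ (a:ℤ) - a' := (Int.natCast_dvd_natCast.2 h1).trans h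
    have h4 : p^k ∣ a ∨ p^k ∣ a' := by
      rw [hp.pow_dvd_iff_le_factorization (Nat.lcm_ne_zero ha.ne' ha'.ne'), Nat.factorization_lcm ha.ne' ha'.ne'] at h2
      rw [hp.pow_dvd_iff_le_factorization ha.ne', hp.pow_dvd_iff_le_factorization ha'.ne']
      simpa using h2
    rcases h4 with h4 | h4
    · refine Nat.dvd_gcd h4 ?_
      have := dvd_sub (Int.natCast_dvd_natCast.2 h4) h3
      rw [sub_sub_cancel] at this
      exact_mod_cast this
    · refine Nat.dvd_gcd ?_ h4
      have := dvd_add (Int.natCast_dvd_natCast.2 h4) h3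
      rw [add_sub_cancel] at this
      exact_mod_cast this
  exact (Nat.dvd_iff_prime_pow_dvd_dvd _ _).2 fun p k hp => key p k hp

lemma arith1 (a a' : ℕ) (ha : 0 < a) (ha' : 0 < a') :
    ∃ b a1 b' a1' Q k : ℕ, a = b * a1 ∧ a' = b' * a1' ∧ b ∣ Q ∧ b' ∣ Q ∧ 0 < Q ∧ Q ∣ b^k ∧ Q ∣ b'^k ∧
      Nat.Coprime a1 a' ∧ Nat.Coprime a1' a ∧ Nat.Coprime a1 a1' ∧ Nat.Coprime a1 Q ∧ Nat.Coprime a1' Q ∧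
      Q ∣ Nat.lcm a a' ∧ 2^Q.primeFactors.card ≤ tau (Nat.gcd a a') ∧ a1 * a1' * Q ∣ Nat.lcm a a' := by
  obtain ⟨b, a1, k1, e1, f1, g1⟩ := decomp a' a ha
  obtain ⟨b', a1', k2, e2, f2, g2⟩ := decomp a a' ha'
  have hb : 0 < b := Nat.pos_of_ne_zero (by rintro rfl; simp at e1; omega)
  have hb' : 0 < b' := Nat.pos_of_ne_zero (by rintro rfl; simp at e2; omega)
  have hba : b ∣ a := ⟨_, e1⟩
  have hba' : b' ∣ a' := ⟨_, e2⟩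
  have ha1a : a1 ∣ a := ⟨b, by rw [e1, mul_comm]⟩
  have ha1a' : a1' ∣ a' := ⟨b', by rw [e2, mul_comm]⟩
  have hQ : 0 < Nat.lcm b b' := Nat.lcm_pos hb hb'
  have h1 : b' ∣ b^k2 := by
    rw [e1, mul_pow] at f2
    refine Nat.Coprime.dvd_of_dvd_mul_right ?_ f2
    exact (Nat.Coprime.pow_left k2 (Nat.Coprime.coprime_dvd_right hba' g1)).symm
  have h2 : b ∣ b'^k1 := by
    rw [e2, mul_pow] at f1
    refine Nat.Coprime.dvd_of_dvd_mul_right ?_ f1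
    exact (Nat.Coprime.pow_left k1 (Nat.Coprime.coprime_dvd_right hba g2)).symm
  have hc1 : Nat.Coprime a1 b := Nat.Coprime.coprime_dvd_right f1 (Nat.Coprime.pow_right k1 g1)
  have hc2 : Nat.Coprime a1' b' := Nat.Coprime.coprime_dvd_right f2 (Nat.Coprime.pow_right k2 g2)
  have hQa1 : Nat.Coprime a1 (Nat.lcm b b') := 
    Nat.Coprime.coprime_dvd_right (Nat.lcm_dvd_mul b b') (hc1.mul_right (Nat.Coprime.coprime_dvd_right hba' g1))
  have hQa1' : Nat.Coprime a1' (Nat.lcm b b') := 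
    Nat.Coprime.coprime_dvd_right (Nat.lcm_dvd_mul b b') ((Nat.Coprime.coprime_dvd_right hba g2).mul_right hc2)
  have haa : Nat.Coprime a1 a1' := Nat.Coprime.coprime_dvd_right ha1a' g1
  have hQL : Nat.lcm b b' ∣ Nat.lcm a a' := Nat.lcm_dvd (hba.trans (Nat.dvd_lcm_left _ _)) (hba'.trans (Nat.dvd_lcm_right _ _))
  refine ⟨b, a1, b', a1', Nat.lcm b b', k1+k2+1, e1, e2, Nat.dvd_lcm_left _ _, Nat.dvd_lcm_right _ _, hQ, 
    Nat.lcm_dvd (dvd_pow_self _ (by omega)) (h1.trans (pow_dvd_pow _ (by omega))), 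
    Nat.lcm_dvd (h2.trans (pow_dvd_pow _ (by omega))) (dvd_pow_self _ (by omega)), g1, g2, haa, hQa1, hQa1', hQL, ?_, ?_⟩
  · have hg : 0 < Nat.gcd a a' := Nat.gcd_pos_of_pos_left _ ha
    refine le_trans ?_ (two_pow_omega_le_tau _ hg.ne')
    apply Nat.pow_le_pow_right (by norm_num)
    apply Finset.card_le_card
    intro p hp
    have hpp := Nat.prime_of_mem_primeFactors hp
    have hpQ := Nat.dvd_of_mem_primeFactors hp
    have hpb : p ∣ b := by
      have := (hpQ.trans (Nat.lcm_dvd_mul b b'))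
      rcases (Nat.Prime.dvd_mul hpp).1 this with h | h
      · exact h
      · exact hpp.dvd_of_dvd_pow (h.trans h1)
    have hpb' : p ∣ b' := hpp.dvd_of_dvd_pow (hpb.trans h2)
    exact Nat.mem_primeFactors.2 ⟨hpp, Nat.dvd_gcd (hpb.trans hba) (hpb'.trans hba'), hg.ne'⟩
  · apply Nat.Coprime.mul_dvd_of_dvd_of_dvd (hQa1.mul_left hQa1') _ hQL
    exact Nat.Coprime.mul_dvd_of_dvd_of_dvd haa (ha1a.trans (Nat.dvd_lcm_left _ _)) (ha1a'.trans (Nat.dvd_lcm_right _ _))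

noncomputable def box4 (N : ℕ) : Finset (ℤ × ℤ × ℤ × ℤ) :=
  Finset.Ico (N:ℤ) (2*N) ×ˢ (Finset.Ico (N:ℤ) (2*N) ×ˢ (Finset.Ico (N:ℤ) (2*N) ×ˢ Finset.Ico (N:ℤ) (2*N)))

lemma mem_box4 (N : ℕ) (p : ℤ × ℤ × ℤ × ℤ) : p ∈ box4 N ↔ ((N:ℤ) ≤ p.1 ∧ p.1 < 2*N) ∧ ((N:ℤ) ≤ p.2.1 ∧ p.2.1 < 2*N) ∧
   ((N:ℤ) ≤ p.2.2.1 ∧ p.2.2.1 < 2*N) ∧ ((N:ℤ) ≤ p.2.2.2 ∧ p.2.2.2 < 2*N) := by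
  simp [box4, Finset.mem_product, Finset.mem_Ico]

lemma fiberF : ∃ C : ℝ, 0 < C ∧ ∀ (q N : ℕ) (h : ℤ) (S : Finset (ℤ × ℤ × ℤ × ℤ)), 8 ≤ q → h ≠ 0 → (q*h.natAbs)^60 ≤ N →
    S ⊆ box4 N → (∀ p ∈ S, p.1^2+p.2.1^2-(p.2.2.1^2+p.2.2.2^2) = h) →
    (∀ p ∈ S, ∀ p' ∈ S, (q:ℤ) ∣ p.1 - p'.1 ∧ (q:ℤ) ∣ p.2.1 - p'.2.1 ∧ (q:ℤ) ∣ p.2.2.1 - p'.2.2.1 ∧ (q:ℤ) ∣ p.2.2.2 - p'.2.2.2) →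
    (∀ p ∈ S, ∀ l : ℕ, l.Prime → l ∣ q → (l:ℤ) ∣ p.2.1 - p.2.2.2 → ¬ (l:ℤ) ∣ p.2.1 + p.2.2.2) →
    (S.card : ℝ) ≤ C*((N:ℝ)^2/q^3) * ∑ d∈h.natAbs.divisors, (Nat.gcd d q:ℝ)/d := by
  obtain ⟨C, hC, hN⟩ := thmN
  refine ⟨C, hC, ?_⟩
  intro q N h S hq hh hbig hS heq hcong hcop
  rcases S.eq_empty_or_nonempty with he | ⟨z, hz⟩
  · rw [he]; simp; positivity
  refine le_trans ?_ (hN q N h (z.1 + z.2.2.1) (z.1 - z.2.2.1) (z.2.1 - z.2.2.2) (z.2.1 + z.2.2.2) hq hh hbig (hcop z hz))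
  have hN0 : 0 < N := lt_of_lt_of_le (Nat.pow_pos (Nat.mul_pos (by omega) (Int.natAbs_pos.2 hh))) hbig
  rw [Nat.cast_le]
  apply Finset.card_le_card_of_injOn (fun p => ((p.1+p.2.2.1).toNat, p.2.1 - p.2.2.2, p.2.1 + p.2.2.2))
  · rintro ⟨P1, P2, R1, R2⟩ hp
    have hp : (P1, P2, R1, R2) ∈ S := hp
    have hb := (mem_box4 N _).1 (hS hp)
    have he := heq _ hp
    have hc := hcong _ hp z hz
    simp only at hb he hc
    obtain ⟨⟨b1, b2⟩, ⟨b3, b4⟩, ⟨b5, b6⟩, ⟨b7, b8⟩⟩ := hb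
    have ht : (((P1 + R1).toNat : ℕ) : ℤ) = P1 + R1 := Int.toNat_of_nonneg (by omega)
    simp only [Finset.coe_filter, Set.mem_setOf_eq, Finset.mem_product, Finset.mem_Ico, Finset.mem_Ioo]
    push_cast
    rw [ht]
    obtain ⟨c1, c2, c3, c4⟩ := hc
    refine ⟨⟨⟨by omega, by omega⟩, ⟨by omega, by omega⟩, by omega, by omega⟩, ?_, ?_, ?_, ?_⟩
    · have := dvd_add c1 c3; ring_nf at this ⊢; exact this
    · have := dvd_sub c2 c4; ring_nf at this ⊢; exact this
    · have := dvd_add c2 c4; ring_nf at this ⊢; exact this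
    · have := mul_dvd_mul_left (P1+R1) (dvd_sub c1 c3)
      rw [← he]; ring_nf at this ⊢; exact this
  · rintro ⟨P1, P2, R1, R2⟩ hp ⟨P1', P2', R1', R2'⟩ hp' hee
    have hp : (P1, P2, R1, R2) ∈ S := hp
    have hp' : (P1', P2', R1', R2') ∈ S := hp'
    have hb := (mem_box4 N _).1 (hS hp)
    have he := heq _ hp
    have hb' := (mem_box4 N _).1 (hS hp')
    have he' := heq _ hp'
    simp only [Prod.mk.injEq] at hb hb' he he' hee ⊢
    obtain ⟨⟨b1, b2⟩, ⟨b3, b4⟩, ⟨b5, b6⟩, ⟨b7, b8⟩⟩ := hb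
    obtain ⟨⟨b1', b2'⟩, ⟨b3', b4'⟩, ⟨b5', b6'⟩, ⟨b7', b8'⟩⟩ := hb'
    obtain ⟨f1, f2, f3⟩ := hee
    have g1 : P1 + R1 = P1' + R1' := by
      have := Int.toNat_of_nonneg (show 0 ≤ P1 + R1 by omega)
      have := Int.toNat_of_nonneg (show 0 ≤ P1' + R1' by omega)
      omega
    have g2 : P2 = P2' := by omega
    have g3 : R2 = R2' := by omega
    have g4 : P1 - R1 = P1' - R1' := by
      have : (P1 + R1) * ((P1 - R1) - (P1' - R1')) = 0 := by
        subst g2 g3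
        linear_combination he - he' - (P1' - R1') * g1
      rcases mul_eq_zero.1 this with h | h <;> omega
    refine ⟨by omega, g2, by omega, g3⟩

noncomputable def sig (n : ℕ) : ℝ := ∑ d ∈ n.divisors, (1:ℝ) / d

lemma gcd_div_sum (n q g : ℕ) (hn : n ≠ 0) (hg : g ≠ 0) (hd : ∀ d ∈ n.divisors, Nat.gcd d q ∣ g) :
    ∑ d ∈ n.divisors, (Nat.gcd d q : ℝ) / d ≤ tau g * sig n := by
  have h1 : ∀ d ∈ n.divisors, (Nat.gcd d q : ℝ) / d ≤ ∑ e ∈ g.divisors, if e ∣ d then (e:ℝ)/d else 0 := by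
    intro d hd'
    have := Finset.single_le_sum (f := fun e : ℕ => if e ∣ d then (e:ℝ)/d else 0) (s := g.divisors)
      (fun i _ => by split_ifs <;> positivity) (Nat.mem_divisors.2 ⟨hd d hd', hg⟩)
    simpa [Nat.gcd_dvd_left] using this
  refine (Finset.sum_le_sum h1).trans ?_
  rw [Finset.sum_comm]
  have h2 : ∀ e ∈ g.divisors, (∑ d ∈ n.divisors, if e ∣ d then (e:ℝ)/d else 0) ≤ sig n := by
    intro e he
    have he0 : 0 < e := Nat.pos_of_mem_divisors he
    rw [← Finset.sum_filter]
    have : ∑ d ∈ n.divisors.filter (fun d => e ∣ d), (e:ℝ)/d = ∑ d ∈ (n.divisors.filter (fun d => e ∣ d)).image (fun d => d / e), (1:ℝ)/d := by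
      rw [Finset.sum_image]
      · apply Finset.sum_congr rfl
        intro d hd'
        obtain ⟨hd1, k, rfl⟩ := Finset.mem_filter.1 hd'
        rw [Nat.mul_div_cancel_left _ he0]
        push_cast
        have hk : (k:ℝ) ≠ 0 := by
          rintro hk
          have : k = 0 := by exact_mod_cast hk
          subst this
          simp at hd1
        have : (e:ℝ) ≠ 0 := by positivity
        field_simp
      · intro x hx y hy hxy
        simp only [Finset.coe_filter, Set.mem_setOf_eq] at hx hy
        rw [← Nat.div_mul_cancel hx.2, ← Nat.div_mul_cancel hy.2]
        simp only at hxy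
        rw [hxy]
    rw [this]
    apply Finset.sum_le_sum_of_subset_of_nonneg
    · intro x hx
      obtain ⟨d, hd', rfl⟩ := Finset.mem_image.1 hx
      obtain ⟨hd1, hd2⟩ := Finset.mem_filter.1 hd'
      exact Nat.mem_divisors.2 ⟨(Nat.div_dvd_of_dvd hd2).trans (Nat.mem_divisors.1 hd1).1, hn⟩
    · intros; positivity
  refine (Finset.sum_le_sum h2).trans ?_
  rw [Finset.sum_const, nsmul_eq_mul]; rfl

lemma zmod_unit_of_coprime (m : ℕ) (z : ℤ) (h : IsCoprime z (m:ℤ)) : IsUnit ((z : ℤ) : ZMod m) := by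
  rw [ZMod.coe_int_isUnit_iff_isCoprime]; exact h.symm

lemma pair_num (N a1 a1' Q b b' w t Sg S1 S2 : ℝ) (C : ℝ) (hC : 0 < C) (h1 : 0 < a1) (h2 : 0 < a1') (hQ : 0 < Q)
    (hb : 0 < b) (hb' : 0 < b') (hw : 0 ≤ w) (hwt : w ≤ t) (hSg : 0 ≤ Sg) (hS1 : 0 ≤ S1) (hS2 : 0 ≤ S2)
    (hS1' : S1 ≤ 4) (hS2' : S2 ≤ 4) :
    (a1^2*S1) * ((a1'^2*S2) * (w * (Q/b*(Q*(Q/b'))))) * (C*(N^2/(a1*a1'*Q)^3)*(t*Sg)) ≤ 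
      16*C*(N^2/((b*a1)*(b'*a1'))) * t^2 * Sg := by
  have e : (a1^2*S1) * ((a1'^2*S2) * (w * (Q/b*(Q*(Q/b'))))) * (C*(N^2/(a1*a1'*Q)^3)*(t*Sg)) = 
    (S1*S2)*w*t*(C*(N^2/((b*a1)*(b'*a1')))*Sg) := by
    field_simp
  rw [e]
  have : (S1*S2)*w*t ≤ 16*t^2 := by
    have : S1*S2 ≤ 16 := by nlinarith
    have h3 : (S1*S2)*w ≤ 16*t := by
      apply mul_le_mul this hwt hw (by norm_num)
    nlinarith
  calc _ ≤ 16*t^2*(C*(N^2/((b*a1)*(b'*a1')))*Sg) := by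
        apply mul_le_mul_of_nonneg_right this; positivity
    _ = _ := by ring

lemma tau_sum_nonneg_mono (n m : ℕ) (h : n ∣ m) (hm : m ≠ 0) : ∑ d ∈ n.divisors, (tau d:ℝ)/d ≤ ∑ d ∈ m.divisors, (tau d:ℝ)/d := by
  apply Finset.sum_le_sum_of_subset_of_nonneg (Nat.divisors_subset_of_dvd hm h)
  intros; positivity

def pairCond (x1 x2 y1 y2 : ℤ) (a a' : ℕ) (p : ℤ × ℤ × ℤ × ℤ) : Prop :=
  (a:ℤ) ∣ x1*p.2.1 - x2*p.1 ∧ IsCoprime (p.1^2+p.2.1^2) (a:ℤ) ∧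
  (a':ℤ) ∣ y1*p.2.2.2 - y2*p.2.2.1 ∧ IsCoprime (p.2.2.1^2+p.2.2.2^2) (a':ℤ) ∧
  p.1^2+p.2.1^2-(p.2.2.1^2+p.2.2.2^2) = (a:ℤ) - a'

set_option maxHeartbeats 2000000 in
theorem pairP : ∃ C : ℝ, 0 < C ∧ ∀ (N : ℕ) (x1 x2 y1 y2 : ℤ) (a a' : ℕ), (a:ℤ) = x1^2+x2^2+6 → (a':ℤ) = y1^2+y2^2+6 →
    a.Coprime 6 → a'.Coprime 6 → IsCoprime (a:ℤ) x2 → IsCoprime (a':ℤ) y2 → a ≠ a' → 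
    ((a*a')*((a:ℤ)-a').natAbs)^60 ≤ N → ∑ d ∈ a.divisors, (tau d:ℝ)/d ≤ 4 → ∑ d ∈ a'.divisors, (tau d:ℝ)/d ≤ 4 →
    ∀ S : Finset (ℤ × ℤ × ℤ × ℤ), S ⊆ box4 N → (∀ p ∈ S, pairCond x1 x2 y1 y2 a a' p) → 
    (S.card : ℝ) ≤ C * ((N:ℝ)^2/(a*a')) * (tau (Nat.gcd a a'))^2 * sig ((a:ℤ)-a').natAbs := by
  obtain ⟨C, hC, hF⟩ := fiberF
  refine ⟨16*C, by positivity, ?_⟩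
  intro N x1 x2 y1 y2 a a' ha ha' h6 h6' hx2 hy2 hne hbig hs hs' S hS hcond
  classical
  have ha0 : 0 < a := by
    have : (0:ℤ) < a := by rw [ha]; positivity
    exact_mod_cast this
  have ha0' : 0 < a' := by
    have : (0:ℤ) < a' := by rw [ha']; positivity
    exact_mod_cast this
  obtain ⟨b, a1, b', a1', Q, k, e1, e2, hbQ, hbQ', hQ, hQk, hQk', c1, c2, c3, c4, c5, hQL, hom, hL⟩ := arith1 a a' ha0 ha0'
  have hb0 : 0 < b := Nat.pos_of_ne_zero (by rintro rfl; simp at e1; omega)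
  have hb0' : 0 < b' := Nat.pos_of_ne_zero (by rintro rfl; simp at e2; omega)
  have ha1 : 0 < a1 := Nat.pos_of_ne_zero (by rintro rfl; simp at e1; omega)
  have ha1' : 0 < a1' := Nat.pos_of_ne_zero (by rintro rfl; simp at e2; omega)
  have hba : b ∣ a := ⟨_, e1⟩
  have hba' : b' ∣ a' := ⟨_, e2⟩
  have ha1a : a1 ∣ a := ⟨b, by rw [e1, mul_comm]⟩
  have ha1a' : a1' ∣ a' := ⟨b', by rw [e2, mul_comm]⟩
  haveI : NeZero a1 := ⟨ha1.ne'⟩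
  haveI : NeZero a1' := ⟨ha1'.ne'⟩
  haveI : NeZero Q := ⟨hQ.ne'⟩
  have hodd : Odd a := Nat.coprime_two_right.1 (Nat.Coprime.coprime_dvd_right (by norm_num) h6)
  have hodd' : Odd a' := Nat.coprime_two_right.1 (Nat.Coprime.coprime_dvd_right (by norm_num) h6')
  have hLp : 0 < Nat.lcm a a' := Nat.lcm_pos ha0 ha0'
  have hLodd : Odd (Nat.lcm a a') := Odd.of_dvd_nat (hodd.mul hodd') (Nat.lcm_dvd_mul a a')
  have hQodd : Odd Q := Odd.of_dvd_nat hLodd hQL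
  set q := a1 * a1' * Q with hq
  have hq0 : 0 < q := by positivity
  have haq : a ∣ q := by
    rw [e1, hq]
    have : b * a1 ∣ Q * a1 := Nat.mul_dvd_mul_right hbQ a1
    exact this.trans ⟨a1', by ring⟩
  have haq' : a' ∣ q := by
    rw [e2, hq]
    have : b' * a1' ∣ Q * a1' := Nat.mul_dvd_mul_right hbQ' a1'
    exact this.trans ⟨a1, by ring⟩
  have h7 : 6 ≤ a := by
    have : (6:ℤ) ≤ a := by rw [ha]; nlinarith [sq_nonneg x1, sq_nonneg x2]
    exact_mod_cast this
  have h7' : 6 ≤ a' := by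
    have : (6:ℤ) ≤ a' := by rw [ha']; nlinarith [sq_nonneg y1, sq_nonneg y2]
    exact_mod_cast this
  have hq8 : 8 ≤ q := by
    have l1 := Nat.le_of_dvd hq0 haq
    have l2 := Nat.le_of_dvd hq0 haq'
    obtain ⟨u, hu⟩ := hodd
    obtain ⟨u', hu'⟩ := hodd'
    omega
  set h : ℤ := (a:ℤ) - a' with hh
  have hh0 : h ≠ 0 := by rw [hh]; intro h0; apply hne; omega
  have hqle : q ≤ a * a' := (Nat.le_of_dvd hLp hL).trans (Nat.le_of_dvd (by positivity) (Nat.lcm_dvd_mul a a'))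
  have hbig' : (q*h.natAbs)^60 ≤ N := le_trans (Nat.pow_le_pow_left (Nat.mul_le_mul_right _ hqle) _) hbig
  -- unit facts
  have cop6 : IsCoprime (a:ℤ) 6 := by exact_mod_cast Nat.isCoprime_iff_coprime.2 h6
  have cop6' : IsCoprime (a':ℤ) 6 := by exact_mod_cast Nat.isCoprime_iff_coprime.2 h6'
  have cn : IsCoprime (x1^2+x2^2) (a:ℤ) := by
    have : IsCoprime (a:ℤ) ((x1^2+x2^2)) := by
      have e : x1^2+x2^2 = -6 + (a:ℤ)*1 := by rw [ha]; ring
      rw [e]; exact (IsCoprime.neg_right cop6).add_mul_left_right 1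
    exact this.symm
  have cn' : IsCoprime (y1^2+y2^2) (a':ℤ) := by
    have : IsCoprime (a':ℤ) ((y1^2+y2^2)) := by
      have e : y1^2+y2^2 = -6 + (a':ℤ)*1 := by rw [ha']; ring
      rw [e]; exact (IsCoprime.neg_right cop6').add_mul_left_right 1
    exact this.symm
  have dQ : (Q:ℤ) ∣ (a:ℤ)^k := by exact_mod_cast hQk.trans (pow_dvd_pow_of_dvd hba k)
  have dQ' : (Q:ℤ) ∣ (a':ℤ)^k := by exact_mod_cast hQk'.trans (pow_dvd_pow_of_dvd hba' k)
  have da1 : (a1:ℤ) ∣ a := by exact_mod_cast ha1a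
  have da1' : (a1':ℤ) ∣ a' := by exact_mod_cast ha1a'
  have uh1 : IsUnit ((h:ℤ) : ZMod a1) := by
    apply zmod_unit_of_coprime
    obtain ⟨w, hw⟩ := da1
    have : IsCoprime (a1:ℤ) h := by
      rw [hh, hw]
      have e : (a1:ℤ)*w - a' = -(a':ℤ) + (a1:ℤ) * w := by ring
      rw [e]
      exact (IsCoprime.neg_right (Nat.isCoprime_iff_coprime.2 c1)).add_mul_left_right w
    exact this.symm
  have uh2 : IsUnit ((h:ℤ) : ZMod a1') := by
    apply zmod_unit_of_coprime
    obtain ⟨w, hw⟩ := da1'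
    have : IsCoprime (a1':ℤ) h := by
      rw [hh, hw]
      have e : (a:ℤ) - (a1':ℤ)*w = (a:ℤ) + (a1':ℤ) * (-w) := by ring
      rw [e]
      exact (Nat.isCoprime_iff_coprime.2 c2).add_mul_left_right (-w)
    exact this.symm
  have W1' := W1 a1 (Odd.of_dvd_nat hodd ha1a) (x1 : ZMod a1) (x2 : ZMod a1) ((h:ℤ) : ZMod a1) 
    (by have := zmod_unit_of_coprime a1 (x1^2+x2^2) (cn.of_isCoprime_of_dvd_right da1); push_cast at this; exact this) uh1
  have W2' := W2 a1' (Odd.of_dvd_nat hodd' ha1a') (y1 : ZMod a1') (y2 : ZMod a1') ((h:ℤ) : ZMod a1') 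
    (by have := zmod_unit_of_coprime a1' (y1^2+y2^2) (cn'.of_isCoprime_of_dvd_right da1'); push_cast at this; exact this) uh2
  have W3' := W3 Q b b' hQodd hbQ hbQ' k hQk (x1 : ZMod Q) (x2 : ZMod Q) (y1 : ZMod Q) (y2 : ZMod Q) ((h:ℤ) : ZMod Q)
    (by have := zmod_unit_of_coprime Q (x1^2+x2^2) ((cn.pow_right (n := k)).of_isCoprime_of_dvd_right dQ); push_cast at this; exact this)
    (by have := zmod_unit_of_coprime Q (y1^2+y2^2) ((cn'.pow_right (n := k)).of_isCoprime_of_dvd_right dQ'); push_cast at this; exact this)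
  set B1 := (Finset.univ.filter (fun p : ZMod a1 × ZMod a1 × ZMod a1 × ZMod a1 =>
      (x1 : ZMod a1) * p.2.1 = (x2 : ZMod a1) * p.1 ∧ p.1^2 + p.2.1^2 - (p.2.2.1^2 + p.2.2.2^2) = ((h:ℤ) : ZMod a1))) with hB1
  set B2 := (Finset.univ.filter (fun p : ZMod a1' × ZMod a1' × ZMod a1' × ZMod a1' =>
      (y1 : ZMod a1') * p.2.2.2 = (y2 : ZMod a1') * p.2.2.1 ∧ p.1^2 + p.2.1^2 - (p.2.2.1^2 + p.2.2.2^2) = ((h:ℤ) : ZMod a1'))) with hB2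
  set B3 := (Finset.univ.filter (fun p : ZMod Q × ZMod Q × ZMod Q × ZMod Q =>
      ZMod.castHom hbQ (ZMod b) ((x1 : ZMod Q) * p.2.1 - (x2 : ZMod Q) * p.1) = 0 ∧ 
      ZMod.castHom hbQ' (ZMod b') ((y1 : ZMod Q) * p.2.2.2 - (y2 : ZMod Q) * p.2.2.1) = 0 ∧ IsUnit (p.1^2+p.2.1^2) ∧
      p.1^2 + p.2.1^2 - (p.2.2.1^2 + p.2.2.2^2) = ((h:ℤ) : ZMod Q))) with hB3
  let φ : (m : ℕ) → (ℤ × ℤ × ℤ × ℤ) → (ZMod m × ZMod m × ZMod m × ZMod m) := fun m p => ((p.1 : ZMod m), (p.2.1 : ZMod m), (p.2.2.1 : ZMod m), (p.2.2.2 : ZMod m))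
  have hmaps : ∀ p ∈ S, (φ a1 p, φ a1' p, φ Q p) ∈ B1 ×ˢ (B2 ×ˢ B3) := by
    intro p hp
    obtain ⟨k1, k2, k3, k4, k5⟩ := hcond p hp
    simp only [φ, hB1, hB2, hB3, Finset.mem_product, Finset.mem_filter, Finset.mem_univ, true_and]
    refine ⟨⟨?_, ?_⟩, ⟨?_, ?_⟩, ?_, ?_, ?_, ?_⟩
    · have := (ZMod.intCast_zmod_eq_zero_iff_dvd _ a1).2 (da1.trans k1)
      push_cast at this; linear_combination this
    · rw [hh, ← k5]; push_cast; ring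
    · have := (ZMod.intCast_zmod_eq_zero_iff_dvd _ a1').2 (da1'.trans k3)
      push_cast at this; linear_combination this
    · rw [hh, ← k5]; push_cast; ring
    · have := (ZMod.intCast_zmod_eq_zero_iff_dvd _ b).2 ((Int.natCast_dvd_natCast.2 hba).trans k1)
      rw [← this]; simp only [map_sub, map_mul, map_intCast, Int.cast_sub, Int.cast_mul]
    · have := (ZMod.intCast_zmod_eq_zero_iff_dvd _ b').2 ((Int.natCast_dvd_natCast.2 hba').trans k3)
      rw [← this]; simp only [map_sub, map_mul, map_intCast, Int.cast_sub, Int.cast_mul]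
    · have := zmod_unit_of_coprime Q _ ((k2.pow_right (n := k)).of_isCoprime_of_dvd_right dQ)
      push_cast at this; exact this
    · rw [hh, ← k5]; push_cast; ring
  have hdiv : ∑ d ∈ h.natAbs.divisors, (Nat.gcd d q : ℝ) / d ≤ tau (Nat.gcd a a') * sig h.natAbs := by
    apply gcd_div_sum _ _ _ (Int.natAbs_ne_zero.2 hh0) (Nat.gcd_pos_of_pos_left _ ha0).ne'
    intro d hd
    have hd1 : (d:ℤ) ∣ h := Int.natCast_dvd.2 (Nat.mem_divisors.1 hd).1
    have hd0 : 0 < d := Nat.pos_of_mem_divisors hd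
    exact (Nat.gcd_dvd_gcd_of_dvd_right d hL).trans (gcd_lcm_dvd a a' d ha0 ha0' hd0 hd1)
  set Fb : ℝ := C*((N:ℝ)^2/(q:ℝ)^3) * ((tau (Nat.gcd a a') : ℝ) * sig h.natAbs) with hFb
  have hfib : ∀ c ∈ B1 ×ˢ (B2 ×ˢ B3), ((S.filter (fun p => (φ a1 p, φ a1' p, φ Q p) = c)).card : ℝ) ≤ Fb := by
    intro c _
    refine le_trans (hF q N h _ hq8 hh0 hbig' ((Finset.filter_subset _ _).trans hS) ?_ ?_ ?_) ?_
    · intro p hp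
      exact (hcond p (Finset.mem_filter.1 hp).1).2.2.2.2
    · intro p hp p' hp'
      have r1 := (Finset.mem_filter.1 hp).2
      have r2 := (Finset.mem_filter.1 hp').2
      rw [← r2] at r1
      simp only [φ, Prod.mk.injEq] at r1
      have comb : ∀ z z' : ℤ, (z : ZMod a1) = z' → (z : ZMod a1') = z' → (z : ZMod Q) = z' → (q:ℤ) ∣ z - z' := by
        intro z z' s1 s2 s3
        rw [ZMod.intCast_eq_intCast_iff_dvd_sub] at s1 s2 s3
        rw [← neg_sub, dvd_neg, hq]
        push_cast
        apply IsCoprime.mul_dvd _ (IsCoprime.mul_dvd (Nat.isCoprime_iff_coprime.2 c3) s1 s2) s3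
        exact IsCoprime.mul_left (Nat.isCoprime_iff_coprime.2 c4) (Nat.isCoprime_iff_coprime.2 c5)
      obtain ⟨⟨s1, s2, s3, s4⟩, ⟨t1, t2, t3, t4⟩, u1, u2, u3, u4⟩ := r1
      exact ⟨comb _ _ s1 t1 u1, comb _ _ s2 t2 u2, comb _ _ s3 t3 u3, comb _ _ s4 t4 u4⟩
    · intro p hp l hl hlq hr ht
      obtain ⟨k1, k2, k3, k4, k5⟩ := hcond p (Finset.mem_filter.1 hp).1
      have hlL : l ∣ a * a' := hlq.trans (hL.trans (Nat.lcm_dvd_mul a a'))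
      have hlodd : l ≠ 2 := by
        rintro rfl
        have := Odd.of_dvd_nat hLodd (hlq.trans hL)
        exact absurd this (by decide)
      have hlp : Prime (l:ℤ) := Nat.prime_iff_prime_int.1 hl
      have l2 : ¬ (l:ℤ) ∣ 2 := by
        intro h2
        have : l ∣ 2 := by exact_mod_cast h2
        exact hlodd ((Nat.prime_dvd_prime_iff_eq hl Nat.prime_two).1 this)
      have hP2 : (l:ℤ) ∣ p.2.1 := by
        have := dvd_add hr ht
        have e : p.2.1 - p.2.2.2 + (p.2.1 + p.2.2.2) = 2 * p.2.1 := by ring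
        rw [e] at this
        exact (hlp.dvd_or_dvd this).resolve_left l2
      have hR2 : (l:ℤ) ∣ p.2.2.2 := by
        have := dvd_sub ht hP2
        rw [add_sub_cancel_left] at this; exact this
      rcases (Nat.Prime.dvd_mul hl).1 hlL with hla | hla
      · have hla : (l:ℤ) ∣ a := by exact_mod_cast hla
        have hP1 : (l:ℤ) ∣ p.1 := by
          have w1 : (l:ℤ) ∣ x2 * p.1 := by
            have := dvd_sub (hP2.mul_left x1) (hla.trans k1)
            rw [sub_sub_cancel] at this; exact this
          refine (hlp.dvd_or_dvd w1).resolve_left fun w2 => ?_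
          exact hlp.not_unit (hx2.isUnit_of_dvd' hla w2)
        exact hlp.not_unit (k2.isUnit_of_dvd' (dvd_add (dvd_pow hP1 (by norm_num)) (dvd_pow hP2 (by norm_num))) hla)
      · have hla : (l:ℤ) ∣ a' := by exact_mod_cast hla
        have hR1 : (l:ℤ) ∣ p.2.2.1 := by
          have w1 : (l:ℤ) ∣ y2 * p.2.2.1 := by
            have := dvd_sub (hR2.mul_left y1) (hla.trans k3)
            rw [sub_sub_cancel] at this; exact this
          refine (hlp.dvd_or_dvd w1).resolve_left fun w2 => ?_
          exact hlp.not_unit (hy2.isUnit_of_dvd' hla w2)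
        exact hlp.not_unit (k4.isUnit_of_dvd' (dvd_add (dvd_pow hR1 (by norm_num)) (dvd_pow hR2 (by norm_num))) hla)
    · rw [hFb]
      gcongr
  have hsum : (S.card : ℝ) ≤ (B1.card * (B2.card * B3.card) : ℝ) * Fb := by
    rw [Finset.card_eq_sum_card_fiberwise (f := fun p => (φ a1 p, φ a1' p, φ Q p)) (t := B1 ×ˢ (B2 ×ˢ B3)) (fun p hp => hmaps p hp)]
    push_cast
    refine (Finset.sum_le_sum hfib).trans ?_
    rw [Finset.sum_const, nsmul_eq_mul, Finset.card_product, Finset.card_product]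
    push_cast; exact le_rfl
  have hsig : 0 ≤ sig h.natAbs := Finset.sum_nonneg (fun i _ => by positivity)
  have hFb0 : 0 ≤ Fb := by rw [hFb]; positivity
  refine hsum.trans ?_
  have hB3' : (B3.card : ℝ) ≤ (2:ℝ)^Q.primeFactors.card * ((Q:ℝ)/b * (Q * ((Q:ℝ)/b'))) := by
    have : (B3.card : ℝ) ≤ ((2^Q.primeFactors.card * ((Q/b) * (Q * (Q/b'))) : ℕ) : ℝ) := by exact_mod_cast W3'
    push_cast at this
    rw [Nat.cast_div hbQ (by positivity), Nat.cast_div hbQ' (by positivity)] at this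
    exact this
  set S1 := ∑ d ∈ a1.divisors, (tau d:ℝ)/d with hS1
  set S2 := ∑ d ∈ a1'.divisors, (tau d:ℝ)/d with hS2
  have hS10 : 0 ≤ S1 := Finset.sum_nonneg (fun i _ => by positivity)
  have hS20 : 0 ≤ S2 := Finset.sum_nonneg (fun i _ => by positivity)
  have step : (B1.card * (B2.card * B3.card) : ℝ) * Fb ≤ (a1^2*S1) * ((a1'^2*S2) * ((2:ℝ)^Q.primeFactors.card * ((Q:ℝ)/b * (Q * ((Q:ℝ)/b'))))) * Fb := by
    apply mul_le_mul_of_nonneg_right _ hFb0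
    gcongr
  refine step.trans ?_
  have := pair_num N a1 a1' Q b b' ((2:ℝ)^Q.primeFactors.card) (tau (Nat.gcd a a')) (sig h.natAbs) S1 S2 C hC 
    (by positivity) (by positivity) (by positivity) (by positivity) (by positivity) (by positivity) (by exact_mod_cast hom) hsig
    hS10 hS20 ((tau_sum_nonneg_mono a1 a ha1a ha0.ne').trans hs) ((tau_sum_nonneg_mono a1' a' ha1a' ha0'.ne').trans hs')
  have ea : (a:ℝ) = b * a1 := by exact_mod_cast e1
  have ea' : (a':ℝ) = b' * a1' := by exact_mod_cast e2
  have eq : (q:ℝ) = a1 * a1' * Q := by rw [hq]; push_cast; ring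
  rw [hFb, eq, ea, ea']
  exact this

lemma div_gcd_dvd (a k : ℕ) (α : ℤ) (ha : 0 < a) (h : (a:ℤ) ∣ k * α) : a / Nat.gcd a α.natAbs ∣ k := by
  have h1 : a ∣ k * α.natAbs := by
    have := Int.natAbs_dvd_natAbs.2 h
    simpa [Int.natAbs_mul] using this
  have hg : 0 < Nat.gcd a α.natAbs := Nat.gcd_pos_of_pos_left _ ha
  have hc := Nat.coprime_div_gcd_div_gcd hg
  refine hc.dvd_of_dvd_mul_right ?_
  have : a / Nat.gcd a α.natAbs * Nat.gcd a α.natAbs ∣ k * (α.natAbs / Nat.gcd a α.natAbs) * Nat.gcd a α.natAbs := by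
    rw [Nat.div_mul_cancel (Nat.gcd_dvd_left _ _), mul_assoc, Nat.div_mul_cancel (Nat.gcd_dvd_right _ _)]
    exact h1
  exact Nat.dvd_of_mul_dvd_mul_right hg this

lemma card_mult (n p : ℕ) : ((Finset.Ioc 0 n).filter (fun x => p ∣ x)).card = n / p := Nat.Ioc_filter_dvd_card_eq_div n p

/-- count of pairs for a fixed primitive direction -/
lemma fibQ (a N m : ℕ) (α β δ1 δ2 : ℤ) (ha : 0 < a) (hm : 0 < m) 
    (hcop : Nat.Coprime (Nat.gcd a α.natAbs) (Nat.gcd a β.natAbs)) (hδ : δ1 ≠ 0)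
    (S : Finset (ℤ × ℤ × ℤ × ℤ)) 
    (hS : ∀ p ∈ S, ∃ k : ℕ, ∃ g : ℤ, 0 < k ∧ g ≠ 0 ∧ p.1 + p.2.2.1 = k * δ1 ∧ p.2.1 + p.2.2.2 = k * δ2 ∧
      p.1 - p.2.2.1 = - g * δ2 ∧ p.2.1 - p.2.2.2 = g * δ1 ∧ (a:ℤ) ∣ k * α ∧ (a:ℤ) ∣ g * β ∧ k * m ≤ 4*N ∧ g.natAbs * m ≤ N) :
    (S.card : ℝ) ≤ 8*(N:ℝ)^2/a * (1/(m:ℝ)^2) := by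
  choose! k g h using hS
  set g1 := Nat.gcd a α.natAbs with hg1
  set g2 := Nat.gcd a β.natAbs with hg2
  have hg1p : 0 < g1 := Nat.gcd_pos_of_pos_left _ ha
  have hg2p : 0 < g2 := Nat.gcd_pos_of_pos_left _ ha
  have hg1d : g1 ∣ a := Nat.gcd_dvd_left _ _
  have hg2d : g2 ∣ a := Nat.gcd_dvd_left _ _
  have hprod : g1 * g2 ≤ a := Nat.le_of_dvd ha (hcop.mul_dvd_of_dvd_of_dvd hg1d hg2d)
  have hc : S.card ≤ (((Finset.Ioc 0 (4*N/m)).filter (fun x => a/g1 ∣ x)) ×ˢ ((Finset.univ : Finset Bool) ×ˢ ((Finset.Ioc 0 (N/m)).filter (fun x => a/g2 ∣ x)))).card := by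
    apply Finset.card_le_card_of_injOn (fun p => (k p, decide (0 < g p), (g p).natAbs))
    · intro p hp
      obtain ⟨h1, h2, h3, h4, h5, h6, h7, h8, h9, h10⟩ := h p hp
      simp only [Finset.coe_product, Finset.coe_filter, Set.mem_prod, Set.mem_setOf_eq, Finset.mem_Ioc, Finset.coe_univ, Set.mem_univ, true_and]
      refine ⟨⟨⟨h1, (Nat.le_div_iff_mul_le hm).2 h9⟩, div_gcd_dvd a _ α ha h7⟩, ⟨⟨Int.natAbs_pos.2 h2, (Nat.le_div_iff_mul_le hm).2 h10⟩, div_gcd_dvd a _ β ha ?_⟩⟩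
      rcases Int.natAbs_eq (g p) with e | e
      · rw [← e]; exact h8
      · have : (((g p).natAbs : ℕ) : ℤ) = - g p := by omega
        rw [this, neg_mul, dvd_neg]; exact h8
    · intro p hp p' hp' he
      obtain ⟨h1, h2, h3, h4, h5, h6, -⟩ := h p hp
      obtain ⟨h1', h2', h3', h4', h5', h6', -⟩ := h p' hp'
      simp only [Prod.mk.injEq, decide_eq_decide] at he
      obtain ⟨e1, e2, e3⟩ := he
      have eg : g p = g p' := by omega
      rw [← e1] at h3' h4'
      rw [← eg] at h5' h6'
      obtain ⟨P1, P2, R1, R2⟩ := p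
      obtain ⟨P1', P2', R1', R2'⟩ := p'
      simp only [Prod.mk.injEq] at *
      refine ⟨by linarith, by linarith, by linarith, by linarith⟩
  rw [Finset.card_product, Finset.card_product, card_mult, card_mult, Finset.card_univ, Fintype.card_bool] at hc
  have hm' : (0:ℝ) < m := by exact_mod_cast hm
  have ha' : (0:ℝ) < a := by exact_mod_cast ha
  have hg1' : (0:ℝ) < g1 := by exact_mod_cast hg1p
  have hg2' : (0:ℝ) < g2 := by exact_mod_cast hg2p
  have i1 : ((4*N/m/(a/g1) : ℕ) : ℝ) ≤ 4*N/m/(a/g1) := by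
    refine Nat.cast_div_le.trans ?_
    rw [Nat.cast_div hg1d hg1'.ne']
    gcongr
    refine Nat.cast_div_le.trans ?_
    push_cast; exact le_rfl
  have i2 : ((N/m/(a/g2) : ℕ) : ℝ) ≤ N/m/(a/g2) := by
    refine Nat.cast_div_le.trans ?_
    rw [Nat.cast_div hg2d hg2'.ne']
    gcongr
    exact Nat.cast_div_le
  calc (S.card : ℝ) ≤ ((4*N/m/(a/g1) : ℕ) : ℝ) * (2 * ((N/m/(a/g2) : ℕ) : ℝ)) := by exact_mod_cast hc
    _ ≤ (4*N/m/(a/g1)) * (2 * (N/m/(a/g2))) := by gcongr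
    _ = 8*(N:ℝ)^2/a*(1/(m:ℝ)^2) * ((g1*g2:ℝ)/a) := by field_simp; ring
    _ ≤ 8*(N:ℝ)^2/a*(1/(m:ℝ)^2) * 1 := by
      gcongr
      rw [div_le_one ha']
      exact_mod_cast hprod
    _ = _ := by ring

/-- sum of `1/max^2` over well-spaced points -/
lemma spaced_sum (K L : ℕ) (hK : 0 < K) (hL : 0 < L) (D : Finset (ℕ × ℕ)) (h1 : ∀ d ∈ D, K ≤ max d.1 d.2 ∧ max d.1 d.2 ≤ L)
    (h2 : ∀ d ∈ D, ∀ d' ∈ D, d.1 / K = d'.1 / K → d.2 / K = d'.2 / K → d = d') :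
    ∑ d ∈ D, 1 / ((max d.1 d.2 : ℕ) : ℝ)^2 ≤ 4 * (1 + Real.log L) / (K:ℝ)^2 := by
  classical
  have hK' : (0:ℝ) < K := by exact_mod_cast hK
  have hmap : ∀ d ∈ D, max (d.1/K) (d.2/K) ∈ Finset.Icc 1 L := by
    intro d hd
    obtain ⟨a1, a2⟩ := h1 d hd
    rw [Finset.mem_Icc]
    constructor
    · rcases le_total d.1 d.2 with h | h
      · rw [max_eq_right h] at a1
        exact le_trans ((Nat.one_le_div_iff hK).2 a1) (le_max_right _ _)
      · rw [max_eq_left h] at a1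
        exact le_trans ((Nat.one_le_div_iff hK).2 a1) (le_max_left _ _)
    · apply max_le
      · exact (Nat.div_le_self _ _).trans ((le_max_left _ _).trans a2)
      · exact (Nat.div_le_self _ _).trans ((le_max_right _ _).trans a2)
  rw [← Finset.sum_fiberwise_of_maps_to hmap]
  have hf : ∀ t ∈ Finset.Icc 1 L, ∑ d ∈ D.filter (fun d => max (d.1/K) (d.2/K) = t), 1 / ((max d.1 d.2 : ℕ) : ℝ)^2 ≤ 4/(K:ℝ)^2 * (1/t) := by
    intro t ht
    have ht1 : 1 ≤ t := (Finset.mem_Icc.1 ht).1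
    have ht' : (1:ℝ) ≤ t := by exact_mod_cast ht1
    have hc : (D.filter (fun d => max (d.1/K) (d.2/K) = t)).card ≤ 4 * t := by
      have : (D.filter (fun d => max (d.1/K) (d.2/K) = t)).card ≤ (({t} ×ˢ Finset.range (t+1)) ∪ (Finset.range (t+1) ×ˢ {t}) : Finset (ℕ×ℕ)).card := by
        apply Finset.card_le_card_of_injOn (fun d => (d.1/K, d.2/K))
        · intro d hd
          have := (Finset.mem_filter.1 hd).2
          simp only [Finset.coe_union, Set.mem_union, Finset.mem_coe, Finset.mem_product, Finset.mem_singleton, Finset.mem_range]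
          omega
        · intro d hd d' hd' he
          simp only [Prod.mk.injEq] at he
          exact h2 d (Finset.mem_filter.1 hd).1 d' (Finset.mem_filter.1 hd').1 he.1 he.2
      refine this.trans ((Finset.card_union_le _ _).trans ?_)
      simp; omega
    calc _ ≤ ∑ d ∈ D.filter (fun d => max (d.1/K) (d.2/K) = t), 1/((K:ℝ)*t)^2 := by
          apply Finset.sum_le_sum
          intro d hd
          have := (Finset.mem_filter.1 hd).2
          have hle : K * t ≤ max d.1 d.2 := by
            rcases le_total (d.1/K) (d.2/K) with h | h
            · rw [max_eq_right h] at this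
              rw [← this]; exact (Nat.mul_div_le _ _).trans (le_max_right _ _)
            · rw [max_eq_left h] at this
              rw [← this]; exact (Nat.mul_div_le _ _).trans (le_max_left _ _)
          have hle' : (K:ℝ)*t ≤ ((max d.1 d.2 : ℕ) : ℝ) := by exact_mod_cast hle
          gcongr
      _ ≤ (4*t) * (1/((K:ℝ)*t)^2) := by
          rw [Finset.sum_const, nsmul_eq_mul]
          gcongr
          exact_mod_cast hc
      _ = _ := by field_simp
  refine (Finset.sum_le_sum hf).trans ?_
  rw [← Finset.mul_sum]
  have hh : ∑ t ∈ Finset.Icc 1 L, (1/(t:ℝ)) ≤ 1 + Real.log L := by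
    have := harmonic_le_one_add_log L
    rw [harmonic_eq_sum_Icc] at this
    push_cast at this
    simpa using this
  calc _ ≤ 4/(K:ℝ)^2 * (1 + Real.log L) := by gcongr
    _ = _ := by ring

lemma cardP (N a : ℕ) (x1 x2 : ℤ) (ha : 0 < a) (haN : a ≤ N) (hx2 : IsCoprime (a:ℤ) x2) (S : Finset (ℤ × ℤ)) 
    (hS : ∀ p ∈ S, ((N:ℤ) ≤ p.1 ∧ p.1 < 2*N) ∧ ((N:ℤ) ≤ p.2 ∧ p.2 < 2*N) ∧ (a:ℤ) ∣ x1*p.2 - x2*p.1) : 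
    (S.card : ℝ) ≤ 2*(N:ℝ)^2/a := by
  classical
  have h1 : S.card ≤ (N/a+1) * (Finset.Ico (N:ℤ) (2*N)).card := by
    apply Finset.card_le_mul_card_image_of_maps_to (f := fun p : ℤ × ℤ => p.2)
    · intro p hp
      exact Finset.mem_Ico.2 (hS p hp).2.1
    · intro z _
      have : (S.filter (fun p : ℤ × ℤ => p.2 = z)).card = ((S.filter (fun p : ℤ × ℤ => p.2 = z)).image (fun p => p.1)).card := by
        rw [Finset.card_image_of_injOn]
        intro p hp p' hp' he
        have e1 := (Finset.mem_filter.1 hp).2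
        have e2 := (Finset.mem_filter.1 hp').2
        exact Prod.ext he (e1.trans e2.symm)
      rw [this]
      apply card_congr_le _ (N:ℤ) N a ha
      · intro x hx
        obtain ⟨p, hp, rfl⟩ := Finset.mem_image.1 hx
        have := (hS p (Finset.mem_filter.1 hp).1).1
        omega
      · intro x hx y hy
        obtain ⟨p, hp, rfl⟩ := Finset.mem_image.1 hx
        obtain ⟨p', hp', rfl⟩ := Finset.mem_image.1 hy
        have k1 := (hS p (Finset.mem_filter.1 hp).1).2.2
        have k2 := (hS p' (Finset.mem_filter.1 hp').1).2.2
        rw [(Finset.mem_filter.1 hp).2] at k1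
        rw [(Finset.mem_filter.1 hp').2] at k2
        have := dvd_sub k2 k1
        have e : x1 * z - x2 * p'.1 - (x1 * z - x2 * p.1) = x2 * (p.1 - p'.1) := by ring
        rw [e] at this
        exact hx2.dvd_of_dvd_mul_left this
  have h2 : (Finset.Ico (N:ℤ) (2*N)).card = N := by simp; omega
  rw [h2] at h1
  have ha' : (0:ℝ) < a := by exact_mod_cast ha
  have haN' : (a:ℝ) ≤ N := by exact_mod_cast haN
  have h3 : ((N/a+1 : ℕ):ℝ) ≤ 2*N/a := by
    push_cast
    have : ((N/a:ℕ):ℝ) ≤ N/a := Nat.cast_div_le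
    have : (1:ℝ) ≤ N/a := by rw [le_div_iff₀ ha']; linarith
    have e : 2*(N:ℝ)/a = N/a+N/a := by ring
    rw [e]; linarith
  calc (S.card:ℝ) ≤ ((N/a+1 : ℕ):ℝ) * N := by exact_mod_cast h1
    _ ≤ 2*N/a*N := by gcongr
    _ = _ := by ring

/-- the primitive direction of P+R -/
def dirQ (p : ℤ × ℤ × ℤ × ℤ) : ℕ × ℕ :=
  ((p.1 + p.2.2.1).toNat / Nat.gcd (p.1 + p.2.2.1).toNat (p.2.1 + p.2.2.2).toNat,
   (p.2.1 + p.2.2.2).toNat / Nat.gcd (p.1 + p.2.2.1).toNat (p.2.1 + p.2.2.2).toNat)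

set_option maxHeartbeats 1000000 in
lemma dirQ_spec (N a : ℕ) (x1 x2 : ℤ) (ha : (a:ℤ) = x1^2+x2^2+6) (h6 : a.Coprime 6) (p : ℤ × ℤ × ℤ × ℤ) (hN : 0 < N)
    (hp : p ∈ box4 N) (h1 : (a:ℤ) ∣ x1*p.2.1 - x2*p.1) (h2 : IsCoprime (p.1^2+p.2.1^2) (a:ℤ))
    (h3 : (a:ℤ) ∣ x1*p.2.2.2 - x2*p.2.2.1) (h5 : p.1^2+p.2.1^2 = p.2.2.1^2+p.2.2.2^2) 
    (hne : ¬ (p.1 = p.2.2.1 ∧ p.2.1 = p.2.2.2)) (d : ℕ × ℕ) (hd : dirQ p = d) :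
    0 < d.1 ∧ 0 < d.2 ∧ max d.1 d.2 ≤ 4*N ∧ (a:ℤ) ∣ (x1*d.2 - x2*d.1) * (x1*d.1 + x2*d.2) ∧
    Nat.Coprime (Nat.gcd a (x1*d.2 - x2*d.1 : ℤ).natAbs) (Nat.gcd a (x1*d.1 + x2*d.2 : ℤ).natAbs) ∧ 
    ∃ k : ℕ, ∃ g : ℤ, 0 < k ∧ g ≠ 0 ∧ p.1 + p.2.2.1 = k * d.1 ∧ p.2.1 + p.2.2.2 = k * d.2 ∧
      p.1 - p.2.2.1 = - g * d.2 ∧ p.2.1 - p.2.2.2 = g * d.1 ∧ (a:ℤ) ∣ k * (x1*d.2 - x2*d.1) ∧ (a:ℤ) ∣ g * (x1*d.1 + x2*d.2) ∧ 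
      k * (max d.1 d.2) ≤ 4*N ∧ g.natAbs * (max d.1 d.2) ≤ N := by
  obtain ⟨P1, P2, R1, R2⟩ := p
  rw [mem_box4] at hp
  simp only [dirQ] at *
  obtain ⟨⟨b1, b2⟩, ⟨b3, b4⟩, ⟨b5, b6⟩, ⟨b7, b8⟩⟩ := hp
  obtain ⟨A, hA⟩ := Int.eq_ofNat_of_zero_le (show 0 ≤ P1 + R1 by omega)
  obtain ⟨B, hB⟩ := Int.eq_ofNat_of_zero_le (show 0 ≤ P2 + R2 by omega)
  have hA0 : 0 < A := by omega
  have hB0 : 0 < B := by omega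
  rw [hA, hB, Int.toNat_natCast, Int.toNat_natCast] at hd
  set k := Nat.gcd A B with hk
  have hk0 : 0 < k := Nat.gcd_pos_of_pos_left _ hA0
  have e1 : A = k * d.1 := by rw [← hd]; exact (Nat.mul_div_cancel' (Nat.gcd_dvd_left _ _)).symm
  have e2 : B = k * d.2 := by rw [← hd]; exact (Nat.mul_div_cancel' (Nat.gcd_dvd_right _ _)).symm
  have hdc : Nat.Coprime d.1 d.2 := by rw [← hd]; exact Nat.coprime_div_gcd_div_gcd hk0
  obtain ⟨d1, d2⟩ := d
  simp only at *
  have hd1 : 0 < d1 := Nat.pos_of_ne_zero (by rintro rfl; omega)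
  have hd2 : 0 < d2 := Nat.pos_of_ne_zero (by rintro rfl; omega)
  have hdcz : IsCoprime (d1:ℤ) d2 := Nat.isCoprime_iff_coprime.2 hdc
  have ez1 : P1 + R1 = k * d1 := by rw [hA, e1]; push_cast; rfl
  have ez2 : P2 + R2 = k * d2 := by rw [hB, e2]; push_cast; rfl
  have hperp : (d1:ℤ) * (P1 - R1) + d2 * (P2 - R2) = 0 := by
    have : (k:ℤ) * ((d1:ℤ) * (P1 - R1) + d2 * (P2 - R2)) = 0 := by
      linear_combination (-(P1-R1)) * ez1 - (P2 - R2) * ez2 + h5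
    rcases mul_eq_zero.1 this with h | h
    · omega
    · exact h
  obtain ⟨g, hg⟩ : (d1:ℤ) ∣ P2 - R2 := by
    apply hdcz.dvd_of_dvd_mul_left
    exact ⟨-(P1-R1), by linear_combination hperp⟩
  have hg2 : P1 - R1 = - g * d2 := by
    have : (d1:ℤ) * ((P1 - R1) - (-g * d2)) = 0 := by linear_combination hperp - d2 * hg
    rcases mul_eq_zero.1 this with h | h
    · omega
    · linarith
  have hg0 : g ≠ 0 := by
    rintro rfl
    apply hne
    simp at hg hg2
    omega
  have q1 : (a:ℤ) ∣ k * (x1*d2 - x2*d1) := by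
    have := dvd_add h1 h3
    have e : x1 * P2 - x2 * P1 + (x1 * R2 - x2 * R1) = k * (x1*d2 - x2*d1) := by linear_combination x1 * ez2 - x2 * ez1
    rwa [e] at this
  have q2 : (a:ℤ) ∣ g * (x1*d1 + x2*d2) := by
    have := dvd_sub h1 h3
    have e : x1 * P2 - x2 * P1 - (x1 * R2 - x2 * R1) = g * (x1*d1 + x2*d2) := by linear_combination x1 * hg - x2 * hg2
    rwa [e] at this
  have hodd : Odd a := Nat.coprime_two_right.1 (Nat.Coprime.coprime_dvd_right (by norm_num) h6)
  -- prime-wise coprimality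
  have hkm : k * max d1 d2 ≤ 4*N := by
    rcases le_total d1 d2 with h | h
    · rw [max_eq_right h, ← e2]; omega
    · rw [max_eq_left h, ← e1]; omega
  refine ⟨hd1, hd2, le_trans (Nat.le_mul_of_pos_left _ hk0) hkm, ?_, ?_, k, g, hk0, hg0, ez1, ez2, hg2, by rw [hg]; ring, q1, q2, hkm, ?_⟩
  · set α : ℤ := x1*d2 - x2*d1
    set β : ℤ := x1*d1 + x2*d2
    have r1 : (a:ℤ) ∣ k * (α * β) := by rw [← mul_assoc]; exact q1.mul_right β
    have r2 : (a:ℤ) ∣ g * (α * β) := by rw [mul_left_comm]; exact q2.mul_left α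
    have r3 : (a:ℤ) ∣ (Int.gcd k g : ℤ) * (α * β) := by
      rw [Int.gcd_eq_gcd_ab, add_mul]
      exact dvd_add (by rw [mul_right_comm]; exact r1.mul_right _) (by rw [mul_right_comm]; exact r2.mul_right _)
    refine IsCoprime.dvd_of_dvd_mul_left ?_ r3
    have s1 : (Int.gcd k g : ℤ) ∣ 2 * P1 := by
      have : 2 * P1 = k * d1 + g * (-d2) := by linear_combination ez1 + hg2
      rw [this]; exact dvd_add ((Int.gcd_dvd_left _ _).mul_right _) ((Int.gcd_dvd_right _ _).mul_right _)
    have s2 : (Int.gcd k g : ℤ) ∣ 2 * P2 := by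
      have : 2 * P2 = k * d2 + g * d1 := by linear_combination ez2 + hg
      rw [this]; exact dvd_add ((Int.gcd_dvd_left _ _).mul_right _) ((Int.gcd_dvd_right _ _).mul_right _)
    have s3 : (Int.gcd k g : ℤ) ∣ 4 * (P1^2+P2^2) := by
      have : 4 * (P1^2+P2^2) = (2*P1)*(2*P1) + (2*P2)*(2*P2) := by ring
      rw [this]; exact dvd_add (s1.mul_right _) (s2.mul_right _)
    have c4 : IsCoprime (4:ℤ) a := by
      have : Nat.Coprime 4 a := Nat.Coprime.pow_left 2 (Nat.coprime_two_left.2 hodd)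
      exact_mod_cast Nat.isCoprime_iff_coprime.2 this
    exact ((c4.mul_left h2).of_isCoprime_of_dvd_left s3).symm
  · apply Nat.Coprime.symm
    apply Nat.coprime_of_dvd
    intro l hl t1 t2
    have la : (l:ℤ) ∣ a := by exact_mod_cast t1.trans (Nat.gcd_dvd_left _ _)
    have lb : (l:ℤ) ∣ x1*d1+x2*d2 := Int.natCast_dvd.2 (t1.trans (Nat.gcd_dvd_right _ _))
    have lc : (l:ℤ) ∣ x1*d2-x2*d1 := Int.natCast_dvd.2 (t2.trans (Nat.gcd_dvd_right _ _))
    have hlp : Prime (l:ℤ) := Nat.prime_iff_prime_int.1 hl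
    have ln : ¬ (l:ℤ) ∣ x1^2+x2^2 := by
      intro h
      have h' := dvd_sub la h
      have e : (a:ℤ) - (x1^2+x2^2) = 6 := by rw [ha]; ring
      rw [e] at h'
      have : l ∣ Nat.gcd a 6 := Nat.dvd_gcd (by exact_mod_cast la) (by exact_mod_cast h')
      rw [h6] at this
      exact hl.one_lt.ne' (Nat.dvd_one.1 this)
    have u1 : (l:ℤ) ∣ d1 := by
      have : (l:ℤ) ∣ (x1^2+x2^2) * d1 := by
        have e : (x1^2+x2^2)*(d1:ℤ) = x1*(x1*d1+x2*d2) - x2*(x1*d2-x2*d1) := by ring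
        rw [e]; exact dvd_sub (lb.mul_left _) (lc.mul_left _)
      exact (hlp.dvd_or_dvd this).resolve_left ln
    have u2 : (l:ℤ) ∣ d2 := by
      have : (l:ℤ) ∣ (x1^2+x2^2) * d2 := by
        have e : (x1^2+x2^2)*(d2:ℤ) = x2*(x1*d1+x2*d2) + x1*(x1*d2-x2*d1) := by ring
        rw [e]; exact dvd_add (lb.mul_left _) (lc.mul_left _)
      exact (hlp.dvd_or_dvd this).resolve_left ln
    exact hlp.not_unit (hdcz.isUnit_of_dvd' u1 u2)
  · have f1 : g.natAbs * d1 ≤ N := by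
      have : g.natAbs * d1 = (P2 - R2).natAbs := by rw [hg, Int.natAbs_mul, Int.natAbs_natCast, mul_comm]
      omega
    have f2 : g.natAbs * d2 ≤ N := by
      have : g.natAbs * d2 = (P1 - R1).natAbs := by rw [hg2, Int.natAbs_mul, Int.natAbs_natCast, Int.natAbs_neg]
      omega
    rcases le_total d1 d2 with h | h
    · rw [max_eq_right h]; exact f2
    · rw [max_eq_left h]; exact f1

set_option maxHeartbeats 1000000 in
theorem thmQ (N K a : ℕ) (x1 x2 : ℤ) (ha : (a:ℤ) = x1^2+x2^2+6) (h6 : a.Coprime 6) (hx2 : IsCoprime (a:ℤ) x2)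
    (haN : a ≤ N) (hK : 0 < K) 
    (g4 : ∀ δ1 δ2 : ℤ, |δ1| ≤ K → |δ2| ≤ K → (a:ℤ) ∣ (x1*δ2-x2*δ1)*(x1*δ1+x2*δ2) → δ1 = 0 ∧ δ2 = 0)
    (hτ : (tau a : ℝ) * (1 + Real.log (4*N)) ≤ (K:ℝ)^2) (S : Finset (ℤ × ℤ × ℤ × ℤ)) (hS : S ⊆ box4 N)
    (hc : ∀ p ∈ S, (a:ℤ) ∣ x1*p.2.1 - x2*p.1 ∧ IsCoprime (p.1^2+p.2.1^2) (a:ℤ) ∧ (a:ℤ) ∣ x1*p.2.2.2 - x2*p.2.2.1 ∧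
      p.1^2+p.2.1^2 = p.2.2.1^2+p.2.2.2^2) : (S.card : ℝ) ≤ 40 * (N:ℝ)^2/a := by
  classical
  have ha0 : 0 < a := by
    have : (0:ℤ) < a := by rw [ha]; positivity
    exact_mod_cast this
  have hN : 0 < N := by omega
  have ha0' : (0:ℝ) < a := by exact_mod_cast ha0
  have hK' : (0:ℝ) < K := by exact_mod_cast hK
  set Dg := S.filter (fun p : ℤ × ℤ × ℤ × ℤ => p.1 = p.2.2.1 ∧ p.2.1 = p.2.2.2) with hDg
  set Of := S.filter (fun p : ℤ × ℤ × ℤ × ℤ => ¬ (p.1 = p.2.2.1 ∧ p.2.1 = p.2.2.2)) with hOf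
  have hsplit : S.card = Dg.card + Of.card := (Finset.card_filter_add_card_filter_not _).symm
  have hdiag : (Dg.card : ℝ) ≤ 2*(N:ℝ)^2/a := by
    have : Dg.card = (Dg.image (fun p => (p.1, p.2.1))).card := by
      rw [Finset.card_image_of_injOn]
      rintro ⟨P1, P2, R1, R2⟩ hp ⟨P1', P2', R1', R2'⟩ hp' he
      have t1 := (Finset.mem_filter.1 hp).2
      have t2 := (Finset.mem_filter.1 hp').2
      simp only [Prod.mk.injEq] at *
      omega
    rw [this]
    apply cardP N a x1 x2 ha0 haN hx2
    intro z hz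
    obtain ⟨p, hp, rfl⟩ := Finset.mem_image.1 hz
    have hpS := (Finset.mem_filter.1 hp).1
    have := (mem_box4 N p).1 (hS hpS)
    exact ⟨this.1, this.2.1, (hc p hpS).1⟩
  have spec : ∀ p ∈ Of, ∀ d, dirQ p = d → _ := fun p hp d hd => 
    dirQ_spec N a x1 x2 ha h6 p hN (hS (Finset.mem_filter.1 hp).1) (hc p (Finset.mem_filter.1 hp).1).1 (hc p (Finset.mem_filter.1 hp).1).2.1
      (hc p (Finset.mem_filter.1 hp).1).2.2.1 (hc p (Finset.mem_filter.1 hp).1).2.2.2 (Finset.mem_filter.1 hp).2 d hd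
  set Δ := Of.image dirQ with hΔ
  have hoff : (Of.card : ℝ) ≤ 8*(N:ℝ)^2/a * ∑ d ∈ Δ, 1/((max d.1 d.2 : ℕ):ℝ)^2 := by
    rw [Finset.card_eq_sum_card_image dirQ Of, Finset.mul_sum, Nat.cast_sum]
    apply Finset.sum_le_sum
    intro d hd
    obtain ⟨p, hp, hpd⟩ := Finset.mem_image.1 hd
    obtain ⟨s1, s2, s3, s4, s5, -⟩ := spec p hp d hpd
    refine fibQ a N (max d.1 d.2) (x1*d.2 - x2*d.1) (x1*d.1+x2*d.2) d.1 d.2 ha0 (lt_max_of_lt_left s1) s5 (by exact_mod_cast s1.ne') _ ?_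
    intro p' hp'
    obtain ⟨t1, t2⟩ := Finset.mem_filter.1 hp'
    exact (spec p' t1 d t2).2.2.2.2.2
  have hΔsum : ∑ d ∈ Δ, 1/((max d.1 d.2 : ℕ):ℝ)^2 ≤ 4 := by
    have hmap : ∀ d ∈ Δ, Nat.gcd a (x1*d.2 - x2*d.1 : ℤ).natAbs ∈ a.divisors := fun d _ => 
      Nat.mem_divisors.2 ⟨Nat.gcd_dvd_left _ _, ha0.ne'⟩
    rw [← Finset.sum_fiberwise_of_maps_to hmap]
    have hb : ∀ g1 ∈ a.divisors, ∑ d ∈ Δ.filter (fun d => Nat.gcd a (x1*d.2 - x2*d.1 : ℤ).natAbs = g1), 1/((max d.1 d.2 : ℕ):ℝ)^2 ≤ 4*(1+Real.log ((4*N:ℕ):ℝ))/(K:ℝ)^2 := by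
      intro g1 hg1
      have fact : ∀ d ∈ Δ.filter (fun d => Nat.gcd a (x1*d.2 - x2*d.1 : ℤ).natAbs = g1), 0 < d.1 ∧ max d.1 d.2 ≤ 4*N ∧ (a:ℤ) ∣ (x1*d.2 - x2*d.1) * (x1*d.1 + x2*d.2) ∧ 
          (g1:ℤ) ∣ x1*d.2 - x2*d.1 ∧ ((a/g1:ℕ):ℤ) ∣ x1*d.1+x2*d.2 := by
        intro d hd
        obtain ⟨hd1, hd2⟩ := Finset.mem_filter.1 hd
        obtain ⟨p, hp, hpd⟩ := Finset.mem_image.1 hd1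
        obtain ⟨s1, s2, s3, s4, s5, -⟩ := spec p hp d hpd
        refine ⟨s1, s3, s4, Int.natCast_dvd.2 (hd2 ▸ Nat.gcd_dvd_right _ _), ?_⟩
        rw [← hd2]
        rw [Int.natCast_dvd]
        apply div_gcd_dvd a _ _ ha0
        rw [← Int.dvd_natAbs, Int.natAbs_mul]
        rw [← Int.dvd_natAbs, Int.natAbs_mul] at s4
        rw [Int.natAbs_natCast, mul_comm]
        exact s4
      apply spaced_sum K (4*N) hK (by omega)
      · intro d hd
        obtain ⟨s1, s2, s3, -⟩ := fact d hd
        refine ⟨?_, s2⟩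
        by_contra hlt
        push Not at hlt
        have l1 : d.1 < K := lt_of_le_of_lt (le_max_left _ _) hlt
        have l2 : d.2 < K := lt_of_le_of_lt (le_max_right _ _) hlt
        have := g4 d.1 d.2 (by rw [abs_of_nonneg (by positivity)]; omega) (by rw [abs_of_nonneg (by positivity)]; omega) s3
        omega
      · intro d hd d' hd' i1 i2
        obtain ⟨-, -, -, s4, s5⟩ := fact d hd
        obtain ⟨-, -, -, s4', s5'⟩ := fact d' hd'
        have near : ∀ u v : ℕ, u / K = v / K → |(u:ℤ) - v| ≤ K := by
          intro u v huv
          have m1 := Nat.div_add_mod u K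
          have m2 := Nat.div_add_mod v K
          have m3 := Nat.mod_lt u hK
          have m4 := Nat.mod_lt v hK
          rw [huv] at m1
          rw [abs_le]; constructor <;> omega
        have hg1a : g1 ∣ a := (Nat.mem_divisors.1 hg1).1
        have hdv : (a:ℤ) ∣ (x1*((d.2:ℤ)-d'.2)-x2*((d.1:ℤ)-d'.1))*(x1*((d.1:ℤ)-d'.1)+x2*((d.2:ℤ)-d'.2)) := by
          have ea : (a:ℤ) = g1 * ((a/g1:ℕ):ℤ) := by
            have := Nat.mul_div_cancel' hg1a
            exact_mod_cast this.symm
          rw [ea]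
          apply mul_dvd_mul
          · have := dvd_sub s4 s4'
            have e : x1 * (d.2:ℤ) - x2 * d.1 - (x1 * d'.2 - x2 * d'.1) = x1*((d.2:ℤ)-d'.2)-x2*((d.1:ℤ)-d'.1) := by ring
            rwa [e] at this
          · have := dvd_sub s5 s5'
            have e : x1 * (d.1:ℤ) + x2 * d.2 - (x1 * d'.1 + x2 * d'.2) = x1*((d.1:ℤ)-d'.1)+x2*((d.2:ℤ)-d'.2) := by ring
            rwa [e] at this
        have := g4 _ _ (near _ _ i1) (near _ _ i2) hdv
        apply Prod.ext <;> omega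
    refine (Finset.sum_le_sum hb).trans ?_
    rw [Finset.sum_const, nsmul_eq_mul]
    push_cast
    change (tau a : ℝ) * _ ≤ 4
    rw [mul_div_assoc', div_le_iff₀ (by positivity)]
    nlinarith
  calc (S.card:ℝ) = Dg.card + Of.card := by rw [hsplit]; push_cast; ring
    _ ≤ 2*(N:ℝ)^2/a + 8*(N:ℝ)^2/a * 4 := by
      have : (Of.card : ℝ) ≤ 8*(N:ℝ)^2/a * 4 := hoff.trans (by gcongr)
      linarith
    _ ≤ _ := by
      rw [← sub_nonneg]
      have : 40 * (N:ℝ)^2/a - (2*(N:ℝ)^2/a + 8*(N:ℝ)^2/a * 4) = 6*((N:ℝ)^2/a) := by ring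
      rw [this]; positivity

def dirR (p : ℤ × ℤ × ℤ × ℤ) : ℕ × ℕ :=
  ((p.1 - p.2.2.1).natAbs / Nat.gcd (p.1 - p.2.2.1).natAbs (p.2.2.2 - p.2.1).natAbs,
   (p.2.2.2 - p.2.1).natAbs / Nat.gcd (p.1 - p.2.2.1).natAbs (p.2.2.2 - p.2.1).natAbs)

lemma dirR_spec (B : ℕ) (p : ℤ × ℤ × ℤ × ℤ) (h1 : 1 ≤ p.1 ∧ p.1 ≤ B) (h2 : 1 ≤ p.2.1 ∧ p.2.1 ≤ B) (h3 : 1 ≤ p.2.2.1 ∧ p.2.2.1 ≤ B)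
    (h4 : 1 ≤ p.2.2.2 ∧ p.2.2.2 ≤ B) (he : p.1^2+p.2.1^2 = p.2.2.1^2+p.2.2.2^2) (hne : p.1 ≠ p.2.2.1) (d : ℕ × ℕ) (hd : dirR p = d) :
    0 < max d.1 d.2 ∧ max d.1 d.2 ≤ 2*B ∧ ∃ s : Bool, ∃ g k : ℕ, 0 < g ∧ 0 < k ∧ g * max d.1 d.2 ≤ 2*B ∧ k * max d.1 d.2 ≤ 2*B ∧
      p.1 - p.2.2.1 = (if s then 1 else -1) * (g*d.1) ∧ p.2.2.2 - p.2.1 = (if s then 1 else -1) * (g * d.2) ∧ 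
      p.1 + p.2.2.1 = k * d.2 ∧ p.2.2.2 + p.2.1 = k * d.1 := by
  obtain ⟨x1, x2, y1, y2⟩ := p
  simp only [dirR] at *
  have hmul : (x1 - y1) * (x1 + y1) = (y2 - x2) * (y2 + x2) := by linear_combination he
  have hne2 : y2 - x2 ≠ 0 := by
    intro h
    rw [h, zero_mul] at hmul
    rcases mul_eq_zero.1 hmul with h' | h' <;> omega
  set A := (x1 - y1).natAbs with hA
  set A' := (y2 - x2).natAbs with hA'
  have hA0 : 0 < A := Int.natAbs_pos.2 (by omega)
  have hA0' : 0 < A' := Int.natAbs_pos.2 hne2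
  set g := Nat.gcd A A' with hg
  have hg0 : 0 < g := Nat.gcd_pos_of_pos_left _ hA0
  have e1 : A = g * d.1 := by rw [← hd]; exact (Nat.mul_div_cancel' (Nat.gcd_dvd_left _ _)).symm
  have e2 : A' = g * d.2 := by rw [← hd]; exact (Nat.mul_div_cancel' (Nat.gcd_dvd_right _ _)).symm
  have hdc : Nat.Coprime d.1 d.2 := by rw [← hd]; exact Nat.coprime_div_gcd_div_gcd hg0
  obtain ⟨u, v⟩ := d
  simp only at *
  have hu : 0 < u := Nat.pos_of_ne_zero (by rintro rfl; omega)
  have hv : 0 < v := Nat.pos_of_ne_zero (by rintro rfl; omega)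
  obtain ⟨s, hs1, hs2⟩ : ∃ s : Bool, x1 - y1 = (if s then 1 else -1) * (A:ℤ) ∧ y2 - x2 = (if s then 1 else -1) * (A':ℤ) := by
    by_cases hpos : 0 < x1 - y1
    · refine ⟨true, by simp; omega, ?_⟩
      have : 0 < y2 - x2 := by
        have : 0 < (y2 - x2) * (y2 + x2) := by rw [← hmul]; apply mul_pos hpos; omega
        exact pos_of_mul_pos_left this (by omega)
      simp; omega
    · refine ⟨false, by simp; omega, ?_⟩
      have : 0 < x2 - y2 := by
        have : 0 < (x2 - y2) * (y2 + x2) := by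
          have : (x2 - y2) * (y2 + x2) = (y1 - x1) * (x1 + y1) := by linear_combination hmul
          rw [this]; apply mul_pos <;> omega
        exact pos_of_mul_pos_left this (by omega)
      simp; omega
  have hmul2 : (u:ℤ) * (x1 + y1) = v * (y2 + x2) := by
    rw [hs1, hs2, e1, e2] at hmul
    push_cast at hmul
    have hg' : (g:ℤ) ≠ 0 := by exact_mod_cast hg0.ne'
    have : (g:ℤ) * ((u:ℤ) * (x1 + y1) - v * (y2 + x2)) = 0 := by
      cases s <;> simp at hmul <;> linarith
    rcases mul_eq_zero.1 this with h | h
    · exact absurd h hg'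
    · linarith
  obtain ⟨kz, hkz⟩ : (v:ℤ) ∣ x1 + y1 := by
    have hc : IsCoprime (v:ℤ) u := (Nat.isCoprime_iff_coprime.2 hdc).symm
    exact hc.dvd_of_dvd_mul_left ⟨_, hmul2⟩
  have hkpos : 0 < kz := by
    have : 0 < (v:ℤ) * kz := by rw [← hkz]; omega
    exact pos_of_mul_pos_right this (by positivity)
  obtain ⟨k, rfl⟩ := Int.eq_ofNat_of_zero_le hkpos.le
  have hk2 : y2 + x2 = k * u := by
    have hv' : (v:ℤ) ≠ 0 := by exact_mod_cast hv.ne'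
    apply mul_left_cancel₀ hv'
    rw [← hmul2, hkz]; ring
  have b1 : g * max u v ≤ 2*B := by
    rcases le_total u v with h | h
    · rw [max_eq_right h, ← e2]; omega
    · rw [max_eq_left h, ← e1]; omega
  refine ⟨lt_max_of_lt_left hu, le_trans (Nat.le_mul_of_pos_left _ hg0) b1, s, g, k, hg0, by exact_mod_cast hkpos, b1, ?_, ?_, ?_, by rw [hkz]; ring, hk2⟩
  · rcases le_total u v with h | h
    · rw [max_eq_right h]
      have : ((k * v : ℕ):ℤ) = x1 + y1 := by rw [hkz]; push_cast; ring
      omega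
    · rw [max_eq_left h]
      have : ((k * u : ℕ):ℤ) = y2 + x2 := by rw [hk2]; push_cast; ring
      omega
  · rw [hs1, e1]; push_cast; rfl
  · rw [hs2, e2]; push_cast; rfl

set_option maxHeartbeats 1000000 in
theorem multR (B : ℕ) (hB : 0 < B) (S : Finset (ℤ × ℤ × ℤ × ℤ)) (hS : ∀ p ∈ S, (1 ≤ p.1 ∧ p.1 ≤ B) ∧ (1 ≤ p.2.1 ∧ p.2.1 ≤ B) ∧ 
    (1 ≤ p.2.2.1 ∧ p.2.2.1 ≤ B) ∧ (1 ≤ p.2.2.2 ∧ p.2.2.2 ≤ B) ∧ p.1^2+p.2.1^2 = p.2.2.1^2+p.2.2.2^2) :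
    (S.card : ℝ) ≤ 40 * (B:ℝ)^2 * (1 + Real.log (2*B)) := by
  classical
  set Dg := S.filter (fun p : ℤ × ℤ × ℤ × ℤ => p.1 = p.2.2.1) with hDg
  set Of := S.filter (fun p : ℤ × ℤ × ℤ × ℤ => ¬ (p.1 = p.2.2.1)) with hOf
  have hsplit : S.card = Dg.card + Of.card := (Finset.card_filter_add_card_filter_not _).symm
  have hdiag : Dg.card ≤ B * B := by
    have : Dg.card ≤ (Finset.Icc (1:ℤ) B ×ˢ Finset.Icc (1:ℤ) B).card := by
      apply Finset.card_le_card_of_injOn (fun p => (p.1, p.2.1))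
      · intro p hp
        have := hS p (Finset.mem_filter.1 hp).1
        simp only [Finset.coe_product, Set.mem_prod, Finset.mem_coe, Finset.mem_Icc]
        exact ⟨this.1, this.2.1⟩
      · rintro ⟨x1, x2, y1, y2⟩ hp ⟨x1', x2', y1', y2'⟩ hp' he
        have a1 := hS _ (Finset.mem_filter.1 hp).1
        have a2 := (Finset.mem_filter.1 hp).2
        have a1' := hS _ (Finset.mem_filter.1 hp').1
        have a2' := (Finset.mem_filter.1 hp').2
        simp only [Prod.mk.injEq] at *
        obtain ⟨_, b2, _, b4, b5⟩ := a1
        obtain ⟨_, b2', _, b4', b5'⟩ := a1'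
        have c1 : x2 = y2 := by
          rw [a2] at b5
          have : x2^2 = y2^2 := by linarith
          exact (sq_eq_sq₀ (by omega) (by omega)).1 this
        have c1' : x2' = y2' := by
          rw [a2'] at b5'
          have : x2'^2 = y2'^2 := by linarith
          exact (sq_eq_sq₀ (by omega) (by omega)).1 this
        omega
    simpa using this
  have spec : ∀ p ∈ Of, ∀ d, dirR p = d → _ := fun p hp d hd => 
    dirR_spec B p (hS p (Finset.mem_filter.1 hp).1).1 (hS p (Finset.mem_filter.1 hp).1).2.1 (hS p (Finset.mem_filter.1 hp).1).2.2.1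
      (hS p (Finset.mem_filter.1 hp).1).2.2.2.1 (hS p (Finset.mem_filter.1 hp).1).2.2.2.2 (Finset.mem_filter.1 hp).2 d hd
  set Δ := Of.image dirR with hΔ
  have hoff : (Of.card : ℝ) ≤ 8*(B:ℝ)^2 * ∑ d ∈ Δ, 1/((max d.1 d.2 : ℕ):ℝ)^2 := by
    rw [Finset.card_eq_sum_card_image dirR Of, Finset.mul_sum, Nat.cast_sum]
    apply Finset.sum_le_sum
    intro d hd
    obtain ⟨p, hp, hpd⟩ := Finset.mem_image.1 hd
    obtain ⟨s1, s2, -⟩ := spec p hp d hpd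
    set m := max d.1 d.2 with hm
    have hsp : ∀ p ∈ Of.filter (fun p => dirR p = d), _ := fun p hp => (spec p (Finset.mem_filter.1 hp).1 d (Finset.mem_filter.1 hp).2).2.2
    choose! s g k h using hsp
    have hc : (Of.filter (fun p => dirR p = d)).card ≤ ((Finset.univ : Finset Bool) ×ˢ (Finset.Ioc 0 (2*B/m) ×ˢ Finset.Ioc 0 (2*B/m))).card := by
      apply Finset.card_le_card_of_injOn (fun p => (s p, g p, k p))
      · intro p hp
        obtain ⟨t1, t2, t3, t4, -⟩ := h p hp
        simp only [Finset.coe_product, Set.mem_prod, Finset.mem_coe, Finset.mem_Ioc, Finset.mem_univ, true_and]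
        exact ⟨⟨t1, (Nat.le_div_iff_mul_le s1).2 t3⟩, t2, (Nat.le_div_iff_mul_le s1).2 t4⟩
      · intro p hp p' hp' he
        obtain ⟨-, -, -, -, t1, t2, t3, t4⟩ := h p hp
        obtain ⟨-, -, -, -, t1', t2', t3', t4'⟩ := h p' hp'
        simp only [Prod.mk.injEq] at he
        obtain ⟨f1, f2, f3⟩ := he
        rw [← f1, ← f2] at t1' t2'
        rw [← f3] at t3' t4'
        obtain ⟨x1, x2, y1, y2⟩ := p
        obtain ⟨x1', x2', y1', y2'⟩ := p'
        simp only [Prod.mk.injEq] at *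
        refine ⟨by linarith, by linarith, by linarith, by linarith⟩
    rw [Finset.card_product, Finset.card_product, Nat.card_Ioc, Finset.card_univ, Fintype.card_bool, Nat.sub_zero] at hc
    have i1 : ((2*B/m : ℕ):ℝ) ≤ 2*B/m := by
      refine Nat.cast_div_le.trans ?_
      push_cast; exact le_rfl
    calc ((Of.filter (fun p => dirR p = d)).card : ℝ) ≤ 2 * (((2*B/m : ℕ):ℝ) * ((2*B/m : ℕ):ℝ)) := by exact_mod_cast hc
      _ ≤ 2 * ((2*B/m) * (2*B/m)) := by gcongr
      _ = _ := by field_simp; ring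
  have hsum : ∑ d ∈ Δ, 1/((max d.1 d.2 : ℕ):ℝ)^2 ≤ 4 * (1 + Real.log ((2*B:ℕ):ℝ)) / ((1:ℕ):ℝ)^2 := by
    apply spaced_sum 1 (2*B) one_pos (by omega)
    · intro d hd
      obtain ⟨p, hp, hpd⟩ := Finset.mem_image.1 hd
      obtain ⟨s1, s2, -⟩ := spec p hp d hpd
      exact ⟨s1, s2⟩
    · intro d _ d' _ i1 i2
      simp at i1 i2
      exact Prod.ext i1 i2
  push_cast at hsum
  have hB1 : (1:ℝ) ≤ B := by exact_mod_cast hB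
  have hlog : 0 ≤ Real.log (2*B) := Real.log_nonneg (by linarith)
  calc (S.card:ℝ) = Dg.card + Of.card := by rw [hsplit]; push_cast; ring
    _ ≤ (B:ℝ)*B + 8*(B:ℝ)^2 * (4 * (1 + Real.log (2*B)) / 1^2) := by
      apply add_le_add (by exact_mod_cast hdiag)
      refine hoff.trans ?_
      push_cast
      gcongr
    _ ≤ _ := by nlinarith [sq_nonneg (B:ℝ), mul_nonneg (sq_nonneg (B:ℝ)) hlog]

def aa (z : ℕ × ℕ) : ℕ := (210*z.1+106)^2 + (210*z.2+71)^2 + 6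

def blk (Y : ℕ) : Finset (ℕ × ℕ) := Finset.Ico Y (2*Y) ×ˢ Finset.Ico Y (2*Y)

lemma mem_blk (Y : ℕ) (z : ℕ × ℕ) : z ∈ blk Y ↔ (Y ≤ z.1 ∧ z.1 < 2*Y) ∧ (Y ≤ z.2 ∧ z.2 < 2*Y) := by
  simp [blk, Finset.mem_product, Finset.mem_Ico]

lemma card_blk (Y : ℕ) : (blk Y).card = Y^2 := by
  simp [blk]; rw [show 2*Y - Y = Y by omega]; ring

lemma aa_le (Y : ℕ) (hY : 1 ≤ Y) (z : ℕ × ℕ) (hz : z ∈ blk Y) : aa z ≤ 2^20*Y^2 := by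
  rw [mem_blk] at hz
  unfold aa
  have h1 : 210*z.1+106 ≤ 526*Y := by omega
  have h2 : 210*z.2+71 ≤ 526*Y := by omega
  have := Nat.pow_le_pow_left h1 2
  have := Nat.pow_le_pow_left h2 2
  nlinarith

lemma aa_ge (Y : ℕ) (z : ℕ × ℕ) (hz : z ∈ blk Y) : Y^2 ≤ aa z := by
  rw [mem_blk] at hz
  unfold aa
  have h1 : Y ≤ 210*z.1+106 := by omega
  have := Nat.pow_le_pow_left h1 2
  omega

lemma aa_pos (z : ℕ × ℕ) : 0 < aa z := by unfold aa; positivity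

lemma aa_coprime (z : ℕ × ℕ) : Nat.Coprime (aa z) 210 := by
  unfold aa
  have e : (210*z.1+106)^2 + (210*z.2+71)^2 + 6 = 16283 + 210 * (210*z.1^2+212*z.1 + 210*z.2^2+142*z.2) := by ring
  rw [e, Nat.coprime_add_mul_left_left]
  norm_num

lemma ncount (d : ℕ) [NeZero d] (hodd : Odd d) (k : ZMod d) (hk : IsUnit k) :
    (Finset.univ.filter (fun p : ZMod d × ZMod d => p.1^2+p.2^2 = k)).card ≤ d * tau d ^ 2 := by
  classical
  have hd0 : 0 < d := NeZero.pos d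
  set n : ZMod d → ℕ := fun k => (Finset.univ.filter (fun p : ZMod d × ZMod d => p.1^2+p.2^2 = k)).card with hn
  -- scaling
  have scale : ∀ (s k : ZMod d), IsUnit s → n k ≤ n (s^2 * k) := by
    intro s k hs
    apply Finset.card_le_card_of_injOn (fun p => (s*p.1, s*p.2))
    · intro p hp
      simp only [Finset.coe_filter, Finset.mem_univ, true_and, Set.mem_setOf_eq] at hp ⊢
      rw [← hp]; ring
    · intro p _ p' _ he
      simp only [Prod.mk.injEq] at he
      exact Prod.ext (hs.mul_left_cancel he.1) (hs.mul_left_cancel he.2)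
  have step1 : n k ≤ n 1 := by
    rcases (Finset.univ.filter (fun p : ZMod d × ZMod d => p.1^2+p.2^2 = k)).eq_empty_or_nonempty with he | ⟨⟨x, y⟩, hz⟩
    · have : n k = 0 := by simp only [hn]; rw [he]; rfl
      omega
    · have hxy : x^2+y^2 = k := (Finset.mem_filter.1 hz).2
      have s1 : n k ≤ n (k^2) := by
        apply Finset.card_le_card_of_injOn (fun p => (p.1*x+p.2*y, p.1*y-p.2*x))
        · intro p hp
          simp only [Finset.coe_filter, Finset.mem_univ, true_and, Set.mem_setOf_eq] at hp ⊢
          have : (p.1*x+p.2*y)^2+(p.1*y-p.2*x)^2 = (p.1^2+p.2^2)*(x^2+y^2) := by ring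
          rw [this, hp, hxy]; ring
        · intro p _ p' _ he
          simp only [Prod.mk.injEq] at he
          apply Prod.ext
          · apply hk.mul_left_cancel
            rw [← hxy]; linear_combination x * he.1 + y * he.2
          · apply hk.mul_left_cancel
            rw [← hxy]; linear_combination y * he.1 - x * he.2
      obtain ⟨u, rfl⟩ := hk
      refine s1.trans ((scale ((u⁻¹ : (ZMod d)ˣ) : ZMod d) _ (Units.isUnit _)).trans ?_)
      have : (((u⁻¹ : (ZMod d)ˣ) : ZMod d))^2 * ((u : ZMod d))^2 = 1 := by rw [← mul_pow, Units.inv_mul, one_pow]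
      rw [this]
  refine step1.trans ?_
  -- squares of units
  set Sq : Finset (ZMod d) := (Finset.univ : Finset (ZMod d)ˣ).image (fun u : (ZMod d)ˣ => ((u : ZMod d))^2) with hSq
  have c1 : d.totient ≤ tau d * Sq.card := by
    rw [← ZMod.card_units_eq_totient, ← Finset.card_univ]
    apply Finset.card_le_mul_card_image_of_maps_to (f := fun u : (ZMod d)ˣ => ((u : ZMod d))^2)
    · intro u _; exact Finset.mem_image_of_mem _ (Finset.mem_univ _)
    · intro b hb
      obtain ⟨u, -, rfl⟩ := Finset.mem_image.1 hb
      refine le_trans ?_ ((sqrt_card d hodd _ ((Units.isUnit u).pow 2)).trans (two_pow_omega_le_tau d hd0.ne'))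
      apply Finset.card_le_card_of_injOn (fun v : (ZMod d)ˣ => (v : ZMod d))
      · intro v hv
        simp only [Finset.coe_filter, Finset.mem_univ, true_and, Set.mem_setOf_eq] at hv ⊢
        exact hv
      · intro v _ v' _ h; exact Units.ext h
  have c2 : Sq.card * n 1 ≤ d^2 := by
    have h1 : ∀ s ∈ Sq, n 1 ≤ n s := by
      intro s hs
      obtain ⟨u, -, rfl⟩ := Finset.mem_image.1 hs
      have := scale (u : ZMod d) 1 (Units.isUnit u)
      rwa [mul_one] at this
    calc Sq.card * n 1 = ∑ s ∈ Sq, n 1 := by simp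
      _ ≤ ∑ s ∈ Sq, n s := Finset.sum_le_sum h1
      _ ≤ ∑ s : ZMod d, n s := Finset.sum_le_sum_of_subset (Finset.subset_univ _)
      _ = (Finset.univ : Finset (ZMod d × ZMod d)).card := by
        rw [Finset.card_eq_sum_card_fiberwise (f := fun p : ZMod d × ZMod d => p.1^2+p.2^2) (t := Finset.univ) (fun _ _ => Finset.mem_coe.2 (Finset.mem_univ _))]
      _ = d^2 := by rw [Finset.card_univ, Fintype.card_prod, ZMod.card]; ring
  have c3 := le_tau_mul_totient d
  have : d * n 1 ≤ d * (d * tau d ^ 2) := by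
    calc d * n 1 ≤ (tau d * d.totient) * n 1 := by gcongr
      _ ≤ (tau d * (tau d * Sq.card)) * n 1 := by gcongr
      _ = tau d ^ 2 * (Sq.card * n 1) := by ring
      _ ≤ tau d ^ 2 * d^2 := by gcongr
      _ = _ := by ring
  exact Nat.le_of_mul_le_mul_left this hd0

lemma card_Ico_class (d Y : ℕ) (hd : 0 < d) (x : ZMod d) (c : ℕ) (hc : Nat.Coprime d 210) : 
    ((Finset.Ico Y (2*Y)).filter (fun u : ℕ => ((210*u+c : ℕ) : ZMod d) = x)).card ≤ Y/d+1 := by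
  classical
  have : ((Finset.Ico Y (2*Y)).filter (fun u : ℕ => ((210*u+c : ℕ) : ZMod d) = x)).card = (((Finset.Ico Y (2*Y)).filter (fun u : ℕ => ((210*u+c : ℕ) : ZMod d) = x)).image (fun u : ℕ => (u:ℤ))).card := by
    rw [Finset.card_image_of_injective _ Nat.cast_injective]
  rw [this]
  apply card_congr_le _ (Y:ℤ) Y d hd
  · intro z hz
    obtain ⟨u, hu, rfl⟩ := Finset.mem_image.1 hz
    have := Finset.mem_Ico.1 (Finset.mem_filter.1 hu).1
    omega
  · intro z hz z' hz'
    obtain ⟨u, hu, rfl⟩ := Finset.mem_image.1 hz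
    obtain ⟨u', hu', rfl⟩ := Finset.mem_image.1 hz'
    have h1 := (Finset.mem_filter.1 hu).2
    have h2 := (Finset.mem_filter.1 hu').2
    rw [← h2] at h1
    have h3 : (((210*u+c : ℕ):ℤ) : ZMod d) = (((210*u'+c : ℕ):ℤ) : ZMod d) := by exact_mod_cast h1
    rw [ZMod.intCast_eq_intCast_iff_dvd_sub] at h3
    have hcz : IsCoprime (d:ℤ) 210 := by exact_mod_cast Nat.isCoprime_iff_coprime.2 hc
    apply hcz.dvd_of_dvd_mul_left
    have := (dvd_neg).2 h3
    push_cast at this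
    have e : -(210 * (u':ℤ) + c - (210 * u + c)) = 210 * (u - u') := by ring
    rwa [e] at this

lemma Nd_small (d Y : ℕ) (hd : 0 < d) (hdY : d ≤ Y) : 
    (((blk Y).filter (fun z => d ∣ aa z)).card : ℝ) ≤ 4 * (Y:ℝ)^2 * (tau d)^2 / d := by
  classical
  rcases ((blk Y).filter (fun z => d ∣ aa z)).eq_empty_or_nonempty with he | ⟨z, hz⟩
  · rw [he]; simp; positivity
  have hc : Nat.Coprime d 210 := Nat.Coprime.coprime_dvd_left (Finset.mem_filter.1 hz).2 (aa_coprime z)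
  haveI : NeZero d := ⟨hd.ne'⟩
  have hodd : Odd d := Nat.coprime_two_right.1 (Nat.Coprime.coprime_dvd_right (by norm_num) hc)
  have h6 : IsUnit (-(6:ZMod d)) := by
    have : IsUnit ((6:ℕ) : ZMod d) := (ZMod.isUnit_iff_coprime 6 d).2 (Nat.Coprime.coprime_dvd_right (by norm_num) hc).symm
    have h := this.neg
    exact_mod_cast h
  have h1 : ((blk Y).filter (fun z => d ∣ aa z)).card ≤ ((Y/d+1)*(Y/d+1)) * (Finset.univ.filter (fun p : ZMod d × ZMod d => p.1^2+p.2^2 = -6)).card := by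
    apply Finset.card_le_mul_card_image_of_maps_to (f := fun z : ℕ × ℕ => (((210*z.1+106:ℕ) : ZMod d), ((210*z.2+71:ℕ) : ZMod d)))
    · intro z hz
      have := (Finset.mem_filter.1 hz).2
      rw [← ZMod.natCast_eq_zero_iff] at this
      unfold aa at this
      simp only [Finset.mem_filter, Finset.mem_univ, true_and]
      push_cast at this ⊢
      linear_combination this
    · rintro ⟨x, y⟩ _
      calc _ ≤ (((Finset.Ico Y (2*Y)).filter (fun u : ℕ => ((210*u+106 : ℕ) : ZMod d) = x)) ×ˢ ((Finset.Ico Y (2*Y)).filter (fun u : ℕ => ((210*u+71 : ℕ) : ZMod d) = y))).card := by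
            apply Finset.card_le_card
            intro z hz
            obtain ⟨hz1, hz2⟩ := Finset.mem_filter.1 hz
            have hz3 := Finset.mem_product.1 (show z ∈ Finset.Ico Y (2*Y) ×ˢ Finset.Ico Y (2*Y) from (Finset.mem_filter.1 hz1).1)
            simp only [Prod.mk.injEq] at hz2
            exact Finset.mem_product.2 ⟨Finset.mem_filter.2 ⟨hz3.1, hz2.1⟩, Finset.mem_filter.2 ⟨hz3.2, hz2.2⟩⟩
        _ ≤ _ := by
            rw [Finset.card_product]
            exact Nat.mul_le_mul (card_Ico_class d Y hd x 106 hc) (card_Ico_class d Y hd y 71 hc)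
  have h2 := ncount d hodd (-6) h6
  have hd' : (0:ℝ) < d := by exact_mod_cast hd
  have hdY' : (d:ℝ) ≤ Y := by exact_mod_cast hdY
  have h3 : ((Y/d+1 : ℕ):ℝ) ≤ 2*Y/d := by
    push_cast
    have : ((Y/d:ℕ):ℝ) ≤ Y/d := Nat.cast_div_le
    have : (1:ℝ) ≤ Y/d := by rw [le_div_iff₀ hd']; linarith
    have e : 2*(Y:ℝ)/d = Y/d+Y/d := by ring
    rw [e]; linarith
  calc (((blk Y).filter (fun z => d ∣ aa z)).card : ℝ) ≤ (((Y/d+1:ℕ):ℝ)*((Y/d+1:ℕ):ℝ)) * ((d:ℝ) * tau d ^ 2) := by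
        exact_mod_cast h1.trans (Nat.mul_le_mul_left _ h2)
    _ ≤ (2*Y/d)*(2*Y/d) * ((d:ℝ) * tau d ^ 2) := by gcongr
    _ = _ := by field_simp; ring

lemma crude_fib (Y d : ℕ) (hd : 0 < d) (S : Finset ℕ) (hS : S ⊆ Finset.Ico Y (2*Y))
    (h : ∀ u ∈ S, ∀ v ∈ S, (d:ℤ) ∣ 210*((u:ℤ)-v)) : S.card ≤ 210*Y/d+1 := by
  classical
  have : S.card = (S.image (fun u : ℕ => 210*(u:ℤ))).card := by
    rw [Finset.card_image_of_injective]
    intro a b hab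
    simp only at hab
    omega
  rw [this]
  apply card_congr_le _ (210*(Y:ℤ)) (210*Y) d hd
  · intro z hz
    obtain ⟨u, hu, rfl⟩ := Finset.mem_image.1 hz
    have := Finset.mem_Ico.1 (hS hu)
    push_cast
    omega
  · intro z hz z' hz'
    obtain ⟨u, hu, rfl⟩ := Finset.mem_image.1 hz
    obtain ⟨u', hu', rfl⟩ := Finset.mem_image.1 hz'
    have := h u hu u' hu'
    rwa [mul_sub] at this

lemma crude_num (Y d e f : ℕ) (hY : 1 ≤ Y) (hd : 0 < d) (hdY : d ≤ 2^22*Y^2) (hef : d ≤ e*f) :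
    ((210*Y/(max e f)+1 : ℕ):ℝ) ≤ 2300*Y/Real.sqrt d := by
  have hd' : (0:ℝ) < d := by exact_mod_cast hd
  have hs : 0 < Real.sqrt d := Real.sqrt_pos.2 hd'
  have h1 : Real.sqrt d ≤ 2^11*Y := by
    rw [Real.sqrt_le_left (by positivity)]
    have : (d:ℝ) ≤ 2^22*Y^2 := by exact_mod_cast hdY
    nlinarith
  have h2 : Real.sqrt d ≤ ((max e f : ℕ):ℝ) := by
    rw [Real.sqrt_le_left (by positivity)]
    have : d ≤ (max e f)^2 := hef.trans (by rw [sq]; exact Nat.mul_le_mul (le_max_left _ _) (le_max_right _ _))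
    exact_mod_cast this
  have h3 : ((210*Y/(max e f):ℕ):ℝ) ≤ ((210*Y:ℕ):ℝ)/((max e f:ℕ):ℝ) := Nat.cast_div_le
  have h4 : ((210*Y:ℕ):ℝ)/((max e f:ℕ):ℝ) ≤ ((210*Y:ℕ):ℝ)/Real.sqrt d := by gcongr
  have h5 : 1 ≤ 2^11*Y/Real.sqrt d := by rw [le_div_iff₀ hs]; linarith
  rw [Nat.cast_add, Nat.cast_one]
  push_cast at h4
  have h6 : 2300*(Y:ℝ)/Real.sqrt d = 210*Y/Real.sqrt d + 2^11*Y/Real.sqrt d + 42*Y/Real.sqrt d := by ring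
  have h7 : 0 ≤ 42*Y/Real.sqrt d := by positivity
  rw [h6]; push_cast at h3 h4 ⊢; linarith

lemma crude_sq (Y d c : ℕ) (w : ℤ) (hY : 1 ≤ Y) (hd : 0 < d) (hdY : d ≤ 2^22*Y^2)
    (S : Finset ℕ) (hS : S ⊆ Finset.Ico Y (2*Y)) (h : ∀ u ∈ S, (d:ℤ) ∣ (210*(u:ℤ)+c)^2 - w) :
    (S.card:ℝ)^2 ≤ tau d * (Y * (2300*Y/Real.sqrt d)) := by
  classical
  set ev : ℕ × ℕ → ℕ := fun p => Int.gcd d (210*((p.1:ℤ)-p.2)) with hev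
  have key : ∀ p ∈ S ×ˢ S, ((d / ev p : ℕ):ℤ) ∣ 210*((p.1:ℤ)+p.2)+2*c := by
    intro p hp
    obtain ⟨h1, h2⟩ := Finset.mem_product.1 hp
    have h3 : (d:ℤ) ∣ 210*((p.1:ℤ)-p.2) * (210*((p.1:ℤ)+p.2)+2*c) := by
      have := dvd_sub (h _ h1) (h _ h2)
      have e : 210*((p.1:ℤ)-p.2) * (210*((p.1:ℤ)+p.2)+2*c) = ((210*(p.1:ℤ)+c)^2 - w) - ((210*(p.2:ℤ)+c)^2 - w) := by ring
      rwa [e]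
    have hg : 0 < ev p := Int.gcd_pos_of_ne_zero_left _ (by exact_mod_cast hd.ne')
    have e1 : ((ev p : ℕ):ℤ) ∣ (d:ℤ) := Int.gcd_dvd_left ..
    have e2 : ((ev p : ℕ):ℤ) ∣ 210*((p.1:ℤ)-p.2) := Int.gcd_dvd_right ..
    have hcop := Int.isCoprime_iff_gcd_eq_one.2 (Int.gcd_ediv_gcd_ediv_gcd (i := (d:ℤ)) (j := 210*((p.1:ℤ)-p.2)) hg)
    have e3 : ((d / ev p : ℕ):ℤ) = (d:ℤ) / (ev p : ℤ) := by push_cast; rfl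
    rw [e3]
    apply hcop.dvd_of_dvd_mul_left
    have hg' : (ev p : ℤ) ≠ 0 := by exact_mod_cast hg.ne'
    rw [← Int.mul_dvd_mul_iff_left hg' ] 
    obtain ⟨a, ha⟩ := e1
    obtain ⟨b, hb⟩ := e2
    change (ev p:ℤ) * ((d:ℤ) / (ev p:ℤ)) ∣ (ev p:ℤ) * (210*((p.1:ℤ)-p.2) / (ev p:ℤ) * _)
    rw [hb, Int.mul_ediv_cancel_left _ hg', Int.mul_ediv_cancel' ⟨a, ha⟩, ← mul_assoc, ← hb]
    exact h3
  have hmaps : ∀ p ∈ S ×ˢ S, ev p ∈ d.divisors := by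
    intro p hp
    rw [Nat.mem_divisors]
    refine ⟨?_, hd.ne'⟩
    have : ((ev p : ℕ):ℤ) ∣ (d:ℤ) := Int.gcd_dvd_left ..
    exact_mod_cast this
  have hfib : ∀ e ∈ d.divisors, ((((S ×ˢ S).filter (fun p => ev p = e)).card : ℕ):ℝ) ≤ Y * (2300*Y/Real.sqrt d) := by
    intro e he
    have hed := Nat.dvd_of_mem_divisors he
    have hepos : 0 < e := Nat.pos_of_mem_divisors he
    have hef : d = e * (d/e) := (Nat.mul_div_cancel' hed).symm
    set D := max e (d/e) with hD
    have hDpos : 0 < D := lt_of_lt_of_le hepos (le_max_left _ _)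
    have h1 : ((S ×ˢ S).filter (fun p => ev p = e)).card ≤ (210*Y/D+1) * S.card := by
      apply Finset.card_le_mul_card_image_of_maps_to (f := fun p : ℕ × ℕ => p.1)
      · intro p hp; exact (Finset.mem_product.1 (Finset.mem_filter.1 hp).1).1
      · intro u hu
        set F := ((S ×ˢ S).filter (fun p => ev p = e)).filter (fun p : ℕ × ℕ => p.1 = u) with hF
        have hFc : F.card = (F.image (fun p : ℕ × ℕ => p.2)).card := by
          rw [Finset.card_image_of_injOn]
          intro p hp q hq hpq
          have t1 := (Finset.mem_filter.1 hp).2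
          have t2 := (Finset.mem_filter.1 hq).2
          exact Prod.ext (t1.trans t2.symm) hpq
        rw [hFc]
        apply crude_fib Y D hDpos
        · intro v hv
          obtain ⟨p, hp, rfl⟩ := Finset.mem_image.1 hv
          exact hS (Finset.mem_product.1 (Finset.mem_filter.1 (Finset.mem_filter.1 hp).1).1).2
        · intro v hv v' hv'
          obtain ⟨p, hp, rfl⟩ := Finset.mem_image.1 hv
          obtain ⟨q, hq, rfl⟩ := Finset.mem_image.1 hv'
          obtain ⟨hp1, hp2⟩ := Finset.mem_filter.1 hp
          obtain ⟨hq1, hq2⟩ := Finset.mem_filter.1 hq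
          obtain ⟨hp3, hp4⟩ := Finset.mem_filter.1 hp1
          obtain ⟨hq3, hq4⟩ := Finset.mem_filter.1 hq1
          rcases max_choice e (d/e) with hm | hm
          · rw [hD, hm]
            have e1 : ((ev p : ℕ):ℤ) ∣ 210*((p.1:ℤ)-p.2) := Int.gcd_dvd_right ..
            have e2 : ((ev q : ℕ):ℤ) ∣ 210*((q.1:ℤ)-q.2) := Int.gcd_dvd_right ..
            rw [hp4] at e1
            rw [hq4] at e2
            have := dvd_sub e2 e1
            rw [hp2, hq2] at this
            have e : 210*((p.2:ℤ)-q.2) = 210*((u:ℤ)-q.2) - 210*((u:ℤ)-p.2) := by ring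
            rwa [e]
          · rw [hD, hm]
            have e1 := key p hp3
            have e2 := key q hq3
            rw [hp4] at e1
            rw [hq4] at e2
            have := dvd_sub e1 e2
            rw [hp2, hq2] at this
            have e : 210*((p.2:ℤ)-q.2) = (210*((u:ℤ)+p.2)+2*c) - (210*((u:ℤ)+q.2)+2*c) := by ring
            rwa [e]
    have h2 : S.card ≤ Y := by
      have := Finset.card_le_card hS
      rw [Nat.card_Ico] at this; omega
    have h3 := crude_num Y d e (d/e) hY hd hdY hef.le
    calc ((((S ×ˢ S).filter (fun p => ev p = e)).card : ℕ):ℝ) ≤ ((210*Y/D+1 : ℕ):ℝ) * (S.card:ℝ) := by exact_mod_cast h1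
      _ ≤ (2300*Y/Real.sqrt d) * (Y:ℝ) := by
        exact mul_le_mul h3 (by exact_mod_cast h2) (Nat.cast_nonneg _) (div_nonneg (mul_nonneg (by norm_num) (Nat.cast_nonneg _)) (Real.sqrt_nonneg _))
      _ = _ := by ring
  have h4 : (S ×ˢ S).card = ∑ e ∈ d.divisors, ((S ×ˢ S).filter (fun p => ev p = e)).card :=
    Finset.card_eq_sum_card_fiberwise (fun p hp => hmaps p hp)
  rw [Finset.card_product] at h4
  have h5 : (S.card:ℝ)^2 = ∑ e ∈ d.divisors, ((((S ×ˢ S).filter (fun p => ev p = e)).card:ℕ):ℝ) := by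
    rw [sq]; exact_mod_cast h4
  rw [h5]
  calc _ ≤ ∑ e ∈ d.divisors, (Y * (2300*Y/Real.sqrt d) : ℝ) := Finset.sum_le_sum hfib
    _ = _ := by rw [Finset.sum_const, nsmul_eq_mul]; rfl

lemma crudeR : ∃ C : ℝ, 0 < C ∧ ∀ (Y d c : ℕ) (w : ℤ), 1 ≤ Y → 0 < d → d ≤ 2^22*Y^2 →
    ∀ S ⊆ Finset.Ico Y (2*Y), (∀ u ∈ S, (d:ℤ) ∣ (210*(u:ℤ)+c)^2 - w) →
    (S.card:ℝ) ≤ C*Y*(d:ℝ)^(-(1/5):ℝ) := by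
  obtain ⟨C, hC, hτ⟩ := tau_bound (1/10) (by norm_num)
  refine ⟨2300*C, by linarith, ?_⟩
  intro Y d c w hY hd hdY S hS h
  have h1 := crude_sq Y d c w hY hd hdY S hS h
  have hd' : (0:ℝ) < d := by exact_mod_cast hd
  have h2 : (tau d:ℝ) * (Y * (2300*Y/Real.sqrt d)) ≤ (2300*C*Y*(d:ℝ)^(-(1/5):ℝ))^2 := by
    have e1 : Real.sqrt d = (d:ℝ)^((1/2):ℝ) := Real.sqrt_eq_rpow _
    have e2 : ((d:ℝ)^(-(1/5):ℝ))^2 = (d:ℝ)^((1/10):ℝ) / (d:ℝ)^((1/2):ℝ) := by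
      rw [← Real.rpow_natCast, ← Real.rpow_mul hd'.le, ← Real.rpow_sub hd']; norm_num
    rw [mul_pow, e2, e1]
    calc (tau d:ℝ) * (Y * (2300*Y/(d:ℝ)^((1/2):ℝ))) ≤ (C*(d:ℝ)^((1/10):ℝ)) * (Y * (2300*Y/(d:ℝ)^((1/2):ℝ))) := by
          gcongr; exact hτ d
      _ = 2300*C*1*Y^2*((d:ℝ)^((1/10):ℝ) / (d:ℝ)^((1/2):ℝ)) := by ring
      _ ≤ 2300*C*(2300*C)*Y^2*((d:ℝ)^((1/10):ℝ) / (d:ℝ)^((1/2):ℝ)) := by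
          gcongr; linarith
      _ = _ := by ring
  have h3 : 0 ≤ 2300*C*Y*(d:ℝ)^(-(1/5):ℝ) := by positivity
  exact abs_le_of_sq_le_sq' (h1.trans h2) h3 |>.2

lemma sum_rpow_bdd (s : ℝ) (hs : 1 < s) : ∃ A : ℝ, 0 < A ∧ ∀ F : Finset ℕ, ∑ d ∈ F, (d:ℝ)^(-s) ≤ A := by
  have h : Summable (fun d : ℕ => (d:ℝ)^(-s)) := Real.summable_nat_rpow.2 (by linarith)
  have h0 : ∀ d : ℕ, 0 ≤ (d:ℝ)^(-s) := fun d => Real.rpow_nonneg (Nat.cast_nonneg _) _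
  have h00 : 0 ≤ ∑' d : ℕ, (d:ℝ)^(-s) := tsum_nonneg h0
  refine ⟨(∑' d : ℕ, (d:ℝ)^(-s)) + 1, by linarith, fun F => ?_⟩
  have := h.sum_le_tsum F (fun d _ => h0 d)
  linarith

lemma crude2 : ∃ C : ℝ, 0 < C ∧ ∀ (Y d : ℕ) (a : ℤ), 1 ≤ Y → 0 < d → d ≤ 2^22*Y^2 →
    (((blk Y).filter (fun z => (d:ℤ) ∣ a - aa z)).card:ℝ) ≤ C*(Y:ℝ)^2*(d:ℝ)^(-(1/5):ℝ) := by
  classical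
  obtain ⟨C, hC, h⟩ := crudeR
  refine ⟨C, hC, ?_⟩
  intro Y d a hY hd hdY
  set F := (blk Y).filter (fun z => (d:ℤ) ∣ a - aa z) with hF
  have h1 : F.card = ∑ v ∈ Finset.Ico Y (2*Y), (F.filter (fun z => z.2 = v)).card := by
    apply Finset.card_eq_sum_card_fiberwise
    intro z hz
    exact (Finset.mem_product.1 (show z ∈ Finset.Ico Y (2*Y) ×ˢ Finset.Ico Y (2*Y) from (Finset.mem_filter.1 hz).1)).2
  have h2 : ∀ v ∈ Finset.Ico Y (2*Y), ((F.filter (fun z => z.2 = v)).card:ℝ) ≤ C*Y*(d:ℝ)^(-(1/5):ℝ) := by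
    intro v _
    have e : (F.filter (fun z => z.2 = v)).card = ((F.filter (fun z => z.2 = v)).image (fun z => z.1)).card := by
      rw [Finset.card_image_of_injOn]
      intro p hp q hq hpq
      have t1 := (Finset.mem_filter.1 hp).2
      have t2 := (Finset.mem_filter.1 hq).2
      exact Prod.ext hpq (t1.trans t2.symm)
    rw [e]
    apply h Y d 106 (a - ((210*(v:ℤ)+71)^2+6)) hY hd hdY
    · intro u hu
      obtain ⟨z, hz, rfl⟩ := Finset.mem_image.1 hu
      exact (Finset.mem_product.1 (show z ∈ Finset.Ico Y (2*Y) ×ˢ Finset.Ico Y (2*Y) from (Finset.mem_filter.1 (Finset.mem_filter.1 hz).1).1)).1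
    · intro u hu
      obtain ⟨z, hz, rfl⟩ := Finset.mem_image.1 hu
      obtain ⟨hz1, hz2⟩ := Finset.mem_filter.1 hz
      have h3 := (Finset.mem_filter.1 hz1).2
      rw [← hz2]
      have e : (210*(z.1:ℤ)+(106:ℕ))^2 - (a - ((210*(z.2:ℤ)+71)^2+6)) = -(a - (aa z : ℤ)) := by
        unfold aa; push_cast; ring
      rw [e, dvd_neg]; exact h3
  rw [h1, Nat.cast_sum]
  calc _ ≤ ∑ v ∈ Finset.Ico Y (2*Y), C*Y*(d:ℝ)^(-(1/5):ℝ) := Finset.sum_le_sum h2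
    _ = _ := by
      rw [Finset.sum_const, Nat.card_Ico, nsmul_eq_mul, show 2*Y - Y = Y by omega]; ring

lemma sig_sq_le (n : ℕ) (A : ℝ) (hA : ∀ F : Finset ℕ, ∑ d ∈ F, (d:ℝ)^(-(11/10):ℝ) ≤ A) :
    sig n ^ 2 ≤ A * ∑ d ∈ n.divisors, (d:ℝ)^(-(9/10):ℝ) := by
  have e1 : sig n = ∑ d ∈ n.divisors, (d:ℝ)^(-(11/20):ℝ) * (d:ℝ)^(-(9/20):ℝ) := by
    unfold sig
    apply Finset.sum_congr rfl
    intro d hd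
    have hd' : (0:ℝ) < d := by exact_mod_cast Nat.pos_of_mem_divisors hd
    rw [← Real.rpow_add hd']
    rw [show (-(11/20) + -(9/20) : ℝ) = -1 by norm_num, Real.rpow_neg_one, one_div]
  rw [e1]
  refine (Finset.sum_mul_sq_le_sq_mul_sq _ _ _).trans ?_
  have e2 : ∑ d ∈ n.divisors, ((d:ℝ)^(-(11/20):ℝ))^2 = ∑ d ∈ n.divisors, (d:ℝ)^(-(11/10):ℝ) := by
    apply Finset.sum_congr rfl
    intro d _
    rw [← Real.rpow_natCast, ← Real.rpow_mul (Nat.cast_nonneg _)]; norm_num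
  have e3 : ∑ d ∈ n.divisors, ((d:ℝ)^(-(9/20):ℝ))^2 = ∑ d ∈ n.divisors, (d:ℝ)^(-(9/10):ℝ) := by
    apply Finset.sum_congr rfl
    intro d _
    rw [← Real.rpow_natCast, ← Real.rpow_mul (Nat.cast_nonneg _)]; norm_num
  rw [e2, e3]
  apply mul_le_mul_of_nonneg_right (hA _)
  apply Finset.sum_nonneg
  intro d _; positivity

lemma sumsig : ∃ C : ℝ, 0 < C ∧ ∀ (Y a : ℕ), 1 ≤ Y → a ≤ 2^20*Y^2 →
    ∑ z ∈ (blk Y).filter (fun z => a ≠ aa z), sig ((a:ℤ) - aa z).natAbs ^ 2 ≤ C*(Y:ℝ)^2 := by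
  classical
  obtain ⟨A, hA, hAF⟩ := sum_rpow_bdd (11/10) (by norm_num)
  obtain ⟨C, hC, hc⟩ := crude2
  refine ⟨A*(C*A), by positivity, ?_⟩
  intro Y a hY ha
  set D := Finset.Icc 1 (2^22*Y^2) with hD
  set F := (blk Y).filter (fun z => a ≠ aa z) with hF
  have h1 : ∀ z ∈ F, sig ((a:ℤ) - aa z).natAbs ^ 2 ≤ A * ∑ d ∈ D, if (d:ℤ) ∣ (a:ℤ) - aa z then (d:ℝ)^(-(9/10):ℝ) else 0 := by
    intro z hz
    obtain ⟨hz1, hz2⟩ := Finset.mem_filter.1 hz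
    refine (sig_sq_le _ A hAF).trans ?_
    apply mul_le_mul_of_nonneg_left _ hA.le
    rw [← Finset.sum_filter]
    apply Finset.sum_le_sum_of_subset_of_nonneg
    · intro d hd
      have hd1 := Nat.dvd_of_mem_divisors hd
      have hd2 := Nat.pos_of_mem_divisors hd
      have h0 : 0 < ((a:ℤ) - aa z).natAbs := by omega
      have := Nat.le_of_dvd h0 hd1
      have := aa_le Y hY z hz1
      refine Finset.mem_filter.2 ⟨Finset.mem_Icc.2 ⟨hd2, ?_⟩, Int.natCast_dvd.2 hd1⟩
      have : 2^20*Y^2 ≤ 2^22*Y^2 := by nlinarith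
      omega
    · intro d _ _; positivity
  calc _ ≤ ∑ z ∈ F, A * ∑ d ∈ D, (if (d:ℤ) ∣ (a:ℤ) - aa z then (d:ℝ)^(-(9/10):ℝ) else 0) := Finset.sum_le_sum h1
    _ = A * ∑ d ∈ D, ∑ z ∈ F, (if (d:ℤ) ∣ (a:ℤ) - aa z then (d:ℝ)^(-(9/10):ℝ) else 0) := by
      rw [← Finset.mul_sum, Finset.sum_comm]
    _ ≤ A * ∑ d ∈ D, C*(Y:ℝ)^2*(d:ℝ)^(-(11/10):ℝ) := by
      apply mul_le_mul_of_nonneg_left _ hA.le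
      apply Finset.sum_le_sum
      intro d hd
      obtain ⟨hd1, hd2⟩ := Finset.mem_Icc.1 hd
      have hd' : (0:ℝ) < d := by exact_mod_cast hd1
      rw [← Finset.sum_filter, Finset.sum_const, nsmul_eq_mul]
      have h2 : ((F.filter (fun z => (d:ℤ) ∣ (a:ℤ) - aa z)).card:ℝ) ≤ C*(Y:ℝ)^2*(d:ℝ)^(-(1/5):ℝ) := by
        refine le_trans ?_ (hc Y d a hY hd1 hd2)
        exact_mod_cast Finset.card_le_card (Finset.filter_subset_filter _ (Finset.filter_subset _ _))
      calc _ ≤ C*(Y:ℝ)^2*(d:ℝ)^(-(1/5):ℝ) * (d:ℝ)^(-(9/10):ℝ) := by gcongr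
        _ = _ := by rw [mul_assoc, ← Real.rpow_add hd']; norm_num
    _ = A * (C*(Y:ℝ)^2 * ∑ d ∈ D, (d:ℝ)^(-(11/10):ℝ)) := by rw [← Finset.mul_sum]
    _ ≤ A * (C*(Y:ℝ)^2 * A) := by gcongr; exact hAF D
    _ = _ := by ring

lemma tau4 : ∃ C : ℝ, 1 ≤ C ∧ ∀ n : ℕ, 0 < n → (tau n:ℝ)^4 ≤ C * (n:ℝ)^((1/10):ℝ) := by
  obtain ⟨C, hC, h⟩ := tau_bound (1/40) (by norm_num)
  refine ⟨C^4, one_le_pow₀ hC, ?_⟩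
  intro n hn
  calc (tau n:ℝ)^4 ≤ (C*(n:ℝ)^((1/40):ℝ))^4 := by gcongr; exact h n
    _ = _ := by
      rw [mul_pow, ← Real.rpow_natCast ((n:ℝ)^((1/40):ℝ)), ← Real.rpow_mul (Nat.cast_nonneg _)]; norm_num

lemma sumtau : ∃ C : ℝ, 0 < C ∧ ∀ (X Y : ℕ), 1 ≤ X → X ≤ Y →
    ∑ z ∈ blk X, ∑ z' ∈ blk Y, (tau (Nat.gcd (aa z) (aa z')):ℝ)^4 ≤ C*((X:ℝ)^2*(Y:ℝ)^2) := by
  classical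
  obtain ⟨A, hA, hAF⟩ := sum_rpow_bdd (3/2) (by norm_num)
  obtain ⟨C, hC, hc⟩ := crude2
  obtain ⟨C1, hC1, h4⟩ := tau4
  obtain ⟨C2, hC2, hτ1⟩ := tau_bound (1/10) (by norm_num)
  obtain ⟨C3, hC3, hτ2⟩ := tau_bound (1/20) (by norm_num)
  refine ⟨C1*(16*C2^4*A + C*C3*2), by positivity, ?_⟩
  intro X Y hX hXY
  have hX' : (0:ℝ) < X := by exact_mod_cast hX
  set Nj : ℕ → ℝ := fun d => (((blk Y).filter (fun z => d ∣ aa z)).card:ℝ) with hNj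
  set Ni : ℕ → ℝ := fun d => (((blk X).filter (fun z => d ∣ aa z)).card:ℝ) with hNi
  have step1 : ∀ z ∈ blk X, ∑ z' ∈ blk Y, (tau (Nat.gcd (aa z) (aa z')):ℝ)^4 ≤ C1 * ∑ d ∈ (aa z).divisors, (d:ℝ)^((1/10):ℝ) * Nj d := by
    intro z hz
    have : ∀ z' ∈ blk Y, (tau (Nat.gcd (aa z) (aa z')):ℝ)^4 ≤ C1 * ∑ d ∈ (aa z).divisors, if d ∣ aa z' then (d:ℝ)^((1/10):ℝ) else 0 := by
      intro z' _
      have hg : 0 < Nat.gcd (aa z) (aa z') := Nat.gcd_pos_of_pos_left _ (aa_pos z)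
      refine (h4 _ hg).trans ?_
      gcongr
      rw [← Finset.sum_filter]
      apply Finset.single_le_sum (f := fun d : ℕ => (d:ℝ)^((1/10):ℝ)) (fun d _ => by positivity)
      exact Finset.mem_filter.2 ⟨Nat.mem_divisors.2 ⟨Nat.gcd_dvd_left _ _, (aa_pos z).ne'⟩, Nat.gcd_dvd_right _ _⟩
    refine (Finset.sum_le_sum this).trans ?_
    rw [← Finset.mul_sum, Finset.sum_comm]
    apply le_of_eq; congr 1
    apply Finset.sum_congr rfl
    intro d _
    rw [← Finset.sum_filter, Finset.sum_const, nsmul_eq_mul, mul_comm]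
  have step2 : ∀ z ∈ blk X, ∑ d ∈ (aa z).divisors, (d:ℝ)^((1/10):ℝ) * Nj d ≤
      (∑ d ∈ Finset.Icc 1 X, if d ∣ aa z then (d:ℝ)^((1/10):ℝ) * Nj d else 0) + C*C3*2*(Y:ℝ)^2 := by
    intro z hz
    have hz' := aa_le X hX z hz
    rw [← Finset.sum_filter_add_sum_filter_not (aa z).divisors (fun d => d ≤ X)]
    apply add_le_add
    · rw [← Finset.sum_filter]
      apply Finset.sum_le_sum_of_subset_of_nonneg
      · intro d hd
        obtain ⟨hd1, hd2⟩ := Finset.mem_filter.1 hd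
        exact Finset.mem_filter.2 ⟨Finset.mem_Icc.2 ⟨Nat.pos_of_mem_divisors hd1, hd2⟩, Nat.dvd_of_mem_divisors hd1⟩
      · intro d _ _; positivity
    · have : ∀ d ∈ (aa z).divisors.filter (fun d => ¬ d ≤ X), (d:ℝ)^((1/10):ℝ) * Nj d ≤ C*(Y:ℝ)^2*(X:ℝ)^(-(1/10):ℝ) := by
        intro d hd
        obtain ⟨hd1, hd2⟩ := Finset.mem_filter.1 hd
        have hd3 := Nat.pos_of_mem_divisors hd1
        have hd' : (0:ℝ) < d := by exact_mod_cast hd3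
        have hd4 := Nat.le_of_dvd (aa_pos z) (Nat.dvd_of_mem_divisors hd1)
        have hXY2 : X^2 ≤ Y^2 := Nat.pow_le_pow_left hXY 2
        have h5 := hc Y d 0 (hX.trans hXY) hd3 (by omega)
        have e : (blk Y).filter (fun z => (d:ℤ) ∣ 0 - (aa z:ℤ)) = (blk Y).filter (fun z => d ∣ aa z) := by
          apply Finset.filter_congr
          intro z _
          rw [zero_sub, dvd_neg, Int.natCast_dvd_natCast]
        rw [e] at h5
        calc (d:ℝ)^((1/10):ℝ) * Nj d ≤ (d:ℝ)^((1/10):ℝ) * (C*(Y:ℝ)^2*(d:ℝ)^(-(1/5):ℝ)) := by gcongr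
          _ = C*(Y:ℝ)^2*((d:ℝ)^((1/10):ℝ) * (d:ℝ)^(-(1/5):ℝ)) := by ring
          _ = C*(Y:ℝ)^2*((d:ℝ)^(-(1/10):ℝ)) := by rw [← Real.rpow_add hd']; norm_num
          _ ≤ _ := by
            gcongr C*(Y:ℝ)^2*?_
            apply Real.rpow_le_rpow_of_nonpos hX' _ (by norm_num)
            have : X ≤ d := by omega
            exact_mod_cast this
      refine (Finset.sum_le_sum this).trans ?_
      rw [Finset.sum_const, nsmul_eq_mul]
      have h6 : (((aa z).divisors.filter (fun d => ¬ d ≤ X)).card:ℝ) ≤ tau (aa z) := by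
        exact_mod_cast Finset.card_le_card (Finset.filter_subset _ _)
      have h7 : (tau (aa z):ℝ) ≤ C3*(2*(X:ℝ)^((1/10):ℝ)) := by
        refine (hτ2 _).trans ?_
        gcongr
        have : ((aa z:ℕ):ℝ) ≤ 2^20*(X:ℝ)^2 := by exact_mod_cast hz'
        calc ((aa z:ℕ):ℝ)^((1/20):ℝ) ≤ (2^20*(X:ℝ)^2)^((1/20):ℝ) := by gcongr
          _ = 2*(X:ℝ)^((1/10):ℝ) := by
            rw [Real.mul_rpow (by positivity) (by positivity), ← Real.rpow_natCast, ← Real.rpow_natCast, ← Real.rpow_mul (by positivity), ← Real.rpow_mul (by positivity)]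
            norm_num
      have e8 : (X:ℝ)^((1/10):ℝ) * (X:ℝ)^(-(1/10):ℝ) = 1 := by
        rw [← Real.rpow_add hX']; norm_num
      calc _ ≤ (C3*(2*(X:ℝ)^((1/10):ℝ))) * (C*(Y:ℝ)^2*(X:ℝ)^(-(1/10):ℝ)) := by
            apply mul_le_mul_of_nonneg_right (h6.trans h7) (by positivity)
        _ = C*C3*2*(Y:ℝ)^2*((X:ℝ)^((1/10):ℝ) * (X:ℝ)^(-(1/10):ℝ)) := by ring
        _ = _ := by rw [e8, mul_one]
  have step3 : ∑ z ∈ blk X, ∑ d ∈ Finset.Icc 1 X, (if d ∣ aa z then (d:ℝ)^((1/10):ℝ) * Nj d else 0) ≤ 16*C2^4*A*((X:ℝ)^2*(Y:ℝ)^2) := by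
    rw [Finset.sum_comm]
    have : ∀ d ∈ Finset.Icc 1 X, ∑ z ∈ blk X, (if d ∣ aa z then (d:ℝ)^((1/10):ℝ) * Nj d else 0) ≤ 16*C2^4*((X:ℝ)^2*(Y:ℝ)^2)*(d:ℝ)^(-(3/2):ℝ) := by
      intro d hd
      obtain ⟨hd1, hd2⟩ := Finset.mem_Icc.1 hd
      have hd' : (0:ℝ) < d := by exact_mod_cast hd1
      rw [← Finset.sum_filter, Finset.sum_const, nsmul_eq_mul]
      have i1 := Nd_small d X hd1 hd2
      have i2 := Nd_small d Y hd1 (hd2.trans hXY)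
      have e1 : ((d:ℝ)^((1/10):ℝ))^4 * (d:ℝ)^((1/10):ℝ) / (d:ℝ)^2 = (d:ℝ)^(-(3/2):ℝ) := by
        rw [← Real.rpow_natCast, ← Real.rpow_mul hd'.le, ← Real.rpow_add hd', ← Real.rpow_natCast, ← Real.rpow_sub hd']
        norm_num
      calc Ni d * ((d:ℝ)^((1/10):ℝ) * Nj d) ≤ (4 * (X:ℝ)^2 * (tau d)^2 / d) * ((d:ℝ)^((1/10):ℝ) * (4 * (Y:ℝ)^2 * (tau d)^2 / d)) := by
            gcongr
        _ = 16*((X:ℝ)^2*(Y:ℝ)^2)*((tau d:ℝ)^4*(d:ℝ)^((1/10):ℝ)/(d:ℝ)^2) := by field_simp; ring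
        _ ≤ 16*((X:ℝ)^2*(Y:ℝ)^2)*((C2*(d:ℝ)^((1/10):ℝ))^4*(d:ℝ)^((1/10):ℝ)/(d:ℝ)^2) := by
            gcongr; exact hτ1 d
        _ = 16*C2^4*((X:ℝ)^2*(Y:ℝ)^2)*(((d:ℝ)^((1/10):ℝ))^4 * (d:ℝ)^((1/10):ℝ) / (d:ℝ)^2) := by ring
        _ = _ := by rw [e1]
    refine (Finset.sum_le_sum this).trans ?_
    rw [← Finset.mul_sum]
    calc _ ≤ 16*C2^4*((X:ℝ)^2*(Y:ℝ)^2)*A := by gcongr; exact hAF _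
      _ = _ := by ring
  calc _ ≤ ∑ z ∈ blk X, C1 * ((∑ d ∈ Finset.Icc 1 X, if d ∣ aa z then (d:ℝ)^((1/10):ℝ) * Nj d else 0) + C*C3*2*(Y:ℝ)^2) := by
        apply Finset.sum_le_sum
        intro z hz
        refine (step1 z hz).trans ?_
        gcongr
        exact step2 z hz
    _ = C1 * ((∑ z ∈ blk X, ∑ d ∈ Finset.Icc 1 X, (if d ∣ aa z then (d:ℝ)^((1/10):ℝ) * Nj d else 0)) + (X:ℝ)^2*(C*C3*2*(Y:ℝ)^2)) := by
        rw [← Finset.mul_sum, Finset.sum_add_distrib, Finset.sum_const, card_blk, nsmul_eq_mul]; push_cast; ring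
    _ ≤ C1 * (16*C2^4*A*((X:ℝ)^2*(Y:ℝ)^2) + (X:ℝ)^2*(C*C3*2*(Y:ℝ)^2)) := by gcongr
    _ = _ := by ring

lemma sig_nonneg (n : ℕ) : 0 ≤ sig n := by
  unfold sig; apply Finset.sum_nonneg; intro d _; positivity

theorem thmA : ∃ C : ℝ, 0 < C ∧ ∀ (X Y : ℕ), 1 ≤ X → X ≤ Y →
    ∑ z ∈ blk X, ∑ z' ∈ (blk Y).filter (fun z' => aa z ≠ aa z'),
      (tau (Nat.gcd (aa z) (aa z')):ℝ)^2 * sig ((aa z:ℤ) - aa z').natAbs ≤ C*((X:ℝ)^2*(Y:ℝ)^2) := by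
  classical
  obtain ⟨C1, hC1, h1⟩ := sumsig
  obtain ⟨C2, hC2, h2⟩ := sumtau
  refine ⟨C1 + C2, by positivity, ?_⟩
  intro X Y hX hXY
  have hXY2 : X^2 ≤ Y^2 := Nat.pow_le_pow_left hXY 2
  calc _ ≤ ∑ z ∈ blk X, ((∑ z' ∈ blk Y, (tau (Nat.gcd (aa z) (aa z')):ℝ)^4) + C1*(Y:ℝ)^2) := by
        apply Finset.sum_le_sum
        intro z hz
        calc _ ≤ ∑ z' ∈ (blk Y).filter (fun z' => aa z ≠ aa z'), ((tau (Nat.gcd (aa z) (aa z')):ℝ)^4 + sig ((aa z:ℤ) - aa z').natAbs^2) := by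
              apply Finset.sum_le_sum
              intro z' _
              have := sig_nonneg ((aa z:ℤ) - aa z').natAbs
              nlinarith [sq_nonneg ((tau (Nat.gcd (aa z) (aa z')):ℝ)^2 - sig ((aa z:ℤ) - aa z').natAbs), sq_nonneg ((tau (Nat.gcd (aa z) (aa z')):ℝ)^2), sq_nonneg (sig ((aa z:ℤ) - aa z').natAbs)]
          _ ≤ _ := by
              rw [Finset.sum_add_distrib]
              apply add_le_add
              · apply Finset.sum_le_sum_of_subset_of_nonneg (Finset.filter_subset _ _)
                intro _ _ _; positivity
              · apply h1 Y (aa z) (hX.trans hXY)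
                have := aa_le X hX z hz
                omega
    _ = (∑ z ∈ blk X, ∑ z' ∈ blk Y, (tau (Nat.gcd (aa z) (aa z')):ℝ)^4) + (X:ℝ)^2*(C1*(Y:ℝ)^2) := by
        rw [Finset.sum_add_distrib, Finset.sum_const, card_blk, nsmul_eq_mul]; push_cast; ring
    _ ≤ C2*((X:ℝ)^2*(Y:ℝ)^2) + (X:ℝ)^2*(C1*(Y:ℝ)^2) := by gcongr; exact h2 X Y hX hXY
    _ = _ := by ring

lemma totient_mul_le' (d m : ℕ) : (d*m).totient ≤ d * m.totient := by
  induction d using induction_on_primes generalizing m with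
  | zero => simp
  | one => simp
  | prime_mul p a hp ih =>
    rw [mul_assoc]
    by_cases h : p ∣ a * m
    · rw [Nat.totient_mul_of_prime_of_dvd hp h, mul_assoc]
      exact Nat.mul_le_mul_left _ (ih m)
    · rw [Nat.totient_mul_of_prime_of_not_dvd hp h, mul_assoc]
      exact Nat.mul_le_mul (Nat.sub_le _ _) (ih m)

lemma sig_mul_totient_le (n : ℕ) : sig n * n.totient ≤ n := by
  have h : (n:ℝ) = ∑ d ∈ n.divisors, ((n/d).totient:ℝ) := by
    have := Nat.sum_div_divisors n (fun d => (d.totient))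
    rw [Nat.sum_totient] at this
    exact_mod_cast this.symm
  conv_rhs => rw [h]
  unfold sig
  rw [Finset.sum_mul]
  apply Finset.sum_le_sum
  intro d hd
  have hd' : (0:ℝ) < d := by exact_mod_cast Nat.pos_of_mem_divisors hd
  have := totient_mul_le' d (n/d)
  rw [Nat.mul_div_cancel' (Nat.dvd_of_mem_divisors hd)] at this
  rw [one_div_mul_eq_div, div_le_iff₀ hd', mul_comm]
  exact_mod_cast this

lemma prod_one_sub_ge' (s : Finset ℕ) (x : ℕ → ℝ) (h0 : ∀ i ∈ s, 0 ≤ x i) (h1 : ∀ i ∈ s, x i ≤ 1) :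
    0 ≤ ∏ i ∈ s, (1 - x i) ∧ ∏ i ∈ s, (1 - x i) ≤ 1 ∧ 1 - ∑ i ∈ s, x i ≤ ∏ i ∈ s, (1 - x i) := by
  classical
  induction s using Finset.induction_on with
  | empty => simp
  | insert a s ha ih =>
    obtain ⟨i0, i1, i2⟩ := ih (fun i hi => h0 i (Finset.mem_insert_of_mem hi)) (fun i hi => h1 i (Finset.mem_insert_of_mem hi))
    have a0 := h0 a (Finset.mem_insert_self _ _)
    have a1 := h1 a (Finset.mem_insert_self _ _)
    rw [Finset.prod_insert ha, Finset.sum_insert ha]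
    refine ⟨by apply mul_nonneg <;> linarith, by nlinarith, by nlinarith⟩

lemma totient_ge_half (a : ℕ) (h : ∑ p ∈ a.primeFactors, (1:ℝ)/p ≤ 1/2) : (a:ℝ)/2 ≤ a.totient := by
  have h1 := Nat.totient_eq_mul_prod_factors a
  have h2 : (a.totient:ℝ) = a * ∏ p ∈ a.primeFactors, (1 - (1:ℝ)/p) := by
    simp only [one_div]
    have h1' := congrArg (fun q : ℚ => (q:ℝ)) h1
    push_cast at h1'
    exact h1'
  have h3 := (prod_one_sub_ge' a.primeFactors (fun p => (1:ℝ)/p) (fun p _ => by positivity) (fun p hp => by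
    have : (1:ℝ) ≤ p := by exact_mod_cast (Nat.prime_of_mem_primeFactors hp).one_lt.le
    rw [div_le_one (by linarith)]; exact this)).2.2
  rw [h2]
  have : (0:ℝ) ≤ a := Nat.cast_nonneg _
  nlinarith

lemma sum_tau_div_le (a : ℕ) (ha : 0 < a) (h : (a:ℝ)/2 ≤ a.totient) : ∑ d ∈ a.divisors, (tau d:ℝ)/d ≤ 4 := by
  classical
  have ha' : (0:ℝ) < a := by exact_mod_cast ha
  have h1 : sig a ≤ 2 := by
    have := sig_mul_totient_le a
    have h0 := sig_nonneg a
    by_contra hlt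
    push Not at hlt
    nlinarith
  have h2 : ∑ d ∈ a.divisors, (tau d:ℝ)/d ≤ sig a * sig a := by
    unfold sig
    rw [Finset.sum_mul_sum, ← Finset.sum_product']
    have e : ∀ d ∈ a.divisors, (tau d:ℝ)/d = ∑ p ∈ d.divisorsAntidiagonal, (1:ℝ)/p.1*(1/p.2) := by
      intro d hd
      have hd0 := Nat.pos_of_mem_divisors hd
      have : ∀ p ∈ d.divisorsAntidiagonal, (1:ℝ)/p.1*(1/p.2) = 1/d := by
        intro p hp
        have := (Nat.mem_divisorsAntidiagonal.1 hp).1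
        rw [← this]; push_cast; rw [one_div_mul_one_div]
      rw [Finset.sum_congr rfl this, Finset.sum_const, nsmul_eq_mul, ← Nat.map_div_right_divisors, Finset.card_map]
      unfold tau; ring
    rw [Finset.sum_congr rfl e, Finset.sum_sigma']
    have : ∀ x ∈ a.divisors.sigma (fun d => d.divisorsAntidiagonal), x.2.1 * x.2.2 = x.1 ∧ x.1 ∣ a := by
      intro x hx
      obtain ⟨hx1, hx2⟩ := Finset.mem_sigma.1 hx
      exact ⟨(Nat.mem_divisorsAntidiagonal.1 hx2).1, Nat.dvd_of_mem_divisors hx1⟩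
    rw [← Finset.sum_image (s := a.divisors.sigma (fun d => d.divisorsAntidiagonal)) (g := fun x => x.2) (f := fun p : ℕ × ℕ => (1:ℝ)/p.1*(1/p.2))]
    · apply Finset.sum_le_sum_of_subset_of_nonneg
      · intro p hp
        obtain ⟨x, hx, rfl⟩ := Finset.mem_image.1 hp
        obtain ⟨t1, t2⟩ := this x hx
        rw [← t1] at t2
        exact Finset.mem_product.2 ⟨Nat.mem_divisors.2 ⟨(Dvd.intro _ rfl).trans t2, ha.ne'⟩, Nat.mem_divisors.2 ⟨(Dvd.intro_left _ rfl).trans t2, ha.ne'⟩⟩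
      · intro p _ _; positivity
    · intro x hx y hy hxy
      have hx1 := (this x hx).1
      have hy1 := (this y hy).1
      obtain ⟨x1, x2⟩ := x
      obtain ⟨y1, y2⟩ := y
      simp only at hxy hx1 hy1
      subst hxy
      have : x1 = y1 := by omega
      subst this; rfl
  have := sig_nonneg a
  nlinarith

lemma quad_card {R : Type*} [CommRing R] [IsDomain R] (A B C : R) (S : Finset R)
    (hS : ∀ x ∈ S, A*x^2+B*x+C = 0) (h : ¬ (A = 0 ∧ B = 0 ∧ C = 0)) : S.card ≤ 2 := by
  by_contra hlt
  push Not at hlt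
  obtain ⟨a, ha, b, hb, c, hc, hab, hac, hbc⟩ := Finset.two_lt_card.1 hlt
  have e1 := hS a ha
  have e2 := hS b hb
  have e3 := hS c hc
  have f1 : A*(a+b)+B = 0 := by
    have : (a-b)*(A*(a+b)+B) = 0 := by linear_combination e1 - e2
    exact (mul_eq_zero.1 this).resolve_left (sub_ne_zero.2 hab)
  have f2 : A*(a+c)+B = 0 := by
    have : (a-c)*(A*(a+c)+B) = 0 := by linear_combination e1 - e3
    exact (mul_eq_zero.1 this).resolve_left (sub_ne_zero.2 hac)
  have f3 : A = 0 := by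
    have : (b-c)*A = 0 := by linear_combination f1 - f2
    exact (mul_eq_zero.1 this).resolve_left (sub_ne_zero.2 hbc)
  have f4 : B = 0 := by rw [f3] at f1; simpa using f1
  have f5 : C = 0 := by rw [f3, f4] at e1; simpa using e1
  exact h ⟨f3, f4, f5⟩

/-- quadratic congruence modulo a prime -/
lemma quad_Ico (p Y c : ℕ) (hp : p.Prime) (hc : Nat.Coprime p 210) (w : ℕ) :
    ((Finset.Ico Y (2*Y)).filter (fun u : ℕ => p ∣ (210*u+c)^2+w)).card ≤ (Y/p+1)*2 := by
  classical
  haveI : Fact p.Prime := ⟨hp⟩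
  have h1 : ((Finset.Ico Y (2*Y)).filter (fun u : ℕ => p ∣ (210*u+c)^2+w)).card ≤ (Y/p+1) * (Finset.univ.filter (fun x : ZMod p => x^2+w=0)).card := by
    apply Finset.card_le_mul_card_image_of_maps_to (f := fun u : ℕ => ((210*u+c:ℕ):ZMod p))
    · intro u hu
      have := (Finset.mem_filter.1 hu).2
      rw [← ZMod.natCast_eq_zero_iff] at this
      simp only [Finset.mem_filter, Finset.mem_univ, true_and]
      exact_mod_cast this
    · intro x _
      refine le_trans (Finset.card_le_card ?_) (card_Ico_class p Y hp.pos x c hc)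
      intro u hu
      obtain ⟨hu1, hu2⟩ := Finset.mem_filter.1 hu
      exact Finset.mem_filter.2 ⟨(Finset.mem_filter.1 hu1).1, hu2⟩
  refine h1.trans (Nat.mul_le_mul_left _ ?_)
  apply quad_card (1:ZMod p) 0 (w:ZMod p)
  · intro x hx
    have := (Finset.mem_filter.1 hx).2
    linear_combination this
  · rintro ⟨h, -⟩; exact one_ne_zero h

lemma lin_Ico (p Y c : ℕ) (hp : 0 < p) (hc : Nat.Coprime p 210) :
    ((Finset.Ico Y (2*Y)).filter (fun u : ℕ => p ∣ 210*u+c)).card ≤ Y/p+1 := by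
  refine le_trans (Finset.card_le_card ?_) (card_Ico_class p Y hp 0 c hc)
  intro u hu
  obtain ⟨hu1, hu2⟩ := Finset.mem_filter.1 hu
  exact Finset.mem_filter.2 ⟨hu1, (ZMod.natCast_eq_zero_iff _ _).2 hu2⟩

lemma sum_inv_sq_11 (M : ℕ) : ∑ p ∈ Finset.Icc 11 M, (1:ℝ)/(p:ℝ)^2 ≤ 1/10 := by
  have : ∀ n : ℕ, ∑ p ∈ Finset.Ico 11 (11+n), (1:ℝ)/(p:ℝ)^2 ≤ 1/10 - 1/(10+n) := by
    intro n
    induction n with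
    | zero => simp
    | succ n ih =>
      rw [← add_assoc, Finset.sum_Ico_succ_top (by omega)]
      have h : (1:ℝ)/((11+n:ℕ):ℝ)^2 ≤ 1/(10+(n:ℝ)) - 1/(10+((n+1:ℕ):ℝ)) := by
        push_cast
        rw [div_sub_div _ _ (by positivity) (by positivity), div_le_div_iff₀ (by positivity) (by positivity)]
        have : (0:ℝ) ≤ n := Nat.cast_nonneg _
        nlinarith
      linarith
  have h1 : Finset.Icc 11 M ⊆ Finset.Ico 11 (11+M) := by
    intro x hx
    rw [Finset.mem_Icc] at hx
    rw [Finset.mem_Ico]; omega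
  calc _ ≤ ∑ p ∈ Finset.Ico 11 (11+M), (1:ℝ)/(p:ℝ)^2 := Finset.sum_le_sum_of_subset_of_nonneg h1 (fun _ _ _ => by positivity)
    _ ≤ _ := (this M).trans (by have : (0:ℝ) ≤ 1/(10+(M:ℝ)) := by positivity
                                linarith)

lemma sum_inv_11 (M : ℕ) : ∑ p ∈ Finset.Icc 11 M, (1:ℝ)/p ≤ 1 + Real.log M := by
  have h := harmonic_le_one_add_log M
  rw [harmonic_eq_sum_Icc] at h
  push_cast at h
  refine le_trans ?_ h
  simp only [one_div]
  apply Finset.sum_le_sum_of_subset_of_nonneg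
  · intro x hx
    rw [Finset.mem_Icc] at hx ⊢; omega
  · intro _ _ _; positivity

lemma prime_ge_11 (p : ℕ) (hp : p.Prime) (hc : Nat.Coprime p 210) : 11 ≤ p := by
  by_contra hlt
  push Not at hlt
  interval_cases p <;> revert hp hc <;> norm_num

def prs (M : ℕ) : Finset ℕ := (Finset.Icc 11 M).filter (fun p => p.Prime ∧ Nat.Coprime p 210)

lemma prod_count (Y : ℕ) (p q : ℕ → Prop) [DecidablePred p] [DecidablePred q] (A B : ℕ)
    (hA : ((Finset.Ico Y (2*Y)).filter p).card ≤ A) (hB : ((Finset.Ico Y (2*Y)).filter q).card ≤ B) :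
    ((blk Y).filter (fun z => p z.1 ∧ q z.2)).card ≤ A * B := by
  unfold blk
  rw [Finset.filter_product, Finset.card_product]
  exact Nat.mul_le_mul hA hB

lemma bad12 (Y : ℕ) (hY : 1 ≤ Y) :
    ((blk Y).filter (fun z => ¬ (Nat.Coprime (210*z.1+106) (210*z.2+71) ∧ Nat.Coprime (aa z) (210*z.2+71)))).card
      ≤ ∑ p ∈ prs (526*Y), 3*(Y/p+1)^2 := by
  classical
  refine le_trans (Finset.card_le_card (t := (prs (526*Y)).biUnion (fun p => ((blk Y).filter (fun z => p ∣ 210*z.1+106 ∧ p ∣ 210*z.2+71)) ∪ ((blk Y).filter (fun z => p ∣ (210*z.1+106)^2+6 ∧ p ∣ 210*z.2+71)))) ?_) ?_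
  · intro z hz
    obtain ⟨hz1, hz2⟩ := Finset.mem_filter.1 hz
    have hzb := (mem_blk Y z).1 hz1
    rw [not_and_or] at hz2
    rcases hz2 with h | h
    · obtain ⟨p, hp, h1, h2⟩ := Nat.Prime.not_coprime_iff_dvd.1 h
      have hc : Nat.Coprime p 210 := by
        rw [hp.coprime_iff_not_dvd]
        intro h3
        have h4 : p ∣ 106 := (Nat.dvd_add_right (h3.mul_right _)).1 h1
        have h5 : p ∣ 71 := (Nat.dvd_add_right (h3.mul_right _)).1 h2
        have := Nat.dvd_gcd h4 h5
        norm_num at this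
        exact hp.one_lt.ne' this
      have hle := Nat.le_of_dvd (by omega) h2
      refine Finset.mem_biUnion.2 ⟨p, Finset.mem_filter.2 ⟨Finset.mem_Icc.2 ⟨prime_ge_11 p hp hc, by omega⟩, hp, hc⟩, ?_⟩
      exact Finset.mem_union_left _ (Finset.mem_filter.2 ⟨hz1, h1, h2⟩)
    · obtain ⟨p, hp, h1, h2⟩ := Nat.Prime.not_coprime_iff_dvd.1 h
      have hc : Nat.Coprime p 210 := Nat.Coprime.coprime_dvd_left h1 (aa_coprime z)
      have hle := Nat.le_of_dvd (by omega) h2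
      refine Finset.mem_biUnion.2 ⟨p, Finset.mem_filter.2 ⟨Finset.mem_Icc.2 ⟨prime_ge_11 p hp hc, by omega⟩, hp, hc⟩, ?_⟩
      refine Finset.mem_union_right _ (Finset.mem_filter.2 ⟨hz1, ?_, h2⟩)
      have e : aa z = ((210*z.1+106)^2+6) + (210*z.2+71)^2 := by unfold aa; ring
      rw [e] at h1
      exact (Nat.dvd_add_left (h2.trans (dvd_pow_self _ (by norm_num)))).1 h1
  · refine Finset.card_biUnion_le.trans (Finset.sum_le_sum ?_)
    intro p hp
    obtain ⟨-, hp1, hp2⟩ := Finset.mem_filter.1 hp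
    have l1 := lin_Ico p Y 106 hp1.pos hp2
    have l2 := lin_Ico p Y 71 hp1.pos hp2
    have l3 := quad_Ico p Y 106 hp1 hp2 6
    have c1 := prod_count Y _ _ _ _ l1 l2
    have c2 := prod_count Y _ _ _ _ l3 l2
    refine (Finset.card_union_le _ _).trans ?_
    calc _ ≤ (Y/p+1)*(Y/p+1) + (Y/p+1)*2*(Y/p+1) := Nat.add_le_add c1 c2
      _ = _ := by ring

lemma bad12R (Y : ℕ) (hY : 1 ≤ Y) :
    (((blk Y).filter (fun z => ¬ (Nat.Coprime (210*z.1+106) (210*z.2+71) ∧ Nat.Coprime (aa z) (210*z.2+71)))).card:ℝ)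
      ≤ 3/10*(Y:ℝ)^2 + 6*Y*(1+Real.log ((526*Y:ℕ):ℝ)) + 1578*Y := by
  have h1 : (((blk Y).filter (fun z => ¬ (Nat.Coprime (210*z.1+106) (210*z.2+71) ∧ Nat.Coprime (aa z) (210*z.2+71)))).card:ℝ) ≤ ∑ p ∈ prs (526*Y), ((3*(Y/p+1)^2 : ℕ):ℝ) := by
    exact_mod_cast bad12 Y hY
  refine h1.trans ?_
  have h2 : ∑ p ∈ prs (526*Y), ((3*(Y/p+1)^2 : ℕ):ℝ) ≤ ∑ p ∈ Finset.Icc 11 (526*Y), (3*(Y:ℝ)^2*((1:ℝ)/(p:ℝ)^2) + 6*Y*((1:ℝ)/p) + 3) := by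
    refine le_trans (Finset.sum_le_sum ?_) (Finset.sum_le_sum_of_subset_of_nonneg (Finset.filter_subset _ _) (fun _ _ _ => by positivity))
    intro p _
    have : ((Y/p:ℕ):ℝ) ≤ Y/p := Nat.cast_div_le
    push_cast
    calc (3:ℝ) * (((Y/p:ℕ):ℝ)+1)^2 ≤ 3*((Y:ℝ)/p+1)^2 := by gcongr
      _ = _ := by ring
  refine h2.trans ?_
  rw [Finset.sum_add_distrib, Finset.sum_add_distrib, ← Finset.mul_sum, ← Finset.mul_sum, Finset.sum_const, nsmul_eq_mul]
  have h3 := sum_inv_sq_11 (526*Y)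
  have h4 := sum_inv_11 (526*Y)
  have h5 : ((Finset.Icc 11 (526*Y)).card:ℝ) ≤ 526*Y := by
    rw [Nat.card_Icc]
    have : 526*Y+1-11 ≤ 526*Y := by omega
    exact_mod_cast this
  have hY0 : (0:ℝ) ≤ Y := Nat.cast_nonneg _
  have h6 := mul_le_mul_of_nonneg_left h3 (show (0:ℝ) ≤ 3*(Y:ℝ)^2 by positivity)
  have h7 := mul_le_mul_of_nonneg_left h4 (show (0:ℝ) ≤ 6*(Y:ℝ) by positivity)
  linarith

lemma bad3R (Y : ℕ) (hY : 1 ≤ Y) :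
    (((blk Y).filter (fun z => ¬ (∑ p ∈ (aa z).primeFactors, (1:ℝ)/p ≤ 1/2))).card:ℝ)
      ≤ 4/10*(Y:ℝ)^2 + 4*Y*(1+Real.log ((2^20*Y^2:ℕ):ℝ)) := by
  classical
  set M := 2^20*Y^2 with hM
  have hNp : ∀ p ∈ prs M, ((((blk Y).filter (fun z => p ∣ aa z)).card:ℕ):ℝ) ≤ 2*Y*((Y:ℝ)/p+1) := by
    intro p hp
    obtain ⟨-, hp1, hp2⟩ := Finset.mem_filter.1 hp
    have h1 : ((blk Y).filter (fun z => p ∣ aa z)).card ≤ ((Y/p+1)*2) * (Finset.Ico Y (2*Y)).card := by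
      apply Finset.card_le_mul_card_image_of_maps_to (f := fun z : ℕ × ℕ => z.2)
      · intro z hz
        exact Finset.mem_Ico.2 ((mem_blk Y z).1 (Finset.mem_filter.1 hz).1).2
      · intro v _
        have e : (((blk Y).filter (fun z => p ∣ aa z)).filter (fun z => z.2 = v)).card = ((((blk Y).filter (fun z => p ∣ aa z)).filter (fun z => z.2 = v)).image (fun z => z.1)).card := by
          rw [Finset.card_image_of_injOn]
          intro a ha b hb hab
          have t1 := (Finset.mem_filter.1 ha).2
          have t2 := (Finset.mem_filter.1 hb).2
          exact Prod.ext hab (t1.trans t2.symm)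
        rw [e]
        refine le_trans (Finset.card_le_card ?_) (quad_Ico p Y 106 hp1 hp2 ((210*v+71)^2+6))
        intro u hu
        obtain ⟨z, hz, rfl⟩ := Finset.mem_image.1 hu
        obtain ⟨hz1, hz2⟩ := Finset.mem_filter.1 hz
        obtain ⟨hz3, hz4⟩ := Finset.mem_filter.1 hz1
        refine Finset.mem_filter.2 ⟨Finset.mem_Ico.2 ((mem_blk Y z).1 hz3).1, ?_⟩
        rw [← hz2]
        unfold aa at hz4
        rwa [← add_assoc]
    rw [Nat.card_Ico, show 2*Y - Y = Y by omega] at h1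
    have : ((Y/p:ℕ):ℝ) ≤ Y/p := Nat.cast_div_le
    calc _ ≤ ((((Y/p+1)*2)*Y:ℕ):ℝ) := by exact_mod_cast h1
      _ = 2*Y*(((Y/p:ℕ):ℝ)+1) := by push_cast; ring
      _ ≤ _ := by gcongr
  set B := (blk Y).filter (fun z => ¬ (∑ p ∈ (aa z).primeFactors, (1:ℝ)/p ≤ 1/2)) with hB
  have h1 : (B.card:ℝ)*(1/2) ≤ ∑ z ∈ blk Y, ∑ p ∈ (aa z).primeFactors, (1:ℝ)/p := by
    calc (B.card:ℝ)*(1/2) = ∑ z ∈ B, (1/2:ℝ) := by rw [Finset.sum_const, nsmul_eq_mul]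
      _ ≤ ∑ z ∈ B, ∑ p ∈ (aa z).primeFactors, (1:ℝ)/p := by
        apply Finset.sum_le_sum
        intro z hz
        exact (not_le.1 (Finset.mem_filter.1 hz).2).le
      _ ≤ _ := Finset.sum_le_sum_of_subset_of_nonneg (Finset.filter_subset _ _) (fun _ _ _ => Finset.sum_nonneg (fun _ _ => by positivity))
  have h2 : ∑ z ∈ blk Y, ∑ p ∈ (aa z).primeFactors, (1:ℝ)/p ≤ ∑ z ∈ blk Y, ∑ p ∈ prs M, if p ∣ aa z then (1:ℝ)/p else 0 := by
    apply Finset.sum_le_sum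
    intro z hz
    rw [← Finset.sum_filter]
    apply Finset.sum_le_sum_of_subset_of_nonneg
    · intro p hp
      have hp1 := Nat.prime_of_mem_primeFactors hp
      have hp2 := Nat.dvd_of_mem_primeFactors hp
      have hc : Nat.Coprime p 210 := Nat.Coprime.coprime_dvd_left hp2 (aa_coprime z)
      have hle := (Nat.le_of_dvd (aa_pos z) hp2).trans (aa_le Y hY z hz)
      exact Finset.mem_filter.2 ⟨Finset.mem_filter.2 ⟨Finset.mem_Icc.2 ⟨prime_ge_11 p hp1 hc, hle⟩, hp1, hc⟩, hp2⟩
    · intro _ _ _; positivity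
  have h3 : ∑ z ∈ blk Y, ∑ p ∈ prs M, (if p ∣ aa z then (1:ℝ)/p else 0) ≤ ∑ p ∈ Finset.Icc 11 M, (2*(Y:ℝ)^2*((1:ℝ)/(p:ℝ)^2) + 2*Y*((1:ℝ)/p)) := by
    rw [Finset.sum_comm]
    refine le_trans (Finset.sum_le_sum ?_) (Finset.sum_le_sum_of_subset_of_nonneg (Finset.filter_subset _ _) (fun _ _ _ => by positivity))
    intro p hp
    rw [← Finset.sum_filter, Finset.sum_const, nsmul_eq_mul]
    calc _ ≤ (2*Y*((Y:ℝ)/p+1)) * ((1:ℝ)/p) := mul_le_mul_of_nonneg_right (hNp p hp) (by positivity)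
      _ = _ := by ring
  rw [Finset.sum_add_distrib, ← Finset.mul_sum, ← Finset.mul_sum] at h3
  have h4 := sum_inv_sq_11 M
  have h5 := sum_inv_11 M
  have hY0 : (0:ℝ) ≤ Y := Nat.cast_nonneg _
  have h6 := mul_le_mul_of_nonneg_left h4 (show (0:ℝ) ≤ 2*(Y:ℝ)^2 by positivity)
  have h7 := mul_le_mul_of_nonneg_left h5 (show (0:ℝ) ≤ 2*(Y:ℝ) by positivity)
  linarith

def xa (z : ℕ × ℕ) : ℤ := 210*(z.1:ℤ)+106
def xb (z : ℕ × ℕ) : ℤ := 210*(z.2:ℤ)+71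

lemma aa_eq (z : ℕ × ℕ) : (aa z : ℤ) = xa z^2 + xb z^2 + 6 := by
  unfold aa xa xb; push_cast; ring

def G4 (K : ℕ) (z : ℕ × ℕ) : Prop := ∀ δ1 δ2 : ℤ, |δ1| ≤ K → |δ2| ≤ K →
  (aa z:ℤ) ∣ (xa z*δ2 - xb z*δ1)*(xa z*δ1+xb z*δ2) → δ1 = 0 ∧ δ2 = 0

lemma g4_fib (Y : ℕ) (δ1 δ2 j : ℤ) (h0 : ¬ (δ1 = 0 ∧ δ2 = 0)) :
    ((blk Y).filter (fun z => (xa z*δ2 - xb z*δ1)*(xa z*δ1+xb z*δ2) = (aa z:ℤ)*j)).card ≤ 2*Y := by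
  classical
  have h1 : ((blk Y).filter (fun z => (xa z*δ2 - xb z*δ1)*(xa z*δ1+xb z*δ2) = (aa z:ℤ)*j)).card ≤ 2 * (Finset.Ico Y (2*Y)).card := by
    apply Finset.card_le_mul_card_image_of_maps_to (f := fun z : ℕ × ℕ => z.2)
    · intro z hz
      exact Finset.mem_Ico.2 ((mem_blk Y z).1 (Finset.mem_filter.1 hz).1).2
    · intro v _
      set F := ((blk Y).filter (fun z => (xa z*δ2 - xb z*δ1)*(xa z*δ1+xb z*δ2) = (aa z:ℤ)*j)).filter (fun z => z.2 = v) with hF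
      have e : F.card = (F.image (fun z => xa z)).card := by
        rw [Finset.card_image_of_injOn]
        intro a ha b hb hab
        have t1 := (Finset.mem_filter.1 ha).2
        have t2 := (Finset.mem_filter.1 hb).2
        simp only [xa] at hab
        exact Prod.ext (by omega) (t1.trans t2.symm)
      rw [e]
      set w : ℤ := 210*(v:ℤ)+71 with hw
      have hwpos : 0 < w := by omega
      apply quad_card (δ1*δ2 - j) (w*(δ2^2-δ1^2)) (-w^2*(δ1*δ2+j) - 6*j)
      · intro x hx
        obtain ⟨z, hz, rfl⟩ := Finset.mem_image.1 hx
        obtain ⟨hz1, hz2⟩ := Finset.mem_filter.1 hz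
        have hz3 := (Finset.mem_filter.1 hz1).2
        rw [aa_eq] at hz3
        have : xb z = w := by unfold xb; rw [hz2]
        rw [this] at hz3
        linear_combination hz3
      · rintro ⟨e1, e2, e3⟩
        apply h0
        have e4 : δ2^2 - δ1^2 = 0 := (mul_eq_zero.1 e2).resolve_left hwpos.ne'
        have e5 : (δ1*δ2)*(w^2+3) = 0 := by
          have : j = δ1*δ2 := by linarith
          rw [this] at e3
          nlinarith
        have e6 : δ1*δ2 = 0 := (mul_eq_zero.1 e5).resolve_right (by positivity)
        rcases mul_eq_zero.1 e6 with h | h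
        · rw [h] at e4
          exact ⟨h, by simpa using e4⟩
        · rw [h] at e4
          exact ⟨by simpa using e4, h⟩
  rw [Nat.card_Ico, show 2*Y - Y = Y by omega] at h1
  exact h1

lemma bad4 (Y K : ℕ) (hK : 1 ≤ K) [DecidablePred (G4 K)] : ((blk Y).filter (fun z => ¬ G4 K z)).card ≤ 54*K^4*Y := by
  classical
  set D : Finset ((ℤ × ℤ) × ℤ) := (((Finset.Icc (-(K:ℤ)) K) ×ˢ (Finset.Icc (-(K:ℤ)) K)) ×ˢ (Finset.Icc (-((K:ℤ)^2)) ((K:ℤ)^2))).filter (fun t => ¬ (t.1.1 = 0 ∧ t.1.2 = 0)) with hD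
  have h1 : ((blk Y).filter (fun z => ¬ G4 K z)) ⊆ D.biUnion (fun t => (blk Y).filter (fun z => (xa z*t.1.2 - xb z*t.1.1)*(xa z*t.1.1+xb z*t.1.2) = (aa z:ℤ)*t.2)) := by
    intro z hz
    obtain ⟨hz1, hz2⟩ := Finset.mem_filter.1 hz
    unfold G4 at hz2
    push Not at hz2
    obtain ⟨δ1, δ2, k1, k2, ⟨j, hj⟩, h0⟩ := hz2
    refine Finset.mem_biUnion.2 ⟨((δ1, δ2), j), ?_, Finset.mem_filter.2 ⟨hz1, hj⟩⟩
    rw [hD, Finset.mem_filter]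
    refine ⟨?_, fun h => h0 h.1 h.2⟩
    rw [Finset.mem_product, Finset.mem_product, Finset.mem_Icc, Finset.mem_Icc, Finset.mem_Icc]
    refine ⟨⟨abs_le.1 k1, abs_le.1 k2⟩, ?_⟩
    rw [← abs_le]
    have ha := aa_eq z
    have q1 : δ1^2 ≤ (K:ℤ)^2 := sq_le_sq' (abs_le.1 k1).1 (abs_le.1 k1).2
    have q2 : δ2^2 ≤ (K:ℤ)^2 := sq_le_sq' (abs_le.1 k2).1 (abs_le.1 k2).2
    have hapos : 0 < (aa z:ℤ) := by exact_mod_cast aa_pos z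
    have e : (xa z*δ2 - xb z*δ1)^2 + (xa z*δ1+xb z*δ2)^2 = (xa z^2+xb z^2)*(δ1^2+δ2^2) := by ring
    set α := xa z*δ2 - xb z*δ1
    set β := xa z*δ1+xb z*δ2
    have hab : 2 * |α * β| ≤ (xa z^2+xb z^2)*(δ1^2+δ2^2) := by
      rw [← e, abs_mul]
      nlinarith [sq_nonneg (|α|-|β|), sq_abs α, sq_abs β]
    have hab2 : (xa z^2+xb z^2)*(δ1^2+δ2^2) ≤ (aa z:ℤ)*(2*(K:ℤ)^2) := by
      apply mul_le_mul <;> first | positivity | nlinarith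
    rw [hj, abs_mul, abs_of_pos hapos] at hab
    have : (aa z:ℤ) * |j| ≤ (aa z:ℤ)*(K:ℤ)^2 := by nlinarith
    exact le_of_mul_le_mul_left this hapos
  have h2 : D.card ≤ 27*K^4 := by
    refine (Finset.card_filter_le _ _).trans ?_
    rw [Finset.card_product, Finset.card_product, Int.card_Icc, Int.card_Icc]
    have e1 : ((K:ℤ)+1 - -(K:ℤ)).toNat = 2*K+1 := by omega
    have e2 : ((K:ℤ)^2+1 - -((K:ℤ)^2)).toNat = 2*K^2+1 := by
      have : ((K:ℤ)^2+1 - -((K:ℤ)^2)) = ((2*K^2+1:ℕ):ℤ) := by push_cast; ring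
      rw [this, Int.toNat_natCast]
    rw [e1, e2]
    have hK2 : 1 ≤ K^2 := Nat.one_le_pow _ _ hK
    calc (2*K+1)*(2*K+1)*(2*K^2+1) ≤ (3*K)*(3*K)*(3*K^2) := by gcongr <;> omega
      _ = _ := by ring
  refine (Finset.card_le_card h1).trans ?_
  calc _ ≤ D.card * (2*Y) := by
        apply Finset.card_biUnion_le_card_mul
        intro t ht
        exact g4_fib Y t.1.1 t.1.2 t.2 (Finset.mem_filter.1 ht).2
    _ ≤ 27*K^4*(2*Y) := by gcongr
    _ = _ := by ring

structure Good (K : ℕ) (z : ℕ × ℕ) : Prop where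
  g1 : Nat.Coprime (210*z.1+106) (210*z.2+71)
  g2 : Nat.Coprime (aa z) (210*z.2+71)
  g3 : ∑ p ∈ (aa z).primeFactors, (1:ℝ)/p ≤ 1/2
  g4 : G4 K z

lemma good_num (Y K b12 b3 b4 : ℝ) (hY : 2^32 ≤ Y) (hK0 : 0 ≤ K) (hK : K^8 ≤ Y)
    (h12 : b12 ≤ 3/10*Y^2 + 6*Y*(1+Real.log (526*Y)) + 1578*Y)
    (h3 : b3 ≤ 4/10*Y^2 + 4*Y*(1+Real.log (2^20*Y^2)))
    (h4 : b4 ≤ 54*K^4*Y) : b12 + b3 + b4 ≤ 3/4*Y^2 := by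
  have hY0 : 0 < Y := by linarith
  set s := Real.sqrt Y with hs
  have hs2 : s^2 = Y := Real.sq_sqrt hY0.le
  have hs0 : 2^16 ≤ s := by
    apply Real.le_sqrt_of_sq_le; norm_num at hY ⊢; exact hY
  have hK4 : K^4 ≤ s := by
    apply Real.le_sqrt_of_sq_le
    calc (K^4)^2 = K^8 := by ring
      _ ≤ Y := hK
  have hl : Real.log Y ≤ 2*s := by
    have : Real.log Y = 2*Real.log s := by rw [← hs2, Real.log_pow]; norm_num
    rw [this]
    have := Real.log_le_sub_one_of_pos (show 0 < s by linarith)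
    linarith
  have hl2 : Real.log 2 ≤ 1 := by
    have := Real.log_le_sub_one_of_pos (show (0:ℝ) < 2 by norm_num)
    linarith
  have l1 : Real.log (2^20*Y^2) ≤ 20 + 4*s := by
    rw [Real.log_mul (by positivity) (by positivity), Real.log_pow, Real.log_pow]
    push_cast; linarith
  have l2 : Real.log (526*Y) ≤ 20+4*s := by
    refine le_trans (Real.log_le_log (by positivity) ?_) l1
    nlinarith
  have m1 : 6*Y*(1+Real.log (526*Y)) ≤ 6*Y*(21+4*s) := mul_le_mul_of_nonneg_left (by linarith) (by positivity)
  have m2 : 4*Y*(1+Real.log (2^20*Y^2)) ≤ 4*Y*(21+4*s) := mul_le_mul_of_nonneg_left (by linarith) (by positivity)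
  have m3 : 54*K^4*Y ≤ 54*s*Y := by gcongr
  have m4 : Y*(210+40*s+1578+54*s) ≤ Y*(1/20*Y) := by
    apply mul_le_mul_of_nonneg_left _ hY0.le
    have : s * 2^16 ≤ s * s := mul_le_mul_of_nonneg_left hs0 (by linarith)
    rw [← hs2]; nlinarith
  have m5 := h12.trans (add_le_add_left (add_le_add_right m1 _) _)
  have m6 := h3.trans (add_le_add_right m2 _)
  have m7 := h4.trans m3
  clear h12 h3 h4 m1 m2 m3 l1 l2 hl hl2 hK4
  have m8 : Y*(210+40*s+1578+54*s) = 210*Y+40*(s*Y)+1578*Y+54*(s*Y) := by ring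
  have m9 : Y*(1/20*Y) = 1/20*Y^2 := by ring
  have m10 : 6*Y*(21+4*s) = 126*Y+24*(s*Y) := by ring
  have m11 : 4*Y*(21+4*s) = 84*Y+16*(s*Y) := by ring
  have m12 : 54*s*Y = 54*(s*Y) := by ring
  rw [m8, m9] at m4
  rw [m10] at m5
  rw [m11] at m6
  rw [m12] at m7
  linarith

lemma good_card (Y K : ℕ) (hY : 2^32 ≤ Y) (hK : 1 ≤ K) (hKY : K^8 ≤ Y) [DecidablePred (Good K)] :
    (Y:ℝ)^2/4 ≤ (((blk Y).filter (fun z => Good K z)).card:ℝ) := by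
  classical
  have h1 := bad12R Y (by omega)
  have h2 := bad3R Y (by omega)
  have h3 : (((blk Y).filter (fun z => ¬ G4 K z)).card:ℝ) ≤ 54*(K:ℝ)^4*Y := by exact_mod_cast bad4 Y K hK
  have h4 : blk Y ⊆ ((blk Y).filter (fun z => Good K z)) ∪ (((blk Y).filter (fun z => ¬ (Nat.Coprime (210*z.1+106) (210*z.2+71) ∧ Nat.Coprime (aa z) (210*z.2+71)))) ∪ (((blk Y).filter (fun z => ¬ (∑ p ∈ (aa z).primeFactors, (1:ℝ)/p ≤ 1/2))) ∪ ((blk Y).filter (fun z => ¬ G4 K z)))) := by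
    intro z hz
    simp only [Finset.mem_union, Finset.mem_filter, hz, true_and]
    by_contra hcon
    push Not at hcon
    exact hcon.1 ⟨hcon.2.1.1, hcon.2.1.2, hcon.2.2.1, hcon.2.2.2⟩
  have h5 := Finset.card_le_card h4
  have h6 := h5.trans ((Finset.card_union_le _ _).trans (Nat.add_le_add_left ((Finset.card_union_le _ _).trans (Nat.add_le_add_left (Finset.card_union_le _ _) _)) _))
  rw [card_blk] at h6
  have h7 := (Nat.cast_le (α := ℝ)).2 h6
  push_cast at h7
  rw [show ((2^20*Y^2:ℕ):ℝ) = 2^20*(Y:ℝ)^2 by norm_num] at h2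
  push_cast at h1
  have h8 := good_num Y K _ _ _ (by exact_mod_cast hY) (Nat.cast_nonneg _) (by exact_mod_cast hKY) h1 h2 h3
  linarith

lemma sum_inv_sq_2 (M : ℕ) : ∑ p ∈ Finset.Icc 2 M, (1:ℝ)/(p:ℝ)^2 ≤ 3/4 := by
  have : ∀ n : ℕ, ∑ p ∈ Finset.Ico 2 (2+n), (1:ℝ)/(p:ℝ)^2 ≤ 2/3 - 1/(3/2+n) := by
    intro n
    induction n with
    | zero => simp
    | succ n ih =>
      rw [← add_assoc, Finset.sum_Ico_succ_top (by omega)]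
      have h : (1:ℝ)/((2+n:ℕ):ℝ)^2 ≤ 1/(3/2+(n:ℝ)) - 1/(3/2+((n+1:ℕ):ℝ)) := by
        push_cast
        rw [div_sub_div _ _ (by positivity) (by positivity), div_le_div_iff₀ (by positivity) (by positivity)]
        have : (0:ℝ) ≤ n := Nat.cast_nonneg _
        nlinarith
      linarith
  have h1 : Finset.Icc 2 M ⊆ Finset.Ico 2 (2+M) := by
    intro x hx
    rw [Finset.mem_Icc] at hx
    rw [Finset.mem_Ico]; omega
  calc _ ≤ ∑ p ∈ Finset.Ico 2 (2+M), (1:ℝ)/(p:ℝ)^2 := Finset.sum_le_sum_of_subset_of_nonneg h1 (fun _ _ _ => by positivity)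
    _ ≤ _ := (this M).trans (by have : (0:ℝ) ≤ 1/(3/2+(M:ℝ)) := by positivity
                                linarith)

lemma sum_inv_2 (M : ℕ) : ∑ p ∈ Finset.Icc 2 M, (1:ℝ)/p ≤ 1 + Real.log M := by
  have h := harmonic_le_one_add_log M
  rw [harmonic_eq_sum_Icc] at h
  push_cast at h
  refine le_trans ?_ h
  simp only [one_div]
  apply Finset.sum_le_sum_of_subset_of_nonneg
  · intro x hx
    rw [Finset.mem_Icc] at hx ⊢; omega
  · intro _ _ _; positivity

lemma modEq_count_ge (N a v : ℕ) (ha : 0 < a) :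
    (N:ℝ)/a - 1 ≤ (((Finset.Ico N (2*N)).filter (fun x => x ≡ v [MOD a])).card:ℝ) := by
  have h := Nat.Ico_filter_modEq_card N (2*N) ha v
  set c := ((Finset.Ico N (2*N)).filter (fun x => x ≡ v [MOD a])).card
  have h1 : ⌈(((2*N:ℕ):ℚ) - v) / (a : ℚ)⌉ - ⌈((N:ℚ) - v) / (a : ℚ)⌉ ≤ (c:ℤ) := by rw [h]; exact le_max_left _ _
  have h2 : (((2*N:ℕ):ℚ) - v) / (a : ℚ) ≤ (⌈(((2*N:ℕ):ℚ) - v) / (a : ℚ)⌉ : ℚ) := Int.le_ceil _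
  have h3 : (⌈((N:ℚ) - v) / (a : ℚ)⌉ : ℚ) < ((N:ℚ) - v) / (a : ℚ) + 1 := Int.ceil_lt_add_one _
  have h4 : ((⌈(((2*N:ℕ):ℚ) - v) / (a : ℚ)⌉:ℚ) - ⌈((N:ℚ) - v) / (a : ℚ)⌉) ≤ (c:ℚ) := by exact_mod_cast h1
  have h5 : (((2*N:ℕ):ℚ) - v) / (a : ℚ) = (N:ℚ)/a + ((N:ℚ) - v) / (a : ℚ) := by push_cast; ring
  have h6 : (N:ℚ)/a - 1 ≤ (c:ℚ) := by linarith
  have := (Rat.cast_le (K := ℝ)).2 h6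
  push_cast at this
  exact this

lemma coprime_count_ge (N a : ℕ) (ha : 0 < a) :
    (a.totient:ℝ) * ((N:ℝ)/a - 1) ≤ (((Finset.Ico N (2*N)).filter (fun x => a.Coprime x)).card:ℝ) := by
  have h1 : ((Finset.Ico N (2*N)).filter (fun x => a.Coprime x)).card = ∑ v ∈ (Finset.range a).filter (fun x => a.Coprime x), (((Finset.Ico N (2*N)).filter (fun x => a.Coprime x)).filter (fun x => x % a = v)).card := by
    apply Finset.card_eq_sum_card_fiberwise
    intro x hx
    have := (Finset.mem_filter.1 hx).2
    refine Finset.mem_coe.2 (Finset.mem_filter.2 ⟨Finset.mem_range.2 (Nat.mod_lt _ ha), ?_⟩)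
    rw [Nat.Coprime, Nat.gcd_comm, ← Nat.gcd_rec]; exact this
  rw [h1, Nat.cast_sum]
  have h2 : ∀ v ∈ (Finset.range a).filter (fun x => a.Coprime x), (N:ℝ)/a - 1 ≤ ((((Finset.Ico N (2*N)).filter (fun x => a.Coprime x)).filter (fun x => x % a = v)).card:ℝ) := by
    intro v hv
    obtain ⟨hv1, hv2⟩ := Finset.mem_filter.1 hv
    refine (modEq_count_ge N a v ha).trans ?_
    have : (Finset.Ico N (2*N)).filter (fun x => x ≡ v [MOD a]) ⊆ ((Finset.Ico N (2*N)).filter (fun x => a.Coprime x)).filter (fun x => x % a = v) := by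
      intro x hx
      obtain ⟨hx1, hx2⟩ := Finset.mem_filter.1 hx
      have hx3 : x % a = v := by
        rw [Nat.ModEq, Nat.mod_eq_of_lt (Finset.mem_range.1 hv1)] at hx2; exact hx2
      refine Finset.mem_filter.2 ⟨Finset.mem_filter.2 ⟨hx1, ?_⟩, hx3⟩
      rw [Nat.Coprime, Nat.gcd_rec, Nat.gcd_comm, hx3]; exact hv2
    exact_mod_cast Finset.card_le_card this
  have h3 := Finset.sum_le_sum h2
  rw [Finset.sum_const, nsmul_eq_mul] at h3
  exact h3

def PN (N a c : ℕ) : Finset (ℕ × ℕ) :=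
  ((Finset.Ico N (2*N)) ×ˢ (Finset.Ico N (2*N))).filter (fun p => p.1 ≡ c*p.2 [MOD a] ∧ a.Coprime p.2)

lemma PN_ge (N a c : ℕ) (ha : 0 < a) (haN : a ≤ N) : (a.totient:ℝ) * ((N:ℝ)/a - 1)^2 ≤ ((PN N a c).card:ℝ) := by
  classical
  have h1 : (PN N a c).card = ∑ v ∈ (Finset.Ico N (2*N)).filter (fun x => a.Coprime x), ((PN N a c).filter (fun p => p.2 = v)).card := by
    apply Finset.card_eq_sum_card_fiberwise
    intro p hp
    obtain ⟨h1, h2⟩ := Finset.mem_filter.1 hp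
    exact Finset.mem_coe.2 (Finset.mem_filter.2 ⟨(Finset.mem_product.1 h1).2, h2.2⟩)
  have ha' : (0:ℝ) < a := by exact_mod_cast ha
  have h0 : 0 ≤ (N:ℝ)/a - 1 := by
    rw [sub_nonneg, le_div_iff₀ ha', one_mul]; exact_mod_cast haN
  have h2 : ∀ v ∈ (Finset.Ico N (2*N)).filter (fun x => a.Coprime x), (N:ℝ)/a - 1 ≤ (((PN N a c).filter (fun p => p.2 = v)).card:ℝ) := by
    intro v hv
    obtain ⟨hv1, hv2⟩ := Finset.mem_filter.1 hv
    refine (modEq_count_ge N a (c*v) ha).trans ?_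
    have : ((Finset.Ico N (2*N)).filter (fun x => x ≡ c*v [MOD a])).card ≤ ((PN N a c).filter (fun p => p.2 = v)).card := by
      apply Finset.card_le_card_of_injOn (fun x => (x, v))
      · intro x hx
        obtain ⟨hx1, hx2⟩ := Finset.mem_filter.1 hx
        exact Finset.mem_coe.2 (Finset.mem_filter.2 ⟨Finset.mem_filter.2 ⟨Finset.mem_product.2 ⟨hx1, hv1⟩, hx2, hv2⟩, rfl⟩)
      · intro x _ y _ hxy
        exact (Prod.mk.inj hxy).1
    exact_mod_cast this
  have h3 := Finset.sum_le_sum h2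
  rw [Finset.sum_const, nsmul_eq_mul] at h3
  rw [h1, Nat.cast_sum]
  refine le_trans ?_ h3
  calc _ = ((a.totient:ℝ) * ((N:ℝ)/a - 1)) * ((N:ℝ)/a - 1) := by ring
    _ ≤ _ := mul_le_mul_of_nonneg_right (coprime_count_ge N a ha) h0

lemma PN_bad (N a c q : ℕ) (ha : 0 < a) (hq : 0 < q) :
    (((PN N a c).filter (fun p => q ∣ p.1 ∧ q ∣ p.2)).card:ℝ) ≤ a.totient * ((N:ℝ)/(q*a)+3) * ((N:ℝ)/(q*a)+1) := by
  classical
  set B := (PN N a c).filter (fun p => q ∣ p.1 ∧ q ∣ p.2) with hB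
  have ha' : (0:ℝ) < a := by exact_mod_cast ha
  have hq' : (0:ℝ) < q := by exact_mod_cast hq
  have mB : ∀ p ∈ B, (p.1 ∈ Finset.Ico N (2*N) ∧ p.2 ∈ Finset.Ico N (2*N)) ∧ (p.1 ≡ c*p.2 [MOD a] ∧ a.Coprime p.2) ∧ q ∣ p.1 ∧ q ∣ p.2 := by
    intro p hp
    obtain ⟨h1, h2⟩ := Finset.mem_filter.1 hp
    obtain ⟨h3, h4⟩ := Finset.mem_filter.1 h1
    exact ⟨Finset.mem_product.1 h3, h4, h2⟩
  set V := (Finset.Ico N (2*N)).filter (fun x => a.Coprime x ∧ q ∣ x) with hV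
  have h1 : B.card ≤ (N/(q*a)+1) * V.card := by
    apply Finset.card_le_mul_card_image_of_maps_to (f := fun p : ℕ × ℕ => p.2)
    · intro p hp
      obtain ⟨t1, t2, t3⟩ := mB p hp
      exact Finset.mem_filter.2 ⟨t1.2, t2.2, t3.2⟩
    · intro v hv
      obtain ⟨hv1, hv2, hv3⟩ := Finset.mem_filter.1 hv
      have hcop : Nat.Coprime q a := (Nat.Coprime.coprime_dvd_right hv3 hv2).symm
      have e : (B.filter (fun p => p.2 = v)).card = ((B.filter (fun p => p.2 = v)).image (fun p => (p.1:ℤ))).card := by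
        rw [Finset.card_image_of_injOn]
        intro x hx y hy hxy
        have t1 := (Finset.mem_filter.1 hx).2
        have t2 := (Finset.mem_filter.1 hy).2
        have hxy' : (x.1:ℤ) = y.1 := hxy
        exact Prod.ext (by exact_mod_cast hxy') (t1.trans t2.symm)
      rw [e]
      apply card_congr_le _ (N:ℤ) N (q*a) (by positivity)
      · intro x hx
        obtain ⟨p, hp, rfl⟩ := Finset.mem_image.1 hx
        have := Finset.mem_Ico.1 (mB p (Finset.mem_filter.1 hp).1).1.1
        omega
      · intro x hx y hy
        obtain ⟨p, hp, rfl⟩ := Finset.mem_image.1 hx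
        obtain ⟨p', hp', rfl⟩ := Finset.mem_image.1 hy
        obtain ⟨hp1, hp2⟩ := Finset.mem_filter.1 hp
        obtain ⟨hp1', hp2'⟩ := Finset.mem_filter.1 hp'
        obtain ⟨-, ⟨s1, -⟩, s2, -⟩ := mB p hp1
        obtain ⟨-, ⟨s1', -⟩, s2', -⟩ := mB p' hp1'
        push_cast
        apply IsCoprime.mul_dvd (Nat.isCoprime_iff_coprime.2 hcop)
        · exact dvd_sub (Int.natCast_dvd_natCast.2 s2) (Int.natCast_dvd_natCast.2 s2')
        · rw [hp2] at s1
          rw [hp2'] at s1'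
          exact (Nat.modEq_iff_dvd.1 (s1'.trans s1.symm))
  have h2 : V.card ≤ a.totient * ((N/q+2)/a+1) := by
    refine le_trans ?_ (Nat.Ico_filter_coprime_le (N/q) (N/q+2) ha.ne')
    apply Finset.card_le_card_of_injOn (fun x => x/q)
    · intro x hx
      obtain ⟨hx1, hx2, hx3⟩ := Finset.mem_filter.1 hx
      obtain ⟨hx4, hx5⟩ := Finset.mem_Ico.1 hx1
      refine Finset.mem_coe.2 (Finset.mem_filter.2 ⟨Finset.mem_Ico.2 ⟨Nat.div_le_div_right hx4, ?_⟩, ?_⟩)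
      · rw [Nat.div_lt_iff_lt_mul hq]
        have := Nat.lt_div_mul_add (a := N) hq
        nlinarith
      · exact Nat.Coprime.coprime_dvd_right (Nat.div_dvd_of_dvd hx3) hx2
    · intro x hx y hy hxy
      obtain ⟨_, _, hx3⟩ := Finset.mem_filter.1 hx
      obtain ⟨_, _, hy3⟩ := Finset.mem_filter.1 hy
      simp only at hxy
      rw [← Nat.div_mul_cancel hx3, ← Nat.div_mul_cancel hy3, hxy]
  have h3 : ((N/(q*a)+1:ℕ):ℝ) ≤ (N:ℝ)/(q*a)+1 := by
    have : ((N/(q*a):ℕ):ℝ) ≤ (N:ℝ)/((q*a:ℕ):ℝ) := Nat.cast_div_le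
    push_cast at this ⊢
    linarith
  have h4 : (((N/q+2)/a+1:ℕ):ℝ) ≤ (N:ℝ)/(q*a)+3 := by
    have t1 : (((N/q+2)/a:ℕ):ℝ) ≤ ((N/q+2:ℕ):ℝ)/a := Nat.cast_div_le
    have t2 : ((N/q:ℕ):ℝ) ≤ (N:ℝ)/q := Nat.cast_div_le
    have t3 : ((N/q+2:ℕ):ℝ)/a ≤ ((N:ℝ)/q+2)/a := by
      push_cast; gcongr
    have t4 : ((N:ℝ)/q+2)/a = (N:ℝ)/(q*a) + 2/a := by rw [add_div, div_div]
    have t5 : (2:ℝ)/a ≤ 2 := by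
      rw [div_le_iff₀ ha']
      have : (1:ℝ) ≤ a := by exact_mod_cast ha
      linarith
    rw [Nat.cast_add, Nat.cast_one]
    linarith
  calc (B.card:ℝ) ≤ ((N/(q*a)+1:ℕ):ℝ) * (V.card:ℝ) := by exact_mod_cast h1
    _ ≤ ((N:ℝ)/(q*a)+1) * ((a.totient:ℝ) * ((N:ℝ)/(q*a)+3)) := by
      apply mul_le_mul h3 _ (Nat.cast_nonneg _) (by positivity)
      calc (V.card:ℝ) ≤ (a.totient:ℝ) * (((N/q+2)/a+1:ℕ):ℝ) := by exact_mod_cast h2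
        _ ≤ _ := by gcongr
    _ = _ := by ring

lemma first_num (N a f X : ℝ) (ha : 192 ≤ a) (haN : a^60 ≤ N) (hf : a/2 ≤ f)
    (h : f*(N/a-1)^2 ≤ X + f*((N/a)^2*(3/4) + 4*(N/a)*(1+Real.log (2*N)) + 6*N)) : N^2/(16*a) ≤ X := by
  have ha0 : 0 < a := by linarith
  have ha8 : a^8 ≤ N := (pow_le_pow_right₀ (by linarith) (by norm_num)).trans haN
  have hN0 : 0 < N := lt_of_lt_of_le (by positivity) ha8
  set s := Real.sqrt N with hs
  have hs2 : s^2 = N := Real.sq_sqrt hN0.le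
  have hsa : a^4 ≤ s := by
    apply Real.le_sqrt_of_sq_le
    calc (a^4)^2 = a^8 := by ring
      _ ≤ N := ha8
  have hs1 : 1 ≤ s := le_trans (one_le_pow₀ (by linarith)) hsa
  have hl : Real.log (2*N) ≤ 1 + 2*s := by
    rw [Real.log_mul (by norm_num) (by positivity), ← hs2, Real.log_pow]
    have h1 := Real.log_le_sub_one_of_pos (show 0 < s by linarith)
    have h2 := Real.log_le_sub_one_of_pos (show (0:ℝ) < 2 by norm_num)
    push_cast; linarith
  set y := N/a with hy
  have hy0 : 0 < y := by positivity
  have hya : y*a = N := by rw [hy]; field_simp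
  have hyN : y ≤ N := by rw [← hya]; nlinarith
  have key : 2*y + 4*y*(1+Real.log (2*N)) + 6*N ≤ y^2/8 := by
    have k1 : 4*y*(1+Real.log (2*N)) ≤ 4*y*(2+2*s) := mul_le_mul_of_nonneg_left (by linarith) (by positivity)
    have k2 : 2*y + 4*y*(2+2*s) + 6*N ≤ 24*s*N := by
      have : y*s ≤ N*s := mul_le_mul_of_nonneg_right hyN (by linarith)
      have : N*1 ≤ N*s := mul_le_mul_of_nonneg_left hs1 hN0.le
      nlinarith
    have k3 : 192*s*a^2 ≤ N := by
      have t : 192 ≤ a^2 := by nlinarith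
      have : 192*a^2 ≤ a^4 := by nlinarith [mul_le_mul_of_nonneg_right t (sq_nonneg a)]
      rw [← hs2]; nlinarith
    have k4 : 24*s*N ≤ y^2/8 := by
      have e : y^2 = N*N/a^2 := by rw [hy]; ring
      rw [e, div_div, le_div_iff₀ (by positivity)]
      nlinarith
    linarith
  have hf0 : 0 < f := by linarith
  have h2 : f*(y^2/8) ≤ X := by
    have e : f*(y-1)^2 = f*y^2 - f*(2*y) + f := by ring
    have := mul_le_mul_of_nonneg_left key hf0.le
    nlinarith
  have h3 : N^2/(16*a) = a/2*(y^2/8) := by rw [hy]; field_simp; ring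
  rw [h3]
  exact (mul_le_mul_of_nonneg_right hf (by positivity)).trans h2

lemma PN_main (N a c : ℕ) (ha : 192 ≤ a) (haN : a^60 ≤ N) (hf : (a:ℝ)/2 ≤ a.totient) :
    (N:ℝ)^2/(16*a) ≤ (((PN N a c).filter (fun p => Nat.Coprime p.1 p.2)).card:ℝ) := by
  classical
  have ha0 : 0 < a := by omega
  have haN' : a ≤ N := (Nat.le_self_pow (by norm_num) a).trans haN
  have hN0 : 0 < N := by omega
  apply first_num (N:ℝ) a a.totient _ (by exact_mod_cast ha) (by exact_mod_cast haN) hf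
  refine (PN_ge N a c ha0 haN').trans ?_
  have h1 : PN N a c ⊆ (PN N a c).filter (fun p => Nat.Coprime p.1 p.2) ∪ (Finset.Icc 2 (2*N)).biUnion (fun q => (PN N a c).filter (fun p => q ∣ p.1 ∧ q ∣ p.2)) := by
    intro p hp
    by_cases h : Nat.Coprime p.1 p.2
    · exact Finset.mem_union_left _ (Finset.mem_filter.2 ⟨hp, h⟩)
    · obtain ⟨q, hq, d1, d2⟩ := Nat.Prime.not_coprime_iff_dvd.1 h
      apply Finset.mem_union_right
      have := Finset.mem_Ico.1 (Finset.mem_product.1 (Finset.mem_filter.1 hp).1).2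
      have := Nat.le_of_dvd (by omega) d2
      exact Finset.mem_biUnion.2 ⟨q, Finset.mem_Icc.2 ⟨hq.two_le, by omega⟩, Finset.mem_filter.2 ⟨hp, d1, d2⟩⟩
  have h2 := (Finset.card_le_card h1).trans ((Finset.card_union_le _ _).trans (Nat.add_le_add_left Finset.card_biUnion_le _))
  have h3 := (Nat.cast_le (α := ℝ)).2 h2
  rw [Nat.cast_add, Nat.cast_sum] at h3
  refine h3.trans (add_le_add_right ?_ _)
  have h4 : ∀ q ∈ Finset.Icc 2 (2*N), (((PN N a c).filter (fun p => q ∣ p.1 ∧ q ∣ p.2)).card:ℝ) ≤ a.totient*(((N:ℝ)/a)^2*((1:ℝ)/(q:ℝ)^2) + 4*((N:ℝ)/a)*((1:ℝ)/q) + 3) := by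
    intro q hq
    have hq0 : 0 < q := by have := (Finset.mem_Icc.1 hq).1; omega
    refine (PN_bad N a c q ha0 hq0).trans (le_of_eq ?_)
    have : (0:ℝ) < q := by exact_mod_cast hq0
    have : (0:ℝ) < a := by exact_mod_cast ha0
    field_simp
    ring
  refine (Finset.sum_le_sum h4).trans ?_
  rw [← Finset.mul_sum, Finset.sum_add_distrib, Finset.sum_add_distrib, ← Finset.mul_sum, ← Finset.mul_sum, Finset.sum_const, nsmul_eq_mul, Nat.card_Icc]
  have s1 := sum_inv_sq_2 (2*N)
  have s2 := sum_inv_2 (2*N)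
  have s3 : ((2*N+1-2:ℕ):ℝ) ≤ 2*N := by
    have : 2*N+1-2 ≤ 2*N := by omega
    exact_mod_cast this
  push_cast at s2
  have t1 := mul_le_mul_of_nonneg_left s1 (show (0:ℝ) ≤ ((N:ℝ)/a)^2 by positivity)
  have t2 := mul_le_mul_of_nonneg_left s2 (show (0:ℝ) ≤ 4*((N:ℝ)/a) by positivity)
  apply mul_le_mul_of_nonneg_left _ (Nat.cast_nonneg _)
  linarith

open Classical in
/-- The integer points counted for the parameter `z`. -/
noncomputable def PP (N : ℕ) (z : ℕ × ℕ) : Finset (ℤ × ℤ) :=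
  ((Finset.Ico (N:ℤ) (2*N)) ×ˢ (Finset.Ico (N:ℤ) (2*N))).filter
    (fun P => (aa z:ℤ) ∣ xa z * P.2 - xb z * P.1 ∧ IsCoprime (P.1^2+P.2^2) (aa z:ℤ) ∧ IsCoprime P.1 P.2)

lemma mem_PP (N : ℕ) (z : ℕ × ℕ) (P : ℤ × ℤ) : P ∈ PP N z ↔
    (((N:ℤ) ≤ P.1 ∧ P.1 < 2*N) ∧ ((N:ℤ) ≤ P.2 ∧ P.2 < 2*N)) ∧ (aa z:ℤ) ∣ xa z * P.2 - xb z * P.1 ∧ IsCoprime (P.1^2+P.2^2) (aa z:ℤ) ∧ IsCoprime P.1 P.2 := by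
  classical
  unfold PP
  rw [Finset.mem_filter, Finset.mem_product, Finset.mem_Ico, Finset.mem_Ico]

lemma aa_cop6 (z : ℕ × ℕ) : Nat.Coprime (aa z) 6 := Nat.Coprime.coprime_dvd_right (by norm_num) (aa_coprime z)

lemma PP_alg (a x y c v u p q : ℤ) (ha : a = x^2+y^2+6) (h6 : IsCoprime a 6) (huv : u*a+v*y = 1)
    (hc : a ∣ x*v - c) (hp : a ∣ p - c*q) (hq : IsCoprime a q) :
    a ∣ x*q - y*p ∧ IsCoprime (p^2+q^2) a := by
  have h1 : a ∣ x*q - y*p := by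
    obtain ⟨k, hk⟩ := hc
    obtain ⟨l, hl⟩ := hp
    refine ⟨x*q*u + y*q*k - y*l, ?_⟩
    linear_combination (x*q)*(-huv) + (y*q)*hk - y*hl
  refine ⟨h1, ?_⟩
  have h2 : a ∣ y^2*(p^2+q^2) + 6*q^2 := by
    obtain ⟨m, hm⟩ := h1
    refine ⟨q^2 - m*(y*p + x*q), ?_⟩
    rw [ha] at hm ⊢
    linear_combination (-(y*p+x*q))*hm
  have h3 : IsCoprime a (6*q^2) := IsCoprime.mul_right h6 (IsCoprime.pow_right hq)
  obtain ⟨m, hm⟩ := h2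
  have e : y^2*(p^2+q^2) = -(6*q^2) + a*m := by linarith
  have h4 : IsCoprime a (y^2*(p^2+q^2)) := by
    rw [e]
    exact (IsCoprime.add_mul_left_right_iff).2 ((IsCoprime.neg_right_iff _ _).2 h3)
  exact (IsCoprime.of_mul_right_right h4).symm

lemma PP_card (N K : ℕ) (z : ℕ × ℕ) (hz : Good K z) (hN : (aa z)^60 ≤ N) :
    (N:ℝ)^2/(16*aa z) ≤ ((PP N z).card:ℝ) := by
  classical
  have ha : 192 ≤ aa z := by unfold aa; nlinarith [Nat.zero_le z.1, Nat.zero_le z.2, sq_nonneg (210*z.2+71)]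
  have hf := totient_ge_half _ hz.g3
  have hcop : IsCoprime (aa z:ℤ) (xb z) := by
    have := Nat.isCoprime_iff_coprime.2 hz.g2
    push_cast at this
    exact this
  obtain ⟨u, v, huv⟩ := hcop
  have h6 : IsCoprime (aa z:ℤ) 6 := by
    have := Nat.isCoprime_iff_coprime.2 (aa_cop6 z)
    exact_mod_cast this
  set c := ((xa z * v) % (aa z:ℤ)).toNat with hc
  have hc' : (c:ℤ) = (xa z * v) % (aa z:ℤ) := by
    rw [hc, Int.toNat_of_nonneg]
    exact Int.emod_nonneg _ (by positivity)
  have hc2 : (aa z:ℤ) ∣ xa z * v - c := by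
    rw [hc']; exact Int.dvd_self_sub_emod
  refine (PN_main N (aa z) c ha hN hf).trans ?_
  rw [Nat.cast_le]
  apply Finset.card_le_card_of_injOn (fun p : ℕ × ℕ => ((p.1:ℤ),(p.2:ℤ)))
  · intro p hp
    have hp := Finset.mem_filter.1 (Finset.mem_coe.1 hp)
    obtain ⟨hp1, hp2⟩ := hp
    unfold PN at hp1
    rw [Finset.mem_filter, Finset.mem_product, Finset.mem_Ico, Finset.mem_Ico] at hp1
    obtain ⟨⟨⟨b1,b2⟩,b3,b4⟩, b5, b6⟩ := hp1
    have b7 := (Nat.modEq_iff_dvd.1 b5.symm)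
    push_cast at b7
    have b8 : IsCoprime (aa z:ℤ) (p.2:ℤ) := Nat.isCoprime_iff_coprime.2 b6
    obtain ⟨r1, r2⟩ := PP_alg (aa z) (xa z) (xb z) c v u p.1 p.2 (aa_eq z) h6 huv hc2 b7 b8
    rw [Finset.mem_coe, mem_PP]
    refine ⟨?_, r1, r2, Nat.isCoprime_iff_coprime.2 hp2⟩
    simp only
    omega
  · intro p _ q _ h
    have h' := Prod.mk.inj h
    exact Prod.ext (by exact_mod_cast h'.1) (by exact_mod_cast h'.2)

/-- general pair count identity -/
lemma pair_count {α β : Type*} (S : Finset α) (T : Finset β) (f : α → ℤ) (g : β → ℤ) (U : Finset ℤ)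
    (hU : ∀ s ∈ S, f s ∈ U) :
    ∑ s ∈ S, ∑ t ∈ T, (if f s = g t then (1:ℝ) else 0)
      = ∑ n ∈ U, ((S.filter (fun s => f s = n)).card:ℝ) * ((T.filter (fun t => g t = n)).card:ℝ) := by
  have h : ∀ s ∈ S, ∑ t ∈ T, (if f s = g t then (1:ℝ) else 0)
      = ∑ n ∈ U, (if f s = n then ((T.filter (fun t => g t = n)).card:ℝ) else 0) := by
    intro s hs
    rw [Finset.sum_ite_eq, if_pos (hU s hs), Finset.sum_boole]
    congr 3
    ext t; exact eq_comm
  rw [Finset.sum_congr rfl h, Finset.sum_comm]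
  apply Finset.sum_congr rfl
  intro n _
  rw [← Finset.sum_filter, Finset.sum_const, nsmul_eq_mul]

lemma pair_amgm {α β : Type*} (S : Finset α) (T : Finset β) (f : α → ℤ) (g : β → ℤ) :
    2 * ∑ s ∈ S, ∑ t ∈ T, (if f s = g t then (1:ℝ) else 0)
      ≤ ∑ s ∈ S, ∑ t ∈ S, (if f s = f t then (1:ℝ) else 0) + ∑ s ∈ T, ∑ t ∈ T, (if g s = g t then (1:ℝ) else 0) := by
  classical
  have hU1 : ∀ s ∈ S, f s ∈ S.image f ∪ T.image g := fun s hs => Finset.mem_union_left _ (Finset.mem_image_of_mem _ hs)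
  have hU2 : ∀ s ∈ T, g s ∈ S.image f ∪ T.image g := fun s hs => Finset.mem_union_right _ (Finset.mem_image_of_mem _ hs)
  rw [pair_count S T f g _ hU1, pair_count S S f f _ hU1, pair_count T T g g _ hU2, Finset.mul_sum, ← Finset.sum_add_distrib]
  apply Finset.sum_le_sum
  intro n _
  nlinarith [sq_nonneg (((S.filter (fun s => f s = n)).card:ℝ) - ((T.filter (fun t => g t = n)).card:ℝ))]

lemma pair_cs {α : Type*} (S : Finset α) (f : α → ℤ) (U : Finset ℤ) (hU : ∀ s ∈ S, f s ∈ U) :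
    (S.card:ℝ)^2 ≤ (U.card:ℝ) * ∑ s ∈ S, ∑ t ∈ S, (if f s = f t then (1:ℝ) else 0) := by
  classical
  rw [pair_count S S f f U hU]
  have h1 : (S.card:ℝ) = ∑ n ∈ U, ((S.filter (fun s => f s = n)).card:ℝ) := by
    rw [← Nat.cast_sum, ← Finset.card_eq_sum_card_fiberwise hU]
  rw [h1]
  refine (sq_sum_le_card_mul_sum_sq).trans (le_of_eq ?_)
  congr 1
  apply Finset.sum_congr rfl
  intro n _
  ring

/-- number of coincidences between the values of two parameters -/
noncomputable def EE (N : ℕ) (z z' : ℕ × ℕ) : ℝ :=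
  ∑ P ∈ PP N z, ∑ R ∈ PP N z', (if P.1^2+P.2^2-(aa z:ℤ) = R.1^2+R.2^2-(aa z':ℤ) then (1:ℝ) else 0)

lemma EE_card (N : ℕ) (z z' : ℕ × ℕ) : ∃ S : Finset (ℤ × ℤ × ℤ × ℤ), EE N z z' = (S.card:ℝ) ∧
    ∀ p ∈ S, (p.1, p.2.1) ∈ PP N z ∧ (p.2.2.1, p.2.2.2) ∈ PP N z' ∧
      p.1^2+p.2.1^2-(aa z:ℤ) = p.2.2.1^2+p.2.2.2^2-(aa z':ℤ) := by
  classical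
  refine ⟨((PP N z ×ˢ PP N z').filter (fun q : (ℤ × ℤ) × (ℤ × ℤ) => q.1.1^2+q.1.2^2-(aa z:ℤ) = q.2.1^2+q.2.2^2-(aa z':ℤ))).image (fun q : (ℤ × ℤ) × (ℤ × ℤ) => (q.1.1, q.1.2, q.2.1, q.2.2)), ?_, ?_⟩
  · rw [Finset.card_image_of_injective]
    · unfold EE
      rw [← Finset.sum_product', Finset.sum_boole]
    · rintro ⟨⟨a, b⟩, c, d⟩ ⟨⟨a', b'⟩, c', d'⟩ h
      simpa [and_assoc] using h
  · intro p hp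
    obtain ⟨q, hq, rfl⟩ := Finset.mem_image.1 hp
    obtain ⟨h1, h2⟩ := Finset.mem_filter.1 hq
    obtain ⟨h3, h4⟩ := Finset.mem_product.1 h1
    exact ⟨h3, h4, h2⟩

lemma EE_nonneg (N : ℕ) (z z' : ℕ × ℕ) : 0 ≤ EE N z z' := by
  obtain ⟨S, h, _⟩ := EE_card N z z'
  rw [h]; exact Nat.cast_nonneg _

lemma Good.cop {K : ℕ} {z : ℕ × ℕ} (hz : Good K z) : IsCoprime (aa z:ℤ) (xb z) := by
  have := Nat.isCoprime_iff_coprime.2 hz.g2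
  push_cast at this
  exact this

lemma Good.sum4 {K : ℕ} {z : ℕ × ℕ} (hz : Good K z) : ∑ d ∈ (aa z).divisors, (tau d:ℝ)/d ≤ 4 :=
  sum_tau_div_le _ (aa_pos z) (totient_ge_half _ hz.g3)

lemma EE_off : ∃ C : ℝ, 0 < C ∧ ∀ (N K K' : ℕ) (z z' : ℕ × ℕ), Good K z → Good K' z' → aa z ≠ aa z' →
    ((aa z*aa z')*((aa z:ℤ)-aa z').natAbs)^60 ≤ N →
    EE N z z' ≤ C*((N:ℝ)^2/(aa z*aa z'))*((tau (Nat.gcd (aa z) (aa z')):ℝ)^2*sig ((aa z:ℤ)-aa z').natAbs) := by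
  obtain ⟨C, hC, H⟩ := pairP
  refine ⟨C, hC, ?_⟩
  intro N K K' z z' hz hz' hne hN
  obtain ⟨S, hS, hS2⟩ := EE_card N z z'
  rw [hS, ← mul_assoc]
  apply H N (xa z) (xb z) (xa z') (xb z') (aa z) (aa z') (aa_eq z) (aa_eq z') (aa_cop6 z) (aa_cop6 z') hz.cop hz'.cop hne hN hz.sum4 hz'.sum4
  · intro p hp
    obtain ⟨h1, h2, _⟩ := hS2 p hp
    rw [mem_PP] at h1 h2
    rw [mem_box4]
    exact ⟨h1.1.1, h1.1.2, h2.1.1, h2.1.2⟩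
  · intro p hp
    obtain ⟨h1, h2, h3⟩ := hS2 p hp
    rw [mem_PP] at h1 h2
    exact ⟨h1.2.1, h1.2.2.1, h2.2.1, h2.2.2.1, by linarith⟩

lemma EE_self (N K : ℕ) (z : ℕ × ℕ) (hz : Good K z) (haN : aa z ≤ N) (hK : 0 < K)
    (hτ : (tau (aa z):ℝ)*(1+Real.log (4*N)) ≤ (K:ℝ)^2) : EE N z z ≤ 40*(N:ℝ)^2/aa z := by
  obtain ⟨S, hS, hS2⟩ := EE_card N z z
  rw [hS]
  apply thmQ N K (aa z) (xa z) (xb z) (aa_eq z) (aa_cop6 z) hz.cop haN hK hz.g4 hτ S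
  · intro p hp
    obtain ⟨h1, h2, _⟩ := hS2 p hp
    rw [mem_PP] at h1 h2
    rw [mem_box4]
    exact ⟨h1.1.1, h1.1.2, h2.1.1, h2.1.2⟩
  · intro p hp
    obtain ⟨h1, h2, h3⟩ := hS2 p hp
    rw [mem_PP] at h1 h2
    exact ⟨h1.2.1, h1.2.2.1, h2.2.1, by linarith⟩

lemma EE_diag (N : ℕ) (z z' : ℕ × ℕ) : 2 * EE N z z' ≤ EE N z z + EE N z' z' :=
  pair_amgm (PP N z) (PP N z') (fun P : ℤ × ℤ => P.1^2+P.2^2-(aa z:ℤ)) (fun P : ℤ × ℤ => P.1^2+P.2^2-(aa z':ℤ))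

lemma Kcond_num (C : ℝ) : ∃ m0 : ℕ, ∀ m : ℕ, m0 ≤ m → 8*C*(8000*m+9003) ≤ (2:ℝ)^m := by
  have h := tendsto_pow_const_div_const_pow_of_one_lt 1 (show (1:ℝ) < 2 by norm_num)
  set D := 8 * |C| *17003 + 1 with hD
  have hD0 : 0 < D := by positivity
  have h2 := h.eventually (gt_mem_nhds (show (0:ℝ) < 1/D by positivity))
  obtain ⟨m0, hm0⟩ := Filter.eventually_atTop.1 h2
  refine ⟨max m0 1, ?_⟩
  intro m hm
  have h3 := hm0 m (le_trans (le_max_left _ _) hm)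
  have hm1 : (1:ℝ) ≤ m := by exact_mod_cast le_trans (le_max_right _ _) hm
  rw [pow_one, div_lt_div_iff₀ (by positivity) hD0] at h3
  have h4 : 8*C*(8000*m+9003) ≤ 8 * |C| *(17003*m) := by
    have a1 : 8*C*(8000*(m:ℝ)+9003) ≤ 8 * |C| *(8000*m+9003) := by
      have := le_abs_self C
      have : 0 ≤ 8000*(m:ℝ)+9003 := by positivity
      nlinarith
    have a2 : 8 * |C| *(8000*(m:ℝ)+9003) ≤ 8 * |C| *(17003*m) := mul_le_mul_of_nonneg_left (by linarith) (by positivity)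
    linarith
  have : (m:ℝ)*D = 8 * |C| *(17003*m) + m := by rw [hD]; ring
  linarith

lemma log4N_le (N k : ℕ) (h0 : 0 < N) (h : N < 2^k) : Real.log (4*N) ≤ k + 2 := by
  have h1 : (4:ℝ)*N ≤ 2^(k+2) := by
    have : ((N:ℕ):ℝ) ≤ ((2^k:ℕ):ℝ) := by exact_mod_cast h.le
    push_cast at this
    rw [pow_add]; linarith
  have h0' : (0:ℝ) < N := by exact_mod_cast h0
  have h2 := Real.log_le_log (by positivity) h1
  rw [Real.log_pow] at h2
  have h3 := Real.log_le_sub_one_of_pos (show (0:ℝ) < 2 by norm_num)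
  refine h2.trans ?_
  push_cast
  have : (0:ℝ) ≤ k := Nat.cast_nonneg _
  nlinarith

lemma Kcond : ∃ j0 : ℕ, ∀ j a N : ℕ, j0 ≤ j → a ≤ 2^20*(2^j)^2 → 0 < N → N < 2^(1000*(j+2)) →
    (tau a:ℝ)*(1+Real.log (4*N)) ≤ ((2^(j/8):ℕ):ℝ)^2 := by
  obtain ⟨C, hC, H⟩ := tau_bound (1/16) (by norm_num)
  obtain ⟨m0, hm0⟩ := Kcond_num C
  refine ⟨8*m0+8, ?_⟩
  intro j a N hj ha hN0 hN
  set m := j/8 with hm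
  have hm1 : m0 ≤ m := by omega
  have hjm : j ≤ 8*m+7 := by omega
  have h1 := hm0 m hm1
  have h2 : (a:ℝ)^((1:ℝ)/16) ≤ 2^(m+3) := by
    have b1 : a ≤ (2^(m+3))^16 := by
      refine ha.trans ?_
      rw [← pow_mul, ← pow_mul, ← pow_add]
      exact Nat.pow_le_pow_right (by norm_num) (by omega)
    have b2 : (a:ℝ) ≤ ((2:ℝ)^(m+3))^16 := by exact_mod_cast b1
    have b3 := Real.rpow_le_rpow (Nat.cast_nonneg a) b2 (show (0:ℝ) ≤ 1/16 by norm_num)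
    refine b3.trans (le_of_eq ?_)
    rw [← Real.rpow_natCast _ 16, ← Real.rpow_mul (by positivity)]
    norm_num
  have h3 : (tau a:ℝ) ≤ C*2^(m+3) := (H a).trans (mul_le_mul_of_nonneg_left h2 (by linarith))
  have h4 : 1 + Real.log (4*N) ≤ 8000*m+9003 := by
    have := log4N_le N _ hN0 hN
    have c : ((1000*(j+2):ℕ):ℝ) ≤ ((8000*m + 9000:ℕ):ℝ) := by
      rw [Nat.cast_le]; omega
    push_cast at this c
    linarith
  have hm0' : (0:ℝ) ≤ m := Nat.cast_nonneg _
  calc (tau a:ℝ)*(1+Real.log (4*N)) ≤ (tau a:ℝ)*(8000*m+9003) := mul_le_mul_of_nonneg_left h4 (Nat.cast_nonneg _)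
    _ ≤ C*2^(m+3)*(8000*m+9003) := mul_le_mul_of_nonneg_right h3 (by linarith)
    _ = 2^m*(8*C*(8000*m+9003)) := by rw [pow_add]; ring
    _ ≤ 2^m*2^m := mul_le_mul_of_nonneg_left h1 (pow_nonneg (by norm_num) _)
    _ = ((2^m:ℕ):ℝ)^2 := by push_cast; ring

open Classical in
/-- good parameters in the dyadic block of index `j` -/
noncomputable def blkG (j : ℕ) : Finset (ℕ × ℕ) := (blk (2^j)).filter (fun z => Good (2^(j/8)) z)

lemma mem_blkG (j : ℕ) (z : ℕ × ℕ) : z ∈ blkG j ↔ z ∈ blk (2^j) ∧ Good (2^(j/8)) z := by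
  classical
  unfold blkG; rw [Finset.mem_filter]

/-- all the parameters that are used -/
noncomputable def II (J : ℕ) : Finset (ℕ × ℕ) := (Finset.Ico J (2*J)).biUnion blkG

lemma II_disj (J : ℕ) : (↑(Finset.Ico J (2*J)) : Set ℕ).PairwiseDisjoint blkG := by
  intro i _ j _ hij
  rw [Function.onFun, Finset.disjoint_left]
  intro z hz hz'
  have h1 := (mem_blk _ _).1 ((mem_blkG i z).1 hz).1
  have h2 := (mem_blk _ _).1 ((mem_blkG j z).1 hz').1
  apply hij
  have key : ∀ i j : ℕ, 2^i ≤ z.1 → z.1 < 2*2^j → i ≤ j := by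
    intro i j a b
    by_contra hc
    have : 2^(j+1) ≤ 2^i := Nat.pow_le_pow_right (by norm_num) (by omega)
    rw [pow_succ] at this
    omega
  apply le_antisymm
  · exact key i j (by tauto) (by tauto)
  · exact key j i (by tauto) (by tauto)

lemma sum_II (J : ℕ) (f : ℕ × ℕ → ℝ) : ∑ z ∈ II J, f z = ∑ j ∈ Finset.Ico J (2*J), ∑ z ∈ blkG j, f z :=
  Finset.sum_biUnion (II_disj J)

lemma aa_size (J j : ℕ) (hj : j < 2*J) (z : ℕ × ℕ) (hz : z ∈ blk (2^j)) : aa z ≤ 2^(4*J+20) := by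
  refine (aa_le (2^j) Nat.one_le_two_pow z hz).trans ?_
  rw [← pow_mul, ← pow_add]
  exact Nat.pow_le_pow_right (by norm_num) (by omega)

lemma aa_size60 (J N a : ℕ) (hJ : 13 ≤ J) (hN : 2^(1000*J) ≤ N) (h : a ≤ 2^(4*J+20)) : a^60 ≤ N := by
  refine (Nat.pow_le_pow_left h 60).trans (le_trans ?_ hN)
  rw [← pow_mul]
  exact Nat.pow_le_pow_right (by norm_num) (by omega)

lemma aa_size3 (J N a b : ℕ) (hJ : 13 ≤ J) (hN : 2^(1000*J) ≤ N) (h : a ≤ 2^(4*J+20)) (h' : b ≤ 2^(4*J+20)) :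
    ((a*b)*((a:ℤ)-b).natAbs)^60 ≤ N := by
  have h3 : ((a:ℤ)-b).natAbs ≤ 2^(4*J+20) := by omega
  refine (Nat.pow_le_pow_left (Nat.mul_le_mul (Nat.mul_le_mul h h') h3) 60).trans (le_trans ?_ hN)
  rw [← pow_add, ← pow_add, ← pow_mul]
  exact Nat.pow_le_pow_right (by norm_num) (by omega)

lemma EE_symm (N : ℕ) (z z' : ℕ × ℕ) : EE N z z' = EE N z' z := by
  unfold EE
  rw [Finset.sum_comm]
  apply Finset.sum_congr rfl; intro P _
  apply Finset.sum_congr rfl; intro R _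
  simp only [eq_comm]

/-- off-diagonal block sum -/
noncomputable def offS (N i j : ℕ) : ℝ :=
  ∑ z ∈ blkG i, ∑ z' ∈ (blkG j).filter (fun z' => aa z ≠ aa z'), EE N z z'

lemma offS_symm (N i j : ℕ) : offS N i j = offS N j i := by
  unfold offS
  simp only [Finset.sum_filter]
  rw [Finset.sum_comm]
  apply Finset.sum_congr rfl; intro P _
  apply Finset.sum_congr rfl; intro R _
  rw [EE_symm N R P]
  simp only [ne_comm]

lemma off_le : ∃ C : ℝ, 0 < C ∧ ∀ J N i j : ℕ, 13 ≤ J → 2^(1000*J) ≤ N → i < 2*J → j < 2*J → i ≤ j →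
    offS N i j ≤ C*(N:ℝ)^2 := by
  obtain ⟨C1, hC1, H1⟩ := EE_off
  obtain ⟨C2, hC2, H2⟩ := thmA
  refine ⟨C1*C2, by positivity, ?_⟩
  intro J N i j hJ hN hi hj hij
  have hXY : 2^i ≤ 2^j := Nat.pow_le_pow_right (by norm_num) hij
  have key := H2 (2^i) (2^j) Nat.one_le_two_pow hXY
  set X : ℝ := ((2^i:ℕ):ℝ) with hX
  set Y : ℝ := ((2^j:ℕ):ℝ) with hY
  have hX0 : 0 < X := by rw [hX]; exact_mod_cast Nat.two_pow_pos i
  have hY0 : 0 < Y := by rw [hY]; exact_mod_cast Nat.two_pow_pos j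
  have hw : ∀ z z' : ℕ × ℕ, 0 ≤ (tau (Nat.gcd (aa z) (aa z')):ℝ)^2 * sig ((aa z:ℤ) - aa z').natAbs :=
    fun z z' => mul_nonneg (sq_nonneg _) (sig_nonneg _)
  have hterm : ∀ z ∈ blkG i, ∀ z' ∈ (blkG j).filter (fun z' => aa z ≠ aa z'),
      EE N z z' ≤ C1*((N:ℝ)^2/(X^2*Y^2)) * ((tau (Nat.gcd (aa z) (aa z')):ℝ)^2 * sig ((aa z:ℤ) - aa z').natAbs) := by
    intro z hz z' hz'
    obtain ⟨hz', hne⟩ := Finset.mem_filter.1 hz'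
    obtain ⟨b1, g1⟩ := (mem_blkG i z).1 hz
    obtain ⟨b2, g2⟩ := (mem_blkG j z').1 hz'
    refine (H1 N _ _ z z' g1 g2 hne (aa_size3 J N _ _ hJ hN (aa_size J i hi z b1) (aa_size J j hj z' b2))).trans ?_
    apply mul_le_mul_of_nonneg_right _ (hw z z')
    apply mul_le_mul_of_nonneg_left _ hC1.le
    have e1 : X^2 ≤ (aa z:ℝ) := by rw [hX]; exact_mod_cast aa_ge _ z b1
    have e2 : Y^2 ≤ (aa z':ℝ) := by rw [hY]; exact_mod_cast aa_ge _ z' b2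
    apply div_le_div_of_nonneg_left (sq_nonneg _) (by positivity)
    exact mul_le_mul e1 e2 (sq_nonneg _) (Nat.cast_nonneg _)
  have hs : offS N i j ≤ C1*((N:ℝ)^2/(X^2*Y^2)) * ∑ z ∈ blk (2^i), ∑ z' ∈ (blk (2^j)).filter (fun z' => aa z ≠ aa z'), (tau (Nat.gcd (aa z) (aa z')):ℝ)^2 * sig ((aa z:ℤ) - aa z').natAbs := by
    unfold offS
    rw [Finset.mul_sum]
    have s1 : blkG i ⊆ blk (2^i) := fun z hz => ((mem_blkG i z).1 hz).1
    have s2 : ∀ z, (blkG j).filter (fun z' => aa z ≠ aa z') ⊆ (blk (2^j)).filter (fun z' => aa z ≠ aa z') := by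
      intro z
      exact Finset.filter_subset_filter _ (fun z hz => ((mem_blkG j z).1 hz).1)
    have hc : 0 ≤ C1*((N:ℝ)^2/(X^2*Y^2)) := mul_nonneg hC1.le (div_nonneg (sq_nonneg _) (mul_nonneg (sq_nonneg _) (sq_nonneg _)))
    refine le_trans ?_ (Finset.sum_le_sum_of_subset_of_nonneg s1 (fun z _ _ => mul_nonneg hc (Finset.sum_nonneg (fun z' _ => hw z z'))))
    apply Finset.sum_le_sum
    intro z hz
    refine (Finset.sum_le_sum (hterm z hz)).trans ?_
    rw [← Finset.mul_sum]
    apply mul_le_mul_of_nonneg_left _ hc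
    exact Finset.sum_le_sum_of_subset_of_nonneg (s2 z) (fun z' _ _ => hw z z')
  refine hs.trans ?_
  have hc : 0 ≤ C1*((N:ℝ)^2/(X^2*Y^2)) := mul_nonneg hC1.le (div_nonneg (sq_nonneg _) (mul_nonneg (sq_nonneg _) (sq_nonneg _)))
  refine (mul_le_mul_of_nonneg_left key hc).trans (le_of_eq ?_)
  have hX1 := hX0.ne'
  have hY1 := hY0.ne'
  clear_value X Y
  field_simp

lemma xa_le (j : ℕ) (z : ℕ × ℕ) (h : aa z ≤ 2^20*(2^j)^2) :
    (1 ≤ xa z ∧ xa z ≤ ((2^10*2^j:ℕ):ℤ)) ∧ (1 ≤ xb z ∧ xb z ≤ ((2^10*2^j:ℕ):ℤ)) := by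
  have h1 : (210*z.1+106)^2 ≤ (2^10*2^j)^2 := by
    refine le_trans ?_ (h.trans (le_of_eq (by ring)))
    unfold aa; omega
  have h2 : (210*z.2+71)^2 ≤ (2^10*2^j)^2 := by
    refine le_trans ?_ (h.trans (le_of_eq (by ring)))
    unfold aa; omega
  have h1' := (Nat.pow_le_pow_iff_left (by norm_num)).1 h1
  have h2' := (Nat.pow_le_pow_iff_left (by norm_num)).1 h2
  have e1 : xa z = ((210*z.1+106:ℕ):ℤ) := by unfold xa; push_cast; ring
  have e2 : xb z = ((210*z.2+71:ℕ):ℤ) := by unfold xb; push_cast; ring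
  rw [e1, e2]
  refine ⟨⟨by omega, by exact_mod_cast h1'⟩, ⟨by omega, by exact_mod_cast h2'⟩⟩

lemma diag_count (J j : ℕ) (hJ : 1 ≤ J) (hj : j < 2*J) (Z : Finset (ℕ × ℕ)) :
    ((((blkG j) ×ˢ Z).filter (fun q => aa q.1 = aa q.2)).card:ℝ) ≤ 40*2^20*14*(((2^j:ℕ):ℝ)^2*J) := by
  classical
  set D := ((blkG j) ×ˢ Z).filter (fun q => aa q.1 = aa q.2) with hD
  set S := D.image (fun q : (ℕ × ℕ) × (ℕ × ℕ) => (xa q.1, xb q.1, xa q.2, xb q.2)) with hS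
  have hcard : S.card = D.card := by
    rw [hS, Finset.card_image_of_injective]
    rintro ⟨⟨a, b⟩, c, d⟩ ⟨⟨a', b'⟩, c', d'⟩ h
    simp only [xa, xb, Prod.mk.injEq] at h ⊢
    omega
  have h := multR (2^10*2^j) (by positivity) S (by
    intro p hp
    obtain ⟨q, hq, rfl⟩ := Finset.mem_image.1 hp
    obtain ⟨hq1, hq2⟩ := Finset.mem_filter.1 hq
    have hz := ((mem_blkG j _).1 (Finset.mem_product.1 hq1).1).1
    have h1 := aa_le (2^j) Nat.one_le_two_pow _ hz
    have h2 := h1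
    rw [hq2] at h2
    obtain ⟨r1, r2⟩ := xa_le j q.1 h1
    obtain ⟨r3, r4⟩ := xa_le j q.2 h2
    refine ⟨r1, r2, r3, r4, ?_⟩
    have e1 := aa_eq q.1
    have e2 := aa_eq q.2
    rw [hq2] at e1
    simp only
    linarith)
  rw [← hcard]
  refine h.trans ?_
  have hl : Real.log (2*((2^10*2^j:ℕ):ℝ)) ≤ 11 + j := by
    have e : 2*((2^10*2^j:ℕ):ℝ) = 2^(11+j) := by
      rw [Nat.cast_mul, Nat.cast_pow, Nat.cast_pow, pow_add]
      norm_num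
      ring
    rw [e, Real.log_pow]
    have h3 := Real.log_le_sub_one_of_pos (show (0:ℝ) < 2 by norm_num)
    have : (0:ℝ) ≤ ((11+j:ℕ):ℝ) := Nat.cast_nonneg _
    have e2 : ((11+j:ℕ):ℝ) = 11 + (j:ℝ) := by push_cast; ring
    rw [← e2]
    nlinarith
  have hj' : (j:ℝ) ≤ 2*J := by exact_mod_cast hj.le
  have hJ' : (1:ℝ) ≤ J := by exact_mod_cast hJ
  have e3 : ((2^10*2^j:ℕ):ℝ) = 2^10*((2^j:ℕ):ℝ) := by rw [Nat.cast_mul, Nat.cast_pow]; norm_num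
  have h5 : 1 + Real.log (2*((2^10*2^j:ℕ):ℝ)) ≤ 14*J := by linarith
  refine (mul_le_mul_of_nonneg_left h5 (mul_nonneg (by norm_num) (sq_nonneg _))).trans (le_of_eq ?_)
  rw [e3]
  ring

lemma EE_self_le : ∃ j0 : ℕ, ∀ J N i : ℕ, j0 ≤ J → 13 ≤ J → 2^(1000*J) ≤ N → N < 2^(1000*(J+1)) → J ≤ i → i < 2*J →
    ∀ z ∈ blkG i, EE N z z ≤ 40*(N:ℝ)^2/aa z := by
  obtain ⟨j0, H⟩ := Kcond
  refine ⟨j0, ?_⟩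
  intro J N i hJ0 hJ hN1 hN2 hi hi2 z hz
  obtain ⟨b, g⟩ := (mem_blkG i z).1 hz
  have hN0 : 0 < N := lt_of_lt_of_le (Nat.two_pow_pos _) hN1
  apply EE_self N _ z g
  · exact (Nat.le_self_pow (by norm_num) _).trans (aa_size60 J N _ hJ hN1 (aa_size J i hi2 z b))
  · exact Nat.two_pow_pos _
  · apply H i (aa z) N (by omega) (aa_le _ Nat.one_le_two_pow z b) hN0
    exact hN2.trans_le (Nat.pow_le_pow_right (by norm_num) (by omega))

lemma mem_II (J : ℕ) (z : ℕ × ℕ) : z ∈ II J ↔ ∃ j, (J ≤ j ∧ j < 2*J) ∧ z ∈ blkG j := by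
  classical
  unfold II
  rw [Finset.mem_biUnion]
  simp only [Finset.mem_Ico]

lemma diag_le : ∃ C : ℝ, 0 < C ∧ ∃ j0 : ℕ, ∀ J N j : ℕ, j0 ≤ J → 13 ≤ J → 2^(1000*J) ≤ N → N < 2^(1000*(J+1)) → J ≤ j → j < 2*J →
    ∑ z ∈ blkG j, ∑ z' ∈ (II J).filter (fun z' => aa z = aa z'), EE N z z' ≤ C*((N:ℝ)^2*J) := by
  obtain ⟨j0, H⟩ := EE_self_le
  refine ⟨40*(40*2^20*14), by norm_num, j0, ?_⟩
  intro J N j hJ0 hJ hN1 hN2 hj hj2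
  have hY0 : (0:ℝ) < ((2^j:ℕ):ℝ) := by exact_mod_cast Nat.two_pow_pos j
  have h1 : ∀ z ∈ blkG j, ∀ z' ∈ (II J).filter (fun z' => aa z = aa z'), EE N z z' ≤ 40*(N:ℝ)^2/((2^j:ℕ):ℝ)^2 := by
    intro z hz z' hz'
    obtain ⟨hz', he⟩ := Finset.mem_filter.1 hz'
    obtain ⟨i, ⟨hi1, hi2⟩, hz'⟩ := (mem_II J z').1 hz'
    have a1 := H J N j hJ0 hJ hN1 hN2 hj hj2 z hz
    have a2 := H J N i hJ0 hJ hN1 hN2 hi1 hi2 z' hz'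
    have a3 := EE_diag N z z'
    rw [← he] at a2
    have a4 : ((2^j:ℕ):ℝ)^2 ≤ (aa z:ℝ) := by exact_mod_cast aa_ge _ z ((mem_blkG j z).1 hz).1
    have a5 : 40*(N:ℝ)^2/aa z ≤ 40*(N:ℝ)^2/((2^j:ℕ):ℝ)^2 :=
      div_le_div_of_nonneg_left (mul_nonneg (by norm_num) (sq_nonneg _)) (pow_pos hY0 2) a4
    linarith
  have h2 : ∑ z ∈ blkG j, ∑ z' ∈ (II J).filter (fun z' => aa z = aa z'), EE N z z' ≤
      ∑ z ∈ blkG j, ∑ z' ∈ (II J).filter (fun z' => aa z = aa z'), 40*(N:ℝ)^2/((2^j:ℕ):ℝ)^2 :=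
    Finset.sum_le_sum (fun z hz => Finset.sum_le_sum (h1 z hz))
  have h3 : ∑ z ∈ blkG j, ∑ z' ∈ (II J).filter (fun z' => aa z = aa z'), 40*(N:ℝ)^2/((2^j:ℕ):ℝ)^2
      = ((((blkG j) ×ˢ (II J)).filter (fun q => aa q.1 = aa q.2)).card:ℝ) * (40*(N:ℝ)^2/((2^j:ℕ):ℝ)^2) := by
    rw [← nsmul_eq_mul, ← Finset.sum_const, Finset.sum_filter, Finset.sum_product]
    apply Finset.sum_congr rfl
    intro z _
    rw [Finset.sum_filter]
  rw [h3] at h2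
  refine h2.trans ?_
  have h4 := diag_count J j (by omega) hj2 (II J)
  refine (mul_le_mul_of_nonneg_right h4 (div_nonneg (mul_nonneg (by norm_num) (sq_nonneg _)) (sq_nonneg _))).trans (le_of_eq ?_)
  have h5 := hY0.ne'
  generalize ((2^j:ℕ):ℝ) = Y at *
  field_simp

lemma thmM2 : ∃ C : ℝ, 0 < C ∧ ∃ J0 : ℕ, ∀ J N : ℕ, J0 ≤ J → 2^(1000*J) ≤ N → N < 2^(1000*(J+1)) →
    ∑ z ∈ II J, ∑ z' ∈ II J, EE N z z' ≤ C*((N:ℝ)^2*(J:ℝ)^2) := by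
  obtain ⟨C1, hC1, H1⟩ := off_le
  obtain ⟨C2, hC2, j0, H2⟩ := diag_le
  refine ⟨C1+C2, by positivity, max j0 13, ?_⟩
  intro J N hJ hN1 hN2
  have hJ0 : j0 ≤ J := le_trans (le_max_left _ _) hJ
  have hJ13 : 13 ≤ J := le_trans (le_max_right _ _) hJ
  have hcard : (Finset.Ico J (2*J)).card = J := by rw [Nat.card_Ico]; omega
  have e1 : ∑ z ∈ II J, ∑ z' ∈ II J, EE N z z' = ∑ z ∈ II J, ∑ z' ∈ (II J).filter (fun z' => aa z = aa z'), EE N z z'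
      + ∑ z ∈ II J, ∑ z' ∈ (II J).filter (fun z' => aa z ≠ aa z'), EE N z z' := by
    rw [← Finset.sum_add_distrib]
    apply Finset.sum_congr rfl
    intro z _
    exact (Finset.sum_filter_add_sum_filter_not _ _ _).symm
  have d1 : ∑ z ∈ II J, ∑ z' ∈ (II J).filter (fun z' => aa z = aa z'), EE N z z' ≤ C2*((N:ℝ)^2*(J:ℝ)^2) := by
    rw [sum_II]
    have := Finset.sum_le_card_nsmul (Finset.Ico J (2*J)) _ _ (fun j hj => H2 J N j hJ0 hJ13 hN1 hN2 (Finset.mem_Ico.1 hj).1 (Finset.mem_Ico.1 hj).2)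
    rw [hcard, nsmul_eq_mul] at this
    refine this.trans (le_of_eq (by ring))
  have d2 : ∑ z ∈ II J, ∑ z' ∈ (II J).filter (fun z' => aa z ≠ aa z'), EE N z z' ≤ C1*((N:ℝ)^2*(J:ℝ)^2) := by
    have e2 : ∑ z ∈ II J, ∑ z' ∈ (II J).filter (fun z' => aa z ≠ aa z'), EE N z z'
        = ∑ i ∈ Finset.Ico J (2*J), ∑ j ∈ Finset.Ico J (2*J), offS N i j := by
      rw [sum_II]
      apply Finset.sum_congr rfl
      intro i _
      unfold offS
      rw [Finset.sum_comm]
      apply Finset.sum_congr rfl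
      intro z _
      simp only [Finset.sum_filter]
      rw [sum_II]
    rw [e2]
    have hb : ∀ i ∈ Finset.Ico J (2*J), ∀ j ∈ Finset.Ico J (2*J), offS N i j ≤ C1*(N:ℝ)^2 := by
      intro i hi j hj
      have hi := (Finset.mem_Ico.1 hi).2
      have hj := (Finset.mem_Ico.1 hj).2
      rcases le_total i j with h | h
      · exact H1 J N i j hJ13 hN1 hi hj h
      · rw [offS_symm]; exact H1 J N j i hJ13 hN1 hj hi h
    have := Finset.sum_le_card_nsmul (Finset.Ico J (2*J)) _ _ (fun i hi => Finset.sum_le_card_nsmul (Finset.Ico J (2*J)) _ _ (hb i hi))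
    rw [hcard, nsmul_eq_mul, nsmul_eq_mul] at this
    refine this.trans (le_of_eq (by ring))
  rw [e1, add_mul]
  linarith

lemma thmM1 (J N : ℕ) (hJ : 32 ≤ J) (hN1 : 2^(1000*J) ≤ N) :
    (N:ℝ)^2*J/(64*2^20) ≤ ∑ z ∈ II J, ((PP N z).card:ℝ) := by
  classical
  rw [sum_II]
  have hcard : (Finset.Ico J (2*J)).card = J := by rw [Nat.card_Ico]; omega
  have hb : ∀ j ∈ Finset.Ico J (2*J), (N:ℝ)^2/(64*2^20) ≤ ∑ z ∈ blkG j, ((PP N z).card:ℝ) := by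
    intro j hj
    obtain ⟨hj1, hj2⟩ := Finset.mem_Ico.1 hj
    have hY0 : (0:ℝ) < ((2^j:ℕ):ℝ) := by exact_mod_cast Nat.two_pow_pos j
    have hK : (2^(j/8))^8 ≤ 2^j := by
      rw [← pow_mul]; exact Nat.pow_le_pow_right (by norm_num) (by omega)
    have hg := good_card (2^j) (2^(j/8)) (Nat.pow_le_pow_right (by norm_num) (by omega)) Nat.one_le_two_pow hK
    have hg' : ((2^j:ℕ):ℝ)^2/4 ≤ ((blkG j).card:ℝ) := by
      refine hg.trans (le_of_eq ?_)
      unfold blkG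
      congr!
    have ht : ∀ z ∈ blkG j, (N:ℝ)^2/(16*(2^20*((2^j:ℕ):ℝ)^2)) ≤ ((PP N z).card:ℝ) := by
      intro z hz
      obtain ⟨b, g⟩ := (mem_blkG j z).1 hz
      refine le_trans ?_ (PP_card N _ z g (aa_size60 J N _ (by omega) hN1 (aa_size J j hj2 z b)))
      have h1 : (aa z:ℝ) ≤ 2^20*((2^j:ℕ):ℝ)^2 := by
        have := aa_le (2^j) Nat.one_le_two_pow z b
        have h2 : ((aa z:ℕ):ℝ) ≤ ((2^20*(2^j)^2:ℕ):ℝ) := Nat.cast_le.2 this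
        rw [Nat.cast_mul, Nat.cast_pow, Nat.cast_pow] at h2
        exact_mod_cast h2
      have h0 : (0:ℝ) < aa z := by exact_mod_cast aa_pos z
      apply div_le_div_of_nonneg_left (sq_nonneg _) (by linarith)
      linarith
    have := Finset.card_nsmul_le_sum _ _ _ ht
    rw [nsmul_eq_mul] at this
    refine le_trans ?_ this
    refine le_trans (le_of_eq ?_) (mul_le_mul_of_nonneg_right hg' (div_nonneg (sq_nonneg _) (mul_nonneg (by norm_num) (mul_nonneg (by norm_num) (sq_nonneg _)))))
    have h5 := hY0.ne'
    clear hg hg' ht this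
    generalize ((2^j:ℕ):ℝ) = Y at *
    field_simp
    ring
  have := Finset.card_nsmul_le_sum _ _ _ hb
  rw [hcard, nsmul_eq_mul] at this
  refine le_trans (le_of_eq ?_) this
  ring

lemma value_ok (J N K : ℕ) (z : ℕ × ℕ) (hz : Good K z) (haN : aa z ≤ N) (P : ℤ × ℤ) (hP : P ∈ PP N z) :
    0 < P.1^2+P.2^2-(aa z:ℤ) ∧ P.1^2+P.2^2-(aa z:ℤ) ≤ 8*(N:ℤ)^2 ∧
    ∃ γ ∈ apollonianGroup, ∃ i : Fin 4, Matrix.mulVec (γ : Matrix (Fin 4) (Fin 4) ℤ) rootQuadruple i = P.1^2+P.2^2-(aa z:ℤ) := by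
  rw [mem_PP] at hP
  obtain ⟨⟨⟨b1, b2⟩, b3, b4⟩, h1, h2, h3⟩ := hP
  have ha0 : (0:ℤ) < aa z := by exact_mod_cast aa_pos z
  have haN' : (aa z:ℤ) ≤ N := by exact_mod_cast haN
  have hN1 : (1:ℤ) ≤ N := by linarith
  refine ⟨by nlinarith, by nlinarith, ?_⟩
  rw [aa_eq] at h1 ⊢
  apply geom (xa z) (xb z) P.1 P.2
  · unfold xa; omega
  · unfold xa xb; omega
  · have := Nat.isCoprime_iff_coprime.2 hz.g1
    push_cast at this
    exact this
  · exact h3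
  · exact h1

lemma final_num (C M1 M2 U N J : ℝ) (hC : 0 < C) (hN : 0 < N) (hJ : 0 < J) (h1 : N^2*J/(64*2^20) ≤ M1)
    (h2 : M2 ≤ C*(N^2*J^2)) (h3 : M1^2 ≤ U*M2) (hU : 0 ≤ U) : N^2/(C*2^52) ≤ U := by
  have h4 : (N^2*J/(64*2^20))^2 ≤ U*(C*(N^2*J^2)) :=
    (pow_le_pow_left₀ (by positivity) h1 2).trans (h3.trans (mul_le_mul_of_nonneg_left h2 hU))
  have e1 : (N^2*J/(64*2^20))^2 = (N^2/(C*2^52))*(C*(N^2*J^2)) := by field_simp; norm_num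
  rw [e1] at h4
  exact le_of_mul_le_mul_right h4 (by positivity)

lemma main_count : ∃ C : ℝ, 0 < C ∧ ∃ N0 : ℕ, ∀ N : ℕ, N0 ≤ N → ∃ U : Finset ℤ, (N:ℝ)^2/C ≤ (U.card:ℝ) ∧
    ∀ n ∈ U, 0 < n ∧ n ≤ 8*(N:ℤ)^2 ∧
    ∃ γ ∈ apollonianGroup, ∃ i : Fin 4, Matrix.mulVec (γ : Matrix (Fin 4) (Fin 4) ℤ) rootQuadruple i = n := by
  classical
  obtain ⟨C, hC, J0, H⟩ := thmM2
  refine ⟨C*2^52, by positivity, 2^(1000*(J0+32)), ?_⟩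
  intro N hN
  have hN0 : N ≠ 0 := by have := Nat.two_pow_pos (1000*(J0+32)); omega
  set J := Nat.log 2 N / 1000 with hJ
  have hlog : 1000*(J0+32) ≤ Nat.log 2 N := Nat.le_log_of_pow_le (by norm_num) hN
  have hJ1 : J0 + 32 ≤ J := by omega
  have hN1 : 2^(1000*J) ≤ N := (Nat.pow_le_pow_right (by norm_num) (by omega)).trans (Nat.pow_log_le_self 2 hN0)
  have hN2 : N < 2^(1000*(J+1)) := (Nat.lt_pow_succ_log_self (by norm_num) N).trans_le (Nat.pow_le_pow_right (by norm_num) (by omega))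
  clear_value J
  set W := (II J).sigma (fun z => PP N z) with hW
  set f : (Σ _ : ℕ × ℕ, ℤ × ℤ) → ℤ := fun w => w.2.1^2+w.2.2^2-(aa w.1:ℤ) with hf
  refine ⟨W.image f, ?_, ?_⟩
  · have h1 := thmM1 J N (by omega) hN1
    have h2 := H J N (by omega) hN1 hN2
    have h3 := pair_cs W f (W.image f) (fun s hs => Finset.mem_image_of_mem _ hs)
    have e1 : (W.card:ℝ) = ∑ z ∈ II J, ((PP N z).card:ℝ) := by
      rw [hW, Finset.card_sigma, Nat.cast_sum]
    have e2 : ∑ s ∈ W, ∑ t ∈ W, (if f s = f t then (1:ℝ) else 0) = ∑ z ∈ II J, ∑ z' ∈ II J, EE N z z' := by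
      rw [hW, Finset.sum_sigma]
      apply Finset.sum_congr rfl
      intro z _
      unfold EE
      rw [Finset.sum_comm, Finset.sum_sigma]
      apply Finset.sum_congr rfl
      intro z' _
      rw [Finset.sum_comm]
    rw [e1, e2] at h3
    exact final_num C _ _ _ N J hC (by exact_mod_cast Nat.pos_of_ne_zero hN0) (by exact_mod_cast (by omega : 0 < J)) h1 h2 h3 (Nat.cast_nonneg _)
  · intro n hn
    obtain ⟨w, hw, rfl⟩ := Finset.mem_image.1 hn
    obtain ⟨hz, hP⟩ := Finset.mem_sigma.1 hw
    obtain ⟨j, ⟨_, hj2⟩, hz⟩ := (mem_II J _).1 hz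
    obtain ⟨b, g⟩ := (mem_blkG j _).1 hz
    exact value_ok J N _ w.1 g ((Nat.le_self_pow (by norm_num) _).trans (aa_size60 J N _ (by omega) hN1 (aa_size J j hj2 _ b))) w.2 hP

theorem stmt18 :
    ∃ c : ℝ, 0 < c ∧ ∃ T₀ : ℝ, ∀ T : ℝ, T₀ ≤ T →
      c * T ≤
        (Nat.card {n : ℕ // 0 < n ∧ (n : ℝ) ≤ T ∧
          ∃ γ ∈ apollonianGroup, ∃ i : Fin 4,
            Matrix.mulVec (γ : Matrix (Fin 4) (Fin 4) ℤ) rootQuadruple i = (n : ℤ)} : ℝ) := by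
  classical
  obtain ⟨C, hC, N0, H⟩ := main_count
  refine ⟨1/(32*C), by positivity, 8*((N0:ℝ)+1)^2, ?_⟩
  intro T hT
  have hT0 : 0 ≤ T := le_trans (by positivity) hT
  set s := Real.sqrt (T/8) with hs
  have hs2 : s^2 = T/8 := Real.sq_sqrt (by positivity)
  have hs0 : 0 ≤ s := Real.sqrt_nonneg _
  have hsN : (N0:ℝ)+1 ≤ s := by
    apply Real.le_sqrt_of_sq_le
    linarith
  set N := ⌊s⌋₊ with hN
  have hN1 : (N:ℝ) ≤ s := Nat.floor_le hs0
  have hN2 : s < N + 1 := Nat.lt_floor_add_one s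
  have hN3 : N0 + 1 ≤ N := Nat.le_floor (by push_cast; exact hsN)
  clear_value N s
  obtain ⟨U, hU1, hU2⟩ := H N (by omega)
  have hN4 : (1:ℝ) ≤ N := by exact_mod_cast (by omega : 1 ≤ N)
  have h8 : 8*(N:ℝ)^2 ≤ T := by nlinarith
  have h32 : T/32 ≤ (N:ℝ)^2 := by nlinarith
  set S : Set ℕ := {n : ℕ | 0 < n ∧ (n : ℝ) ≤ T ∧
          ∃ γ ∈ apollonianGroup, ∃ i : Fin 4,
            Matrix.mulVec (γ : Matrix (Fin 4) (Fin 4) ℤ) rootQuadruple i = (n : ℤ)} with hS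
  have hfin : S.Finite := by
    apply (Set.finite_Iic ⌊T⌋₊).subset
    intro n hn
    exact Nat.le_floor hn.2.1
  have hsub : (↑(U.image Int.toNat) : Set ℕ) ⊆ S := by
    intro n hn
    obtain ⟨m, hm, rfl⟩ := Finset.mem_image.1 (Finset.mem_coe.1 hn)
    obtain ⟨p1, p2, p3⟩ := hU2 m hm
    have e : ((m.toNat:ℕ):ℤ) = m := Int.toNat_of_nonneg p1.le
    refine ⟨by omega, ?_, ?_⟩
    · have q : ((m.toNat:ℕ):ℝ) = (m:ℝ) := by exact_mod_cast e
      rw [q]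
      have : (m:ℝ) ≤ 8*(N:ℝ)^2 := by exact_mod_cast p2
      linarith
    · rw [e]; exact p3
  have hc := Set.ncard_le_ncard hsub hfin
  rw [Set.ncard_coe_finset, Finset.card_image_of_injOn] at hc
  · have h9 : (U.card:ℝ) ≤ (Nat.card S:ℝ) := by
      rw [Nat.card_coe_set_eq]; exact_mod_cast hc
    have h10 : 1/(32*C)*T ≤ (N:ℝ)^2/C := by
      have e : 1/(32*C)*T = (T/32)/C := by field_simp
      rw [e]
      exact div_le_div_of_nonneg_right h32 hC.le
    exact h10.trans (hU1.trans h9)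
  · intro x hx y hy hxy
    have := (hU2 x hx).1
    have := (hU2 y hy).1
    have hxy' : x.toNat = y.toNat := hxy
    omega
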